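/- Let Ω be a smooth pseudoconvex bounded domain in ℂ^n and let z₀ ∈ ∂Ω be a point of finite type in the sense of D'Angelo. Suppose V is a neighborhood of z₀ such that V ∩ ∂Ω is convex. Then there exist a neighborhood U of z₀ and a constant C > 0 such that all the bisectional curvatures of the Bergman metric of Ω satisfy B_Ω(z;X,Y) ≥ −C for all z ∈ U ∩ Ω and all nonzero X, Y ∈ ℂ^n. -/

import Mathlib

open MeasureTheory Complex Topology Filter Set

noncomputable section

/-! ### Wirtinger derivatives and complex Hessians on ℂⁿ -/

/-- The Wirtinger derivative `∂u/∂z_j` of a function `u : ℂⁿ → ℂ` at `z`. -/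
def wder (n : ℕ) (j : Fin n) (u : (Fin n → ℂ) → ℂ) (z : Fin n → ℂ) : ℂ :=
  (1 / 2) * (fderiv ℝ u z (Pi.single j 1) - Complex.I * fderiv ℝ u z (Pi.single j Complex.I))

/-- The conjugate Wirtinger derivative `∂u/∂z̄_j` of a function `u : ℂⁿ → ℂ` at `z`. -/
def wderBar (n : ℕ) (j : Fin n) (u : (Fin n → ℂ) → ℂ) (z : Fin n → ℂ) : ℂ :=
  (1 / 2) * (fderiv ℝ u z (Pi.single j 1) + Complex.I * fderiv ℝ u z (Pi.single j Complex.I))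

/-- The complex Hessian `∂²φ/∂z_j∂z̄_k` of a real-valued function `φ` at `z`. -/
def cHess (n : ℕ) (φ : (Fin n → ℂ) → ℝ) (z : Fin n → ℂ) (j k : Fin n) : ℂ :=
  wderBar n k (fun w => wder n j (fun v => (φ v : ℂ)) w) z

/-- The (real part of the) Hermitian form `Σ_{j,k} H_{jk} X_j conj (Y_k)`. -/
def hermForm (n : ℕ) (H : Fin n → Fin n → ℂ) (X Y : Fin n → ℂ) : ℝ :=
  (∑ j, ∑ k, H j k * X j * starRingEnd ℂ (Y k)).re

/-! ### The Bergman space, Bergman kernel, minimum integrals -/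

/-- Membership in the Bergman space `A²(Ω)`: holomorphic and square-integrable on `Ω`. -/
def InBergman (n : ℕ) (Ω : Set (Fin n → ℂ)) (f : (Fin n → ℂ) → ℂ) : Prop :=
  DifferentiableOn ℂ f Ω ∧ IntegrableOn (fun z => ‖f z‖ ^ 2) Ω

/-- The squared `L²(Ω)`-norm `∫_Ω |f|²`. -/
def l2sq (n : ℕ) (Ω : Set (Fin n → ℂ)) (f : (Fin n → ℂ) → ℂ) : ℝ :=
  ∫ z in Ω, ‖f z‖ ^ 2

/-- The holomorphic directional derivative `Σ_i X_i ∂f/∂z_i(p)`. -/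
def holDeriv (n : ℕ) (f : (Fin n → ℂ) → ℂ) (p X : Fin n → ℂ) : ℂ :=
  ∑ i, X i * fderiv ℂ f p (Pi.single i 1)

/-- The second-order holomorphic derivative `Σ_{j,k} X_j Y_k ∂²f/∂z_j∂z_k(p)`. -/
def holDeriv2 (n : ℕ) (f : (Fin n → ℂ) → ℂ) (p X Y : Fin n → ℂ) : ℂ :=
  ∑ j, ∑ k, X j * Y k * fderiv ℂ (fun z => fderiv ℂ f z (Pi.single k 1)) p (Pi.single j 1)

/-- Bergman's minimum integral `I⁰_Ω(p)`. -/
def I0 (n : ℕ) (Ω : Set (Fin n → ℂ)) (p : Fin n → ℂ) : ℝ :=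
  sInf {r | ∃ f, InBergman n Ω f ∧ f p = 1 ∧ r = l2sq n Ω f}

/-- Bergman's minimum integral `I¹_Ω(p; X)`. -/
def I1 (n : ℕ) (Ω : Set (Fin n → ℂ)) (p X : Fin n → ℂ) : ℝ :=
  sInf {r | ∃ f, InBergman n Ω f ∧ f p = 0 ∧ holDeriv n f p X = 1 ∧ r = l2sq n Ω f}

/-- Bergman's minimum integral `I²_Ω(p; X, Y)`. -/
def I2 (n : ℕ) (Ω : Set (Fin n → ℂ)) (p X Y : Fin n → ℂ) : ℝ :=
  sInf {r | ∃ f, InBergman n Ω f ∧ f p = 0 ∧ fderiv ℂ f p = 0 ∧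
    holDeriv2 n f p X Y = 1 ∧ r = l2sq n Ω f}

/-- The Bergman kernel on the diagonal,
`K_Ω(p, p̄) = sup {|f(p)|² : f ∈ A²(Ω), ‖f‖_{L²(Ω)} ≤ 1}`. -/
def bergmanKernel (n : ℕ) (Ω : Set (Fin n → ℂ)) (p : Fin n → ℂ) : ℝ :=
  sSup {r | ∃ f, InBergman n Ω f ∧ l2sq n Ω f ≤ 1 ∧ r = ‖f p‖ ^ 2}

/-- The components `g_{jk̄}(z) = ∂² log K_Ω(z,z̄)/∂z_j∂z̄_k` of the Bergman metric. -/
def bergMetricMat (n : ℕ) (Ω : Set (Fin n → ℂ)) (z : Fin n → ℂ) (j k : Fin n) : ℂ :=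
  cHess n (fun w => Real.log (bergmanKernel n Ω w)) z j k

/-- The Bergman metric `g_Ω(z; X) = Σ_{j,k} g_{jk̄}(z) X_j X̄_k`. -/
def bergMetric (n : ℕ) (Ω : Set (Fin n → ℂ)) (z X : Fin n → ℂ) : ℝ :=
  hermForm n (bergMetricMat n Ω z) X X

/-- The inverse matrix `(g^{νμ̄})` of the Bergman metric. -/
def bergMetricInv (n : ℕ) (Ω : Set (Fin n → ℂ)) (z : Fin n → ℂ) : Matrix (Fin n) (Fin n) ℂ :=
  (Matrix.of (bergMetricMat n Ω z))⁻¹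

/-- The curvature tensor of the Bergman metric,
`R_{h̄jkl̄} = −∂²g_{jh̄}/∂z_k∂z̄_l + g^{νμ̄} (∂g_{jμ̄}/∂z_k)(∂g_{νh̄}/∂z̄_l)`. -/
def bergCurvTensor (n : ℕ) (Ω : Set (Fin n → ℂ)) (z : Fin n → ℂ) (h j k l : Fin n) : ℂ :=
  - wderBar n l (fun w => wder n k (fun v => bergMetricMat n Ω v j h) w) z
  + ∑ ν, ∑ μ, bergMetricInv n Ω z ν μ *
      wder n k (fun v => bergMetricMat n Ω v j μ) z *
      wderBar n l (fun v => bergMetricMat n Ω v ν h) z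

/-- The bisectional curvature of the Bergman metric,
`B_Ω(z;X,Y) = R_{h̄jkl̄} X̄_h X_j Y_k Ȳ_l / (g(z;X) g(z;Y))`. -/
def bisecCurv (n : ℕ) (Ω : Set (Fin n → ℂ)) (z X Y : Fin n → ℂ) : ℝ :=
  (∑ h, ∑ j, ∑ k, ∑ l, bergCurvTensor n Ω z h j k l *
      starRingEnd ℂ (X h) * X j * Y k * starRingEnd ℂ (Y l)).re /
    (bergMetric n Ω z X * bergMetric n Ω z Y)

/-- The holomorphic sectional curvature `H_Ω(z;X) = B_Ω(z;X,X)`. -/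
def holSecCurv (n : ℕ) (Ω : Set (Fin n → ℂ)) (z X : Fin n → ℂ) : ℝ := bisecCurv n Ω z X X

/-- The Ricci curvature `Ric_Ω(z;X) = Σ_j B_Ω(z;E^j,X)` (standard basis). -/
def ricciCurv (n : ℕ) (Ω : Set (Fin n → ℂ)) (z X : Fin n → ℂ) : ℝ :=
  ∑ j, bisecCurv n Ω z (Pi.single j 1) X

/-! ### Plurisubharmonicity and pseudoconvexity -/

/-- `u` is plurisubharmonic on `Ω`: upper semicontinuous and satisfying the sub-mean value
inequality on circles in complex lines contained in `Ω`. -/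
def PSHOn (n : ℕ) (u : (Fin n → ℂ) → ℝ) (Ω : Set (Fin n → ℂ)) : Prop :=
  UpperSemicontinuousOn u Ω ∧
  ∀ z ∈ Ω, ∀ w : Fin n → ℂ, ∀ r : ℝ, 0 < r →
    (∀ t : ℂ, ‖t‖ ≤ r → z + t • w ∈ Ω) →
    u z ≤ (1 / (2 * Real.pi)) *
      ∫ θ in (0:ℝ)..(2 * Real.pi), u (z + ((r : ℂ) * Complex.exp ((θ : ℂ) * Complex.I)) • w)

/-- A `C²` function `φ` is plurisubharmonic on `Ω` iff its complex Hessian is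
positive semidefinite at every point of `Ω`. -/
def PSHOnC2 (n : ℕ) (φ : (Fin n → ℂ) → ℝ) (Ω : Set (Fin n → ℂ)) : Prop :=
  ∀ z ∈ Ω, ∀ X : Fin n → ℂ, 0 ≤ hermForm n (cHess n φ z) X X

/-- `Ω` is pseudoconvex: it admits a continuous plurisubharmonic exhaustion function. -/
def PseudoconvexExh (n : ℕ) (Ω : Set (Fin n → ℂ)) : Prop :=
  ∃ u : (Fin n → ℂ) → ℝ, ContinuousOn u Ω ∧ PSHOn n u Ω ∧
    ∀ c : ℝ, ∃ K : Set (Fin n → ℂ), IsCompact K ∧ K ⊆ Ω ∧ {z ∈ Ω | u z ≤ c} ⊆ K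

/-! ### Smooth boundary, Levi form, Levi rank -/

/-- `ρ` is a (global) smooth defining function for the domain `Ω`. -/
def IsDefining (n : ℕ) (Ω : Set (Fin n → ℂ)) (ρ : (Fin n → ℂ) → ℝ) : Prop :=
  ContDiff ℝ (⊤ : ℕ∞) ρ ∧ (∀ z ∈ Ω, ρ z < 0) ∧ (∀ z ∈ frontier Ω, ρ z = 0) ∧
    ∀ z ∈ frontier Ω, fderiv ℝ ρ z ≠ 0

/-- The coefficient `∂ρ/∂z_j(q)` of `∂ρ` (for a real-valued `ρ`). -/
def dzCoef (n : ℕ) (ρ : (Fin n → ℂ) → ℝ) (q : Fin n → ℂ) (j : Fin n) : ℂ :=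
  wder n j (fun v => (ρ v : ℂ)) q

/-- The ℂ-linear map `X ↦ Σ_j ∂ρ/∂z_j(q) X_j`. -/
def cTangentMap (n : ℕ) (ρ : (Fin n → ℂ) → ℝ) (q : Fin n → ℂ) : (Fin n → ℂ) →ₗ[ℂ] ℂ :=
  ∑ j, dzCoef n ρ q j • (LinearMap.proj j : (Fin n → ℂ) →ₗ[ℂ] ℂ)

/-- The complex tangent space `T^{1,0}_q(∂Ω) = {X : Σ_j ∂ρ/∂z_j(q) X_j = 0}`. -/
def cTangent (n : ℕ) (ρ : (Fin n → ℂ) → ℝ) (q : Fin n → ℂ) : Submodule ℂ (Fin n → ℂ) :=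
  LinearMap.ker (cTangentMap n ρ q)

/-- The Levi form of `ρ` at `q` is positive semidefinite on the complex tangent space. -/
def LeviPSDAt (n : ℕ) (ρ : (Fin n → ℂ) → ℝ) (q : Fin n → ℂ) : Prop :=
  ∀ X ∈ cTangent n ρ q, 0 ≤ hermForm n (cHess n ρ q) X X

/-- The ℂ-linear map `X ↦ Σ_{j,k} ρ_{jk̄}(q) X_j conj (Y_k)` (Levi pairing against `Y`). -/
def leviPairMap (n : ℕ) (ρ : (Fin n → ℂ) → ℝ) (q Y : Fin n → ℂ) : (Fin n → ℂ) →ₗ[ℂ] ℂ :=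
  ∑ j, (∑ k, cHess n ρ q j k * starRingEnd ℂ (Y k)) • (LinearMap.proj j : (Fin n → ℂ) →ₗ[ℂ] ℂ)

/-- The kernel of the Levi form of `ρ` at `q`, as a Hermitian form on `T^{1,0}_q(∂Ω)`. -/
def leviKernel (n : ℕ) (ρ : (Fin n → ℂ) → ℝ) (q : Fin n → ℂ) : Submodule ℂ (Fin n → ℂ) :=
  cTangent n ρ q ⊓ ⨅ Y ∈ cTangent n ρ q, LinearMap.ker (leviPairMap n ρ q Y)

/-- The Levi form of `ρ` at `q`, as a Hermitian form on `T^{1,0}_q(∂Ω)`, has rank `l`. -/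
def LeviRankAt (n : ℕ) (ρ : (Fin n → ℂ) → ℝ) (q : Fin n → ℂ) (l : ℕ) : Prop :=
  Module.finrank ℂ ↥(cTangent n ρ q) - Module.finrank ℂ ↥(leviKernel n ρ q) = l

/-! ### Test functions, polydiscs, Euclidean norms, biholomorphisms -/

/-- A smooth test function compactly supported in `Ω`. -/
def IsTestFun (n : ℕ) (ψ : (Fin n → ℂ) → ℂ) (Ω : Set (Fin n → ℂ)) : Prop :=
  ContDiff ℝ (⊤ : ℕ∞) ψ ∧ HasCompactSupport ψ ∧ tsupport ψ ⊆ Ω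

/-- The polydisc `P(c, β) = {z : |z_j − c_j| < β_j for all j}`. -/
def polydisc (n : ℕ) (c : Fin n → ℂ) (β : Fin n → ℝ) : Set (Fin n → ℂ) :=
  {z | ∀ j, ‖z j - c j‖ < β j}

/-- The Euclidean norm of the components of `ζ` indexed by `s`. -/
def eucNormOn (n : ℕ) (s : Finset (Fin n)) (ζ : Fin n → ℂ) : ℝ :=
  Real.sqrt (∑ j ∈ s, ‖ζ j‖ ^ 2)

/-- The Euclidean ball of radius `r` centered at the origin in ℂⁿ. -/
def eball (n : ℕ) (r : ℝ) : Set (Fin n → ℂ) :=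
  {ζ | eucNormOn n Finset.univ ζ < r}

/-- `f` is a biholomorphism from `A` onto `B`. -/
def Biholo (n : ℕ) (f : (Fin n → ℂ) → (Fin n → ℂ)) (A B : Set (Fin n → ℂ)) : Prop :=
  DifferentiableOn ℂ f A ∧ Set.BijOn f A B ∧
    ∃ g, DifferentiableOn ℂ g B ∧ ∀ z ∈ A, g (f z) = z

/-- The determinant of the complex Jacobian of `f` at `p`. -/
def cJacDet (n : ℕ) (f : (Fin n → ℂ) → (Fin n → ℂ)) (p : Fin n → ℂ) : ℂ :=
  LinearMap.det ((fderiv ℂ f p).toLinearMap)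

/-! ### Mixed derivatives `D^α` in the variables `z_j`, `z̄_j` -/

/-- The multi-index `α : Fin n → ℕ` recording how many of the directions `ι i` hit slot `j`. -/
def multiIdxOf (n : ℕ) {m : ℕ} (ι : Fin m → Fin n) : Fin n → ℕ :=
  fun j => (Finset.univ.filter fun i => ι i = j).card

/-- All mixed derivatives `D^α φ` of total order `≤ mmax`, where in each slot `j` one may
differentiate in the real directions underlying `z_j` and `z̄_j` (i.e. `e_j` and `i·e_j`),
are bounded on `P` by `bound α`. -/
def MixedDerivBound (n : ℕ) (φ : (Fin n → ℂ) → ℝ) (P : Set (Fin n → ℂ))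
    (mmax : ℕ) (bound : (Fin n → ℕ) → ℝ) : Prop :=
  ∀ m : ℕ, m ≤ mmax → ∀ ι : Fin m → Fin n, ∀ ε : Fin m → ℂ,
    (∀ i, ε i = 1 ∨ ε i = Complex.I) → ∀ z ∈ P,
      ‖iteratedFDeriv ℝ m φ z (fun i => Pi.single (ι i) (ε i))‖ ≤ bound (multiIdxOf n ι)

/-- All mixed derivatives `D^α φ` (of any order) are bounded on `P` by `bound α`. -/
def MixedDerivBoundAll (n : ℕ) (φ : (Fin n → ℂ) → ℝ) (P : Set (Fin n → ℂ))
    (bound : (Fin n → ℕ) → ℝ) : Prop :=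
  ∀ m : ℕ, ∀ ι : Fin m → Fin n, ∀ ε : Fin m → ℂ,
    (∀ i, ε i = 1 ∨ ε i = Complex.I) → ∀ z ∈ P,
      ‖iteratedFDeriv ℝ m φ z (fun i => Pi.single (ι i) (ε i))‖ ≤ bound (multiIdxOf n ι)

/-! ### Fu's centering maps and normal forms (constant Levi rank `l`) -/

/-- Lean indices `1,…,l`, i.e. the coordinates `ζ_2,…,ζ_{l+1}` (the block `ζ'`). -/
def primIdx (n l : ℕ) : Finset (Fin n) := Finset.univ.filter fun j => 1 ≤ j.val ∧ j.val ≤ l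

/-- Lean indices `l+1,…,n−1`, i.e. the coordinates `ζ_{l+2},…,ζ_n` (the block `ζ''`). -/
def dprimIdx (n l : ℕ) : Finset (Fin n) := Finset.univ.filter fun j => l + 1 ≤ j.val

/-- Lean indices `1,…,n−l−1`, i.e. the coordinates `ζ_2,…,ζ_{n−l}`. -/
def midIdx (n l : ℕ) : Finset (Fin n) :=
  Finset.univ.filter fun j => 1 ≤ j.val ∧ j.val ≤ n - l - 1

/-- Lean indices `n−l,…,n−1`, i.e. the coordinates `ζ_{n−l+1},…,ζ_n`. -/
def tailIdx (n l : ℕ) : Finset (Fin n) := Finset.univ.filter fun j => n - l ≤ j.val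

/-- `ρ` is a smooth local defining function for the real hypersurface `S` near `0`
(on the Euclidean ball of radius `ε`). -/
def IsLocalDefining (n : ℕ) (S : Set (Fin n → ℂ)) (ρ : (Fin n → ℂ) → ℝ) (ε : ℝ) : Prop :=
  ContDiffOn ℝ (⊤ : ℕ∞) ρ (eball n ε) ∧
    S ∩ eball n ε = {ζ ∈ eball n ε | ρ ζ = 0} ∧
    ∀ ζ ∈ S ∩ eball n ε, fderiv ℝ ρ ζ ≠ 0

/-- `ρ(ζ) = Re ζ₁ + Σ_{j=2}^{l+1} λ_j |ζ_j|² + O(|ζ'|²·|ζ''| + |ζ'|³ + |Im ζ₁|·|ζ|)` near `0`. -/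
def NormalForm (n l : ℕ) [NeZero n] (lam : Fin n → ℝ) (ρ : (Fin n → ℂ) → ℝ) (ε : ℝ) : Prop :=
  ∃ C > (0:ℝ), ∀ ζ ∈ eball n ε,
    |ρ ζ - ((ζ 0).re + ∑ j ∈ primIdx n l, lam j * ‖ζ j‖ ^ 2)| ≤
      C * ((eucNormOn n (primIdx n l) ζ) ^ 2 * eucNormOn n (dprimIdx n l) ζ +
        (eucNormOn n (primIdx n l) ζ) ^ 3 + |(ζ 0).im| * eucNormOn n Finset.univ ζ)

/-- Fu's centering data near a boundary point: for each `q ∈ U ∩ ∂Ω`, `Φ q` is a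
biholomorphism of `U` onto the unit ball with `Φ q q = 0`, depending smoothly on `q`,
such that `Φ q (U ∩ ∂Ω)` has, near `0`, a defining function `ρloc q` in normal form with
positive coefficients `lam q j` (for `j` in the block `ζ'`) depending smoothly on `q`. -/
def CenteringData (n l : ℕ) [NeZero n] (Ω U : Set (Fin n → ℂ))
    (Φ : (Fin n → ℂ) → (Fin n → ℂ) → (Fin n → ℂ))
    (lam : (Fin n → ℂ) → Fin n → ℝ)
    (ρloc : (Fin n → ℂ) → (Fin n → ℂ) → ℝ) (ε : ℝ) : Prop :=
  ContDiffOn ℝ (⊤ : ℕ∞) (fun pq : (Fin n → ℂ) × (Fin n → ℂ) => Φ pq.1 pq.2)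
      ((U ∩ frontier Ω) ×ˢ U) ∧
  (∀ j : Fin n, ContDiffOn ℝ (⊤ : ℕ∞) (fun q => lam q j) (U ∩ frontier Ω)) ∧
  ∀ q ∈ U ∩ frontier Ω,
    Φ q q = 0 ∧ Biholo n (Φ q) U (eball n 1) ∧
    (∀ j ∈ primIdx n l, 0 < lam q j) ∧
    IsLocalDefining n (Φ q '' (U ∩ frontier Ω)) (ρloc q) ε ∧
    NormalForm n l (lam q) (ρloc q) ε

/-- Fu's polydisc-type region
`P_{δ,a} = {ζ : |ζ₁| < aδ, |ζ_j| < aδ^{1/2} (2 ≤ j ≤ n−l), |ζ_k| < a (n−l+1 ≤ k ≤ n)}`. -/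
def PdaSet (n l : ℕ) [NeZero n] (δ a : ℝ) : Set (Fin n → ℂ) :=
  {ζ | ‖ζ 0‖ < a * δ ∧ (∀ j ∈ midIdx n l, ‖ζ j‖ < a * Real.sqrt δ) ∧
    ∀ j ∈ tailIdx n l, ‖ζ j‖ < a}

/-! ### Finite type in the sense of D'Angelo -/

/-- `h` vanishes to order at least `k` at `0`. -/
def vanishGe (E : Type*) [Norm E] (h : ℂ → E) (k : ℕ) : Prop :=
  ∃ C > (0:ℝ), ∃ ε > (0:ℝ), ∀ t : ℂ, ‖t‖ < ε → ‖h t‖ ≤ C * ‖t‖ ^ k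

/-- The vanishing order of `h` at `0`, as an extended natural number. -/
def vOrder (E : Type*) [Norm E] (h : ℂ → E) : ℕ∞ :=
  sSup ((fun k : ℕ => (k : ℕ∞)) '' {k | vanishGe E h k})

/-- `z₀ ∈ ∂Ω` is a point of finite type in the sense of D'Angelo (w.r.t. the defining
function `ρ`): the order of contact of `∂Ω` with nonconstant holomorphic curves through
`z₀` is uniformly bounded. -/
def FiniteTypeAt (n : ℕ) (ρ : (Fin n → ℂ) → ℝ) (z₀ : Fin n → ℂ) : Prop :=
  ∃ T : ℕ, ∀ γ : ℂ → (Fin n → ℂ), AnalyticAt ℂ γ 0 → γ 0 = z₀ →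
    ¬ (∀ᶠ t in 𝓝 (0:ℂ), γ t = z₀) →
    vOrder ℝ (fun t => ρ (γ t)) ≤ (T : ℕ∞) * vOrder (Fin n → ℂ) (fun t => γ t - z₀)

end

/-! ### Circle-invariant mollifiers and the mean value property -/

open scoped ContDiff Convolution

/-- A smooth nonnegative mollifier on `ℂⁿ`, supported in the closed ball of radius `r` and
invariant under multiplication by unimodular scalars. -/
structure IsCircleBump (n : ℕ) (r : ℝ) (η : (Fin n → ℂ) → ℝ) : Prop where
  contDiff : ContDiff ℝ ∞ η
  nonneg : ∀ w, 0 ≤ η w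
  integral_eq_one : ∫ w, η w = 1
  zero_of_lt : ∀ w, r ≤ ‖w‖ → η w = 0
  smul_eq : ∀ c : ℂ, ‖c‖ = 1 → ∀ w, η (c • w) = η w

theorem exists_isCircleBump (n : ℕ) {r : ℝ} (hr : 0 < r) : ∃ η, IsCircleBump n r η := by
  set q : (Fin n → ℂ) → ℝ := fun w => ∑ j, ‖w j‖ ^ 2 with hq
  set g : (Fin n → ℂ) → ℝ := fun w => expNegInvGlue (r ^ 2 - q w) with hg
  have hqs : ContDiff ℝ ∞ q := by
    refine ContDiff.sum fun j _ => ?_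
    exact ((contDiff_apply ℝ ℂ j).norm_sq ℝ)
  have hgs : ContDiff ℝ ∞ g := expNegInvGlue.contDiff.comp (contDiff_const.sub hqs)
  have hg0 : ∀ w, 0 ≤ g w := fun w => expNegInvGlue.nonneg _
  have hgc : ∀ c : ℂ, ‖c‖ = 1 → ∀ w, g (c • w) = g w := by
    intro c hc w
    simp [hg, hq, hc]
  have hgz : ∀ w, r ≤ ‖w‖ → g w = 0 := by
    intro w hw
    apply expNegInvGlue.zero_of_nonpos
    have hr' : ∃ j, r ≤ ‖w j‖ := by
      by_contra! h
      exact absurd hw (not_le.mpr ((pi_norm_lt_iff hr).mpr h))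
    obtain ⟨j, hj⟩ := hr'
    have h1 : ‖w j‖ ^ 2 ≤ q w :=
      Finset.single_le_sum (f := fun j => ‖w j‖ ^ 2) (fun _ _ => by positivity) (Finset.mem_univ j)
    have : r ^ 2 ≤ ‖w j‖ ^ 2 := by gcongr
    linarith
  have hcs : HasCompactSupport g := by
    refine HasCompactSupport.of_support_subset_isCompact (isCompact_closedBall 0 r) ?_
    intro w hw
    by_contra h
    exact hw (hgz w (by simpa using (not_le.mp (by simpa using h)).le))
  have hInt : Integrable g := hgs.continuous.integrable_of_hasCompactSupport hcs
  have hg00 : g 0 ≠ 0 := by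
    have : 0 < g 0 := by
      apply expNegInvGlue.pos_of_pos
      simp [hq]; positivity
    exact this.ne'
  have hpos : 0 < ∫ w, g w :=
    hgs.continuous.integral_pos_of_hasCompactSupport_nonneg_nonzero hcs hg0 hg00
  clear_value g
  refine ⟨fun w => (∫ w, g w)⁻¹ * g w, ⟨contDiff_const.mul hgs, fun w => ?_, ?_, ?_, ?_⟩⟩
  · have := hg0 w; positivity
  · rw [integral_const_mul, inv_mul_cancel₀ hpos.ne']
  · intro w hw; simp [hgz w hw]
  · intro c hc w
    simp [hgc c hc w]

namespace IsCircleBump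

variable {n : ℕ} {r : ℝ} {η : (Fin n → ℂ) → ℝ}

theorem continuous (h : IsCircleBump n r η) : Continuous η := h.contDiff.continuous

theorem hasCompactSupport (h : IsCircleBump n r η) : HasCompactSupport η := by
  refine HasCompactSupport.of_support_subset_isCompact (isCompact_closedBall 0 r) ?_
  intro w hw
  by_contra h'
  exact hw (h.zero_of_lt w (not_le.mp (by simpa using h')).le)

theorem integrable (h : IsCircleBump n r η) : Integrable η :=
  h.continuous.integrable_of_hasCompactSupport h.hasCompactSupport

theorem neg_eq (h : IsCircleBump n r η) (w : Fin n → ℂ) : η (-w) = η w := by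
  simpa using h.smul_eq (-1) (by simp) w

end IsCircleBump

theorem measurePreserving_unit_smul {n : ℕ} {c : ℂ} (hc : ‖c‖ = 1) :
    MeasurePreserving (fun w : Fin n → ℂ => c • w) := by
  refine volume_preserving_pi (f := fun (_ : Fin n) (z : ℂ) => c • z) fun i => ?_
  have h1 := (rotation ⟨c, mem_sphere_zero_iff_norm.mpr hc⟩).measurePreserving
  have h2 : (fun z : ℂ => c • z) = rotation ⟨c, mem_sphere_zero_iff_norm.mpr hc⟩ := by
    rfl
  rw [h2]
  exact h1

theorem IsCircleBump.integral_eq {n : ℕ} {r : ℝ} {η : (Fin n → ℂ) → ℝ} (h : IsCircleBump n r η)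
    {F : Type*} [NormedAddCommGroup F] [NormedSpace ℂ F] [CompleteSpace F]
    {f : (Fin n → ℂ) → F} {U : Set (Fin n → ℂ)} (hU : IsOpen U) (hf : DifferentiableOn ℂ f U)
    {z : Fin n → ℂ} (hz : Metric.closedBall z r ⊆ U) :
    ∫ w, η w • f (z + w) = f z := by
  rcases lt_or_ge r 0 with hr | hr
  · have : ∀ w, η w = 0 := fun w => h.zero_of_lt w (hr.le.trans (norm_nonneg _))
    have h1 := h.integral_eq_one
    simp [this] at h1
  set K := Metric.closedBall (0 : Fin n → ℂ) r
  have hKc : IsCompact K := isCompact_closedBall 0 r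
  have key : ∀ θ : ℝ, ∫ w, η w • f (z + w) = ∫ w, η w • f (z + circleMap 0 1 θ • w) := by
    intro θ
    have hn : ‖circleMap 0 1 θ‖ = 1 := by simp
    have hne : circleMap 0 1 θ ≠ 0 := by
      intro h0; simp [h0] at hn
    have hme : MeasurableEmbedding (fun w : Fin n → ℂ => circleMap 0 1 θ • w) :=
      (Homeomorph.smulOfNeZero _ hne).measurableEmbedding
    rw [← (measurePreserving_unit_smul hn).integral_comp hme]
    simp only [h.smul_eq _ hn]
  have hcirc : ∀ w ∈ K, ∀ θ : ℝ, z + circleMap 0 1 θ • w ∈ Metric.closedBall z r := by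
    intro w hw θ
    have : ‖w‖ ≤ r := by simpa [K] using hw
    simpa [norm_smul] using this
  have hfc : ContinuousOn f (Metric.closedBall z r) := hf.continuousOn.mono hz
  have havg : ∀ w ∈ K, Real.circleAverage (fun t : ℂ => f (z + t • w)) 0 1 = f z := by
    intro w hw
    have hd : DiffContOnCl ℂ (fun t : ℂ => f (z + t • w)) (Metric.ball 0 |1|) := by
      apply DifferentiableOn.diffContOnCl
      intro t ht
      have ht' : ‖t‖ ≤ 1 := by
        have := Metric.closure_ball_subset_closedBall ht
        simpa using this
      have hmem : z + t • w ∈ U := by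
        apply hz
        have h1 : ‖w‖ ≤ r := by simpa [K] using hw
        have : ‖t‖ * ‖w‖ ≤ 1 * r := by gcongr
        simpa [norm_smul] using this
      have h2 := hf.differentiableAt (hU.mem_nhds hmem)
      refine DifferentiableAt.differentiableWithinAt ?_
      exact DifferentiableAt.comp t h2 (by fun_prop)
    have := hd.circleAverage
    simpa using this
  have hrestr : ∀ θ : ℝ, ∫ w, η w • f (z + circleMap 0 1 θ • w)
      = ∫ w in K, η w • f (z + circleMap 0 1 θ • w) := by
    intro θ
    rw [setIntegral_eq_integral_of_forall_compl_eq_zero]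
    intro w hw
    rw [h.zero_of_lt w (not_le.mp (by simpa [K] using hw)).le, zero_smul]
  have hswap : ∫ θ in (0:ℝ)..(2 * Real.pi), ∫ w in K, η w • f (z + circleMap 0 1 θ • w)
      = ∫ w in K, ∫ θ in (0:ℝ)..(2 * Real.pi), η w • f (z + circleMap 0 1 θ • w) := by
    have hle : (0:ℝ) ≤ 2 * Real.pi := by positivity
    rw [intervalIntegral.integral_of_le hle]
    simp_rw [intervalIntegral.integral_of_le hle]
    refine integral_integral_swap ?_
    rw [Measure.prod_restrict]
    have hcont : ContinuousOn (Function.uncurry fun (θ : ℝ) (w : Fin n → ℂ) =>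
        η w • f (z + circleMap 0 1 θ • w)) (Icc 0 (2 * Real.pi) ×ˢ K) := by
      have h0 : ContinuousOn (fun p : ℝ × (Fin n → ℂ) => η p.2) (Icc 0 (2 * Real.pi) ×ˢ K) :=
        (h.continuous.comp continuous_snd).continuousOn
      refine h0.smul ?_
      refine hfc.comp (Continuous.continuousOn ?_) ?_
      · have := continuous_circleMap 0 1
        fun_prop
      · rintro ⟨θ, w⟩ ⟨_, hw⟩
        exact hcirc w hw θ
    refine (hcont.integrableOn_compact (isCompact_Icc.prod hKc)).mono_set ?_
    exact prod_mono Ioc_subset_Icc_self le_rfl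
  have h2 : ∫ θ in (0:ℝ)..(2 * Real.pi), (∫ w, η w • f (z + w))
      = (2 * Real.pi) • ∫ w in K, η w • f z := by
    calc ∫ θ in (0:ℝ)..(2 * Real.pi), (∫ w, η w • f (z + w))
        = ∫ θ in (0:ℝ)..(2 * Real.pi), ∫ w in K, η w • f (z + circleMap 0 1 θ • w) := by
          refine intervalIntegral.integral_congr fun θ _ => ?_
          rw [← hrestr θ, key θ]
      _ = _ := hswap
      _ = ∫ w in K, (2 * Real.pi) • (η w • f z) := by
          refine setIntegral_congr_fun hKc.measurableSet fun w hw => ?_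
          rw [intervalIntegral.integral_smul, ← havg w hw, Real.circleAverage_def, smul_comm,
            smul_inv_smul₀ (by positivity)]
      _ = _ := by rw [integral_smul]
  rw [intervalIntegral.integral_const, sub_zero] at h2
  have h3 := smul_right_injective F (r := 2 * Real.pi) (by positivity) h2
  rw [h3, integral_smul_const]
  have : ∫ w in K, η w = 1 := by
    rw [← h.integral_eq_one, setIntegral_eq_integral_of_forall_compl_eq_zero]
    intro w hw
    exact h.zero_of_lt w (not_le.mp (by simpa [K] using hw)).le
  rw [this, one_smul]

/-! ### Smoothness of holomorphic maps and Cauchy estimates -/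

open scoped ContDiff Convolution

theorem DifferentiableOn.contDiffOn_real_pi {n : ℕ} {F : Type*} [NormedAddCommGroup F]
    [NormedSpace ℂ F] [CompleteSpace F] {f : (Fin n → ℂ) → F} {U : Set (Fin n → ℂ)}
    (hf : DifferentiableOn ℂ f U) (hU : IsOpen U) : ContDiffOn ℝ ∞ f U := by
  intro z hz
  obtain ⟨r, hr, hrU⟩ : ∃ r > 0, Metric.closedBall z (2 * r) ⊆ U := by
    obtain ⟨ε, hε, h⟩ := Metric.nhds_basis_closedBall.mem_iff.mp (hU.mem_nhds hz)
    exact ⟨ε / 2, by positivity, by simpa [mul_div_cancel₀] using h⟩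
  obtain ⟨η, hη⟩ := exists_isCircleBump n hr
  set g := (Metric.closedBall z (2 * r)).indicator f with hg
  have hgi : Integrable g := by
    rw [hg, integrable_indicator_iff Metric.isClosed_closedBall.measurableSet]
    exact (hf.continuousOn.mono hrU).integrableOn_compact (isCompact_closedBall _ _)
  have hs : ContDiff ℝ ∞ (η ⋆[ContinuousLinearMap.lsmul ℝ ℝ, volume] g) :=
    hη.hasCompactSupport.contDiff_convolution_left _ hη.contDiff hgi.locallyIntegrable
  refine (hs.contDiffAt.congr_of_eventuallyEq ?_).contDiffWithinAt
  filter_upwards [Metric.ball_mem_nhds z hr] with p hp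
  have hpU : Metric.closedBall p r ⊆ Metric.closedBall z (2 * r) := by
    apply Metric.closedBall_subset_closedBall'
    have := Metric.mem_ball.mp hp
    linarith
  rw [← hη.integral_eq hU hf (hpU.trans hrU), ← integral_neg_eq_self, convolution]
  congr 1
  ext w
  rw [hη.neg_eq, ContinuousLinearMap.lsmul_apply, ← sub_eq_add_neg]
  rcases lt_or_ge ‖w‖ r with h | h
  · rw [hg, indicator_of_mem]
    apply hpU
    simpa using h.le
  · simp [hη.zero_of_lt w h]

theorem DifferentiableOn.fderiv_pi {n : ℕ} {F : Type*} [NormedAddCommGroup F]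
    [NormedSpace ℂ F] [CompleteSpace F] {f : (Fin n → ℂ) → F} {U : Set (Fin n → ℂ)}
    (hf : DifferentiableOn ℂ f U) (hU : IsOpen U) : DifferentiableOn ℂ (fderiv ℂ f) U := by
  have hs := hf.contDiffOn_real_pi hU
  have heq : ∀ z ∈ U, fderiv ℝ f z = (fderiv ℂ f z).restrictScalars ℝ := fun z hz =>
    (hf.differentiableAt (hU.mem_nhds hz)).fderiv_restrictScalars ℝ
  have hd2 : ∀ z ∈ U, DifferentiableAt ℝ (fderiv ℝ f) z := fun z hz =>
    ((hs.contDiffAt (hU.mem_nhds hz)).fderiv_right (m := 1) (by norm_cast)).differentiableAt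
      (by norm_num)
  have hv : ∀ v, DifferentiableOn ℂ (fun z => fderiv ℂ f z v) U := by
    intro v z hz
    have hev : (fun z => fderiv ℂ f z v) =ᶠ[𝓝 z] fun z => fderiv ℝ f z v := by
      filter_upwards [hU.mem_nhds hz] with p hp
      simp [heq p hp]
    refine (DifferentiableAt.congr_of_eventuallyEq ?_ hev).differentiableWithinAt
    have hr : ∀ w, HasFDerivAt (fun z => fderiv ℝ f z w) ((fderiv ℝ (fderiv ℝ f) z).flip w) z :=
      fun w => by
        exact (ContinuousLinearMap.apply ℝ F w).hasFDerivAt.comp z (hd2 z hz).hasFDerivAt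
    have hsym : ∀ a b, fderiv ℝ (fderiv ℝ f) z a b = fderiv ℝ (fderiv ℝ f) z b a := by
      have := (hs.contDiffAt (hU.mem_nhds hz)).isSymmSndFDerivAt (by
        simpa using WithTop.coe_le_coe.2 (le_top : (2 : ℕ∞) ≤ ⊤))
      exact fun a b => this a b
    have hI : ∀ a, fderiv ℝ (fderiv ℝ f) z (I • a) v = I • fderiv ℝ (fderiv ℝ f) z a v := by
      intro a
      rw [hsym (I • a), hsym a]
      have h1 := (hr (I • a)).congr_of_eventuallyEq (f₁ := fun z => I • fderiv ℝ f z a) (by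
        filter_upwards [hU.mem_nhds hz] with p hp
        simp [heq p hp])
      have h2 := (hr a).const_smul I
      have := congrArg (fun L => L v) (h1.unique h2)
      simpa using this
    rw [differentiableAt_iff_restrictScalars ℝ (hr v).differentiableAt, (hr v).fderiv]
    refine ⟨⟨⟨⟨fun a => fderiv ℝ (fderiv ℝ f) z a v, fun a b => by simp⟩, fun c a => ?_⟩,
      by fun_prop⟩, by ext a; simp⟩
    have : c • a = c.re • a + c.im • (I • a) := by
      rw [← Complex.coe_smul c.re, ← Complex.coe_smul c.im, smul_smul, ← add_smul,
        Complex.re_add_im]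
    simp only [this, map_add, map_smul, add_apply,
      smul_apply, hI]
    rw [← Complex.coe_smul c.re, ← Complex.coe_smul c.im, smul_smul, ← add_smul,
        Complex.re_add_im]
    rfl
  have hsum : ∀ z, fderiv ℂ f z = ∑ j, (ContinuousLinearMap.proj (R := ℂ) (φ := fun _ : Fin n => ℂ)
      j).smulRight (fderiv ℂ f z (Pi.single j 1)) := by
    intro z
    ext v
    conv_lhs => rw [pi_eq_sum_univ' v]
    simp only [map_sum, map_smul, sum_apply,
      ContinuousLinearMap.smulRight_apply, ContinuousLinearMap.proj_apply]
  rw [show fderiv ℂ f = fun z => ∑ j, (ContinuousLinearMap.proj (R := ℂ)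
    (φ := fun _ : Fin n => ℂ) j).smulRight (fderiv ℂ f z (Pi.single j 1)) from funext hsum]
  refine DifferentiableOn.fun_sum fun j _ => ?_
  exact ((ContinuousLinearMap.smulRightL ℂ (Fin n → ℂ) F
    (ContinuousLinearMap.proj (R := ℂ) (φ := fun _ : Fin n => ℂ) j)).differentiable.comp_differentiableOn
      (hv _))

theorem norm_fderiv_le_of_forall_ball {E F : Type*} [NormedAddCommGroup E] [NormedSpace ℂ E]
    [NormedAddCommGroup F] [NormedSpace ℂ F] {f : E → F} {z : E} {r M : ℝ} (hr : 0 < r)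
    (hf : DifferentiableOn ℂ f (Metric.ball z r)) (hM : ∀ w ∈ Metric.ball z r, ‖f w‖ ≤ M) :
    ‖fderiv ℂ f z‖ ≤ 2 * M / r := by
  have hM0 : 0 ≤ M := (norm_nonneg _).trans (hM z (Metric.mem_ball_self hr))
  refine ContinuousLinearMap.opNorm_le_bound _ (by positivity) fun v => ?_
  rcases eq_or_ne v 0 with rfl | hv
  · simp
  have hv' : 0 < ‖v‖ := norm_pos_iff.mpr hv
  set R := r / (2 * ‖v‖) with hR
  have hR0 : 0 < R := by positivity
  have hmem : ∀ t : ℂ, t ∈ Metric.closedBall (0:ℂ) R → z + t • v ∈ Metric.ball z r := by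
    intro t ht
    have h1 : ‖t‖ ≤ R := by simpa using ht
    have : ‖t‖ * ‖v‖ ≤ R * ‖v‖ := by gcongr
    have h3 : R * ‖v‖ = r / 2 := by rw [hR]; field_simp
    simp only [Metric.mem_ball, dist_self_add_left, norm_smul]
    linarith
  have hd : DifferentiableOn ℂ (fun t : ℂ => f (z + t • v)) (Metric.closedBall 0 R) :=
    hf.comp (Differentiable.differentiableOn (by fun_prop)) hmem
  have h1 := Complex.norm_deriv_le_of_forall_mem_sphere_norm_le (f := fun t : ℂ => f (z + t • v))
    hR0 (hd.mono Metric.closure_ball_subset_closedBall).diffContOnCl (C := M)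
    (fun t ht => hM _ (hmem t (Metric.sphere_subset_closedBall ht)))
  have h2 : HasDerivAt (fun t : ℂ => f (z + t • v)) (fderiv ℂ f z v) 0 := by
    have h3 : HasFDerivAt f (fderiv ℂ f z) (z + (0:ℂ) • v) := by
      simpa using (hf.differentiableAt (Metric.ball_mem_nhds z hr)).hasFDerivAt
    refine h3.comp_hasDerivAt (0:ℂ) ?_
    simpa using ((hasDerivAt_id (0:ℂ)).smul_const v).const_add z
  rw [h2.deriv] at h1
  refine h1.trans (le_of_eq ?_)
  rw [hR]; field_simp

theorem exists_norm_iteratedFDeriv_le (i : ℕ) {r : ℝ} (hr : 0 < r) :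
    ∃ C : ℝ, 0 ≤ C ∧ ∀ (n : ℕ) (F : Type) [NormedAddCommGroup F] [NormedSpace ℂ F]
      [CompleteSpace F] (f : (Fin n → ℂ) → F) (z : Fin n → ℂ) (M : ℝ),
      DifferentiableOn ℂ f (Metric.ball z r) → (∀ w ∈ Metric.ball z r, ‖f w‖ ≤ M) →
      ‖iteratedFDeriv ℝ i f z‖ ≤ C * M := by
  induction i generalizing r with
  | zero =>
    refine ⟨1, zero_le_one, fun n F _ _ _ f z M _ hM => ?_⟩
    simpa using hM z (Metric.mem_ball_self hr)
  | succ i ih =>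
    obtain ⟨C, hC, h⟩ := ih (half_pos hr)
    refine ⟨C * (2 / (r / 2)), by positivity, fun n F _ _ _ f z M hf hM => ?_⟩
    have hsub : ∀ w ∈ Metric.ball z (r / 2), Metric.ball w (r / 2) ⊆ Metric.ball z r := by
      intro w hw
      apply Metric.ball_subset_ball'
      have := Metric.mem_ball.mp hw
      linarith
    have h1 := h n _ (fderiv ℂ f) z (2 * M / (r / 2))
      ((hf.fderiv_pi Metric.isOpen_ball).mono (Metric.ball_subset_ball (by linarith)))
      (fun w hw => norm_fderiv_le_of_forall_ball (half_pos hr) (hf.mono (hsub w hw))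
        fun p hp => hM p (hsub w hw hp))
    rw [← norm_iteratedFDeriv_fderiv]
    have hev : fderiv ℝ f =ᶠ[𝓝 z]
        (ContinuousLinearMap.restrictScalarsIsometry ℂ (Fin n → ℂ) F ℝ ℝ) ∘ fderiv ℂ f := by
      filter_upwards [Metric.ball_mem_nhds z hr] with p hp
      exact (hf.differentiableAt (Metric.isOpen_ball.mem_nhds hp)).fderiv_restrictScalars ℝ
    rw [(hev.iteratedFDeriv ℝ i).eq_of_nhds, LinearIsometry.norm_iteratedFDeriv_comp_left]
    · refine h1.trans (le_of_eq ?_)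
      ring
    · exact ((hf.fderiv_pi Metric.isOpen_ball).contDiffOn_real_pi Metric.isOpen_ball).contDiffAt
        (Metric.ball_mem_nhds z hr)
    · exact_mod_cast le_top

/-! ### Mollification in `L²` -/

open scoped ContDiff Convolution ENNReal

theorem MeasureTheory.MemLp.exists_eLpNorm_translate_sub_le {n : ℕ} {f : (Fin n → ℂ) → ℂ}
    (hf : MemLp f 2) {δ : ℝ≥0∞} (hδ : δ ≠ 0) :
    ∃ ε > (0:ℝ), ∀ w, ‖w‖ < ε → eLpNorm (fun x => f (x + w) - f x) 2 ≤ δ := by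
  set g : (Fin n → ℂ) → C(Fin n → ℂ, Fin n → ℂ) := fun w =>
    (⟨fun p : (Fin n → ℂ) × (Fin n → ℂ) => p.2 + p.1, by fun_prop⟩ :
      C((Fin n → ℂ) × (Fin n → ℂ), Fin n → ℂ)).curry w with hg
  have hgc : Continuous g := ContinuousMap.continuous _
  have hgm : ∀ w, MeasurePreserving (g w) volume volume := fun w => measurePreserving_add_right _ w
  have hc := Continuous.compMeasurePreservingLp (f := fun _ : Fin n → ℂ => hf.toLp f)
    continuous_const hgc hgm (by norm_num)
  have h0 := hc.tendsto 0
  rw [EMetric.tendsto_nhds] at h0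
  have h1 := h0 δ (pos_iff_ne_zero.mpr hδ)
  obtain ⟨ε, hε, hb⟩ := Metric.eventually_nhds_iff.mp h1
  refine ⟨ε, hε, fun w hw => ?_⟩
  have h2 := hb (y := w) (by simpa using hw)
  simp only [Lp.toLp_compMeasurePreserving] at h2
  rw [Lp.edist_toLp_toLp] at h2
  refine (le_of_eq ?_).trans h2.le
  congr 1
  ext x
  simp [hg]

namespace IsCircleBump

variable {n : ℕ} {r : ℝ} {η : (Fin n → ℂ) → ℝ}

theorem lintegral_eq_one (h : IsCircleBump n r η) : ∫⁻ w, ENNReal.ofReal (η w) = 1 := by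
  rw [← ofReal_integral_eq_lintegral_ofReal h.integrable (ae_of_all _ h.nonneg), h.integral_eq_one,
    ENNReal.ofReal_one]

theorem enorm_integral_sq_le (h : IsCircleBump n r η) {f : (Fin n → ℂ) → ℂ}
    (hf : AEStronglyMeasurable f) :
    ‖∫ w, η w • f w‖ₑ ^ 2 ≤ ∫⁻ w, ENNReal.ofReal (η w) * ‖f w‖ₑ ^ 2 := by
  have hm : Measurable fun w => ENNReal.ofReal (η w) :=
    ENNReal.measurable_ofReal.comp h.continuous.measurable
  set ν := (volume : Measure (Fin n → ℂ)).withDensity fun w => ENNReal.ofReal (η w) with hν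
  have : IsProbabilityMeasure ν := ⟨by rw [hν, withDensity_apply _ MeasurableSet.univ]; simpa using h.lintegral_eq_one⟩
  have hfν : AEStronglyMeasurable f ν := hf.mono_ac (withDensity_absolutelyContinuous _ _)
  have h1 := eLpNorm_le_eLpNorm_of_exponent_le (p := 1) (q := 2) (by norm_num) hfν
  have h2 : ‖∫ w, η w • f w‖ₑ ≤ eLpNorm f 1 ν := by
    rw [eLpNorm_one_eq_lintegral_enorm, hν,
      lintegral_withDensity_eq_lintegral_mul_non_measurable _ hm (by simp)]
    refine (enorm_integral_le_lintegral_enorm _).trans (le_of_eq ?_)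
    refine lintegral_congr fun w => ?_
    rw [enorm_smul, Real.enorm_eq_ofReal (h.nonneg w)]
    rfl
  calc ‖∫ w, η w • f w‖ₑ ^ 2 ≤ eLpNorm f 2 ν ^ 2 := by gcongr; exact h2.trans h1
    _ = ∫⁻ w, ‖f w‖ₑ ^ 2 ∂ν := by
      rw [eLpNorm_eq_lintegral_rpow_enorm_toReal (by norm_num) (by norm_num)]
      rw [← ENNReal.rpow_natCast, ← ENNReal.rpow_mul]
      norm_num
    _ = _ := by
      rw [hν, lintegral_withDensity_eq_lintegral_mul_non_measurable _ hm (by simp)]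
      rfl

end IsCircleBump

/-- The average of the translates of `f` with respect to the density `η`. -/
noncomputable def mollify {n : ℕ} (η : (Fin n → ℂ) → ℝ) (f : (Fin n → ℂ) → ℂ)
    (x : Fin n → ℂ) : ℂ := ∫ w, η w • f (x + w)

theorem IsCircleBump.mollify_eq {n : ℕ} {r : ℝ} {η : (Fin n → ℂ) → ℝ} (h : IsCircleBump n r η)
    (f : (Fin n → ℂ) → ℂ) :
    mollify η f = η ⋆[ContinuousLinearMap.lsmul ℝ ℝ, volume] f := by
  ext x
  rw [mollify, convolution, ← integral_neg_eq_self]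
  congr 1
  ext w
  rw [h.neg_eq, ContinuousLinearMap.lsmul_apply, ← sub_eq_add_neg]

theorem MeasureTheory.MemLp.locallyIntegrable_two {n : ℕ} {f : (Fin n → ℂ) → ℂ} (hf : MemLp f 2) :
    LocallyIntegrable f :=
  hf.locallyIntegrable (by norm_num)

theorem IsCircleBump.integrable_smul {n : ℕ} {r : ℝ} {η : (Fin n → ℂ) → ℝ}
    (h : IsCircleBump n r η) {f : (Fin n → ℂ) → ℂ} (hf : LocallyIntegrable f) (x : Fin n → ℂ) :
    Integrable fun w => η w • f (x + w) := by
  have h1 : LocallyIntegrable fun w => f (x + w) := by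
    intro z
    obtain ⟨u, hu, hi⟩ := hf (x + z)
    refine ⟨(fun w => x + w) ⁻¹' u, (continuous_const_add x).continuousAt.preimage_mem_nhds hu, ?_⟩
    exact (measurePreserving_add_left volume x).integrableOn_comp_preimage
      (Homeomorph.addLeft x).measurableEmbedding |>.mpr hi
  exact h1.integrable_smul_left_of_hasCompactSupport h.continuous h.hasCompactSupport

theorem aestronglyMeasurable_comp_add {n : ℕ} {f : (Fin n → ℂ) → ℂ} (hf : AEStronglyMeasurable f) :
    AEStronglyMeasurable (fun p : (Fin n → ℂ) × (Fin n → ℂ) => f (p.1 + p.2))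
      (volume.prod volume) :=
  hf.comp_quasiMeasurePreserving (Measure.quasiMeasurePreserving_snd.comp
    (measurePreserving_prod_add volume volume).quasiMeasurePreserving)

theorem IsCircleBump.eLpNorm_mollify_sub_le {n : ℕ} {r : ℝ} {η : (Fin n → ℂ) → ℝ}
    (h : IsCircleBump n r η) {f : (Fin n → ℂ) → ℂ} (hf : MemLp f 2) {δ : ℝ≥0∞}
    (hδ : ∀ w, ‖w‖ < r → eLpNorm (fun x => f (x + w) - f x) 2 ≤ δ) :
    eLpNorm (mollify η f - f) 2 ≤ δ := by
  have hm : Measurable fun w => ENNReal.ofReal (η w) :=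
    ENNReal.measurable_ofReal.comp h.continuous.measurable
  have hsq : ∀ g : (Fin n → ℂ) → ℂ, eLpNorm g 2 volume ^ 2 = ∫⁻ x, ‖g x‖ₑ ^ 2 := by
    intro g
    rw [eLpNorm_eq_lintegral_rpow_enorm_toReal (by norm_num) (by norm_num),
      ← ENNReal.rpow_natCast, ← ENNReal.rpow_mul]
    norm_num
  have hmp := aestronglyMeasurable_comp_add hf.1
  have step1 : ∫⁻ x, ‖(mollify η f - f) x‖ₑ ^ 2
      ≤ ∫⁻ x, ∫⁻ w, ENNReal.ofReal (η w) * ‖f (x + w) - f x‖ₑ ^ 2 := by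
    refine lintegral_mono fun x => ?_
    have : (mollify η f - f) x = ∫ w, η w • (f (x + w) - f x) := by
      simp_rw [smul_sub]
      rw [integral_sub (h.integrable_smul hf.locallyIntegrable_two x)
        (h.integrable.smul_const _), integral_smul_const, h.integral_eq_one, one_smul]
      rfl
    rw [this]
    refine h.enorm_integral_sq_le (AEStronglyMeasurable.sub ?_ aestronglyMeasurable_const)
    exact hf.1.comp_measurePreserving (measurePreserving_add_left volume x)
  have step2 : ∫⁻ x, ∫⁻ w, ENNReal.ofReal (η w) * ‖f (x + w) - f x‖ₑ ^ 2
      = ∫⁻ w, ∫⁻ x, ENNReal.ofReal (η w) * ‖f (x + w) - f x‖ₑ ^ 2 := by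
    refine lintegral_lintegral_swap ?_
    have h1 : AEMeasurable (fun p : (Fin n → ℂ) × (Fin n → ℂ) => ENNReal.ofReal (η p.2))
        (volume.prod volume) := (hm.comp measurable_snd).aemeasurable
    have h2 : AEMeasurable (fun p : (Fin n → ℂ) × (Fin n → ℂ) => ‖f (p.1 + p.2) - f p.1‖ₑ ^ 2)
        (volume.prod volume) := (hmp.sub hf.1.comp_fst).enorm.pow_const 2
    exact h1.mul h2
  have step3 : ∀ w, ∫⁻ x, ENNReal.ofReal (η w) * ‖f (x + w) - f x‖ₑ ^ 2
      ≤ ENNReal.ofReal (η w) * δ ^ 2 := by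
    intro w
    rw [lintegral_const_mul' _ _ ENNReal.ofReal_ne_top]
    rcases lt_or_ge ‖w‖ r with hw | hw
    · gcongr
      rw [← hsq fun x => f (x + w) - f x]
      gcongr
      exact hδ w hw
    · simp [h.zero_of_lt w hw]
  have key : eLpNorm (mollify η f - f) 2 volume ^ 2 ≤ δ ^ 2 := by
    rw [hsq]
    refine step1.trans (step2.le.trans ((lintegral_mono step3).trans (le_of_eq ?_)))
    rw [lintegral_mul_const _ hm, h.lintegral_eq_one, one_mul]
  exact (ENNReal.pow_le_pow_left_iff two_ne_zero).mp key

/-! ### Wirtinger calculus -/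

theorem single_complex_eq {n : ℕ} (j : Fin n) (c : ℂ) :
    (Pi.single j c : Fin n → ℂ)
      = c.re • (Pi.single j 1 : Fin n → ℂ) + c.im • (Pi.single j I : Fin n → ℂ) := by
  ext i
  rcases eq_or_ne i j with rfl | h
  · simp [Complex.re_add_im]
  · simp [h]

theorem clm_real_eq_sum {n : ℕ} {F : Type*} [NormedAddCommGroup F] [NormedSpace ℂ F]
    (L : (Fin n → ℂ) →L[ℝ] F) (v : Fin n → ℂ) :
    L v = ∑ j, ((v j).re • L (Pi.single j 1) + (v j).im • L (Pi.single j I)) := by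
  conv_lhs => rw [← Finset.univ_sum_single v]
  rw [map_sum]
  refine Finset.sum_congr rfl fun j _ => ?_
  rw [single_complex_eq, map_add, map_smul, map_smul]

theorem differentiableAt_complex_of_single {n : ℕ} {F : Type*} [NormedAddCommGroup F]
    [NormedSpace ℂ F] {u : (Fin n → ℂ) → F} {z : Fin n → ℂ} (hu : DifferentiableAt ℝ u z)
    (h : ∀ j, fderiv ℝ u z (Pi.single j I) = I • fderiv ℝ u z (Pi.single j 1)) :
    DifferentiableAt ℂ u z := by
  rw [differentiableAt_iff_restrictScalars ℝ hu]
  refine ⟨∑ j, (ContinuousLinearMap.proj (R := ℂ) (φ := fun _ : Fin n => ℂ) j).smulRight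
    (fderiv ℝ u z (Pi.single j 1)), ?_⟩
  ext v
  rw [clm_real_eq_sum (fderiv ℝ u z)]
  simp only [ContinuousLinearMap.coe_restrictScalars', sum_apply,
    ContinuousLinearMap.smulRight_apply, ContinuousLinearMap.proj_apply, h]
  refine Finset.sum_congr rfl fun j _ => ?_
  rw [← Complex.coe_smul, ← Complex.coe_smul, smul_smul, ← add_smul, Complex.re_add_im]

theorem differentiableAt_complex_of_wderBar {n : ℕ} {u : (Fin n → ℂ) → ℂ} {z : Fin n → ℂ}
    (hu : DifferentiableAt ℝ u z) (h : ∀ j, wderBar n j u z = 0) : DifferentiableAt ℂ u z := by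
  refine differentiableAt_complex_of_single hu fun j => ?_
  have h1 := h j
  simp only [wderBar, mul_eq_zero, one_div, inv_eq_zero, OfNat.ofNat_ne_zero, false_or] at h1
  have h2 := congrArg (fun t => -I * t) h1
  simp only [mul_add, ← mul_assoc, mul_zero] at h2
  simp only [neg_mul, I_mul_I, neg_neg, one_mul] at h2
  rw [smul_eq_mul]
  linear_combination h2

theorem wderBar_eq_zero_of_differentiableAt {n : ℕ} {u : (Fin n → ℂ) → ℂ} {z : Fin n → ℂ}
    (hu : DifferentiableAt ℂ u z) (j : Fin n) : wderBar n j u z = 0 := by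
  rw [wderBar, hu.fderiv_restrictScalars ℝ]
  have : (Pi.single j I : Fin n → ℂ) = I • Pi.single j 1 := by
    rw [← Pi.single_smul]; simp
  simp only [ContinuousLinearMap.coe_restrictScalars', this, map_smul, smul_eq_mul]
  rw [← mul_assoc, I_mul_I]; ring

theorem fderiv_apply_of_wder {n : ℕ} {u : (Fin n → ℂ) → ℂ} (z v : Fin n → ℂ) :
    fderiv ℝ u z v = ∑ j, (v j * wder n j u z + starRingEnd ℂ (v j) * wderBar n j u z) := by
  rw [clm_real_eq_sum (fderiv ℝ u z)]
  refine Finset.sum_congr rfl fun j _ => ?_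
  simp only [wder, wderBar, Complex.real_smul]
  have h1 : v j = (v j).re + (v j).im * I := (Complex.re_add_im _).symm
  have h2 : starRingEnd ℂ (v j) = (v j).re - (v j).im * I := by
    apply Complex.ext <;> simp
  rw [h2]
  conv_rhs => rw [h1]
  simp only [add_re, ofReal_re, mul_re, I_re, mul_zero, ofReal_im, I_im, mul_one, sub_self, add_zero,
    add_im, mul_im, zero_add]
  ring_nf
  rw [I_sq]
  ring

/-! ### Derivatives of mollifications -/

open scoped ContDiff Convolution ENNReal

namespace IsCircleBump

variable {n : ℕ} {r : ℝ} {η : (Fin n → ℂ) → ℝ}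

theorem contDiff_mollify (h : IsCircleBump n r η) {f : (Fin n → ℂ) → ℂ}
    (hf : LocallyIntegrable f) : ContDiff ℝ ∞ (mollify η f) := by
  rw [h.mollify_eq]
  exact h.hasCompactSupport.contDiff_convolution_left _ h.contDiff hf

theorem fderiv_neg (h : IsCircleBump n r η) (x : Fin n → ℂ) :
    fderiv ℝ η (-x) = -fderiv ℝ η x := by
  have h1 : HasFDerivAt η (fderiv ℝ η (-x)) (-x) :=
    (h.contDiff.differentiable (by norm_num) _).hasFDerivAt
  have h2 := h1.comp x (hasFDerivAt_id (𝕜 := ℝ) x).neg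
  have h3 : η ∘ Neg.neg = η := by
    ext y; simp [h.neg_eq]
  rw [h3] at h2
  rw [h2.fderiv]
  ext v
  simp

theorem fderiv_mollify (h : IsCircleBump n r η) {f : (Fin n → ℂ) → ℂ}
    (hf : LocallyIntegrable f) (x v : Fin n → ℂ) :
    fderiv ℝ (mollify η f) x v = -∫ y, fderiv ℝ η (y - x) v • f y := by
  have h1 := h.hasCompactSupport.hasFDerivAt_convolution_left (ContinuousLinearMap.lsmul ℝ ℝ)
    (h.contDiff.of_le (by exact_mod_cast le_top)) hf x
  rw [h.mollify_eq, h1.fderiv]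
  have hce : ConvolutionExistsAt (fderiv ℝ η) f x
      ((ContinuousLinearMap.lsmul ℝ ℝ).precompL (Fin n → ℂ)) volume :=
    (h.hasCompactSupport.fderiv ℝ).convolutionExists_left _
      (h.contDiff.continuous_fderiv (by norm_num)) hf x
  rw [convolution, ContinuousLinearMap.integral_apply hce]
  simp only [ContinuousLinearMap.precompL_apply, ContinuousLinearMap.lsmul_apply]
  rw [← integral_sub_left_eq_self _ volume x, ← integral_neg]
  congr 1
  ext y
  rw [sub_sub_cancel, ← neg_sub y x, h.fderiv_neg]
  simp

theorem fderiv_bump_translate (h : IsCircleBump n r η) (x y v : Fin n → ℂ) :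
    fderiv ℝ (fun y => (η (y - x) : ℂ)) y v = (fderiv ℝ η (y - x) v : ℂ) := by
  have h1 : HasFDerivAt η (fderiv ℝ η (y - x)) (y - x) :=
    (h.contDiff.differentiable (by norm_num) _).hasFDerivAt
  have h2 := (Complex.ofRealCLM.hasFDerivAt (x := η (y - x))).comp y
    (h1.comp y ((hasFDerivAt_id (𝕜 := ℝ) y).sub_const x))
  have h3 : fderiv ℝ (fun y => (η (y - x) : ℂ)) y = _ := HasFDerivAt.fderiv h2
  rw [h3]
  simp

theorem integrable_fderiv_smul (h : IsCircleBump n r η) {f : (Fin n → ℂ) → ℂ}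
    (hf : LocallyIntegrable f) (x v : Fin n → ℂ) :
    Integrable fun y => fderiv ℝ η (y - x) v • f y := by
  refine hf.integrable_smul_left_of_hasCompactSupport ?_ ?_
  · have := h.contDiff.continuous_fderiv (by norm_num)
    fun_prop
  · exact ((h.hasCompactSupport.fderiv_apply ℝ v)).comp_homeomorph (Homeomorph.subRight x)

theorem wderBar_mollify (h : IsCircleBump n r η) {f : (Fin n → ℂ) → ℂ}
    (hf : LocallyIntegrable f) (x : Fin n → ℂ) (j : Fin n) :
    wderBar n j (mollify η f) x = -∫ y, f y * wderBar n j (fun y => (η (y - x) : ℂ)) y := by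
  simp only [wderBar, h.fderiv_mollify hf, h.fderiv_bump_translate]
  have e : ∀ y, f y * (1 / 2 * ((fderiv ℝ η (y - x) (Pi.single j 1) : ℂ) +
      I * (fderiv ℝ η (y - x) (Pi.single j I) : ℂ))) = 1 / 2 * (fderiv ℝ η (y - x) (Pi.single j 1) • f y
        + I * (fderiv ℝ η (y - x) (Pi.single j I) • f y)) := by
    intro y; simp only [Complex.real_smul]; ring
  simp_rw [e]
  rw [integral_const_mul, integral_add (h.integrable_fderiv_smul hf x _)
    ((h.integrable_fderiv_smul hf x _).const_mul I), integral_const_mul]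
  ring

theorem wder_mollify (h : IsCircleBump n r η) {f : (Fin n → ℂ) → ℂ}
    (hf : LocallyIntegrable f) (x : Fin n → ℂ) (j : Fin n) :
    wder n j (mollify η f) x = -∫ y, f y * wder n j (fun y => (η (y - x) : ℂ)) y := by
  simp only [wder, h.fderiv_mollify hf, h.fderiv_bump_translate]
  have e : ∀ y, f y * (1 / 2 * ((fderiv ℝ η (y - x) (Pi.single j 1) : ℂ) -
      I * (fderiv ℝ η (y - x) (Pi.single j I) : ℂ))) = 1 / 2 * (fderiv ℝ η (y - x) (Pi.single j 1) • f y
        - I * (fderiv ℝ η (y - x) (Pi.single j I) • f y)) := by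
    intro y; simp only [Complex.real_smul]; ring
  simp_rw [e]
  rw [integral_const_mul, integral_sub (h.integrable_fderiv_smul hf x _)
    ((h.integrable_fderiv_smul hf x _).const_mul I), integral_const_mul]
  ring

theorem isTestFun_translate (h : IsCircleBump n r η) {U : Set (Fin n → ℂ)} {x : Fin n → ℂ}
    (hx : Metric.closedBall x r ⊆ U) : IsTestFun n (fun y => (η (y - x) : ℂ)) U := by
  have hsub : tsupport (fun y => (η (y - x) : ℂ)) ⊆ Metric.closedBall x r := by
    refine closure_minimal (fun y hy => ?_) Metric.isClosed_closedBall
    by_contra hn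
    apply hy
    have : r ≤ ‖y - x‖ := by
      rw [← dist_eq_norm]; exact (not_le.mp (by simpa using hn)).le
    simp [h.zero_of_lt _ this]
  refine ⟨?_, ?_, hsub.trans hx⟩
  · exact Complex.ofRealCLM.contDiff.comp (h.contDiff.comp (contDiff_id.sub contDiff_const))
  · exact HasCompactSupport.of_support_subset_isCompact (isCompact_closedBall x r)
      ((subset_tsupport _).trans hsub)

end IsCircleBump

/-! ### Pointwise bounds, Taylor expansion and Weyl's lemma -/

open scoped ContDiff ENNReal

theorem IsCircleBump.exists_bound {n : ℕ} {r : ℝ} {η : (Fin n → ℂ) → ℝ}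
    (h : IsCircleBump n r η) : ∃ B > (0:ℝ), ∀ w, η w ≤ B := by
  obtain ⟨C, hC⟩ := h.hasCompactSupport.exists_bound_of_continuous h.continuous
  exact ⟨max C 1, by positivity, fun w => ((le_abs_self _).trans (hC w)).trans (le_max_left _ _)⟩

theorem IsCircleBump.enorm_mollify_sq_le {n : ℕ} {r B : ℝ} {η : (Fin n → ℂ) → ℝ}
    (h : IsCircleBump n r η) (hB : ∀ w, η w ≤ B) {f : (Fin n → ℂ) → ℂ}
    (hf : AEStronglyMeasurable f) (x : Fin n → ℂ) :
    ‖mollify η f x‖ₑ ^ 2 ≤ ENNReal.ofReal B * ∫⁻ y, ‖f y‖ₑ ^ 2 := by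
  refine (h.enorm_integral_sq_le
    (hf.comp_measurePreserving (measurePreserving_add_left volume x))).trans ?_
  rw [← lintegral_add_left_eq_self (fun y => ‖f y‖ₑ ^ 2) x,
    ← lintegral_const_mul' _ _ ENNReal.ofReal_ne_top]
  refine lintegral_mono fun w => ?_
  dsimp only [Function.comp]
  gcongr
  exact hB w

theorem exists_enorm_sq_le_lintegral (n : ℕ) {r : ℝ} (hr : 0 < r) :
    ∃ C > (0:ℝ), ∀ (f : (Fin n → ℂ) → ℂ) (z : Fin n → ℂ),
      DifferentiableOn ℂ f (Metric.ball z r) →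
      ‖f z‖ₑ ^ 2 ≤ ENNReal.ofReal C * ∫⁻ y in Metric.ball z r, ‖f y‖ₑ ^ 2 := by
  obtain ⟨η, h⟩ := exists_isCircleBump n (half_pos hr)
  obtain ⟨B, hB0, hB⟩ := h.exists_bound
  refine ⟨B, hB0, fun f z hf => ?_⟩
  have hsub : Metric.closedBall z (r / 2) ⊆ Metric.ball z r :=
    Metric.closedBall_subset_ball (by linarith)
  set g := (Metric.ball z r).indicator f with hg
  have hgm : AEStronglyMeasurable g :=
    (aestronglyMeasurable_indicator_iff Metric.isOpen_ball.measurableSet).mpr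
      (hf.continuousOn.aestronglyMeasurable Metric.isOpen_ball.measurableSet)
  have h1 : mollify η g z = f z := by
    rw [← h.integral_eq Metric.isOpen_ball hf hsub, mollify]
    congr 1
    ext w
    rcases lt_or_ge ‖w‖ (r / 2) with hw | hw
    · rw [hg, indicator_of_mem]
      apply hsub
      simpa using hw.le
    · simp [h.zero_of_lt w hw]
  have h2 := h.enorm_mollify_sq_le hB hgm z
  rw [h1] at h2
  refine h2.trans (le_of_eq ?_)
  rw [← lintegral_indicator Metric.isOpen_ball.measurableSet]
  congr 2
  ext y
  by_cases hy : y ∈ Metric.ball z r <;> simp [hg, hy]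

theorem exists_taylor_bound {r : ℝ} (hr : 0 < r) :
    ∃ C : ℝ, 0 ≤ C ∧ ∀ (n : ℕ) (f : (Fin n → ℂ) → ℂ) (z : Fin n → ℂ) (M : ℝ),
      DifferentiableOn ℂ f (Metric.ball z r) → (∀ w ∈ Metric.ball z r, ‖f w‖ ≤ M) →
      ∀ h : Fin n → ℂ, ‖h‖ < r / 2 → ‖f (z + h) - f z - fderiv ℂ f z h‖ ≤ C * M * ‖h‖ ^ 2 := by
  refine ⟨2 * (2 / (r / 4)) / (r / 4), by positivity, fun n f z M hf hM h hh => ?_⟩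
  have hD : ∀ w ∈ Metric.ball z (3 * r / 4), ‖fderiv ℂ f w‖ ≤ 2 * M / (r / 4) := by
    intro w hw
    have hsub : Metric.ball w (r / 4) ⊆ Metric.ball z r := by
      apply Metric.ball_subset_ball'
      have := Metric.mem_ball.mp hw
      linarith
    exact norm_fderiv_le_of_forall_ball (by positivity) (hf.mono hsub) fun p hp => hM p (hsub hp)
  have hDf := hf.fderiv_pi Metric.isOpen_ball
  have hD2 : ∀ w ∈ Metric.ball z (r / 2), ‖fderiv ℂ (fderiv ℂ f) w‖
      ≤ 2 * (2 * M / (r / 4)) / (r / 4) := by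
    intro w hw
    have hsub : Metric.ball w (r / 4) ⊆ Metric.ball z (3 * r / 4) := by
      apply Metric.ball_subset_ball'
      have := Metric.mem_ball.mp hw
      linarith
    exact norm_fderiv_le_of_forall_ball (by positivity)
      (hDf.mono (hsub.trans (Metric.ball_subset_ball (by linarith)))) fun p hp => hD p (hsub hp)
  set s := Metric.closedBall z ‖h‖
  have hs : s ⊆ Metric.ball z (r / 2) := Metric.closedBall_subset_ball hh
  have hs' : s ⊆ Metric.ball z r := hs.trans (Metric.ball_subset_ball (by linarith))
  have hcs : Convex ℝ s := convex_closedBall _ _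
  have hzs : z ∈ s := Metric.mem_closedBall_self (norm_nonneg _)
  have hzh : z + h ∈ s := by simp [s]
  have h1 : ∀ w ∈ s, ‖fderiv ℂ f w - fderiv ℂ f z‖ ≤ 2 * (2 * M / (r / 4)) / (r / 4) * ‖h‖ := by
    intro w hw
    have hM0 : 0 ≤ M := (norm_nonneg _).trans (hM z (Metric.mem_ball_self hr))
    have := hcs.norm_image_sub_le_of_norm_fderiv_le (𝕜 := ℂ)
      (fun x hx => hDf.differentiableAt (Metric.isOpen_ball.mem_nhds (hs' hx)))
      (fun x hx => hD2 x (hs hx)) hzs hw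
    refine this.trans ?_
    gcongr
    simpa [s, dist_eq_norm] using hw
  have h2 := hcs.norm_image_sub_le_of_norm_fderiv_le' (𝕜 := ℂ)
    (fun x hx => hf.differentiableAt (Metric.isOpen_ball.mem_nhds (hs' hx))) h1 hzs hzh
  rw [add_sub_cancel_left] at h2
  refine h2.trans (le_of_eq ?_)
  ring

theorem differentiableOn_mollify_of_weak {n : ℕ} {U : Set (Fin n → ℂ)}
    {F : (Fin n → ℂ) → ℂ} (hF : LocallyIntegrable F)
    (hw : ∀ ψ, IsTestFun n ψ U → ∀ j, ∫ z, F z * wderBar n j ψ z = 0)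
    {r : ℝ} {η : (Fin n → ℂ) → ℝ} (h : IsCircleBump n r η) {p : Fin n → ℂ}
    (hp : Metric.closedBall p r ⊆ U) : DifferentiableAt ℂ (mollify η F) p := by
  refine differentiableAt_complex_of_wderBar ((h.contDiff_mollify hF).differentiable
    (by norm_num) _) fun j => ?_
  rw [h.wderBar_mollify hF, hw _ (h.isTestFun_translate hp), neg_zero]

theorem weyl_lemma {n : ℕ} {U : Set (Fin n → ℂ)} (hU : IsOpen U) {F : (Fin n → ℂ) → ℂ}
    (hF : MemLp F 2 (volume.restrict U))
    (hw : ∀ ψ, IsTestFun n ψ U → ∀ j, ∫ z in U, F z * wderBar n j ψ z = 0) :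
    ∃ G, DifferentiableOn ℂ G U ∧ F =ᵐ[volume.restrict U] G := by
  set F' := U.indicator F with hF'
  have hF2 : MemLp F' 2 := (memLp_indicator_iff_restrict hU.measurableSet).mpr hF
  have hFl := hF2.locallyIntegrable_two
  have hw' : ∀ ψ, IsTestFun n ψ U → ∀ j, ∫ z, F' z * wderBar n j ψ z = 0 := by
    intro ψ hψ j
    rw [← hw ψ hψ j, ← integral_indicator hU.measurableSet]
    congr 1
    ext z
    by_cases hz : z ∈ U <;> simp [hF', hz]
  have hpos : ∀ k : ℕ, (0:ℝ) < 1 / ((k:ℝ) + 1) := fun k => Nat.one_div_pos_of_nat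
  choose η hη using fun k : ℕ => exists_isCircleBump n (hpos k)
  have hlim : Tendsto (fun k : ℕ => 1 / ((k:ℝ) + 1)) atTop (𝓝 0) :=
    tendsto_one_div_add_atTop_nhds_zero_nat
  have hL2 : Tendsto (fun k => eLpNorm (mollify (η k) F' - F') 2 volume) atTop (𝓝 0) := by
    rw [ENNReal.tendsto_nhds_zero]
    intro δ hδ
    obtain ⟨ε, hε, hb⟩ := hF2.exists_eLpNorm_translate_sub_le hδ.ne'
    filter_upwards [hlim.eventually (gt_mem_nhds hε)] with k hk
    exact (hη k).eLpNorm_mollify_sub_le hF2 fun w hw => hb w (hw.trans hk)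
  have hmeas : ∀ k, AEStronglyMeasurable (mollify (η k) F') := fun k =>
    ((hη k).contDiff_mollify hFl).continuous.aestronglyMeasurable
  have hpt : ∀ {r : ℝ} {θ : (Fin n → ℂ) → ℝ}, 0 < r → IsCircleBump n r θ → ∀ p : Fin n → ℂ,
      Metric.closedBall p (2 * r) ⊆ U →
      Tendsto (fun k => mollify (η k) F' p) atTop (𝓝 (mollify θ F' p)) := by
    intro r θ hr hθ p hp
    obtain ⟨B, hB0, hB⟩ := hθ.exists_bound
    have hev : ∀ᶠ k in atTop, mollify (η k) F' p = mollify θ (mollify (η k) F') p := by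
      filter_upwards [hlim.eventually (gt_mem_nhds (half_pos hr))] with k hk
      symm
      refine hθ.integral_eq Metric.isOpen_ball (U := Metric.ball p (3 * r / 2))
        (fun q hq => ?_) (Metric.closedBall_subset_ball (by linarith))
      refine (differentiableOn_mollify_of_weak hFl hw' (hη k) ?_).differentiableWithinAt
      refine (Metric.closedBall_subset_closedBall' ?_).trans hp
      have := Metric.mem_ball.mp hq
      linarith
    refine Tendsto.congr' (f₁ := fun k => mollify θ (mollify (η k) F') p)
      (hev.mono fun k hk => hk.symm) ?_
    rw [tendsto_iff_edist_tendsto_0]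
    have hle : ∀ k, edist (mollify θ (mollify (η k) F') p) (mollify θ F' p) ^ 2
        ≤ ENNReal.ofReal B * eLpNorm (mollify (η k) F' - F') 2 volume ^ 2 := by
      intro k
      have h1 : mollify θ (mollify (η k) F') p - mollify θ F' p
          = mollify θ (mollify (η k) F' - F') p := by
        rw [mollify, mollify, mollify, ← integral_sub
          (hθ.integrable_smul ((hη k).contDiff_mollify hFl).continuous.locallyIntegrable p)
          (hθ.integrable_smul hFl p)]
        congr 1
        ext w
        rw [← smul_sub]
        rfl
      have h2 := hθ.enorm_mollify_sq_le hB ((hmeas k).sub hF2.1) p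
      rw [edist_eq_enorm_sub, h1]
      refine h2.trans (le_of_eq ?_)
      rw [eLpNorm_eq_lintegral_rpow_enorm_toReal (by norm_num) (by norm_num),
        ← ENNReal.rpow_natCast, ← ENNReal.rpow_mul]
      norm_num
    have h3 : Tendsto (fun k => ENNReal.ofReal B * eLpNorm (mollify (η k) F' - F') 2 volume ^ 2)
        atTop (𝓝 0) := by
      have := ENNReal.Tendsto.const_mul (a := ENNReal.ofReal B)
        (ENNReal.Tendsto.pow (n := 2) hL2) (Or.inr ENNReal.ofReal_ne_top)
      simpa using this
    have h4 := tendsto_of_tendsto_of_tendsto_of_le_of_le tendsto_const_nhds h3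
      (fun _ => zero_le) hle
    have h5 := h4.ennrpow_const (1 / 2)
    simp only [← ENNReal.rpow_natCast, ← ENNReal.rpow_mul] at h5
    norm_num at h5
    exact h5
  have hloc : ∀ z ∈ U, ∃ r > 0, Metric.closedBall z (3 * r) ⊆ U := by
    intro z hz
    obtain ⟨ε, hε, h⟩ := Metric.nhds_basis_closedBall.mem_iff.mp (hU.mem_nhds hz)
    exact ⟨ε / 3, by positivity, by convert h using 2; ring⟩
  refine ⟨fun p => limUnder atTop fun k => mollify (η k) F' p, ?_, ?_⟩
  · intro z hz
    obtain ⟨r, hr, hrU⟩ := hloc z hz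
    obtain ⟨θ, hθ⟩ := exists_isCircleBump n hr
    refine ((differentiableOn_mollify_of_weak hFl hw' hθ (p := z)
      ((Metric.closedBall_subset_closedBall (by linarith)).trans hrU)).congr_of_eventuallyEq
        ?_).differentiableWithinAt
    filter_upwards [Metric.ball_mem_nhds z hr] with p hp
    refine (hpt hr hθ p ((Metric.closedBall_subset_closedBall' ?_).trans hrU)).limUnder_eq
    have := Metric.mem_ball.mp hp
    linarith
  · obtain ⟨ns, hns, hae⟩ := (tendstoInMeasure_of_tendsto_eLpNorm (by norm_num) hmeas hF2.1
      hL2).exists_seq_tendsto_ae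
    rw [EventuallyEq, ae_restrict_iff' hU.measurableSet]
    filter_upwards [hae] with z hz hzU
    obtain ⟨r, hr, hrU⟩ := hloc z hzU
    obtain ⟨θ, hθ⟩ := exists_isCircleBump n hr
    have h1 := hpt hr hθ z ((Metric.closedBall_subset_closedBall (by linarith)).trans hrU)
    rw [h1.limUnder_eq]
    have h2 := tendsto_nhds_unique hz (h1.comp hns.tendsto_atTop)
    rw [← h2, hF', indicator_of_mem hzU]

/-! ### Rules of the Wirtinger calculus -/

open scoped ContDiff ENNReal ComplexConjugate

section WirtingerRules

variable {n : ℕ} {j k : Fin n} {u v : (Fin n → ℂ) → ℂ} {z : Fin n → ℂ} {U : Set (Fin n → ℂ)}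

theorem wder_mul (hu : DifferentiableAt ℝ u z) (hv : DifferentiableAt ℝ v z) :
    wder n j (fun w => u w * v w) z = wder n j u z * v z + u z * wder n j v z := by
  simp only [wder, fderiv_fun_mul hu hv, add_apply, smul_apply, smul_eq_mul]
  ring

theorem wderBar_mul (hu : DifferentiableAt ℝ u z) (hv : DifferentiableAt ℝ v z) :
    wderBar n j (fun w => u w * v w) z = wderBar n j u z * v z + u z * wderBar n j v z := by
  simp only [wderBar, fderiv_fun_mul hu hv, add_apply, smul_apply, smul_eq_mul]
  ring

theorem wder_add (hu : DifferentiableAt ℝ u z) (hv : DifferentiableAt ℝ v z) :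
    wder n j (fun w => u w + v w) z = wder n j u z + wder n j v z := by
  simp only [wder, fderiv_fun_add hu hv, add_apply]
  ring

theorem wderBar_add (hu : DifferentiableAt ℝ u z) (hv : DifferentiableAt ℝ v z) :
    wderBar n j (fun w => u w + v w) z = wderBar n j u z + wderBar n j v z := by
  simp only [wderBar, fderiv_fun_add hu hv, add_apply]
  ring

theorem wderBar_sub (hu : DifferentiableAt ℝ u z) (hv : DifferentiableAt ℝ v z) :
    wderBar n j (fun w => u w - v w) z = wderBar n j u z - wderBar n j v z := by
  simp only [wderBar, fderiv_fun_sub hu hv, sub_apply]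
  ring

theorem fderiv_conj_apply (u : (Fin n → ℂ) → ℂ) (z v : Fin n → ℂ) :
    fderiv ℝ (fun w => conj (u w)) z v = conj (fderiv ℝ u z v) := by
  have := conjCLE.comp_fderiv (f := u) (x := z)
  have h2 : (fun w => conj (u w)) = conjCLE ∘ u := by ext; simp
  rw [h2, this]; simp

theorem wder_conj : wder n j (fun w => conj (u w)) z = conj (wderBar n j u z) := by
  simp only [wder, wderBar, fderiv_conj_apply, map_mul, map_add, conj_I]
  simp only [map_div₀, map_one, map_ofNat]
  ring

theorem wderBar_conj : wderBar n j (fun w => conj (u w)) z = conj (wder n j u z) := by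
  simp only [wder, wderBar, fderiv_conj_apply, map_mul, map_sub, conj_I]
  simp only [map_div₀, map_one, map_ofNat]
  ring

theorem wder_cexp (hu : DifferentiableAt ℝ u z) :
    wder n j (fun w => Complex.exp (u w)) z = Complex.exp (u z) * wder n j u z := by
  have h := hu.hasFDerivAt.cexp.fderiv
  simp only [wder, h, smul_apply, smul_eq_mul]
  ring

theorem wderBar_cexp (hu : DifferentiableAt ℝ u z) :
    wderBar n j (fun w => Complex.exp (u w)) z = Complex.exp (u z) * wderBar n j u z := by
  have h := hu.hasFDerivAt.cexp.fderiv
  simp only [wderBar, h, smul_apply, smul_eq_mul]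
  ring

theorem wder_neg : wder n j (fun w => -u w) z = -wder n j u z := by
  simp only [wder, fderiv_fun_neg, neg_apply]
  ring

theorem wderBar_neg : wderBar n j (fun w => -u w) z = -wderBar n j u z := by
  simp only [wderBar, fderiv_fun_neg, neg_apply]
  ring

theorem conj_wder_ofReal (φ : (Fin n → ℂ) → ℝ) :
    conj (wder n j (fun w => (φ w : ℂ)) z) = wderBar n j (fun w => (φ w : ℂ)) z := by
  rw [← wderBar_conj]; simp

theorem Filter.EventuallyEq.wder_eq (h : u =ᶠ[𝓝 z] v) : wder n j u z = wder n j v z := by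
  simp only [wder, h.fderiv_eq]

theorem Filter.EventuallyEq.wderBar_eq (h : u =ᶠ[𝓝 z] v) :
    wderBar n j u z = wderBar n j v z := by
  simp only [wderBar, h.fderiv_eq]

theorem ContDiffOn.fderiv_apply_const {F : Type*} [NormedAddCommGroup F] [NormedSpace ℝ F]
    {f : (Fin n → ℂ) → F} (hu : ContDiffOn ℝ ∞ f U) (hU : IsOpen U) (a : Fin n → ℂ) :
    ContDiffOn ℝ ∞ (fun w => fderiv ℝ f w a) U :=
  (hu.fderiv_of_isOpen hU (by simp)).clm_apply contDiffOn_const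

theorem ContDiffOn.wder (hu : ContDiffOn ℝ ∞ u U) (hU : IsOpen U) (j : Fin n) :
    ContDiffOn ℝ ∞ (wder n j u) U := by
  unfold _root_.wder
  exact contDiffOn_const.mul ((hu.fderiv_apply_const hU _).sub
    (contDiffOn_const.mul (hu.fderiv_apply_const hU _)))

theorem ContDiffOn.wderBar (hu : ContDiffOn ℝ ∞ u U) (hU : IsOpen U) (j : Fin n) :
    ContDiffOn ℝ ∞ (wderBar n j u) U := by
  unfold _root_.wderBar
  exact contDiffOn_const.mul ((hu.fderiv_apply_const hU _).add
    (contDiffOn_const.mul (hu.fderiv_apply_const hU _)))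

theorem fderiv_fderiv_apply_comm {F : Type*} [NormedAddCommGroup F] [NormedSpace ℝ F]
    {f : (Fin n → ℂ) → F} (hU : IsOpen U) (hu : ContDiffOn ℝ ∞ f U)
    (hz : z ∈ U) (a b : Fin n → ℂ) :
    fderiv ℝ (fun w => fderiv ℝ f w a) z b = fderiv ℝ (fun w => fderiv ℝ f w b) z a := by
  have hs : IsSymmSndFDerivAt ℝ f z :=
    (hu.contDiffAt (hU.mem_nhds hz)).isSymmSndFDerivAt
      (by simpa using WithTop.coe_le_coe.2 (le_top : (2:ℕ∞) ≤ ⊤))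
  have hd : DifferentiableAt ℝ (fderiv ℝ f) z :=
    (((hu.fderiv_of_isOpen hU (m := ∞) (by simp)).contDiffAt (hU.mem_nhds hz)).differentiableAt
      (by norm_num))
  rw [fderiv_clm_apply hd (by fun_prop), fderiv_clm_apply hd (by fun_prop)]
  simp [hs.eq a b]

theorem ContDiffOn.differentiableAt_of_isOpen {F : Type*} [NormedAddCommGroup F]
    [NormedSpace ℝ F] {f : (Fin n → ℂ) → F} (hu : ContDiffOn ℝ ∞ f U) (hU : IsOpen U)
    (hz : z ∈ U) : DifferentiableAt ℝ f z :=
  (hu.contDiffAt (hU.mem_nhds hz)).differentiableAt (by norm_num)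

theorem fderiv_linear_comb (hU : IsOpen U) (hu : ContDiffOn ℝ ∞ u U) (hz : z ∈ U) (c : ℂ)
    (a b v : Fin n → ℂ) :
    fderiv ℝ (fun w => 1 / 2 * (fderiv ℝ u w a + c * fderiv ℝ u w b)) z v
      = 1 / 2 * (fderiv ℝ (fun w => fderiv ℝ u w a) z v
        + c * fderiv ℝ (fun w => fderiv ℝ u w b) z v) := by
  have ha := (hu.fderiv_apply_const hU a).differentiableAt_of_isOpen hU hz
  have hb := (hu.fderiv_apply_const hU b).differentiableAt_of_isOpen hU hz
  rw [fderiv_const_mul (ha.fun_add (hb.const_mul c)), fderiv_fun_add ha (hb.const_mul c),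
    fderiv_const_mul hb]
  simp only [smul_apply, add_apply, smul_eq_mul]

theorem wder_eq_add (u : (Fin n → ℂ) → ℂ) : wder n j u = fun z =>
    1 / 2 * (fderiv ℝ u z (Pi.single j 1) + (-I) * fderiv ℝ u z (Pi.single j I)) := by
  ext z; rw [wder]; ring

theorem wderBar_wder_comm (hU : IsOpen U) (hu : ContDiffOn ℝ ∞ u U) (hz : z ∈ U) :
    wderBar n k (wder n j u) z = wder n j (wderBar n k u) z := by
  rw [wder_eq_add, wder_eq_add]
  unfold wderBar
  simp only [fderiv_linear_comb hU hu hz]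
  rw [fderiv_fderiv_apply_comm hU hu hz (Pi.single j 1) (Pi.single k 1),
    fderiv_fderiv_apply_comm hU hu hz (Pi.single j I) (Pi.single k 1),
    fderiv_fderiv_apply_comm hU hu hz (Pi.single j 1) (Pi.single k I),
    fderiv_fderiv_apply_comm hU hu hz (Pi.single j I) (Pi.single k I)]
  ring

theorem wderBar_wderBar_comm (hU : IsOpen U) (hu : ContDiffOn ℝ ∞ u U) (hz : z ∈ U) :
    wderBar n k (wderBar n j u) z = wderBar n j (wderBar n k u) z := by
  unfold wderBar
  simp only [fderiv_linear_comb hU hu hz]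
  rw [fderiv_fderiv_apply_comm hU hu hz (Pi.single j 1) (Pi.single k 1),
    fderiv_fderiv_apply_comm hU hu hz (Pi.single j I) (Pi.single k 1),
    fderiv_fderiv_apply_comm hU hu hz (Pi.single j 1) (Pi.single k I),
    fderiv_fderiv_apply_comm hU hu hz (Pi.single j I) (Pi.single k I)]
  ring

end WirtingerRules

/-! ### Test functions -/

namespace IsTestFun

variable {n : ℕ} {ψ χ : (Fin n → ℂ) → ℂ} {Ω : Set (Fin n → ℂ)}

theorem of_contDiffOn (hΩ : IsOpen Ω) (h : ContDiffOn ℝ ∞ ψ Ω) (hc : HasCompactSupport ψ)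
    (hs : tsupport ψ ⊆ Ω) : IsTestFun n ψ Ω := by
  refine ⟨contDiff_iff_contDiffAt.2 fun x => ?_, hc, hs⟩
  by_cases hx : x ∈ tsupport ψ
  · exact h.contDiffAt (hΩ.mem_nhds (hs hx))
  · exact (contDiffAt_const (c := (0:ℂ))).congr_of_eventuallyEq
      (notMem_tsupport_iff_eventuallyEq.1 hx)

theorem mul_left (hψ : IsTestFun n ψ Ω) (hΩ : IsOpen Ω) {a : (Fin n → ℂ) → ℂ}
    (ha : ContDiffOn ℝ ∞ a Ω) : IsTestFun n (fun z => a z * ψ z) Ω :=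
  of_contDiffOn hΩ (ha.mul hψ.1.contDiffOn) hψ.2.1.mul_left
    ((closure_mono (Function.support_mul_subset_right a ψ)).trans hψ.2.2)

theorem mul_right (hψ : IsTestFun n ψ Ω) (hΩ : IsOpen Ω) {a : (Fin n → ℂ) → ℂ}
    (ha : ContDiffOn ℝ ∞ a Ω) : IsTestFun n (fun z => ψ z * a z) Ω := by
  simpa only [mul_comm] using hψ.mul_left hΩ ha

theorem sub (hψ : IsTestFun n ψ Ω) (hχ : IsTestFun n χ Ω) :
    IsTestFun n (fun z => ψ z - χ z) Ω :=
  ⟨hψ.1.sub hχ.1, hψ.2.1.sub hχ.2.1, (closure_mono (Function.support_sub ψ χ)).trans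
    (by rw [closure_union]; exact union_subset hψ.2.2 hχ.2.2)⟩

theorem add (hψ : IsTestFun n ψ Ω) (hχ : IsTestFun n χ Ω) :
    IsTestFun n (fun z => ψ z + χ z) Ω :=
  ⟨hψ.1.add hχ.1, hψ.2.1.add hχ.2.1, (closure_mono (Function.support_add ψ χ)).trans
    (by rw [closure_union]; exact union_subset hψ.2.2 hχ.2.2)⟩

theorem star (hψ : IsTestFun n ψ Ω) : IsTestFun n (fun z => conj (ψ z)) Ω := by
  have hs : Function.support (fun z => conj (ψ z)) = Function.support ψ := by
    ext; simp
  refine ⟨conjCLE.contDiff.comp hψ.1, ?_, ?_⟩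
  · unfold HasCompactSupport tsupport; rw [hs]; exact hψ.2.1
  · unfold tsupport; rw [hs]; exact hψ.2.2

theorem wder_apply_eq_zero {j : Fin n} {x : Fin n → ℂ} (hx : x ∉ tsupport ψ) :
    _root_.wder n j ψ x = 0 ∧ _root_.wderBar n j ψ x = 0 := by
  have := (notMem_tsupport_iff_eventuallyEq.1 hx)
  rw [this.wder_eq, this.wderBar_eq]
  simp only [_root_.wder, _root_.wderBar]
  change 1 / 2 * (fderiv ℝ (fun _ => (0:ℂ)) x _ - I * fderiv ℝ (fun _ => (0:ℂ)) x _) = 0 ∧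
    1 / 2 * (fderiv ℝ (fun _ => (0:ℂ)) x _ + I * fderiv ℝ (fun _ => (0:ℂ)) x _) = 0
  simp

theorem wder (hψ : IsTestFun n ψ Ω) (j : Fin n) : IsTestFun n (_root_.wder n j ψ) Ω := by
  have hs : Function.support (_root_.wder n j ψ) ⊆ tsupport ψ := fun x hx => by
    by_contra h; exact hx (wder_apply_eq_zero h).1
  refine ⟨contDiffOn_univ.1 (hψ.1.contDiffOn.wder isOpen_univ j),
    HasCompactSupport.of_support_subset_isCompact hψ.2.1 hs,
    (closure_minimal hs (isClosed_tsupport _)).trans hψ.2.2⟩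

theorem wderBar (hψ : IsTestFun n ψ Ω) (j : Fin n) : IsTestFun n (_root_.wderBar n j ψ) Ω := by
  have hs : Function.support (_root_.wderBar n j ψ) ⊆ tsupport ψ := fun x hx => by
    by_contra h; exact hx (wder_apply_eq_zero h).2
  refine ⟨contDiffOn_univ.1 (hψ.1.contDiffOn.wderBar isOpen_univ j),
    HasCompactSupport.of_support_subset_isCompact hψ.2.1 hs,
    (closure_minimal hs (isClosed_tsupport _)).trans hψ.2.2⟩

theorem integrable (hψ : IsTestFun n ψ Ω) : Integrable ψ :=
  hψ.1.continuous.integrable_of_hasCompactSupport hψ.2.1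

theorem eq_zero_of_notMem (hψ : IsTestFun n ψ Ω) {x : Fin n → ℂ} (hx : x ∉ Ω) : ψ x = 0 :=
  image_eq_zero_of_notMem_tsupport fun h => hx (hψ.2.2 h)

theorem setIntegral_eq (hψ : IsTestFun n ψ Ω) : ∫ z in Ω, ψ z = ∫ z, ψ z :=
  setIntegral_eq_integral_of_forall_compl_eq_zero fun _ hx => hψ.eq_zero_of_notMem hx

theorem integral_fderiv (hψ : IsTestFun n ψ Ω) (a : Fin n → ℂ) :
    ∫ z, fderiv ℝ ψ z a = 0 := by
  have hi : Integrable fun z => fderiv ℝ ψ z a :=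
    (hψ.1.continuous_fderiv (by norm_num)).clm_apply continuous_const
      |>.integrable_of_hasCompactSupport (hψ.2.1.fderiv_apply ℝ a)
  have := integral_mul_fderiv_eq_neg_fderiv_mul_of_integrable (μ := volume) (𝕜 := ℂ)
    (f := fun _ : Fin n → ℂ => (1:ℂ)) (g := ψ) (v := a) (by simp) (by simpa using hi)
    (by simpa using hψ.integrable) (by simp) (fun x _ => hψ.1.differentiable (by norm_num) x)
  simpa using this

theorem integrable_fderiv (hψ : IsTestFun n ψ Ω) (a : Fin n → ℂ) :
    Integrable fun z => fderiv ℝ ψ z a :=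
  (hψ.1.continuous_fderiv (by norm_num)).clm_apply continuous_const
    |>.integrable_of_hasCompactSupport (hψ.2.1.fderiv_apply ℝ a)

theorem integral_wder (hψ : IsTestFun n ψ Ω) (j : Fin n) :
    ∫ z in Ω, _root_.wder n j ψ z = 0 := by
  rw [(hψ.wder j).setIntegral_eq]
  simp only [_root_.wder]
  rw [integral_const_mul, integral_sub (hψ.integrable_fderiv _)
    ((hψ.integrable_fderiv _).const_mul I), integral_const_mul, hψ.integral_fderiv,
    hψ.integral_fderiv]
  simp

theorem integral_wderBar (hψ : IsTestFun n ψ Ω) (j : Fin n) :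
    ∫ z in Ω, _root_.wderBar n j ψ z = 0 := by
  rw [(hψ.wderBar j).setIntegral_eq]
  simp only [_root_.wderBar]
  rw [integral_const_mul, integral_add (hψ.integrable_fderiv _)
    ((hψ.integrable_fderiv _).const_mul I), integral_const_mul, hψ.integral_fderiv,
    hψ.integral_fderiv]
  simp

end IsTestFun

/-! ### The Bochner–Kohn inequality for test forms -/

open scoped ContDiff ENNReal ComplexConjugate

section Bochner

variable {n : ℕ} {Ω : Set (Fin n → ℂ)} {φ : (Fin n → ℂ) → ℝ} {w : Fin n → (Fin n → ℂ) → ℂ}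

theorem ContDiffOn.ofReal_complex (hφ : ContDiffOn ℝ ∞ φ Ω) :
    ContDiffOn ℝ ∞ (fun z => (φ z : ℂ)) Ω :=
  Complex.ofRealCLM.contDiff.comp_contDiffOn hφ

theorem ContDiffOn.cexp_neg_ofReal (hφ : ContDiffOn ℝ ∞ φ Ω) :
    ContDiffOn ℝ ∞ (fun z => Complex.exp (-(φ z : ℂ))) Ω :=
  Complex.contDiff_exp.comp_contDiffOn hφ.ofReal_complex.neg

/-- The twisted divergence term `∂_j w_j - (∂_j φ) w_j`. -/
noncomputable def twistDer (n : ℕ) (φ : (Fin n → ℂ) → ℝ) (w : Fin n → (Fin n → ℂ) → ℂ) (j : Fin n)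
    (z : Fin n → ℂ) : ℂ :=
  wder n j (w j) z - wder n j (fun v => (φ v : ℂ)) z * w j z

theorem twistDer_isTestFun (hΩ : IsOpen Ω) (hφ : ContDiffOn ℝ ∞ φ Ω)
    (hw : ∀ j, IsTestFun n (w j) Ω) (j : Fin n) : IsTestFun n (twistDer n φ w j) Ω :=
  ((hw j).wder j).sub ((hw j).mul_left hΩ (hφ.ofReal_complex.wder hΩ j))

theorem twistDer_mul_conj (hΩ : IsOpen Ω) (hφ : ContDiffOn ℝ ∞ φ Ω)
    (hw : ∀ j, IsTestFun n (w j) Ω) (j k : Fin n) {z : Fin n → ℂ} (hz : z ∈ Ω) :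
    twistDer n φ w j z * conj (twistDer n φ w k z) * Complex.exp (-(φ z : ℂ)) =
      wderBar n k (fun v => twistDer n φ w j v * (conj (w k v) * Complex.exp (-(φ v : ℂ)))) z
      - wder n j (fun v => wderBar n k (w j) v * (conj (w k v) * Complex.exp (-(φ v : ℂ)))) z
      + wderBar n k (w j) z * conj (wderBar n j (w k) z) * Complex.exp (-(φ z : ℂ))
      + cHess n φ z j k * w j z * conj (w k z) * Complex.exp (-(φ z : ℂ)) := by
  have d : ∀ {u : (Fin n → ℂ) → ℂ}, ContDiffOn ℝ ∞ u Ω → DifferentiableAt ℝ u z :=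
    fun h => h.differentiableAt_of_isOpen hΩ hz
  have hΦ := hφ.ofReal_complex
  have hwj := fun j => (hw j).1.contDiffOn (s := Ω)
  have hwk := (hw k).star.1.contDiffOn (s := Ω)
  rw [wderBar_mul (d (twistDer_isTestFun hΩ hφ hw j).1.contDiffOn)
      ((d hwk).fun_mul (d hφ.cexp_neg_ofReal)),
    wder_mul (d ((hwj j).wderBar hΩ k)) ((d hwk).fun_mul (d hφ.cexp_neg_ofReal)),
    wderBar_mul (d hwk) (d hφ.cexp_neg_ofReal), wder_mul (d hwk) (d hφ.cexp_neg_ofReal),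
    wderBar_cexp (d hΦ.neg), wder_cexp (d hΦ.neg), wderBar_neg, wder_neg, wderBar_conj, wder_conj]
  have e : wderBar n k (twistDer n φ w j) z = wder n j (wderBar n k (w j)) z
      - (cHess n φ z j k * w j z + wder n j (fun v => (φ v : ℂ)) z * wderBar n k (w j) z) := by
    unfold twistDer
    rw [wderBar_sub (d ((hwj j).wder hΩ j)) ((d (hΦ.wder hΩ j)).fun_mul (d (hwj j))),
      wderBar_mul (d (hΦ.wder hΩ j)) (d (hwj j)), wderBar_wder_comm hΩ (hwj j) hz]
    rfl
  rw [e]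
  have e2 : conj (twistDer n φ w k z) = conj (wder n k (w k) z)
      - wderBar n k (fun v => (φ v : ℂ)) z * conj (w k z) := by
    rw [twistDer, map_sub, map_mul, conj_wder_ofReal]
  rw [e2]
  ring

theorem integrableOn_bochner (hΩ : IsOpen Ω) (hφ : ContDiffOn ℝ ∞ φ Ω)
    (hw : ∀ j, IsTestFun n (w j) Ω) (j k : Fin n) :
    IntegrableOn (fun z => (wderBar n k (w j) z * conj (wderBar n j (w k) z)
        + cHess n φ z j k * w j z * conj (w k z)) * Complex.exp (-(φ z : ℂ))) Ω := by
  refine IsTestFun.integrable (Ω := Ω) ?_ |>.integrableOn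
  refine IsTestFun.mul_right (IsTestFun.add ?_ ?_) hΩ hφ.cexp_neg_ofReal
  · exact ((hw k).wderBar j).star.mul_left hΩ ((hw j).wderBar k).1.contDiffOn
  · exact (hw k).star.mul_left hΩ (((hφ.ofReal_complex.wder hΩ j).wderBar hΩ k).mul
      (hw j).1.contDiffOn)

theorem IsTestFun.sum {ι : Type*} {s : Finset ι} {u : ι → (Fin n → ℂ) → ℂ}
    (h : ∀ i ∈ s, IsTestFun n (u i) Ω) : IsTestFun n (fun z => ∑ i ∈ s, u i z) Ω := by
  classical
  induction s using Finset.induction_on with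
  | empty =>
    have h0 : tsupport (fun _ : Fin n → ℂ => (0:ℂ)) = ∅ := by simp [tsupport]
    simp only [Finset.sum_empty]
    exact ⟨contDiff_const, by rw [HasCompactSupport, h0]; exact isCompact_empty, by simp [h0]⟩
  | insert a s ha ih =>
    simp only [Finset.sum_insert ha]
    exact (h a (by simp)).add (ih fun i hi => h i (by simp [hi]))

theorem IsTestFun.integrableOn_norm_sq_mul_exp (hΩ : IsOpen Ω) (hφ : ContDiffOn ℝ ∞ φ Ω)
    {u : (Fin n → ℂ) → ℂ} (hu : IsTestFun n u Ω) :
    IntegrableOn (fun z => ‖u z‖ ^ 2 * Real.exp (-φ z)) Ω := by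
  have h := ((hu.star.mul_right hΩ hφ.cexp_neg_ofReal).mul_left hΩ
    hu.1.contDiffOn).integrable.norm.integrableOn (s := Ω)
  refine h.congr_fun (fun z _ => ?_) hΩ.measurableSet
  simp only [norm_mul, RCLike.norm_conj, Complex.norm_exp, neg_re, ofReal_re]
  ring

theorem sum_twistDer_integral (hΩ : IsOpen Ω) (hφ : ContDiffOn ℝ ∞ φ Ω)
    (hw : ∀ j, IsTestFun n (w j) Ω) :
    ∫ z in Ω, (∑ j, twistDer n φ w j z) * conj (∑ j, twistDer n φ w j z)
        * Complex.exp (-(φ z : ℂ)) =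
      ∫ z in Ω, ∑ j, ∑ k, (wderBar n k (w j) z * conj (wderBar n j (w k) z)
        + cHess n φ z j k * w j z * conj (w k z)) * Complex.exp (-(φ z : ℂ)) := by
  have hM := hφ.cexp_neg_ofReal
  have hA : ∀ j k, IsTestFun n
      (fun v => twistDer n φ w j v * (conj (w k v) * Complex.exp (-(φ v : ℂ)))) Ω := fun j k =>
    (((hw k).star.mul_right hΩ hM).mul_left hΩ (twistDer_isTestFun hΩ hφ hw j).1.contDiffOn)
  have hB : ∀ j k, IsTestFun n
      (fun v => wderBar n k (w j) v * (conj (w k v) * Complex.exp (-(φ v : ℂ)))) Ω := fun j k =>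
    (((hw k).star.mul_right hΩ hM).mul_left hΩ ((hw j).wderBar k).1.contDiffOn)
  have hC : ∀ j k, IntegrableOn (fun z => (wderBar n k (w j) z * conj (wderBar n j (w k) z)
        + cHess n φ z j k * w j z * conj (w k z)) * Complex.exp (-(φ z : ℂ))) Ω :=
    fun j k => integrableOn_bochner hΩ hφ hw j k
  have hD : ∀ j k, ∫ z in Ω, (twistDer n φ w j z * conj (twistDer n φ w k z)
      * Complex.exp (-(φ z : ℂ))) = ∫ z in Ω,
      (wderBar n k (w j) z * conj (wderBar n j (w k) z)
        + cHess n φ z j k * w j z * conj (w k z)) * Complex.exp (-(φ z : ℂ)) := by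
    intro j k
    rw [setIntegral_congr_fun hΩ.measurableSet
      (fun z hz => twistDer_mul_conj hΩ hφ hw j k hz)]
    have : ∀ z, wderBar n k (fun v => twistDer n φ w j v * (conj (w k v) *
          Complex.exp (-(φ v : ℂ)))) z
      - wder n j (fun v => wderBar n k (w j) v * (conj (w k v) * Complex.exp (-(φ v : ℂ)))) z
      + wderBar n k (w j) z * conj (wderBar n j (w k) z) * Complex.exp (-(φ z : ℂ))
      + cHess n φ z j k * w j z * conj (w k z) * Complex.exp (-(φ z : ℂ)) =
      wderBar n k (fun v => twistDer n φ w j v * (conj (w k v) * Complex.exp (-(φ v : ℂ)))) z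
      - wder n j (fun v => wderBar n k (w j) v * (conj (w k v) * Complex.exp (-(φ v : ℂ)))) z
      + (wderBar n k (w j) z * conj (wderBar n j (w k) z)
        + cHess n φ z j k * w j z * conj (w k z)) * Complex.exp (-(φ z : ℂ)) := by
      intro z; ring
    simp_rw [this]
    have i1 := ((hA j k).wderBar k).integrable.integrableOn (s := Ω)
    have i2 := ((hB j k).wder j).integrable.integrableOn (s := Ω)
    rw [integral_add (i1.fun_sub i2) (hC j k), integral_sub i1 i2, (hA j k).integral_wderBar,
      (hB j k).integral_wder]
    simp
  have hE : ∀ j k, IntegrableOn (fun z => twistDer n φ w j z * conj (twistDer n φ w k z)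
      * Complex.exp (-(φ z : ℂ))) Ω := fun j k =>
    (((twistDer_isTestFun hΩ hφ hw k).star.mul_left hΩ
      (twistDer_isTestFun hΩ hφ hw j).1.contDiffOn).mul_right hΩ hM).integrable.integrableOn
  have e : ∀ z, (∑ j, twistDer n φ w j z) * conj (∑ j, twistDer n φ w j z)
        * Complex.exp (-(φ z : ℂ)) = ∑ j, ∑ k, twistDer n φ w j z * conj (twistDer n φ w k z)
      * Complex.exp (-(φ z : ℂ)) := by
    intro z
    rw [map_sum, Finset.sum_mul_sum, Finset.sum_mul]
    exact Finset.sum_congr rfl fun j _ => Finset.sum_mul _ _ _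
  simp_rw [e]
  rw [integral_finsetSum _ fun j _ => integrable_finsetSum _ fun k _ => hE j k,
    integral_finsetSum _ fun j _ => integrable_finsetSum _ fun k _ => hC j k]
  refine Finset.sum_congr rfl fun j _ => ?_
  rw [integral_finsetSum _ fun k _ => hE j k, integral_finsetSum _ fun k _ => hC j k]
  exact Finset.sum_congr rfl fun k _ => hD j k

theorem re_sum_mul_conj_swap_ge (a : Fin n → Fin n → ℂ) :
    -(∑ j, ∑ k, ‖a j k - a k j‖ ^ 2) ≤ (∑ j, ∑ k, a k j * conj (a j k)).re := by
  have h1 : ∀ j k, ‖a j k - a k j‖ ^ 2 = ‖a j k‖ ^ 2 + ‖a k j‖ ^ 2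
      - 2 * (a k j * conj (a j k)).re := by
    intro j k
    rw [← Complex.normSq_eq_norm_sq, ← Complex.normSq_eq_norm_sq, ← Complex.normSq_eq_norm_sq,
      Complex.normSq_sub, mul_re, mul_re]
    simp only [conj_re, conj_im]
    ring
  rw [Complex.re_sum, ← Finset.sum_neg_distrib]
  refine Finset.sum_le_sum fun j _ => ?_
  rw [Complex.re_sum, ← Finset.sum_neg_distrib]
  refine Finset.sum_le_sum fun k _ => ?_
  have h2 := h1 j k
  have h3 : ‖a j k - a k j‖ ^ 2 ≥ 0 := by positivity
  have h4 : |(a k j * conj (a j k)).re| ≤ ‖a k j‖ * ‖a j k‖ :=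
    (Complex.abs_re_le_norm _).trans (by rw [norm_mul, RCLike.norm_conj])
  have h5 := abs_le.1 h4
  rw [h2]
  nlinarith [sq_nonneg (‖a j k‖ - ‖a k j‖)]

theorem bochner_lintegral (hΩ : IsOpen Ω) (hφ : ContDiffOn ℝ ∞ φ Ω)
    (hw : ∀ j, IsTestFun n (w j) Ω) {l : (Fin n → ℂ) → ℝ} (hl0 : ∀ z ∈ Ω, 0 ≤ l z)
    (hl : ∀ z ∈ Ω, ∀ X, l z * ∑ j, ‖X j‖ ^ 2 ≤ hermForm n (cHess n φ z) X X) :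
    ∫⁻ z in Ω, ENNReal.ofReal (l z * Real.exp (-φ z) * ∑ j, ‖w j z‖ ^ 2) ≤
      ∫⁻ z in Ω, ENNReal.ofReal (Real.exp (-φ z) * (‖∑ j, twistDer n φ w j z‖ ^ 2
        + ∑ j, ∑ k, ‖wderBar n j (w k) z - wderBar n k (w j) z‖ ^ 2)) := by
  set G : (Fin n → ℂ) → ℂ := fun z =>
    ∑ j, ∑ k, (wderBar n k (w j) z * conj (wderBar n j (w k) z)
        + cHess n φ z j k * w j z * conj (w k z)) * Complex.exp (-(φ z : ℂ)) with hG
  have hGi : IntegrableOn G Ω := integrable_finsetSum _ fun j _ =>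
    integrable_finsetSum _ fun k _ => integrableOn_bochner hΩ hφ hw j k
  set D : (Fin n → ℂ) → ℂ := fun z => ∑ j, twistDer n φ w j z
  have hD : IsTestFun n D Ω :=
    IsTestFun.sum fun j _ => twistDer_isTestFun hΩ hφ hw j
  set S : (Fin n → ℂ) → ℝ := fun z =>
    ∑ j, ∑ k, ‖wderBar n j (w k) z - wderBar n k (w j) z‖ ^ 2 with hS
  have hDi := hD.integrableOn_norm_sq_mul_exp hΩ hφ
  have hSi : IntegrableOn (fun z => S z * Real.exp (-φ z)) Ω := by
    simp only [hS, Finset.sum_mul]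
    exact integrable_finsetSum _ fun j _ => integrable_finsetSum _ fun k _ =>
      (((hw k).wderBar j).sub ((hw j).wderBar k)).integrableOn_norm_sq_mul_exp hΩ hφ
  have hGr : IntegrableOn (fun z => (G z).re) Ω := hGi.re
  have hGD : ∫ z in Ω, (G z).re = ∫ z in Ω, ‖D z‖ ^ 2 * Real.exp (-φ z) := by
    have h1 := sum_twistDer_integral hΩ hφ hw
    have h2 : ∫ z in Ω, (G z).re = (∫ z in Ω, G z).re := by
      simpa using (integral_re (𝕜 := ℂ) hGi)
    rw [h2, ← h1]
    have h3 : ∀ z, (∑ j, twistDer n φ w j z) * conj (∑ j, twistDer n φ w j z)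
        * Complex.exp (-(φ z : ℂ)) = ((‖D z‖ ^ 2 * Real.exp (-φ z) : ℝ) : ℂ) := by
      intro z
      rw [Complex.mul_conj]
      push_cast
      rw [Complex.normSq_eq_norm_sq]
      push_cast; rfl
    simp_rw [h3]
    rw [integral_complex_ofReal, ofReal_re]
  have hGre : ∀ z, (G z).re = ((∑ j, ∑ k, wderBar n k (w j) z * conj (wderBar n j (w k) z)).re
      + hermForm n (cHess n φ z) (fun j => w j z) (fun j => w j z)) * Real.exp (-φ z) := by
    intro z
    simp only [hG, hermForm, ← Complex.add_re, ← Finset.sum_add_distrib, ← Finset.sum_mul]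
    rw [← Complex.ofReal_neg, ← Complex.ofReal_exp, Complex.re_mul_ofReal]
  have hpt : ∀ z ∈ Ω, l z * Real.exp (-φ z) * ∑ j, ‖w j z‖ ^ 2
      ≤ (G z).re + S z * Real.exp (-φ z) := by
    intro z hz
    have h1 := hl z hz (fun j => w j z)
    have h2 := re_sum_mul_conj_swap_ge (fun j k => wderBar n j (w k) z)
    rw [hGre, ← add_mul]
    have h3 := Real.exp_pos (-φ z)
    calc _ = (l z * ∑ j, ‖w j z‖ ^ 2) * Real.exp (-φ z) := by ring
      _ ≤ _ := by
        refine mul_le_mul_of_nonneg_right ?_ h3.le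
        simp only [hS]
        linarith
  have hnn : ∀ z ∈ Ω, 0 ≤ (G z).re + S z * Real.exp (-φ z) := fun z hz =>
    (mul_nonneg (mul_nonneg (hl0 z hz) (Real.exp_pos _).le) (by positivity)).trans (hpt z hz)
  calc _ ≤ ∫⁻ z in Ω, ENNReal.ofReal ((G z).re + S z * Real.exp (-φ z)) :=
        setLIntegral_mono' hΩ.measurableSet fun z hz => ENNReal.ofReal_le_ofReal (hpt z hz)
    _ = ENNReal.ofReal (∫ z in Ω, ((G z).re + S z * Real.exp (-φ z))) := by
        refine (ofReal_integral_eq_lintegral_ofReal (hGr.fun_add hSi) ?_).symm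
        exact (ae_restrict_iff' hΩ.measurableSet).2 (Eventually.of_forall hnn)
    _ = ENNReal.ofReal (∫ z in Ω, (‖D z‖ ^ 2 * Real.exp (-φ z) + S z * Real.exp (-φ z))) := by
        rw [integral_add hGr hSi, integral_add hDi hSi, ← hGD]
    _ = _ := by
        rw [ofReal_integral_eq_lintegral_ofReal (hDi.fun_add hSi)
          (Eventually.of_forall fun z => by positivity)]
        refine lintegral_congr fun z => ?_
        rw [← add_mul, mul_comm]

end Bochner

/-! ### The Bochner–Kohn inequality for compactly supported `L²` forms -/

open scoped ContDiff ENNReal ComplexConjugate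

theorem norm_sq_le_two_mul {E : Type*} [SeminormedAddCommGroup E] (a b : E) :
    ‖a‖ ^ 2 ≤ 2 * ‖b‖ ^ 2 + 2 * ‖b - a‖ ^ 2 := by
  have h : ‖a‖ ≤ ‖b‖ + ‖b - a‖ := by
    rw [norm_sub_rev]; simpa using norm_add_le b (a - b)
  nlinarith [norm_nonneg a, sq_nonneg (‖b‖ - ‖b - a‖)]

theorem norm_sum_mul_sq_le {n : ℕ} {M : ℝ} {p d : Fin n → ℂ} (hp : ∀ j, ‖p j‖ ≤ M) :
    ‖∑ j, p j * d j‖ ^ 2 ≤ n * M ^ 2 * ∑ j, ‖d j‖ ^ 2 := by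
  have h1 : ‖∑ j, p j * d j‖ ≤ ∑ j, M * ‖d j‖ :=
    (norm_sum_le _ _).trans (Finset.sum_le_sum fun j _ => by
      rw [norm_mul]; exact mul_le_mul_of_nonneg_right (hp j) (norm_nonneg _))
  have h2 := sq_sum_le_card_mul_sum_sq (s := Finset.univ) (f := fun j => M * ‖d j‖)
  simp only [Finset.card_univ, Fintype.card_fin, mul_pow, ← Finset.mul_sum] at h2
  calc _ ≤ (∑ j, M * ‖d j‖) ^ 2 := by gcongr
    _ ≤ _ := by rw [← Finset.mul_sum, mul_pow]; linarith

theorem lintegral_ofReal_norm_sq {n : ℕ} (f : (Fin n → ℂ) → ℂ) :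
    ∫⁻ x, ENNReal.ofReal (‖f x‖ ^ 2) = eLpNorm f 2 volume ^ 2 := by
  rw [eLpNorm_eq_lintegral_rpow_enorm_toReal (by norm_num) (by norm_num),
    ← ENNReal.rpow_natCast, ← ENNReal.rpow_mul]
  norm_num

theorem exists_bump_seq (n : ℕ) {δ : ℝ} (hδ : 0 < δ) :
    ∃ (r : ℕ → ℝ) (η : ℕ → (Fin n → ℂ) → ℝ), (∀ k, r k ≤ δ) ∧ (∀ k, IsCircleBump n (r k) (η k)) ∧
      ∀ f : (Fin n → ℂ) → ℂ, MemLp f 2 → Tendsto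
        (fun k => ∫⁻ x, ENNReal.ofReal (‖mollify (η k) f x - f x‖ ^ 2)) atTop (𝓝 0) := by
  have hr : ∀ k : ℕ, 0 < min δ (1 / ((k:ℝ) + 1)) := fun k => lt_min hδ (by positivity)
  choose η hη using fun k => exists_isCircleBump n (hr k)
  refine ⟨fun k => min δ (1 / ((k:ℝ) + 1)), η, fun k => min_le_left _ _, hη, fun f hf => ?_⟩
  have h1 : Tendsto (fun k => eLpNorm (mollify (η k) f - f) 2 volume) atTop (𝓝 0) := by
    rw [ENNReal.tendsto_atTop_zero]
    intro ε hε
    obtain ⟨t, ht, h⟩ := hf.exists_eLpNorm_translate_sub_le hε.ne'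
    obtain ⟨N, hN⟩ := exists_nat_one_div_lt ht
    refine ⟨N, fun k hk => (hη k).eLpNorm_mollify_sub_le hf fun w hw => h w (hw.trans_le ?_)⟩
    refine (min_le_right _ _).trans (le_trans ?_ hN.le)
    have : (N:ℝ) ≤ k := by exact_mod_cast hk
    gcongr
  have h2 := ENNReal.Tendsto.pow (n := 2) h1
  simp only [ne_eq, OfNat.ofNat_ne_zero, not_false_eq_true, zero_pow] at h2
  refine h2.congr fun k => (lintegral_ofReal_norm_sq _).symm

theorem IsCircleBump.mollify_eq_zero {n : ℕ} {r : ℝ} {η : (Fin n → ℂ) → ℝ}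
    (h : IsCircleBump n r η) {f : (Fin n → ℂ) → ℂ} {K : Set (Fin n → ℂ)}
    (hf : ∀ x, x ∉ K → f x = 0) {x : Fin n → ℂ} (hx : x ∉ Metric.cthickening r K) :
    mollify η f x = 0 := by
  rw [mollify]
  refine integral_eq_zero_of_ae (Eventually.of_forall fun w => ?_)
  by_cases hw : r ≤ ‖w‖
  · simp [h.zero_of_lt w hw]
  · change η w • f (x + w) = 0
    rw [hf, smul_zero]
    intro hK
    apply hx
    refine Metric.mem_cthickening_of_dist_le x _ r K hK ?_
    rw [dist_eq_norm]; simpa using (not_le.1 hw).le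

theorem IsCircleBump.isTestFun_mollify {n : ℕ} {r : ℝ} {η : (Fin n → ℂ) → ℝ}
    (h : IsCircleBump n r η) {f : (Fin n → ℂ) → ℂ} {K K' Ω : Set (Fin n → ℂ)}
    (hf : ∀ x, x ∉ K → f x = 0) (hK' : IsCompact K') (hKK' : Metric.cthickening r K ⊆ K')
    (hΩ : K' ⊆ Ω) (hfl : LocallyIntegrable f) : IsTestFun n (mollify η f) Ω := by
  have hs : Function.support (mollify η f) ⊆ K' := fun x hx => by
    by_contra hn
    exact hx (h.mollify_eq_zero hf fun h' => hn (hKK' h'))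
  exact ⟨h.contDiff_mollify hfl, HasCompactSupport.of_support_subset_isCompact hK' hs,
    (closure_minimal hs hK'.isClosed).trans hΩ⟩

section
variable {n : ℕ}

theorem IsTestFun.integrable_mul {Ω : Set (Fin n → ℂ)} {ψ f : (Fin n → ℂ) → ℂ}
    (hψ : IsTestFun n ψ Ω) (hf : LocallyIntegrable f) : Integrable fun x => f x * ψ x := by
  simpa only [smul_eq_mul, mul_comm] using
    hf.integrable_smul_left_of_hasCompactSupport hψ.1.continuous hψ.2.1

theorem bochner_real_le_left {M l : ℝ} {a b : Fin n → ℂ} (h0 : 0 ≤ l) (hl : l ≤ M) :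
    l * ∑ j, ‖a j‖ ^ 2 ≤ 2 * (l * ∑ j, ‖b j‖ ^ 2) + 2 * M * ∑ j, ‖b j - a j‖ ^ 2 := by
  have h1 : ∑ j, ‖a j‖ ^ 2 ≤ 2 * ∑ j, ‖b j‖ ^ 2 + 2 * ∑ j, ‖b j - a j‖ ^ 2 := by
    rw [Finset.mul_sum, Finset.mul_sum, ← Finset.sum_add_distrib]
    exact Finset.sum_le_sum fun j _ => norm_sq_le_two_mul _ _
  have h2 : 0 ≤ ∑ j, ‖b j - a j‖ ^ 2 := by positivity
  calc l * ∑ j, ‖a j‖ ^ 2 ≤ l * (2 * ∑ j, ‖b j‖ ^ 2 + 2 * ∑ j, ‖b j - a j‖ ^ 2) := by gcongr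
    _ = 2 * (l * ∑ j, ‖b j‖ ^ 2) + 2 * (l * ∑ j, ‖b j - a j‖ ^ 2) := by ring
    _ ≤ 2 * (l * ∑ j, ‖b j‖ ^ 2) + 2 * (M * ∑ j, ‖b j - a j‖ ^ 2) := by gcongr
    _ = _ := by ring

theorem bochner_real_aux {M e N u u' v v' A g B : ℝ} (h0 : 0 ≤ e) (he : e ≤ M) (hN : 0 ≤ N)
    (hA : 0 ≤ A) (hg : 0 ≤ g) (hB : 0 ≤ B) (hu : u' ≤ 2 * u + 2 * (2 * g + 2 * (N * A)))
    (hv : v' ≤ 2 * v + 2 * B) :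
    e * (u' + v') ≤ 2 * (e * (u + v)) + 4 * M * (1 + N) * (A + g + B) := by
  have h7 : u' + v' ≤ 2 * (u + v) + 4 * (1 + N) * (A + g + B) := by
    have h8 := mul_nonneg hN hg
    have h9 := mul_nonneg hN hB
    have h10 : 4 * (1 + N) * (A + g + B) = 4 * A + 4 * g + 4 * B
      + 4 * (N * A) + 4 * (N * g) + 4 * (N * B) := by ring
    linarith
  have h8 : 0 ≤ 4 * (1 + N) * (A + g + B) := by positivity
  have h9 := mul_le_mul_of_nonneg_left h7 h0
  have h10 := mul_le_mul_of_nonneg_right he h8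
  calc _ ≤ _ := h9
    _ = 2 * (e * (u + v)) + e * (4 * (1 + N) * (A + g + B)) := by ring
    _ ≤ 2 * (e * (u + v)) + M * (4 * (1 + N) * (A + g + B)) := by linarith
    _ = _ := by ring

theorem bochner_real_le_right {M e : ℝ} {a b p : Fin n → ℂ} {G G' : ℂ} {s s' : Fin n → Fin n → ℂ}
    (h0 : 0 ≤ e) (he : e ≤ M) (hp : ∀ j, ‖p j‖ ≤ M) :
    e * (‖G' - ∑ j, p j * b j‖ ^ 2 + ∑ j, ∑ k, ‖s' j k‖ ^ 2) ≤
      2 * (e * (‖G - ∑ j, p j * a j‖ ^ 2 + ∑ j, ∑ k, ‖s j k‖ ^ 2))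
      + 4 * M * (1 + n * M ^ 2) * (∑ j, ‖b j - a j‖ ^ 2 + ‖G' - G‖ ^ 2
        + ∑ j, ∑ k, ‖s' j k - s j k‖ ^ 2) := by
  have h1 := norm_sq_le_two_mul (G' - ∑ j, p j * b j) (G - ∑ j, p j * a j)
  have h2 := norm_sum_mul_sq_le (d := fun j => b j - a j) hp
  have h3 : ‖(G - ∑ j, p j * a j) - (G' - ∑ j, p j * b j)‖ ^ 2
      ≤ 2 * ‖G' - G‖ ^ 2 + 2 * (n * M ^ 2 * ∑ j, ‖b j - a j‖ ^ 2) := by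
    have h4 := norm_sq_le_two_mul ((G - ∑ j, p j * a j) - (G' - ∑ j, p j * b j))
      (∑ j, p j * (b j - a j))
    have h5 : ∑ j, p j * (b j - a j) - ((G - ∑ j, p j * a j) - (G' - ∑ j, p j * b j))
      = G' - G := by
      simp only [mul_sub, Finset.sum_sub_distrib]; ring
    rw [h5] at h4
    linarith
  have h6 : ∑ j, ∑ k, ‖s' j k‖ ^ 2 ≤ 2 * ∑ j, ∑ k, ‖s j k‖ ^ 2
      + 2 * ∑ j, ∑ k, ‖s' j k - s j k‖ ^ 2 := by
    simp only [Finset.mul_sum]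
    rw [← Finset.sum_add_distrib]
    refine Finset.sum_le_sum fun j _ => ?_
    rw [← Finset.sum_add_distrib]
    refine Finset.sum_le_sum fun k _ => ?_
    rw [norm_sub_rev]; exact norm_sq_le_two_mul _ _
  rw [norm_sub_rev] at h3
  have hA : 0 ≤ ∑ j, ‖b j - a j‖ ^ 2 := by positivity
  have hB : 0 ≤ ∑ j, ∑ k, ‖s' j k - s j k‖ ^ 2 := by positivity
  exact bochner_real_aux h0 he (by positivity) hA (sq_nonneg _) hB
    (by rw [norm_sub_rev (G - _)] at h1; linarith [h1, h3]) h6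

/-- Bochner–Kohn inequality for an `L²` form `w` supported in a compact `K ⊆ Ω` with weak
divergence `G` and weak `∂̄`-curl `s` in `L²`. -/
theorem bochner_weak {Ω K : Set (Fin n → ℂ)} (hΩ : IsOpen Ω) (hK : IsCompact K) (hKΩ : K ⊆ Ω)
    {φ l : (Fin n → ℂ) → ℝ} (hφ : ContDiffOn ℝ ∞ φ Ω) (hlc : ContinuousOn l Ω)
    (hl0 : ∀ z ∈ Ω, 0 ≤ l z)
    (hl : ∀ z ∈ Ω, ∀ X, l z * ∑ j, ‖X j‖ ^ 2 ≤ hermForm n (cHess n φ z) X X)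
    {w : Fin n → (Fin n → ℂ) → ℂ} {G : (Fin n → ℂ) → ℂ} {s : Fin n → Fin n → (Fin n → ℂ) → ℂ}
    (hw : ∀ j, MemLp (w j) 2) (hG : MemLp G 2) (hs : ∀ j k, MemLp (s j k) 2)
    (hwK : ∀ j, ∀ x ∉ K, w j x = 0) (hGK : ∀ x ∉ K, G x = 0) (hsK : ∀ j k, ∀ x ∉ K, s j k x = 0)
    (hwG : ∀ ψ, IsTestFun n ψ univ → ∫ x, ∑ j, w j x * wder n j ψ x = -∫ x, G x * ψ x)
    (hws : ∀ ψ, IsTestFun n ψ univ → ∀ j k,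
      ∫ x, (w k x * wderBar n j ψ x - w j x * wderBar n k ψ x) = -∫ x, s j k x * ψ x) :
    ∫⁻ z in Ω, ENNReal.ofReal (l z * Real.exp (-φ z) * ∑ j, ‖w j z‖ ^ 2) ≤
      4 * ∫⁻ z in Ω, ENNReal.ofReal (Real.exp (-φ z) *
        (‖G z - ∑ j, wder n j (fun v => (φ v : ℂ)) z * w j z‖ ^ 2
        + ∑ j, ∑ k, ‖s j k z‖ ^ 2)) := by
  obtain ⟨δ, hδ, hδΩ⟩ := hK.exists_cthickening_subset_open hΩ hKΩ
  set K' := Metric.cthickening δ K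
  have hK'c : IsCompact K' := hK.cthickening
  have hKK' : K ⊆ K' := Metric.self_subset_cthickening K
  -- bounds for the weights on `K'`
  obtain ⟨M, hM0, hMe, hMl, hMp⟩ : ∃ M : ℝ, 0 ≤ M ∧ (∀ z ∈ K', Real.exp (-φ z) ≤ M) ∧
      (∀ z ∈ K', l z * Real.exp (-φ z) ≤ M) ∧
      ∀ z ∈ K', ∀ j, ‖wder n j (fun v => (φ v : ℂ)) z‖ ≤ M := by
    have hφc : ContinuousOn φ K' := hφ.continuousOn.mono hδΩ
    have hec : ContinuousOn (fun z => Real.exp (-φ z)) K' :=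
      Real.continuous_exp.comp_continuousOn hφc.neg
    obtain ⟨M1, h1⟩ := hK'c.exists_bound_of_continuousOn hec
    obtain ⟨M2, h2⟩ := hK'c.exists_bound_of_continuousOn ((hlc.mono hδΩ).mul hec)
    have h3 : ∀ j, ∃ M, ∀ z ∈ K', ‖wder n j (fun v => (φ v : ℂ)) z‖ ≤ M := fun j =>
      hK'c.exists_bound_of_continuousOn
        ((hφ.ofReal_complex.wder hΩ j).continuousOn.mono hδΩ)
    choose M3 h3 using h3
    refine ⟨|M1| + |M2| + ∑ j, |M3 j|, by positivity, fun z hz => ?_, fun z hz => ?_,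
      fun z hz j => ?_⟩
    · have := (le_abs_self _).trans ((h1 z hz).trans (le_abs_self _))
      have h4 : 0 ≤ ∑ j, |M3 j| := by positivity
      linarith [abs_nonneg M2]
    · have : l z * Real.exp (-φ z) ≤ |M2| :=
        (le_abs_self _).trans ((h2 z hz).trans (le_abs_self _))
      have h4 : 0 ≤ ∑ j, |M3 j| := by positivity
      linarith [abs_nonneg M1]
    · have h5 := (h3 j z hz).trans (le_abs_self _)
      have h4 := Finset.single_le_sum (f := fun j => |M3 j|) (fun _ _ => abs_nonneg _)
        (Finset.mem_univ j)
      linarith [abs_nonneg M1, abs_nonneg M2]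
  obtain ⟨r, η, hrδ, hη, happ⟩ := exists_bump_seq n hδ
  have hwl : ∀ j, LocallyIntegrable (w j) := fun j => (hw j).locallyIntegrable_two
  have hGl := hG.locallyIntegrable_two
  have hsl : ∀ j k, LocallyIntegrable (s j k) := fun j k => (hs j k).locallyIntegrable_two
  have hsub : ∀ i, Metric.cthickening (r i) K ⊆ K' := fun i =>
    Metric.cthickening_mono (hrδ i) K
  have hwT : ∀ i j, IsTestFun n (mollify (η i) (w j)) Ω := fun i j =>
    (hη i).isTestFun_mollify (hwK j) hK'c (hsub i) hδΩ (hwl j)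
  have htr : ∀ i x, IsTestFun n (fun y => (η i (y - x) : ℂ)) univ := fun i x =>
    (hη i).isTestFun_translate (subset_univ _)
  have hmol : ∀ i x f, mollify (η i) f x = ∫ y, f y * (η i (y - x) : ℂ) := by
    intro i x f
    rw [mollify, ← integral_sub_right_eq_self _ x]
    refine integral_congr_ae (Eventually.of_forall fun y => ?_)
    simp [mul_comm]
  have hdiv : ∀ i x, ∑ j, wder n j (mollify (η i) (w j)) x = mollify (η i) G x := by
    intro i x
    have h1 := hwG _ (htr i x)
    simp_rw [(hη i).wder_mollify (hwl _)]
    rw [integral_finsetSum _ fun j _ => ((htr i x).wder j).integrable_mul (hwl j)] at h1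
    rw [Finset.sum_neg_distrib, h1, neg_neg, hmol]
  have hcurl : ∀ i x j k, wderBar n j (mollify (η i) (w k)) x
      - wderBar n k (mollify (η i) (w j)) x = mollify (η i) (s j k) x := by
    intro i x j k
    have h1 := hws _ (htr i x) j k
    rw [integral_sub (((htr i x).wderBar j).integrable_mul (hwl k))
      (((htr i x).wderBar k).integrable_mul (hwl j))] at h1
    rw [(hη i).wderBar_mollify (hwl _), (hη i).wderBar_mollify (hwl _)]
    rw [hmol]
    linear_combination -h1
  -- the total mollification error
  set E : ℕ → (Fin n → ℂ) → ℝ := fun i z => ∑ j, ‖mollify (η i) (w j) z - w j z‖ ^ 2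
    + ‖mollify (η i) G z - G z‖ ^ 2 + ∑ j, ∑ k, ‖mollify (η i) (s j k) z - s j k z‖ ^ 2 with hE
  have hmeas : ∀ i {f : (Fin n → ℂ) → ℂ}, MemLp f 2 →
      AEMeasurable fun z => ENNReal.ofReal (‖mollify (η i) f z - f z‖ ^ 2) := by
    intro i f hf
    have := (((hη i).contDiff_mollify hf.locallyIntegrable_two).continuous.aestronglyMeasurable
      (μ := volume)).sub hf.1
    exact ((this.norm.aemeasurable).pow_const 2).ennreal_ofReal
  have hEof : ∀ i z, ENNReal.ofReal (E i z) =
      ∑ j, ENNReal.ofReal (‖mollify (η i) (w j) z - w j z‖ ^ 2)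
      + ENNReal.ofReal (‖mollify (η i) G z - G z‖ ^ 2)
      + ∑ j, ∑ k, ENNReal.ofReal (‖mollify (η i) (s j k) z - s j k z‖ ^ 2) := by
    intro i z
    rw [hE, ENNReal.ofReal_add (by positivity) (by positivity),
      ENNReal.ofReal_add (by positivity) (by positivity),
      ENNReal.ofReal_sum_of_nonneg fun _ _ => by positivity,
      ENNReal.ofReal_sum_of_nonneg fun _ _ => Finset.sum_nonneg fun _ _ => by positivity]
    congr 1
    exact Finset.sum_congr rfl fun j _ =>
      ENNReal.ofReal_sum_of_nonneg fun _ _ => by positivity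
  have hEm : ∀ i, AEMeasurable fun z => ENNReal.ofReal (E i z) := by
    intro i
    simp only [hEof]
    exact ((Finset.aemeasurable_fun_sum _ fun j _ => hmeas i (hw j)).add (hmeas i hG)).add
      (Finset.aemeasurable_fun_sum _ fun j _ => Finset.aemeasurable_fun_sum _ fun k _ =>
        hmeas i (hs j k))
  have hEt : Tendsto (fun i => ∫⁻ z, ENNReal.ofReal (E i z)) atTop (𝓝 0) := by
    have h1 : ∀ i, ∫⁻ z, ENNReal.ofReal (E i z) =
        (∑ j, ∫⁻ z, ENNReal.ofReal (‖mollify (η i) (w j) z - w j z‖ ^ 2))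
        + (∫⁻ z, ENNReal.ofReal (‖mollify (η i) G z - G z‖ ^ 2))
        + ∑ j, ∑ k, ∫⁻ z, ENNReal.ofReal (‖mollify (η i) (s j k) z - s j k z‖ ^ 2) := by
      intro i
      simp only [hEof]
      rw [lintegral_add_left' ((Finset.aemeasurable_fun_sum _ fun j _ => hmeas i (hw j)).fun_add
        (hmeas i hG)), lintegral_add_left' (Finset.aemeasurable_fun_sum _ fun j _ => hmeas i (hw j)),
        lintegral_finsetSum' _ fun j _ => hmeas i (hw j),
        lintegral_finsetSum' _ fun j _ => Finset.aemeasurable_fun_sum _ fun k _ =>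
          hmeas i (hs j k)]
      congr 1
      exact Finset.sum_congr rfl fun j _ => lintegral_finsetSum' _ fun k _ => hmeas i (hs j k)
    simp only [h1]
    have := ((tendsto_finsetSum Finset.univ fun j _ => happ _ (hw j)).add (happ _ hG)).add
      (tendsto_finsetSum Finset.univ fun j _ => tendsto_finsetSum Finset.univ fun k _ =>
        happ _ (hs j k))
    simpa using this
  set Q := ∫⁻ z in Ω, ENNReal.ofReal (Real.exp (-φ z) *
        (‖G z - ∑ j, wder n j (fun v => (φ v : ℂ)) z * w j z‖ ^ 2
        + ∑ j, ∑ k, ‖s j k z‖ ^ 2)) with hQ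
  set C1 := 4 * M * (1 + n * M ^ 2)
  have hC1 : 0 ≤ C1 := by positivity
  have hstep : ∀ i, ∫⁻ z in Ω, ENNReal.ofReal (l z * Real.exp (-φ z) * ∑ j, ‖w j z‖ ^ 2) ≤
      4 * Q + ENNReal.ofReal (2 * C1 + 2 * M) * ∫⁻ z, ENNReal.ofReal (E i z) := by
    intro i
    have hEle : ∫⁻ z in Ω, ENNReal.ofReal (E i z) ≤ ∫⁻ z, ENNReal.ofReal (E i z) :=
      setLIntegral_le_lintegral _ _
    have hE0 : ∀ z, 0 ≤ E i z := fun z => by positivity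
    have hzero : ∀ z, z ∉ K' → (∀ j, w j z = 0) ∧ G z = 0 ∧ (∀ j k, s j k z = 0) ∧
        (∀ j, mollify (η i) (w j) z = 0) ∧ mollify (η i) G z = 0 ∧
        ∀ j k, mollify (η i) (s j k) z = 0 := by
      intro z hz
      have hz' : z ∉ K := fun h => hz (hKK' h)
      have hz'' : z ∉ Metric.cthickening (r i) K := fun h => hz (hsub i h)
      exact ⟨fun j => hwK j z hz', hGK z hz', fun j k => hsK j k z hz',
        fun j => (hη i).mollify_eq_zero (hwK j) hz'', (hη i).mollify_eq_zero hGK hz'',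
        fun j k => (hη i).mollify_eq_zero (hsK j k) hz''⟩
    have hleft : ∫⁻ z in Ω, ENNReal.ofReal (l z * Real.exp (-φ z) * ∑ j, ‖w j z‖ ^ 2) ≤
        2 * (∫⁻ z in Ω, ENNReal.ofReal (l z * Real.exp (-φ z) *
          ∑ j, ‖mollify (η i) (w j) z‖ ^ 2))
        + ENNReal.ofReal (2 * M) * ∫⁻ z in Ω, ENNReal.ofReal (E i z) := by
      rw [← lintegral_const_mul' _ _ (by norm_num), ← lintegral_const_mul' _ _ ENNReal.ofReal_ne_top,
        ← lintegral_add_right' _ ((hEm i).restrict.const_mul _)]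
      refine setLIntegral_mono' hΩ.measurableSet fun z hz => ?_
      have hlz : 0 ≤ l z * Real.exp (-φ z) := mul_nonneg (hl0 z hz) (Real.exp_pos _).le
      rw [← ENNReal.ofReal_mul (by positivity),
        show (2:ℝ≥0∞) = ENNReal.ofReal 2 by simp, ← ENNReal.ofReal_mul (by positivity),
        ← ENNReal.ofReal_add (by positivity) (mul_nonneg (by positivity) (hE0 z))]
      refine ENNReal.ofReal_le_ofReal ?_
      by_cases hzK : z ∈ K'
      · refine (bochner_real_le_left (b := fun j => mollify (η i) (w j) z) hlz
          (hMl z hzK)).trans ?_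
        gcongr
        simp only [hE]
        have h1 : 0 ≤ ‖mollify (η i) G z - G z‖ ^ 2 := by positivity
        have h2 : 0 ≤ ∑ j, ∑ k, ‖mollify (η i) (s j k) z - s j k z‖ ^ 2 := by positivity
        linarith
      · obtain ⟨h1, h2, h3, h4, h5, h6⟩ := hzero z hzK
        simp [h1, h2, h3, h4, h5, h6, hE]
    have hright : ∫⁻ z in Ω, ENNReal.ofReal (Real.exp (-φ z) *
        (‖∑ j, twistDer n φ (fun j => mollify (η i) (w j)) j z‖ ^ 2
        + ∑ j, ∑ k, ‖wderBar n j (mollify (η i) (w k)) z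
          - wderBar n k (mollify (η i) (w j)) z‖ ^ 2)) ≤
        2 * Q + ENNReal.ofReal C1 * ∫⁻ z in Ω, ENNReal.ofReal (E i z) := by
      rw [hQ, ← lintegral_const_mul' _ _ (by norm_num), ← lintegral_const_mul' _ _ ENNReal.ofReal_ne_top,
        ← lintegral_add_right' _ ((hEm i).restrict.const_mul _)]
      refine setLIntegral_mono' hΩ.measurableSet fun z hz => ?_
      rw [← ENNReal.ofReal_mul hC1,
        show (2:ℝ≥0∞) = ENNReal.ofReal 2 by simp, ← ENNReal.ofReal_mul (by positivity),
        ← ENNReal.ofReal_add (by positivity) (mul_nonneg hC1 (hE0 z))]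
      refine ENNReal.ofReal_le_ofReal ?_
      simp only [hcurl, twistDer, Finset.sum_sub_distrib, hdiv]
      by_cases hzK : z ∈ K'
      · exact bochner_real_le_right (Real.exp_pos _).le (hMe z hzK) (hMp z hzK)
      · obtain ⟨h1, h2, h3, h4, h5, h6⟩ := hzero z hzK
        simp [h1, h2, h3, h4, h5, h6, hE]
    calc _ ≤ _ := hleft
      _ ≤ 2 * (2 * Q + ENNReal.ofReal C1 * ∫⁻ z in Ω, ENNReal.ofReal (E i z))
        + ENNReal.ofReal (2 * M) * ∫⁻ z in Ω, ENNReal.ofReal (E i z) := by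
          gcongr
          exact (bochner_lintegral hΩ hφ (hwT i) hl0 hl).trans hright
      _ = 4 * Q + ENNReal.ofReal (2 * C1 + 2 * M) * ∫⁻ z in Ω, ENNReal.ofReal (E i z) := by
          rw [ENNReal.ofReal_add (by positivity) (by positivity),
            ENNReal.ofReal_mul (p := 2) (q := C1) (by norm_num), ENNReal.ofReal_ofNat]
          ring
      _ ≤ _ := by gcongr
  have hlim : Tendsto (fun i => 4 * Q + ENNReal.ofReal (2 * C1 + 2 * M) *
      ∫⁻ z, ENNReal.ofReal (E i z)) atTop (𝓝 (4 * Q + ENNReal.ofReal (2 * C1 + 2 * M) * 0)) :=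
    tendsto_const_nhds.add (ENNReal.Tendsto.const_mul hEt (Or.inr ENNReal.ofReal_ne_top))
  rw [mul_zero, add_zero] at hlim
  exact ge_of_tendsto hlim (Eventually.of_forall hstep)

end

/-! ### A priori estimate for weakly `∂̄`-closed forms -/

open scoped ContDiff ENNReal ComplexConjugate

section
variable {n : ℕ} {Ω : Set (Fin n → ℂ)}

theorem fderiv_ofReal_apply {P : (Fin n → ℂ) → ℝ} {z : Fin n → ℂ}
    (hP : DifferentiableAt ℝ P z) (a : Fin n → ℂ) :
    fderiv ℝ (fun v => (P v : ℂ)) z a = (fderiv ℝ P z a : ℂ) := by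
  have h : HasFDerivAt (fun v => (P v : ℂ)) (Complex.ofRealCLM.comp (fderiv ℝ P z)) z :=
    Complex.ofRealCLM.hasFDerivAt.comp z hP.hasFDerivAt
  rw [h.fderiv]
  rfl

theorem wder_comp_real {g : ℝ → ℝ} {P : (Fin n → ℂ) → ℝ} {z : Fin n → ℂ} {j : Fin n}
    (hg : DifferentiableAt ℝ g (P z)) (hP : DifferentiableAt ℝ P z) :
    wder n j (fun v => (g (P v) : ℂ)) z =
      ((deriv g (P z) : ℝ) : ℂ) * wder n j (fun v => (P v : ℂ)) z := by
  have h := hg.hasDerivAt.comp_hasFDerivAt z hP.hasFDerivAt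
  have h2 : ∀ a, fderiv ℝ (fun v => (g (P v) : ℂ)) z a = (deriv g (P z) * fderiv ℝ P z a : ℝ) :=
    fun a => by
    rw [fderiv_ofReal_apply (P := fun v => g (P v)) h.differentiableAt]
    congr 1
    exact congrArg (fun L => L a) h.fderiv
  simp only [wder, fderiv_ofReal_apply hP, h2]
  push_cast
  ring

theorem IsTestFun.exists_bound {ψ : (Fin n → ℂ) → ℂ} (hψ : IsTestFun n ψ Ω) :
    ∃ M : ℝ, ∀ z, ‖ψ z‖ ≤ M := hψ.2.1.exists_bound_of_continuous hψ.1.continuous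

theorem IsTestFun.memLp_mul {ψ W : (Fin n → ℂ) → ℂ} (hψ : IsTestFun n ψ Ω) (hΩ : IsOpen Ω)
    (hW : MemLp W 2 (volume.restrict Ω)) : MemLp (fun z => ψ z * W z) 2 := by
  have h1 : MemLp (fun z => ψ z * W z) 2 (volume.restrict Ω) := by
    obtain ⟨M, hM⟩ := hψ.exists_bound
    refine hW.of_le_mul (c := M) (hψ.1.continuous.aestronglyMeasurable.mul hW.1)
      (Eventually.of_forall fun z => ?_)
    rw [norm_mul]
    exact mul_le_mul_of_nonneg_right (hM z) (norm_nonneg _)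
  have h2 : (fun z => ψ z * W z) = Ω.indicator fun z => ψ z * W z := by
    ext z
    by_cases hz : z ∈ Ω
    · rw [indicator_of_mem hz]
    · rw [indicator_of_notMem hz, hψ.eq_zero_of_notMem hz, zero_mul]
  rw [h2, memLp_indicator_iff_restrict hΩ.measurableSet]
  exact h1

theorem IsTestFun.memLp {ψ : (Fin n → ℂ) → ℂ} (hψ : IsTestFun n ψ Ω) (p : ℝ≥0∞) : MemLp ψ p :=
  hψ.1.continuous.memLp_of_hasCompactSupport hψ.2.1

theorem IsTestFun.integrableOn_mul {ψ W : (Fin n → ℂ) → ℂ} (hψ : IsTestFun n ψ Ω)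
    (hW : MemLp W 2 (volume.restrict Ω)) : IntegrableOn (fun z => ψ z * W z) Ω :=
  MemLp.integrable_mul (p := 2) (q := 2) ((hψ.memLp 2).mono_measure Measure.restrict_le_self) hW

theorem ContDiffOn.exp_half_ofReal {Φ : (Fin n → ℂ) → ℝ} (hΦ : ContDiffOn ℝ ∞ Φ Ω) :
    ContDiffOn ℝ ∞ (fun z => (Real.exp (Φ z / 2) : ℂ)) Ω :=
  (Real.contDiff_exp.comp_contDiffOn (hΦ.div_const 2)).ofReal_complex

theorem exists_cutoff (hΩ : IsOpen Ω) {P : (Fin n → ℂ) → ℝ} (hP : ContDiffOn ℝ ∞ P Ω)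
    (hcomp : ∀ c, IsCompact {z ∈ Ω | P z ≤ c}) {A : ℝ}
    (hPd : ∀ z ∈ Ω, ∀ j, ‖wder n j (fun v => (P v : ℂ)) z‖ ≤ A * P z ^ 2) :
    ∃ C ≥ 0, ∀ R > 0, ∃ χ : (Fin n → ℂ) → ℝ, IsTestFun n (fun z => (χ z : ℂ)) Ω ∧
      (∀ z, 0 ≤ χ z ∧ χ z ≤ 1) ∧ (∀ z ∈ Ω, P z ≤ R → χ z = 1) ∧
      (∀ z ∈ Ω, ∀ j, ‖wder n j (fun v => (χ v : ℂ)) z‖ ≤ C * R) ∧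
      ∀ z ∈ Ω, ∀ j, ¬(R ≤ P z ∧ P z ≤ 2 * R) → wder n j (fun v => (χ v : ℂ)) z = 0 := by
  have hst : ContDiff ℝ ∞ Real.smoothTransition := Real.smoothTransition.contDiff
  obtain ⟨K, hK⟩ := (isCompact_Icc (a := (0:ℝ)) (b := 1)).exists_bound_of_continuousOn
    (hst.continuous_deriv (by norm_num)).continuousOn
  refine ⟨4 * |K| * |A|, by positivity, fun R hR => ?_⟩
  classical
  set g : ℝ → ℝ := fun t => Real.smoothTransition (2 - t / R) with hg
  have hgd : ContDiff ℝ ∞ g := hst.comp (contDiff_const.sub (contDiff_id.div_const R))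
  have hg1 : ∀ t, t ≤ R → g t = 1 := fun t ht =>
    Real.smoothTransition.one_of_one_le (by have := (div_le_one hR).2 ht; linarith)
  have hg0 : ∀ t, 2 * R ≤ t → g t = 0 := fun t ht =>
    Real.smoothTransition.zero_of_nonpos (by have := (le_div_iff₀ hR).2 ht; linarith)
  have hgK : ∀ t, R ≤ t → t ≤ 2 * R → |deriv g t| ≤ |K| / R := by
    intro t h1 h2
    have hd : HasDerivAt g (deriv Real.smoothTransition (2 - t / R) * -(1 / R)) t := by
      have h3 : HasDerivAt (fun t => 2 - t / R) (-(1 / R)) t :=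
        ((hasDerivAt_id t).div_const R).const_sub 2
      exact ((hst.differentiable (by norm_num)).differentiableAt.hasDerivAt).comp t h3
    rw [hd.deriv, abs_mul, abs_neg, abs_of_pos (by positivity : 0 < 1 / R)]
    have h4 := hK (2 - t / R) ⟨by have := (div_le_iff₀ hR).2 h2; linarith,
      by have := (one_le_div hR).2 h1; linarith⟩
    rw [Real.norm_eq_abs] at h4
    have h5 := h4.trans (le_abs_self K)
    rw [div_eq_mul_one_div |K| R]
    gcongr
  set χ : (Fin n → ℂ) → ℝ := fun z => if z ∈ Ω then g (P z) else 0 with hχ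
  have heq : ∀ z ∈ Ω, χ =ᶠ[𝓝 z] fun v => g (P v) := fun z hz => by
    filter_upwards [hΩ.mem_nhds hz] with v hv
    simp [hχ, hv]
  have hsupp : Function.support (fun z => (χ z : ℂ)) ⊆ {z ∈ Ω | P z ≤ 2 * R} := by
    intro z hz
    by_cases hzΩ : z ∈ Ω
    · refine ⟨hzΩ, ?_⟩
      by_contra! hlt
      exact hz (by simp [hχ, hzΩ, hg0 _ hlt.le])
    · exact absurd (by simp [hχ, hzΩ]) hz
  have hwd : ∀ z ∈ Ω, ∀ j, wder n j (fun v => (χ v : ℂ)) z =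
      ((deriv g (P z) : ℝ) : ℂ) * wder n j (fun v => (P v : ℂ)) z := by
    intro z hz j
    rw [← wder_comp_real (hgd.differentiable (by norm_num)).differentiableAt
      (hP.differentiableAt_of_isOpen hΩ hz)]
    refine Filter.EventuallyEq.wder_eq ?_
    filter_upwards [heq z hz] with v hv
    rw [hv]
  have hdz : ∀ t, ¬(R ≤ t ∧ t ≤ 2 * R) → deriv g t = 0 := by
    intro t ht
    rcases lt_or_ge t R with h | h
    · have : g =ᶠ[𝓝 t] fun _ => 1 := by
        filter_upwards [Iio_mem_nhds h] with s hs using hg1 s (le_of_lt hs)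
      rw [this.deriv_eq, deriv_const]
    · have h' : 2 * R < t := by by_contra! h2; exact ht ⟨h, h2⟩
      have : g =ᶠ[𝓝 t] fun _ => 0 := by
        filter_upwards [Ioi_mem_nhds h'] with s hs using hg0 s (le_of_lt hs)
      rw [this.deriv_eq, deriv_const]
  refine ⟨χ, IsTestFun.of_contDiffOn hΩ ?_ ?_ ?_, fun z => ?_, fun z hz h => ?_,
    fun z hz j => ?_, fun z hz j h => ?_⟩
  · refine ((hgd.comp_contDiffOn hP).ofReal_complex).congr fun z hz => ?_
    simp [hχ, hz]
  · exact HasCompactSupport.of_support_subset_isCompact (hcomp _) hsupp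
  · exact (closure_minimal hsupp (hcomp _).isClosed).trans fun z hz => hz.1
  · by_cases hz : z ∈ Ω
    · simp only [hχ, hz, if_true]
      exact ⟨Real.smoothTransition.nonneg _, Real.smoothTransition.le_one _⟩
    · simp [hχ, hz]
  · simp [hχ, hz, hg1 _ h]
  · by_cases h : R ≤ P z ∧ P z ≤ 2 * R
    · rw [hwd z hz, norm_mul, Complex.norm_real, Real.norm_eq_abs]
      calc |deriv g (P z)| * ‖wder n j (fun v => (P v : ℂ)) z‖
          ≤ (|K| / R) * (|A| * (2 * R) ^ 2) := by
            refine mul_le_mul (hgK _ h.1 h.2) ((hPd z hz j).trans ?_) (norm_nonneg _)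
              (by positivity)
            have h0 : 0 ≤ P z := hR.le.trans h.1
            have := le_abs_self A
            have h2 := h.2
            gcongr
        _ = 4 * |K| * |A| * R := by field_simp; ring
    · rw [hwd z hz, hdz _ h]; simp; positivity
  · rw [hwd z hz, hdz _ h]; simp

theorem norm_curl_sq_sum_le {M : ℝ} {p W : Fin n → ℂ} (hp : ∀ j, ‖p j‖ ≤ M) :
    ∑ j, ∑ k, ‖p j * W k - p k * W j‖ ^ 2 ≤ 4 * n * M ^ 2 * ∑ j, ‖W j‖ ^ 2 := by
  have h1 : ∀ j k, ‖p j * W k - p k * W j‖ ^ 2 ≤ 2 * M ^ 2 * ‖W k‖ ^ 2 + 2 * M ^ 2 * ‖W j‖ ^ 2 := by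
    intro j k
    have h2 : ‖p j * W k - p k * W j‖ ≤ M * ‖W k‖ + M * ‖W j‖ := by
      refine (norm_sub_le _ _).trans ?_
      rw [norm_mul, norm_mul]
      gcongr
      · exact hp j
      · exact hp k
    calc _ ≤ (M * ‖W k‖ + M * ‖W j‖) ^ 2 := by gcongr
      _ ≤ _ := by nlinarith [sq_nonneg (M * ‖W k‖ - M * ‖W j‖)]
  calc _ ≤ ∑ j, ∑ k, (2 * M ^ 2 * ‖W k‖ ^ 2 + 2 * M ^ 2 * ‖W j‖ ^ 2) :=
        Finset.sum_le_sum fun j _ => Finset.sum_le_sum fun k _ => h1 j k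
    _ = _ := by
      simp only [Finset.sum_add_distrib, ← Finset.mul_sum, Finset.sum_const, Finset.card_univ,
        Fintype.card_fin, nsmul_eq_mul]
      ring

/-- The Bochner–Kohn estimate after multiplication with a cutoff function `χ`. -/
theorem cutoff_estimate (hΩ : IsOpen Ω) {Φ l : (Fin n → ℂ) → ℝ} (hΦ : ContDiffOn ℝ ∞ Φ Ω)
    (hlc : ContinuousOn l Ω) (hl0 : ∀ z ∈ Ω, 0 ≤ l z)
    (hl : ∀ z ∈ Ω, ∀ X, l z * ∑ j, ‖X j‖ ^ 2 ≤ hermForm n (cHess n Φ z) X X)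
    {W : Fin n → (Fin n → ℂ) → ℂ} {g : (Fin n → ℂ) → ℂ}
    (hW : ∀ j, MemLp (W j) 2 (volume.restrict Ω)) (hg : MemLp g 2 (volume.restrict Ω))
    (hcl : ∀ ψ, IsTestFun n ψ Ω → ∀ j k,
      ∫ z in Ω, (Real.exp (Φ z / 2) * W k z * wderBar n j ψ z
        - Real.exp (Φ z / 2) * W j z * wderBar n k ψ z) = 0)
    (hdiv : ∀ ψ, IsTestFun n ψ Ω →
      ∫ z in Ω, ∑ j, Real.exp (Φ z / 2) * W j z * wder n j ψ z =
        -∫ z in Ω, (∑ j, wder n j (fun v => (Φ v : ℂ)) z * (Real.exp (Φ z / 2) * W j z)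
          - Real.exp (Φ z / 2) * g z) * ψ z)
    {χ : (Fin n → ℂ) → ℝ} (hχ : IsTestFun n (fun z => (χ z : ℂ)) Ω)
    (hχ1 : ∀ z, 0 ≤ χ z ∧ χ z ≤ 1) {M : ℝ}
    (hχM : ∀ z ∈ Ω, ∀ j, ‖wder n j (fun v => (χ v : ℂ)) z‖ ≤ M) {T : Set (Fin n → ℂ)}
    (hTm : MeasurableSet T)
    (hχT : ∀ z ∈ Ω, ∀ j, z ∉ T → wder n j (fun v => (χ v : ℂ)) z = 0) :
    ∫⁻ z in Ω, ENNReal.ofReal (l z * χ z ^ 2 * ∑ j, ‖W j z‖ ^ 2) ≤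
      8 * (∫⁻ z in Ω, ENNReal.ofReal (‖g z‖ ^ 2))
      + ENNReal.ofReal (24 * n * M ^ 2) * ∫⁻ z in T ∩ Ω, ENNReal.ofReal (∑ j, ‖W j z‖ ^ 2) := by
  set E : (Fin n → ℂ) → ℂ := fun z => (Real.exp (Φ z / 2) : ℂ) with hE
  have hEs : ContDiffOn ℝ ∞ E Ω := hΦ.exp_half_ofReal
  set p : Fin n → (Fin n → ℂ) → ℂ := fun j => wder n j fun v => (χ v : ℂ) with hp
  set q : Fin n → (Fin n → ℂ) → ℂ := fun j => wderBar n j fun v => (χ v : ℂ) with hq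
  have hqp : ∀ j z, q j z = conj (p j z) := fun j z => (conj_wder_ofReal χ).symm
  set Φd : Fin n → (Fin n → ℂ) → ℂ := fun j => wder n j fun v => (Φ v : ℂ) with hΦd
  have hΦds : ∀ j, ContDiffOn ℝ ∞ (Φd j) Ω := fun j => hΦ.ofReal_complex.wder hΩ j
  have hpT : ∀ j, IsTestFun n (p j) Ω := fun j => hχ.wder j
  have hqT : ∀ j, IsTestFun n (q j) Ω := fun j => hχ.wderBar j
  have hχE := hχ.mul_right hΩ hEs
  -- the cut off data
  set w : Fin n → (Fin n → ℂ) → ℂ := fun j z => χ z * E z * W j z with hw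
  set G : (Fin n → ℂ) → ℂ := fun z => ∑ j, (χ z * (Φd j z * E z) + p j z * E z) * W j z
    - χ z * E z * g z with hG
  set s : Fin n → Fin n → (Fin n → ℂ) → ℂ := fun j k z =>
    q j z * E z * W k z - q k z * E z * W j z with hs
  have hwL : ∀ j, MemLp (w j) 2 := fun j => hχE.memLp_mul hΩ (hW j)
  have hcT : ∀ j, IsTestFun n (fun z => χ z * (Φd j z * E z) + p j z * E z) Ω := fun j =>
    (hχ.mul_right hΩ ((hΦds j).mul hEs)).add ((hpT j).mul_right hΩ hEs)
  have hGL : MemLp G 2 :=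
    (memLp_finsetSum _ fun j _ => (hcT j).memLp_mul hΩ (hW j)).sub (hχE.memLp_mul hΩ hg)
  have hsL : ∀ j k, MemLp (s j k) 2 := fun j k =>
    (((hqT j).mul_right hΩ hEs).memLp_mul hΩ (hW k)).sub
      (((hqT k).mul_right hΩ hEs).memLp_mul hΩ (hW j))
  have hz0 : ∀ z, z ∉ tsupport (fun z => (χ z : ℂ)) →
      (χ z : ℂ) = 0 ∧ (∀ j, p j z = 0) ∧ ∀ j, q j z = 0 := fun z hz =>
    ⟨image_eq_zero_of_notMem_tsupport (f := fun z => (χ z : ℂ)) hz, fun j => (IsTestFun.wder_apply_eq_zero hz).1,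
      fun j => (IsTestFun.wder_apply_eq_zero hz).2⟩
  have hB := bochner_weak hΩ hχ.2.1 hχ.2.2 hΦ hlc hl0 hl hwL hGL hsL
    (fun j z hz => by simp [hw, (hz0 z hz).1])
    (fun z hz => by simp [hG, (hz0 z hz).1, (hz0 z hz).2.1])
    (fun j k z hz => by simp [hs, (hz0 z hz).2.2])
    (fun ψ hψ => by
      have hψχ : IsTestFun n (fun z => χ z * ψ z) Ω := hχ.mul_right hΩ hψ.1.contDiffOn
      have h1 := hdiv _ hψχ
      have hz : ∀ x ∉ Ω, ∑ j, w j x * wder n j ψ x = 0 := fun x hx => by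
        have := (hz0 x fun h => hx (hχ.2.2 h)).1
        simp [hw, this]
      have hz' : ∀ x ∉ Ω, G x * ψ x = 0 := fun x hx => by
        have := hz0 x fun h => hx (hχ.2.2 h)
        simp [hG, this.1, this.2.1]
      rw [← setIntegral_eq_integral_of_forall_compl_eq_zero hz,
        ← setIntegral_eq_integral_of_forall_compl_eq_zero hz']
      have h2 : ∫ z in Ω, ∑ j, w j z * wder n j ψ z =
          (∫ z in Ω, ∑ j, E z * W j z * wder n j (fun z => χ z * ψ z) z)
          - ∫ z in Ω, ∑ j, (p j z * (E z * ψ z)) * W j z := by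
        rw [← integral_sub]
        · refine setIntegral_congr_fun hΩ.measurableSet fun z hz => ?_
          simp only [← Finset.sum_sub_distrib]
          refine Finset.sum_congr rfl fun j _ => ?_
          rw [wder_mul (hχ.1.differentiable (by norm_num) z) (hψ.1.differentiable (by norm_num) z)]
          simp only [hw, hp]
          ring
        · refine integrable_finsetSum _ fun j _ => ?_
          refine (((hψχ.wder j).mul_left hΩ hEs).integrableOn_mul (hW j)).congr
            (Eventually.of_forall fun z => ?_)
          simp only; ring
        · exact integrable_finsetSum _ fun j _ =>
            ((hpT j).mul_right hΩ (hEs.mul hψ.1.contDiffOn)).integrableOn_mul (hW j)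
      have h3 : ∫ z in Ω, G z * ψ z =
          (∫ z in Ω, (∑ j, Φd j z * (E z * W j z) - E z * g z) * (χ z * ψ z))
          + ∫ z in Ω, ∑ j, (p j z * (E z * ψ z)) * W j z := by
        rw [← integral_add]
        · refine setIntegral_congr_fun hΩ.measurableSet fun z hz => ?_
          simp only [hG, sub_mul, Finset.sum_mul]
          rw [sub_add_eq_add_sub, ← Finset.sum_add_distrib]
          congr 1
          · refine Finset.sum_congr rfl fun j _ => ?_
            ring
          · ring
        · have h4 : Integrable (fun z => ∑ j, (Φd j z * E z * (χ z * ψ z)) * W j z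
              - (E z * (χ z * ψ z)) * g z) (volume.restrict Ω) :=
            (integrable_finsetSum _ fun j _ =>
              (hψχ.mul_left hΩ ((hΦds j).mul hEs)).integrableOn_mul (hW j)).sub
              ((hψχ.mul_left hΩ hEs).integrableOn_mul hg)
          refine h4.congr (Eventually.of_forall fun z => ?_)
          simp only [sub_mul, Finset.sum_mul]
          congr 1
          · refine Finset.sum_congr rfl fun j _ => ?_
            ring
          · ring
        · exact integrable_finsetSum _ fun j _ =>
            ((hpT j).mul_right hΩ (hEs.mul hψ.1.contDiffOn)).integrableOn_mul (hW j)
      rw [h2, h3, h1]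
      ring)
    (fun ψ hψ j k => by
      have hψχ : IsTestFun n (fun z => χ z * ψ z) Ω := hχ.mul_right hΩ hψ.1.contDiffOn
      have h1 := hcl _ hψχ j k
      have hz : ∀ x ∉ Ω, w k x * wderBar n j ψ x - w j x * wderBar n k ψ x = 0 := fun x hx => by
        have := (hz0 x fun h => hx (hχ.2.2 h)).1
        simp [hw, this]
      have hz' : ∀ x ∉ Ω, s j k x * ψ x = 0 := fun x hx => by
        have := hz0 x fun h => hx (hχ.2.2 h)
        simp [hs, this.2.2]
      rw [← setIntegral_eq_integral_of_forall_compl_eq_zero hz,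
        ← setIntegral_eq_integral_of_forall_compl_eq_zero hz', eq_neg_iff_add_eq_zero, ← h1,
        ← integral_add]
      · refine setIntegral_congr_fun hΩ.measurableSet fun z hz => ?_
        rw [wderBar_mul (hχ.1.differentiable (by norm_num) z)
            (hψ.1.differentiable (by norm_num) z),
          wderBar_mul (hχ.1.differentiable (by norm_num) z)
            (hψ.1.differentiable (by norm_num) z)]
        simp only [hw, hs, hq]
        ring
      · refine (((hχE.mul_right hΩ (hψ.1.contDiffOn.wderBar hΩ j)).integrableOn_mul (hW k)).sub
          ((hχE.mul_right hΩ (hψ.1.contDiffOn.wderBar hΩ k)).integrableOn_mul (hW j))).congr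
            (Eventually.of_forall fun z => ?_)
        simp only [hw, Pi.sub_apply]; ring
      · refine ((((hqT j).mul_right hΩ (hEs.mul hψ.1.contDiffOn)).integrableOn_mul (hW k)).sub
          (((hqT k).mul_right hΩ (hEs.mul hψ.1.contDiffOn)).integrableOn_mul (hW j))).congr
            (Eventually.of_forall fun z => ?_)
        simp only [hs, Pi.sub_apply]; ring)
  have hEn : ∀ z, ‖E z‖ ^ 2 = Real.exp (Φ z) := fun z => by
    simp only [hE, Complex.norm_real, Real.norm_eq_abs, abs_of_pos (Real.exp_pos _)]
    rw [← Real.exp_nat_mul]; congr 1; push_cast; ring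
  have hEn' : ∀ z, Real.exp (-Φ z) * ‖E z‖ ^ 2 = 1 := fun z => by
    rw [hEn, ← Real.exp_add]; simp
  have hleft : ∀ z, l z * Real.exp (-Φ z) * ∑ j, ‖w j z‖ ^ 2 =
      l z * χ z ^ 2 * ∑ j, ‖W j z‖ ^ 2 := by
    intro z
    have : ∀ j, ‖w j z‖ ^ 2 = χ z ^ 2 * ‖E z‖ ^ 2 * ‖W j z‖ ^ 2 := fun j => by
      simp only [hw, norm_mul, mul_pow, Complex.norm_real, Real.norm_eq_abs, sq_abs]
    simp only [this, ← Finset.mul_sum]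
    linear_combination (l z * χ z ^ 2 * ∑ j, ‖W j z‖ ^ 2) * hEn' z
  simp only [hleft] at hB
  refine hB.trans ?_
  have hptw : ∀ z ∈ Ω, Real.exp (-Φ z) * (‖G z - ∑ j, Φd j z * w j z‖ ^ 2
      + ∑ j, ∑ k, ‖s j k z‖ ^ 2) ≤ 2 * ‖g z‖ ^ 2
      + 6 * n * M ^ 2 * T.indicator (fun z => ∑ j, ‖W j z‖ ^ 2) z := by
    intro z hz
    have h1 : G z - ∑ j, Φd j z * w j z = E z * (∑ j, p j z * W j z - χ z * g z) := by
      simp only [hG, hw, mul_sub, Finset.mul_sum]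
      rw [sub_right_comm, ← Finset.sum_sub_distrib]
      congr 1
      · refine Finset.sum_congr rfl fun j _ => ?_
        ring
      · ring
    have h2 : ∀ j k, s j k z = E z * (q j z * W k z - q k z * W j z) := fun j k => by
      simp only [hs]; ring
    simp only [h1, h2, norm_mul, mul_pow, ← Finset.mul_sum]
    rw [← mul_add, ← mul_assoc, hEn', one_mul]
    have h3 : ‖∑ j, p j z * W j z - χ z * g z‖ ^ 2 ≤
        2 * ‖g z‖ ^ 2 + 2 * ‖∑ j, p j z * W j z‖ ^ 2 := by
      have h4 : ‖(χ z : ℂ) * g z‖ ≤ ‖g z‖ := by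
        rw [norm_mul, Complex.norm_real, Real.norm_eq_abs, abs_of_nonneg (hχ1 z).1]
        exact mul_le_of_le_one_left (norm_nonneg _) (hχ1 z).2
      have h5 := norm_sub_le (∑ j, p j z * W j z) (χ z * g z)
      have h6 : ‖∑ j, p j z * W j z - χ z * g z‖ ≤ ‖∑ j, p j z * W j z‖ + ‖g z‖ := by linarith
      calc _ ≤ (‖∑ j, p j z * W j z‖ + ‖g z‖) ^ 2 := by gcongr
        _ ≤ _ := by nlinarith [sq_nonneg (‖∑ j, p j z * W j z‖ - ‖g z‖)]
    by_cases hzT : z ∈ T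
    · rw [indicator_of_mem hzT]
      have h4 := norm_sum_mul_sq_le (d := fun j => W j z) (hχM z hz)
      have h5 := norm_curl_sq_sum_le (p := fun j => q j z) (W := fun j => W j z) (M := M)
        (fun j => by rw [hqp]; simpa using hχM z hz j)
      simp only [hp] at h3 ⊢
      linarith
    · have h4 : ∀ j, p j z = 0 := fun j => hχT z hz j hzT
      simp only [h4, hqp, map_zero, zero_mul, Finset.sum_const_zero, sub_self, norm_zero] at h3 ⊢
      rw [indicator_of_notMem hzT]
      simpa using h3
  have hSm : AEMeasurable (fun z => ENNReal.ofReal (∑ j, ‖W j z‖ ^ 2)) (volume.restrict Ω) :=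
    (Finset.aemeasurable_fun_sum _ fun j _ =>
      ((hW j).1.norm.aemeasurable.pow_const 2)).ennreal_ofReal
  calc _ ≤ 4 * ∫⁻ z in Ω, (2 * ENNReal.ofReal (‖g z‖ ^ 2)
        + ENNReal.ofReal (6 * n * M ^ 2) *
          T.indicator (fun z => ENNReal.ofReal (∑ j, ‖W j z‖ ^ 2)) z) := by
        gcongr 4 * ?_
        refine setLIntegral_mono' hΩ.measurableSet fun z hz => ?_
        refine (ENNReal.ofReal_le_ofReal (hptw z hz)).trans ?_
        refine ENNReal.ofReal_add_le.trans ?_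
        rw [ENNReal.ofReal_mul (by norm_num), ENNReal.ofReal_mul (by positivity)]
        by_cases hzT : z ∈ T
        · simp [hzT]
        · simp [hzT]
    _ = _ := by
        rw [lintegral_add_right' _ ((hSm.indicator hTm).const_mul _),
          lintegral_const_mul' _ _ (by norm_num), lintegral_const_mul' _ _ ENNReal.ofReal_ne_top,
          lintegral_indicator hTm, Measure.restrict_restrict hTm, mul_add, ← mul_assoc, ← mul_assoc]
        congr 2
        · norm_num
        · rw [show (4:ℝ≥0∞) = ENNReal.ofReal 4 by simp, ← ENNReal.ofReal_mul (by norm_num)]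
          congr 1; ring

end

section Apriori

open scoped ContDiff ENNReal ComplexConjugate

variable {n : ℕ} {Ω : Set (Fin n → ℂ)}

theorem cutoff_decay_aux {c κ F N R a t : ℝ} (hc : 0 ≤ c) (hκ : 0 < κ) (hF : 0 ≤ F)
    (hR : 1 ≤ R) (h1 : κ * R ^ 5 * a ≤ 8 * F + c * (2 * R) ^ 2 * N)
    (h2 : t ≤ 8 * F + c * R ^ 2 * a) : t ≤ 8 * F + c * (8 * F + 4 * c * N) / κ / R := by
  have hR0 : 0 < R := by linarith
  have h3 : κ * R ^ 3 * a ≤ 8 * F + 4 * c * N := by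
    have h4 : R ^ 2 * (κ * R ^ 3 * a) ≤ R ^ 2 * (8 * F + 4 * c * N) := by
      have : 8 * F ≤ R ^ 2 * (8 * F) := le_mul_of_one_le_left (by positivity) (by nlinarith)
      nlinarith
    exact le_of_mul_le_mul_left h4 (by positivity)
  have h5 : R ^ 2 * a ≤ (8 * F + 4 * c * N) / κ / R := by
    rw [le_div_iff₀ hR0, le_div_iff₀ hκ]; nlinarith
  have h6 : c * (R ^ 2 * a) ≤ c * ((8 * F + 4 * c * N) / κ / R) := mul_le_mul_of_nonneg_left h5 hc
  have h7 : c * ((8 * F + 4 * c * N) / κ / R) = c * (8 * F + 4 * c * N) / κ / R := by ring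
  nlinarith

/-- Hörmander's a priori estimate: a square-integrable solution of the weighted system is
controlled by its weighted divergence. -/
theorem hormander_apriori (hΩ : IsOpen Ω) {P : (Fin n → ℂ) → ℝ} (hP : ContDiffOn ℝ ∞ P Ω)
    (hcomp : ∀ c, IsCompact {z ∈ Ω | P z ≤ c}) {A : ℝ}
    (hPd : ∀ z ∈ Ω, ∀ j, ‖wder n j (fun v => (P v : ℂ)) z‖ ≤ A * P z ^ 2)
    {Φ l : (Fin n → ℂ) → ℝ} (hΦ : ContDiffOn ℝ ∞ Φ Ω)
    (hlc : ContinuousOn l Ω) (hl1 : ∀ z ∈ Ω, 1 ≤ l z) {κ : ℝ} (hκ : 0 < κ)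
    (hlP : ∀ z ∈ Ω, κ * P z ^ 5 ≤ l z)
    (hl : ∀ z ∈ Ω, ∀ X, l z * ∑ j, ‖X j‖ ^ 2 ≤ hermForm n (cHess n Φ z) X X)
    {W : Fin n → (Fin n → ℂ) → ℂ} {g : (Fin n → ℂ) → ℂ}
    (hW : ∀ j, MemLp (W j) 2 (volume.restrict Ω)) (hg : MemLp g 2 (volume.restrict Ω))
    (hcl : ∀ ψ, IsTestFun n ψ Ω → ∀ j k,
      ∫ z in Ω, (Real.exp (Φ z / 2) * W k z * wderBar n j ψ z
        - Real.exp (Φ z / 2) * W j z * wderBar n k ψ z) = 0)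
    (hdiv : ∀ ψ, IsTestFun n ψ Ω →
      ∫ z in Ω, ∑ j, Real.exp (Φ z / 2) * W j z * wder n j ψ z =
        -∫ z in Ω, (∑ j, wder n j (fun v => (Φ v : ℂ)) z * (Real.exp (Φ z / 2) * W j z)
          - Real.exp (Φ z / 2) * g z) * ψ z) :
    ∫⁻ z in Ω, ENNReal.ofReal (∑ j, ‖W j z‖ ^ 2) ≤
      8 * ∫⁻ z in Ω, ENNReal.ofReal (‖g z‖ ^ 2) := by
  obtain ⟨C, hC, hcut⟩ := exists_cutoff hΩ hP hcomp hPd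
  set S : (Fin n → ℂ) → ℝ≥0∞ := fun z => ENNReal.ofReal (∑ j, ‖W j z‖ ^ 2) with hS
  have hN : ∫⁻ z in Ω, S z ≠ ⊤ := by
    have : Integrable (fun z => ∑ j, ‖W j z‖ ^ 2) (volume.restrict Ω) :=
      integrable_finsetSum _ fun j _ => (hW j).integrable_norm_pow two_ne_zero
    exact (hasFiniteIntegral_iff_ofReal (ae_of_all _ fun z => by positivity)).1 this.2 |>.ne
  have hF : ∫⁻ z in Ω, ENNReal.ofReal (‖g z‖ ^ 2) ≠ ⊤ := by
    have : Integrable (fun z => ‖g z‖ ^ 2) (volume.restrict Ω) :=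
      hg.integrable_norm_pow two_ne_zero
    exact (hasFiniteIntegral_iff_ofReal (ae_of_all _ fun z => by positivity)).1 this.2 |>.ne
  set N := ∫⁻ z in Ω, S z with hNdef
  set F := ∫⁻ z in Ω, ENNReal.ofReal (‖g z‖ ^ 2) with hFdef
  set L : ℝ → Set (Fin n → ℂ) := fun R => {z ∈ Ω | P z ≤ R} with hL
  have hLm : ∀ R, MeasurableSet (L R) := fun R => (hcomp R).measurableSet
  set T : ℝ → Set (Fin n → ℂ) := fun R => L (2 * R) \ {z ∈ Ω | P z < R} with hT
  have hTm : ∀ R, MeasurableSet (T R) := fun R =>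
    (hLm _).diff (hP.continuousOn.isOpen_inter_preimage hΩ isOpen_Iio).measurableSet
  have hTΩ : ∀ R, T R ∩ Ω = T R := fun R => inter_eq_left.2 fun z hz => hz.1.1
  have key : ∀ R > 0, ∫⁻ z in L R, ENNReal.ofReal (l z) * S z ≤
      8 * F + ENNReal.ofReal (24 * n * (C * R) ^ 2) * ∫⁻ z in T R, S z := by
    intro R hR
    obtain ⟨χ, h1, h2, h3, h4, h5⟩ := hcut R hR
    have := cutoff_estimate hΩ hΦ hlc (fun z hz => zero_le_one.trans (hl1 z hz)) hl hW hg hcl hdiv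
      h1 h2 h4 (hTm R) fun z hz j hzT => h5 z hz j fun h =>
        hzT ⟨⟨hz, h.2⟩, fun h' => absurd h'.2 (not_lt.2 h.1)⟩
    rw [hTΩ] at this
    refine le_trans ?_ this
    refine le_trans ?_ (lintegral_mono_set (s := L R) fun z hz => hz.1)
    refine setLIntegral_mono' (hLm R) fun z hz => ?_
    rw [h3 z hz.1 hz.2, one_pow, mul_one,
      ENNReal.ofReal_mul (zero_le_one.trans (hl1 z hz.1))]
  have hTN : ∀ R, ∫⁻ z in T R, S z ≤ N := fun R => lintegral_mono_set fun z hz => hz.1.1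
  have hTL : ∀ R > 0, ENNReal.ofReal (κ * R ^ 5) * ∫⁻ z in T R, S z ≤
      ∫⁻ z in L (2 * R), ENNReal.ofReal (l z) * S z := by
    intro R hR
    rw [← lintegral_const_mul' _ _ ENNReal.ofReal_ne_top]
    refine le_trans ?_ (lintegral_mono_set (s := T R) fun z hz => hz.1)
    refine setLIntegral_mono' (hTm R) fun z hz => ?_
    have hRz : R ≤ P z := not_lt.1 fun h => hz.2 ⟨hz.1.1, h⟩
    gcongr
    exact (by gcongr : κ * R ^ 5 ≤ κ * P z ^ 5).trans (hlP z hz.1.1)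
  have hSl : ∀ R, ∫⁻ z in L R, S z ≤ ∫⁻ z in L R, ENNReal.ofReal (l z) * S z := fun R =>
    setLIntegral_mono' (hLm R) fun z hz => by
      refine le_mul_of_one_le_left zero_le ?_
      rw [← ENNReal.ofReal_one]
      exact ENNReal.ofReal_le_ofReal (hl1 z hz.1)
  set D : ℝ := 24 * n * C ^ 2 * (8 * F.toReal + 4 * (24 * n * C ^ 2) * N.toReal) / κ with hD
  have hbd : ∀ R, 1 ≤ R → ∫⁻ z in L R, S z ≤ ENNReal.ofReal (8 * F.toReal + D / R) := by
    intro R hR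
    have hR0 : 0 < R := by linarith
    set a := ∫⁻ z in T R, S z with ha
    have haN : a ≠ ⊤ := ne_top_of_le_ne_top hN (hTN R)
    have k1 : ENNReal.ofReal (κ * R ^ 5) * a ≤
        8 * F + ENNReal.ofReal (24 * n * (C * (2 * R)) ^ 2) * N :=
      (hTL R hR0).trans ((key _ (by positivity)).trans (by gcongr; exact hTN _))
    have k2 := (hSl R).trans (key R hR0)
    have e8 : (8 : ℝ≥0∞) = ENNReal.ofReal 8 := by simp
    rw [← ENNReal.ofReal_toReal haN, ← ENNReal.ofReal_toReal hN, ← ENNReal.ofReal_toReal hF, e8,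
      ← ENNReal.ofReal_mul (by positivity), ← ENNReal.ofReal_mul (by positivity),
      ← ENNReal.ofReal_mul (by positivity), ← ENNReal.ofReal_add (by positivity) (by positivity),
      ENNReal.ofReal_le_ofReal_iff (by positivity)] at k1
    rw [← ha, ← ENNReal.ofReal_toReal haN, ← ENNReal.ofReal_toReal hF, e8,
      ← ENNReal.ofReal_mul (by positivity), ← ENNReal.ofReal_mul (by positivity),
      ← ENNReal.ofReal_add (by positivity) (by positivity)] at k2
    refine k2.trans (ENNReal.ofReal_le_ofReal ?_)
    exact cutoff_decay_aux (c := 24 * n * C ^ 2) (by positivity) hκ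
      (by positivity) (N := N.toReal) hR (a := a.toReal) (k1.trans (by
        apply le_of_eq; ring)) (by apply le_of_eq; ring)
  have hk : ∀ k : ℕ, ∫⁻ z in L k, S z ≤ 8 * F := by
    intro k
    have hlim : Tendsto (fun R : ℝ => ENNReal.ofReal (8 * F.toReal + D / R)) atTop
        (𝓝 (ENNReal.ofReal (8 * F.toReal + 0))) :=
      (ENNReal.continuous_ofReal.tendsto _).comp
        (tendsto_const_nhds.add (tendsto_const_nhds.div_atTop tendsto_id))
    have e : ENNReal.ofReal (8 * F.toReal + 0) = 8 * F := by
      rw [add_zero, ENNReal.ofReal_mul (by norm_num), ENNReal.ofReal_toReal hF]; simp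
    rw [e] at hlim
    refine ge_of_tendsto hlim ?_
    filter_upwards [eventually_ge_atTop (1:ℝ), eventually_ge_atTop (k:ℝ)] with R hR hkR
    have hsub : L k ⊆ L R := fun z hz => ⟨hz.1, hz.2.trans hkR⟩
    exact (lintegral_mono_set hsub).trans (hbd R hR)
  have hU : Ω = ⋃ k : ℕ, L k := by
    ext z
    simp only [mem_iUnion]
    refine ⟨fun hz => ?_, fun ⟨k, hk⟩ => hk.1⟩
    obtain ⟨k, hk⟩ := exists_nat_ge (P z)
    exact ⟨k, hz, hk⟩
  have hdir : Directed (· ⊆ ·) fun k : ℕ => L k :=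
    Monotone.directed_le fun _ _ hij _ hz => ⟨hz.1, hz.2.trans (by exact_mod_cast hij)⟩
  calc N = ∫⁻ z in ⋃ k : ℕ, L k, S z := by rw [← hU]
    _ = ⨆ k : ℕ, ∫⁻ z in L k, S z := setLIntegral_iUnion_of_directed _ hdir
    _ ≤ 8 * F := iSup_le hk

end Apriori

/-! ### Orthogonal projections for tuples of square-integrable functions -/

section TupleInner

open scoped ComplexConjugate

variable {α : Type*} [MeasurableSpace α] {μ : Measure α} {n : ℕ}

/-- The `L²` inner product of two tuples of functions. -/
noncomputable def tupleInner (μ : Measure α) (A W : Fin n → α → ℂ) : ℂ :=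
  ∑ j, ∫ x, conj (A j x) * W j x ∂μ

/-- A tuple of square-integrable functions as an element of a Hilbert space. -/
noncomputable def tupleToLp {W : Fin n → α → ℂ} (hW : ∀ j, MemLp (W j) 2 μ) :
    PiLp 2 fun _ : Fin n => Lp ℂ 2 μ :=
  WithLp.toLp 2 fun j => (hW j).toLp

theorem inner_tupleToLp {A W : Fin n → α → ℂ} (hA : ∀ j, MemLp (A j) 2 μ)
    (hW : ∀ j, MemLp (W j) 2 μ) :
    inner ℂ (tupleToLp hA) (tupleToLp hW) = tupleInner μ A W := by
  rw [PiLp.inner_apply]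
  refine Finset.sum_congr rfl fun j _ => ?_
  rw [L2.inner_def]
  refine integral_congr_ae ?_
  filter_upwards [(hA j).coeFn_toLp, (hW j).coeFn_toLp] with x h1 h2
  simp only [tupleToLp]
  rw [h1, h2, RCLike.inner_apply, mul_comm]

theorem tupleInner_self {W : Fin n → α → ℂ} :
    tupleInner μ W W = ((∑ j, ∫ x, ‖W j x‖ ^ 2 ∂μ : ℝ) : ℂ) := by
  rw [tupleInner, ofReal_sum]
  refine Finset.sum_congr rfl fun j _ => ?_
  rw [← integral_complex_ofReal]
  congr 1 with x
  rw [mul_comm, Complex.mul_conj, Complex.normSq_eq_norm_sq]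

theorem norm_tupleToLp_sq {W : Fin n → α → ℂ} (hW : ∀ j, MemLp (W j) 2 μ) :
    ‖tupleToLp hW‖ ^ 2 = ∑ j, ∫ x, ‖W j x‖ ^ 2 ∂μ := by
  rw [← inner_self_eq_norm_sq (𝕜 := ℂ), inner_tupleToLp, tupleInner_self]
  exact ofReal_re _

theorem norm_tupleInner_sq_le {A W : Fin n → α → ℂ} (hA : ∀ j, MemLp (A j) 2 μ)
    (hW : ∀ j, MemLp (W j) 2 μ) :
    ‖tupleInner μ A W‖ ^ 2 ≤ (∑ j, ∫ x, ‖A j x‖ ^ 2 ∂μ) * ∑ j, ∫ x, ‖W j x‖ ^ 2 ∂μ := by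
  rw [← inner_tupleToLp hA hW, ← norm_tupleToLp_sq hA, ← norm_tupleToLp_sq hW, ← mul_pow]
  exact pow_le_pow_left₀ (norm_nonneg _) (norm_inner_le_norm _ _) 2

theorem exists_tupleToLp_eq (x : PiLp 2 fun _ : Fin n => Lp ℂ 2 μ) :
    ∃ (W : Fin n → α → ℂ) (hW : ∀ j, MemLp (W j) 2 μ), tupleToLp hW = x := by
  refine ⟨fun j => x j, fun j => Lp.memLp _, ?_⟩
  ext1 j
  exact Lp.toLp_coeFn (x j) (Lp.memLp (x j))

theorem exists_projection_of_set {H : Type*} [NormedAddCommGroup H] [InnerProductSpace ℂ H]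
    [CompleteSpace H] (S : Set H) (w : H) :
    ∃ w' : H, (∀ s ∈ S, inner ℂ s w' = 0) ∧
      ∀ a : H, (∀ s ∈ S, inner ℂ s a = 0) → inner ℂ a w = inner ℂ a w' := by
  set K : Submodule ℂ H := (Submodule.span ℂ S)ᗮ with hK
  have hmem : ∀ a : H, a ∈ K ↔ ∀ s ∈ S, inner ℂ s a = 0 := by
    intro a
    refine ⟨fun h s hs => (Submodule.mem_orthogonal _ _).1 h _ (Submodule.subset_span hs),
      fun h => (Submodule.mem_orthogonal _ _).2 fun u hu => ?_⟩
    induction hu using Submodule.span_induction with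
    | mem x hx => exact h x hx
    | zero => simp
    | add x y _ _ hx hy => rw [inner_add_left, hx, hy, add_zero]
    | smul a x _ hx => rw [inner_smul_left, hx, mul_zero]
  refine ⟨K.starProjection w, (hmem _).1 (Submodule.starProjection_apply_mem _ _), fun a ha => ?_⟩
  rw [← sub_eq_zero, ← inner_sub_right]
  exact (Submodule.mem_orthogonal _ _).1 (Submodule.sub_starProjection_mem_orthogonal _) _
    ((hmem a).2 ha)

/-- Projection of a tuple onto the orthogonal complement of a family of tuples. -/
theorem exists_tuple_projection {S : Set (Fin n → α → ℂ)}
    (hS : ∀ s ∈ S, ∀ j, MemLp (s j) 2 μ) {W : Fin n → α → ℂ} (hW : ∀ j, MemLp (W j) 2 μ) :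
    ∃ W' : Fin n → α → ℂ, (∀ j, MemLp (W' j) 2 μ) ∧ (∀ s ∈ S, tupleInner μ s W' = 0) ∧
      ∀ A : Fin n → α → ℂ, (∀ j, MemLp (A j) 2 μ) → (∀ s ∈ S, tupleInner μ s A = 0) →
        tupleInner μ A W = tupleInner μ A W' := by
  obtain ⟨w, hw1, hw2⟩ := exists_projection_of_set
    {x | ∃ s, ∃ h : s ∈ S, x = tupleToLp (hS s h)} (tupleToLp hW)
  obtain ⟨W', hW', rfl⟩ := exists_tupleToLp_eq w
  refine ⟨W', hW', fun s hs => ?_, fun A hA hAS => ?_⟩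
  · rw [← inner_tupleToLp (hS s hs) hW']
    exact hw1 _ ⟨s, hs, rfl⟩
  · rw [← inner_tupleToLp hA hW, ← inner_tupleToLp hA hW']
    refine hw2 _ ?_
    rintro _ ⟨s, hs, rfl⟩
    rw [inner_tupleToLp, hAS s hs]

/-- A square-integrable function whose pairings against a linear space `R` are bounded can be
replaced, as far as `R` is concerned, by a function of small norm. -/
theorem exists_small_representative {R : Set (α → ℂ)} (hR : ∀ r ∈ R, MemLp r 2 μ)
    (hR0 : (0 : α → ℂ) ∈ R) (hadd : ∀ r ∈ R, ∀ s ∈ R, r + s ∈ R)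
    (hsmul : ∀ (c : ℂ), ∀ r ∈ R, c • r ∈ R) {V : α → ℂ} (hV : MemLp V 2 μ) {c : ℝ} (hc : 0 ≤ c)
    (hb : ∀ r ∈ R, ‖∫ x, conj (r x) * V x ∂μ‖ ^ 2 ≤ c * ∫ x, ‖r x‖ ^ 2 ∂μ) :
    ∃ U : α → ℂ, MemLp U 2 μ ∧ ∫ x, ‖U x‖ ^ 2 ∂μ ≤ c ∧
      ∀ r ∈ R, ∫ x, conj (r x) * (V x - U x) ∂μ = 0 := by
  have hin : ∀ {f g : α → ℂ} (hf : MemLp f 2 μ) (hg : MemLp g 2 μ),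
      inner ℂ hf.toLp hg.toLp = ∫ x, conj (f x) * g x ∂μ := by
    intro f g hf hg
    rw [L2.inner_def]
    refine integral_congr_ae ?_
    filter_upwards [hf.coeFn_toLp, hg.coeFn_toLp] with x h1 h2
    rw [h1, h2, RCLike.inner_apply, mul_comm]
  have hno : ∀ {f : α → ℂ} (hf : MemLp f 2 μ), ‖hf.toLp‖ ^ 2 = ∫ x, ‖f x‖ ^ 2 ∂μ := by
    intro f hf
    have e : ∫ x, conj (f x) * f x ∂μ = ((∫ x, ‖f x‖ ^ 2 ∂μ : ℝ) : ℂ) := by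
      rw [← integral_complex_ofReal]
      congr 1 with x
      rw [mul_comm, Complex.mul_conj, Complex.normSq_eq_norm_sq]
    rw [← inner_self_eq_norm_sq (𝕜 := ℂ), hin, e]
    exact ofReal_re _
  let M : Submodule ℂ (Lp ℂ 2 μ) :=
    { carrier := {f | ∃ r, ∃ h : r ∈ R, f = (hR r h).toLp}
      zero_mem' := ⟨0, hR0, rfl⟩
      add_mem' := by
        rintro _ _ ⟨r, hr, rfl⟩ ⟨s, hs, rfl⟩
        exact ⟨r + s, hadd r hr s hs, rfl⟩
      smul_mem' := by
        rintro a _ ⟨r, hr, rfl⟩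
        exact ⟨a • r, hsmul a r hr, rfl⟩ }
  set K := M.topologicalClosure with hK
  have : CompleteSpace K := M.isClosed_topologicalClosure.completeSpace_coe
  set v := hV.toLp with hv
  have hKb : ∀ x ∈ K, ‖inner ℂ x v‖ ^ 2 ≤ c * ‖x‖ ^ 2 := by
    have hcl : IsClosed {x : Lp ℂ 2 μ | ‖inner ℂ x v‖ ^ 2 ≤ c * ‖x‖ ^ 2} :=
      isClosed_le (by fun_prop) (by fun_prop)
    refine fun x hx => closure_minimal ?_ hcl hx
    rintro _ ⟨r, hr, rfl⟩
    rw [mem_ofPred_eq, hin, hno]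
    exact hb r hr
  set u := K.starProjection v with hu
  have horth : ∀ x ∈ K, inner ℂ x (v - u) = 0 :=
    (Submodule.mem_orthogonal _ _).1 (Submodule.sub_starProjection_mem_orthogonal _)
  have huK : u ∈ K := Submodule.starProjection_apply_mem _ _
  have hun : ‖u‖ ^ 2 ≤ c := by
    have h1 := hKb u huK
    have h2 : inner ℂ u v = inner ℂ u u := by
      rw [← sub_eq_zero, ← inner_sub_right, horth u huK]
    rw [h2, inner_self_eq_norm_sq_to_K] at h1
    rcases eq_or_lt_of_le (norm_nonneg u) with h | h
    · rw [← h]; simpa using hc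
    · have h4 : ‖u‖ ^ 2 * ‖u‖ ^ 2 ≤ c * ‖u‖ ^ 2 := by
        have : ‖(RCLike.ofReal ‖u‖ : ℂ) ^ 2‖ = ‖u‖ ^ 2 := by simp
        rw [this] at h1; nlinarith
      exact le_of_mul_le_mul_right h4 (by positivity)
  refine ⟨u, Lp.memLp u, ?_, fun r hr => ?_⟩
  · rw [← hno (Lp.memLp u), Lp.toLp_coeFn]; exact hun
  · have h1 := horth _ (M.le_topologicalClosure ⟨r, hr, rfl⟩)
    have e : (hV.sub (Lp.memLp u)).toLp = v - u := by
      rw [MemLp.toLp_sub hV (Lp.memLp u), Lp.toLp_coeFn]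
    rw [← e, hin] at h1
    exact h1

end TupleInner

section Duality

open scoped ContDiff ENNReal ComplexConjugate

variable {n : ℕ} {Ω : Set (Fin n → ℂ)}

theorem IsTestFun.differentiableAt {ψ : (Fin n → ℂ) → ℂ} (hψ : IsTestFun n ψ Ω) (z : Fin n → ℂ) :
    DifferentiableAt ℝ ψ z := hψ.1.differentiable (by norm_num) z

theorem integral_mul_wderBar_test (hΩ : IsOpen Ω) {u ψ : (Fin n → ℂ) → ℂ}
    (hψ : IsTestFun n ψ Ω) (hu : ContDiffOn ℝ ∞ u Ω) (j : Fin n) :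
    ∫ z in Ω, u z * wderBar n j ψ z = -∫ z in Ω, wderBar n j u z * ψ z := by
  have h := (hψ.mul_left hΩ hu).integral_wderBar j
  have e : ∫ z in Ω, wderBar n j (fun w => u w * ψ w) z =
      ∫ z in Ω, (wderBar n j u z * ψ z + u z * wderBar n j ψ z) :=
    setIntegral_congr_fun hΩ.measurableSet fun z hz =>
      wderBar_mul (hu.differentiableAt_of_isOpen hΩ hz) (hψ.differentiableAt z)
  rw [e, integral_add ((hψ.mul_left hΩ (hu.wderBar hΩ j)).integrable.integrableOn)
    (((hψ.wderBar j).mul_left hΩ hu).integrable.integrableOn)] at h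
  linear_combination h

theorem integral_curl_eq_zero (hΩ : IsOpen Ω) {u ψ : (Fin n → ℂ) → ℂ}
    (hψ : IsTestFun n ψ Ω) (hu : ContDiffOn ℝ ∞ u Ω) (j k : Fin n) :
    ∫ z in Ω, (wderBar n j ψ z * wderBar n k u z - wderBar n k ψ z * wderBar n j u z) = 0 := by
  have h1 := integral_mul_wderBar_test hΩ hψ (hu.wderBar hΩ k) j
  have h2 := integral_mul_wderBar_test hΩ hψ (hu.wderBar hΩ j) k
  have e : ∫ z in Ω, wderBar n j (wderBar n k u) z * ψ z =
      ∫ z in Ω, wderBar n k (wderBar n j u) z * ψ z :=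
    setIntegral_congr_fun hΩ.measurableSet fun z hz => by
      simp only [wderBar_wderBar_comm hΩ hu hz]
  rw [integral_sub (((hψ.wderBar j).mul_right hΩ (hu.wderBar hΩ k)).integrable.integrableOn)
    (((hψ.wderBar k).mul_right hΩ (hu.wderBar hΩ j)).integrable.integrableOn), sub_eq_zero]
  simp only [mul_comm (wderBar n _ ψ _)]
  rw [h1, h2, e]

theorem hermForm_cHess_add_const_mul (hΩ : IsOpen Ω) {φ Q : (Fin n → ℂ) → ℝ}
    (hφ : ContDiffOn ℝ ∞ φ Ω) (hQ : ContDiffOn ℝ ∞ Q Ω) (τ : ℝ) {z : Fin n → ℂ} (hz : z ∈ Ω)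
    (X : Fin n → ℂ) :
    hermForm n (cHess n (fun w => φ w + τ * Q w) z) X X =
      hermForm n (cHess n φ z) X X + τ * hermForm n (cHess n Q z) X X := by
  have hφ' := hφ.ofReal_complex
  have hQ' := hQ.ofReal_complex
  have h1 : ∀ j, ∀ w ∈ Ω, wder n j (fun v => ((φ v + τ * Q v : ℝ) : ℂ)) w =
      wder n j (fun v => (φ v : ℂ)) w + τ * wder n j (fun v => (Q v : ℂ)) w := by
    intro j w hw
    have hd1 := hφ'.differentiableAt_of_isOpen hΩ hw
    have hd2 := hQ'.differentiableAt_of_isOpen hΩ hw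
    have e : (fun v => ((φ v + τ * Q v : ℝ) : ℂ)) = fun v => (φ v : ℂ) + (τ : ℂ) * (Q v : ℂ) := by
      ext v; push_cast; ring
    rw [e, wder_add hd1 (hd2.const_mul _), wder_mul (differentiableAt_const _) hd2]
    simp [wder]
  have h2 : ∀ j k, cHess n (fun w => φ w + τ * Q w) z j k =
      cHess n φ z j k + τ * cHess n Q z j k := by
    intro j k
    unfold cHess
    rw [(Filter.eventuallyEq_of_mem (hΩ.mem_nhds hz) (h1 j)).wderBar_eq]
    have hd1 := (hφ'.wder hΩ j).differentiableAt_of_isOpen hΩ hz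
    have hd2 := (hQ'.wder hΩ j).differentiableAt_of_isOpen hΩ hz
    rw [wderBar_add hd1 (hd2.const_mul _), wderBar_mul (differentiableAt_const _) hd2]
    simp [wderBar]
  unfold hermForm
  rw [← Complex.re_ofReal_mul, ← Complex.add_re, Finset.mul_sum, ← Finset.sum_add_distrib]
  congr 1
  refine Finset.sum_congr rfl fun j _ => ?_
  rw [Finset.mul_sum, ← Finset.sum_add_distrib]
  refine Finset.sum_congr rfl fun k _ => ?_
  rw [h2]; ring

theorem sum_integral_eq_of_fin {α : Type*} [MeasurableSpace α] {μ : Measure α}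
    {f : Fin n → α → ℂ} (hf : ∀ j, Integrable (f j) μ) :
    ∑ j, ∫ x, f j x ∂μ = ∫ x, ∑ j, f j x ∂μ := (integral_finsetSum _ fun j _ => hf j).symm

/-- The duality form of Hörmander's estimate for a fixed weight. -/
theorem hormander_dual_of_weight (hΩ : IsOpen Ω) {P : (Fin n → ℂ) → ℝ}
    (hP : ContDiffOn ℝ ∞ P Ω) (hcomp : ∀ c, IsCompact {z ∈ Ω | P z ≤ c}) {A : ℝ}
    (hPd : ∀ z ∈ Ω, ∀ j, ‖wder n j (fun v => (P v : ℂ)) z‖ ≤ A * P z ^ 2)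
    {Φ l : (Fin n → ℂ) → ℝ} (hΦ : ContDiffOn ℝ ∞ Φ Ω)
    (hlc : ContinuousOn l Ω) (hl1 : ∀ z ∈ Ω, 1 ≤ l z) {κ : ℝ} (hκ : 0 < κ)
    (hlP : ∀ z ∈ Ω, κ * P z ^ 5 ≤ l z)
    (hl : ∀ z ∈ Ω, ∀ X, l z * ∑ j, ‖X j‖ ^ 2 ≤ hermForm n (cHess n Φ z) X X)
    (hΦb : ∃ B, ∀ z ∈ Ω, Real.exp (-Φ z / 2) ≤ B)
    {v : (Fin n → ℂ) → ℂ} (hv : ContDiffOn ℝ ∞ v Ω)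
    (hvb : ∀ j, MemLp (wderBar n j v) 2 (volume.restrict Ω))
    {h : Fin n → (Fin n → ℂ) → ℂ} (hh : ∀ j, IsTestFun n (h j) Ω) :
    ‖∫ z in Ω, v z * ∑ j, wderBar n j (h j) z‖ ^ 2 ≤
      8 * (∑ j, ∫ z in Ω, Real.exp (-Φ z) * ‖wderBar n j v z‖ ^ 2) *
        ∫ z in Ω, Real.exp (Φ z) * ‖∑ j, wderBar n j (h j) z‖ ^ 2 := by
  set μ := volume.restrict Ω with hμ
  set E : (Fin n → ℂ) → ℂ := fun z => (Real.exp (Φ z / 2) : ℂ) with hE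
  set E' : (Fin n → ℂ) → ℂ := fun z => (Real.exp (-Φ z / 2) : ℂ) with hE'
  have hEs : ContDiffOn ℝ ∞ E Ω := hΦ.exp_half_ofReal
  have hE's : ContDiffOn ℝ ∞ E' Ω := hΦ.neg.exp_half_ofReal
  have hEE : ∀ z, E' z * E z = 1 := fun z => by
    simp only [hE, hE']; rw [← ofReal_mul, ← Real.exp_add]; ring_nf; simp
  have hEc : ∀ z, conj (E z) = E z := fun z => conj_ofReal _
  have hE'c : ∀ z, conj (E' z) = E' z := fun z => conj_ofReal _
  -- the family defining closed tuples
  set s : ((Fin n → ℂ) → ℂ) → Fin n → Fin n → Fin n → (Fin n → ℂ) → ℂ := fun ψ j k m z =>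
    conj (wderBar n j ψ z) * E z * (if m = k then 1 else 0) -
      conj (wderBar n k ψ z) * E z * (if m = j then 1 else 0) with hs
  set S : Set (Fin n → (Fin n → ℂ) → ℂ) := {t | ∃ ψ j k, IsTestFun n ψ Ω ∧ t = s ψ j k} with hS
  have hsT : ∀ ψ j k m, IsTestFun n ψ Ω → IsTestFun n (s ψ j k m) Ω := fun ψ j k m hψ =>
    (((hψ.wderBar j).star.mul_right hΩ hEs).mul_right hΩ contDiffOn_const).sub
      (((hψ.wderBar k).star.mul_right hΩ hEs).mul_right hΩ contDiffOn_const)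
  have hSL : ∀ t ∈ S, ∀ m, MemLp (t m) 2 μ := by
    rintro t ⟨ψ, j, k, hψ, rfl⟩ m
    exact ((hsT ψ j k m hψ).memLp 2).restrict _
  have hsin : ∀ ψ j k (B : Fin n → (Fin n → ℂ) → ℂ), IsTestFun n ψ Ω →
      (∀ m, MemLp (B m) 2 μ) → tupleInner μ (s ψ j k) B =
        ∫ z in Ω, (E z * B k z * wderBar n j ψ z - E z * B j z * wderBar n k ψ z) := by
    intro ψ j k B hψ hB
    rw [tupleInner, sum_integral_eq_of_fin fun m =>
      ((hsT ψ j k m hψ).star.integrableOn_mul (hB m))]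
    congr 1 with z
    simp only [hs, map_sub, map_mul, Complex.conj_conj, hEc, sub_mul, Finset.sum_sub_distrib]
    simp only [apply_ite (starRingEnd ℂ), map_one, map_zero, mul_ite, mul_one, mul_zero, ite_mul,
      zero_mul, Finset.sum_ite_eq', Finset.mem_univ, if_true]
    ring
  -- gradients are closed
  have hgrad : ∀ u : (Fin n → ℂ) → ℂ, ContDiffOn ℝ ∞ u Ω →
      (∀ m, MemLp (fun z => E' z * wderBar n m u z) 2 μ) →
      ∀ t ∈ S, tupleInner μ t (fun m z => E' z * wderBar n m u z) = 0 := by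
    rintro u hu huL t ⟨ψ, j, k, hψ, rfl⟩
    rw [hsin ψ j k _ hψ huL, ← integral_curl_eq_zero hΩ hψ hu j k]
    congr 1 with z
    linear_combination (wderBar n j ψ z * wderBar n k u z - wderBar n k ψ z * wderBar n j u z) *
      hEE z
  set W : Fin n → (Fin n → ℂ) → ℂ := fun j z => E z * conj (h j z) with hWdef
  have hWT : ∀ j, IsTestFun n (W j) Ω := fun j => (hh j).star.mul_left hΩ hEs
  have hWL : ∀ j, MemLp (W j) 2 μ := fun j => ((hWT j).memLp 2).restrict _
  obtain ⟨W', hW', hW'S, hproj⟩ := exists_tuple_projection hSL hWL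
  set Dh : (Fin n → ℂ) → ℂ := fun z => ∑ j, wderBar n j (h j) z with hDh
  have hDhT : IsTestFun n Dh Ω := IsTestFun.sum fun j _ => (hh j).wderBar j
  set g : (Fin n → ℂ) → ℂ := fun z => -(E z * conj (Dh z)) with hg
  have hgT : IsTestFun n (fun z => E z * conj (Dh z)) Ω := hDhT.star.mul_left hΩ hEs
  have hgL : MemLp g 2 μ := ((hgT.memLp 2).restrict _).neg
  have hE2 : ∀ z, Real.exp (Φ z) = ‖E z‖ ^ 2 := fun z => by
    simp only [hE]; rw [Complex.norm_real, Real.norm_eq_abs, Real.abs_exp, ← Real.exp_nat_mul]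
    ring_nf
  have hE'2 : ∀ z, Real.exp (-Φ z) = ‖E' z‖ ^ 2 := fun z => by
    simp only [hE']; rw [Complex.norm_real, Real.norm_eq_abs, Real.abs_exp, ← Real.exp_nat_mul]
    ring_nf
  have hdiv : ∀ ψ, IsTestFun n ψ Ω →
      ∫ z in Ω, ∑ j, Real.exp (Φ z / 2) * W' j z * wder n j ψ z =
        -∫ z in Ω, (∑ j, wder n j (fun v => (Φ v : ℂ)) z * (Real.exp (Φ z / 2) * W' j z)
          - Real.exp (Φ z / 2) * g z) * ψ z := by
    intro ψ hψ
    set b : (Fin n → ℂ) → ℂ := fun z => conj (E z * E z * ψ z) with hb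
    have hbT : IsTestFun n b Ω := (hψ.mul_left hΩ (hEs.mul hEs)).star
    have hB : ∀ m, IsTestFun n (fun z => E' z * wderBar n m b z) Ω := fun m =>
      (hbT.wderBar m).mul_left hΩ hE's
    have hBL : ∀ m, MemLp (fun z => E' z * wderBar n m b z) 2 μ := fun m =>
      ((hB m).memLp 2).restrict _
    have hEd : ∀ m, ∀ z ∈ Ω, wder n m (fun w => E w * E w) z =
        E z * E z * wder n m (fun v => (Φ v : ℂ)) z := by
      intro m z hz
      have e : (fun w => E w * E w) = fun w => cexp (Φ w : ℂ) := by
        ext w; simp only [hE]; rw [← ofReal_mul, ← Real.exp_add, ← ofReal_exp]; ring_nf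
      rw [e, wder_cexp (hΦ.ofReal_complex.differentiableAt_of_isOpen hΩ hz)]
      congr 1
      exact (congrFun e z).symm
    have hbd : ∀ m, ∀ z ∈ Ω, conj (E' z * wderBar n m b z) =
        E z * (wder n m ψ z + wder n m (fun v => (Φ v : ℂ)) z * ψ z) := by
      intro m z hz
      have hd := (hEs.mul hEs).differentiableAt_of_isOpen hΩ hz
      rw [map_mul, hE'c, ← wder_conj]
      simp only [hb, Complex.conj_conj]
      rw [wder_mul hd (hψ.differentiableAt z), hEd m z hz]
      linear_combination (E z * (wder n m ψ z + wder n m (fun v => (Φ v : ℂ)) z * ψ z)) * hEE z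
    have h1 := hproj _ hBL (hgrad b hbT.1.contDiffOn hBL)
    have h2 : tupleInner μ (fun m z => E' z * wderBar n m b z) W =
        -∫ z in Ω, E z * E z * ψ z * conj (Dh z) := by
      have h3 : ∀ j, ∫ z in Ω, conj (E' z * wderBar n j b z) * W j z =
          -∫ z in Ω, E z * E z * ψ z * conj (wderBar n j (h j) z) := by
        intro j
        have h4 := integral_mul_wderBar_test hΩ (hh j) (u := b) hbT.1.contDiffOn j
        have h5 := congrArg (starRingEnd ℂ) h4
        rw [map_neg, ← integral_conj, ← integral_conj] at h5
        simp only [map_mul, hb, Complex.conj_conj, hEc] at h5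
        rw [← neg_eq_iff_eq_neg] at h5
        rw [h5]
        congr 1 with z
        simp only [hWdef, map_mul, hE'c]
        simp only [hb, map_mul, hEc]
        linear_combination (conj (wderBar n j (fun z => E z * E z * conj (ψ z)) z) * conj (h j z)) *
          hEE z
      rw [tupleInner, Finset.sum_congr rfl fun j _ => h3 j, Finset.sum_neg_distrib,
        sum_integral_eq_of_fin fun j => ((((hψ.mul_left hΩ (hEs.mul hEs))).mul_right hΩ
          ((hh j).wderBar j).star.1.contDiffOn).integrable.integrableOn)]
      congr 2 with z
      simp only [hDh, map_sum, Finset.mul_sum]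
    have h3 : tupleInner μ (fun m z => E' z * wderBar n m b z) W' =
        ∫ z in Ω, ∑ j, E z * (wder n j ψ z + wder n j (fun v => (Φ v : ℂ)) z * ψ z) * W' j z := by
      rw [tupleInner, sum_integral_eq_of_fin fun m =>
        (hB m).star.integrableOn_mul (hW' m)]
      exact setIntegral_congr_fun hΩ.measurableSet fun z hz => by
        simp only [fun m => hbd m z hz]
    rw [h2, h3] at h1
    have i1 : IntegrableOn (fun z => ∑ j, E z * W' j z * wder n j ψ z) Ω :=
      integrable_finsetSum _ fun j _ =>
        (((hψ.wder j).mul_left hΩ hEs).integrableOn_mul (hW' j)).congr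
          (ae_of_all _ fun z => by ring)
    have i2 : IntegrableOn (fun z => (∑ j, wder n j (fun v => (Φ v : ℂ)) z * (E z * W' j z)
          - E z * g z) * ψ z) Ω := by
      have i3 : IntegrableOn (fun z => ∑ j, wder n j (fun v => (Φ v : ℂ)) z * E z * ψ z * W' j z) Ω :=
        integrable_finsetSum _ fun j _ => (hψ.mul_left hΩ
          ((hΦ.ofReal_complex.wder hΩ j).mul hEs)).integrableOn_mul (hW' j)
      have i4 : IntegrableOn (fun z => E z * ψ z * g z) Ω :=
        (hψ.mul_left hΩ hEs).integrableOn_mul hgL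
      refine (i3.sub i4).congr (ae_of_all _ fun z => ?_)
      simp only [Pi.sub_apply, sub_mul, Finset.sum_mul]
      congr 1
      · exact Finset.sum_congr rfl fun j _ => by ring
      · ring
    have i5 : IntegrableOn (fun z => E z * E z * ψ z * conj (Dh z)) Ω :=
      ((hψ.mul_left hΩ (hEs.mul hEs)).mul_right hΩ hDhT.star.1.contDiffOn).integrable.integrableOn
    have e : ∫ z in Ω, ∑ j, E z * (wder n j ψ z + wder n j (fun v => (Φ v : ℂ)) z * ψ z) * W' j z =
        ∫ z in Ω, ((∑ j, E z * W' j z * wder n j ψ z +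
          (∑ j, wder n j (fun v => (Φ v : ℂ)) z * (E z * W' j z) - E z * g z) * ψ z) -
          E z * E z * ψ z * conj (Dh z)) := by
      congr 1 with z
      have e1 : ∑ j, E z * (wder n j ψ z + wder n j (fun v => (Φ v : ℂ)) z * ψ z) * W' j z =
          ∑ j, E z * W' j z * wder n j ψ z +
            (∑ j, wder n j (fun v => (Φ v : ℂ)) z * (E z * W' j z)) * ψ z := by
        rw [Finset.sum_mul, ← Finset.sum_add_distrib]
        exact Finset.sum_congr rfl fun j _ => by ring
      rw [e1]
      simp only [hg]
      ring
    rw [e, integral_sub (Integrable.fun_add i1 i2) i5, integral_add i1 i2] at h1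
    linear_combination -h1
  have hcl : ∀ ψ, IsTestFun n ψ Ω → ∀ j k,
      ∫ z in Ω, (Real.exp (Φ z / 2) * W' k z * wderBar n j ψ z
        - Real.exp (Φ z / 2) * W' j z * wderBar n k ψ z) = 0 := by
    intro ψ hψ j k
    rw [← hW'S _ ⟨ψ, j, k, hψ, rfl⟩, hsin ψ j k W' hψ hW']
  have hap := hormander_apriori hΩ hP hcomp hPd hΦ hlc hl1 hκ hlP hl hW' hgL hcl hdiv
  obtain ⟨B, hB⟩ := hΦb
  set 𝒜 : Fin n → (Fin n → ℂ) → ℂ := fun m z => E' z * wderBar n m v z with h𝒜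
  have hAL : ∀ m, MemLp (𝒜 m) 2 μ := by
    intro m
    refine ((hvb m).const_mul (B : ℂ)).mono (((hE's.continuousOn.aestronglyMeasurable
      hΩ.measurableSet)).mul (hvb m).1) ?_
    filter_upwards [ae_restrict_mem hΩ.measurableSet] with z hz
    rw [norm_mul, norm_mul]
    gcongr
    simp only [hE', Complex.norm_real, Real.norm_eq_abs, Real.abs_exp]
    exact (hB z hz).trans (le_abs_self B)
  have hfin := norm_tupleInner_sq_le hAL hW'
  rw [← hproj _ hAL (hgrad v hv hAL)] at hfin
  have e1 : tupleInner μ 𝒜 W = -conj (∫ z in Ω, v z * Dh z) := by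
    have h1 : ∀ j, ∫ z in Ω, conj (𝒜 j z) * W j z =
        -conj (∫ z in Ω, v z * wderBar n j (h j) z) := by
      intro j
      rw [integral_mul_wderBar_test hΩ (hh j) hv j, map_neg, neg_neg, ← integral_conj]
      congr 1 with z
      simp only [h𝒜, hWdef, map_mul, hE'c]
      linear_combination (conj (wderBar n j v z) * conj (h j z)) * hEE z
    rw [tupleInner, Finset.sum_congr rfl fun j _ => h1 j, Finset.sum_neg_distrib, ← map_sum,
      sum_integral_eq_of_fin fun j =>
        (((hh j).wderBar j).mul_left hΩ hv).integrable.integrableOn]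
    simp only [hDh, Finset.mul_sum]
  have e2 : ∑ j, ∫ x in Ω, ‖𝒜 j x‖ ^ 2 =
      ∑ j, ∫ z in Ω, Real.exp (-Φ z) * ‖wderBar n j v z‖ ^ 2 := by
    refine Finset.sum_congr rfl fun j _ => ?_
    congr 1 with z
    rw [hE'2, h𝒜, norm_mul, mul_pow]
  have e3 : ∑ j, ∫ x in Ω, ‖W' j x‖ ^ 2 ≤
      8 * ∫ z in Ω, Real.exp (Φ z) * ‖Dh z‖ ^ 2 := by
    have hWi : ∀ j, Integrable (fun x => ‖W' j x‖ ^ 2) μ := fun j =>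
      (hW' j).integrable_norm_pow two_ne_zero
    have hgi : Integrable (fun x => ‖g x‖ ^ 2) μ := hgL.integrable_norm_pow two_ne_zero
    rw [← ofReal_integral_eq_lintegral_ofReal (integrable_finsetSum _ fun j _ => hWi j)
      (ae_of_all _ fun z => by positivity), ← ofReal_integral_eq_lintegral_ofReal hgi
      (ae_of_all _ fun z => by positivity), show (8 : ℝ≥0∞) = ENNReal.ofReal 8 by simp,
      ← ENNReal.ofReal_mul (by norm_num),
      ENNReal.ofReal_le_ofReal_iff (mul_nonneg (by norm_num) (integral_nonneg fun z => by
        positivity)), integral_finsetSum _ fun j _ => hWi j] at hap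
    refine hap.trans (le_of_eq ?_)
    congr 2 with z
    rw [hE2, hg, norm_neg, norm_mul, mul_pow, RCLike.norm_conj]
  rw [e1, norm_neg, RCLike.norm_conj, e2] at hfin
  refine hfin.trans ?_
  rw [mul_comm 8, mul_assoc]
  refine mul_le_mul_of_nonneg_left e3 (Finset.sum_nonneg fun j _ => integral_nonneg fun z => by
    positivity)

end Duality

section Hormander

open scoped ContDiff ENNReal ComplexConjugate

variable {n : ℕ} {Ω : Set (Fin n → ℂ)}

theorem le_of_forall_exp_mul {a b M : ℝ} (h : ∀ τ > 0, a ≤ Real.exp (τ * M) * b) : a ≤ b := by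
  have hlim : Tendsto (fun τ : ℝ => Real.exp (τ * M) * b) (𝓝[>] 0) (𝓝 (Real.exp (0 * M) * b)) :=
    ((by fun_prop : Continuous fun τ : ℝ => Real.exp (τ * M) * b).tendsto 0).mono_left
      nhdsWithin_le_nhds
  have := ge_of_tendsto hlim (by filter_upwards [self_mem_nhdsWithin] with τ hτ using h τ hτ)
  simpa using this

/-- The duality form of Hörmander's estimate for a bounded weight on a domain with a suitable
exhaustion function. -/
theorem hormander_dual (hΩ : IsOpen Ω) {P : (Fin n → ℂ) → ℝ}
    (hP : ContDiffOn ℝ ∞ P Ω) (hP0 : ∀ z ∈ Ω, 0 ≤ P z)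
    (hcomp : ∀ c, IsCompact {z ∈ Ω | P z ≤ c}) {A : ℝ}
    (hPd : ∀ z ∈ Ω, ∀ j, ‖wder n j (fun v => (P v : ℂ)) z‖ ≤ A * P z ^ 2) {c : ℝ} (hc : 0 < c)
    (hPl : ∀ z ∈ Ω, ∀ X, c * P z ^ 5 * ∑ j, ‖X j‖ ^ 2 ≤
      hermForm n (cHess n (fun w => P w ^ 5) z) X X)
    {φ : (Fin n → ℂ) → ℝ} (hφ : ContDiffOn ℝ ∞ φ Ω)
    (hφl : ∀ z ∈ Ω, ∀ X, ∑ j, ‖X j‖ ^ 2 ≤ hermForm n (cHess n φ z) X X)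
    {B : ℝ} (hφb : ∀ z ∈ Ω, |φ z| ≤ B)
    {v : (Fin n → ℂ) → ℂ} (hv : ContDiffOn ℝ ∞ v Ω)
    (hvb : ∀ j, MemLp (wderBar n j v) 2 (volume.restrict Ω))
    {h : Fin n → (Fin n → ℂ) → ℂ} (hh : ∀ j, IsTestFun n (h j) Ω) :
    ‖∫ z in Ω, v z * ∑ j, wderBar n j (h j) z‖ ^ 2 ≤
      8 * (∑ j, ∫ z in Ω, Real.exp (-φ z) * ‖wderBar n j v z‖ ^ 2) *
        ∫ z in Ω, Real.exp (φ z) * ‖∑ j, wderBar n j (h j) z‖ ^ 2 := by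
  set Dh : (Fin n → ℂ) → ℂ := fun z => ∑ j, wderBar n j (h j) z with hDh
  have hDhT : IsTestFun n Dh Ω := IsTestFun.sum fun j _ => (hh j).wderBar j
  have hQ : ContDiffOn ℝ ∞ (fun w => P w ^ 5) Ω := hP.pow 5
  obtain ⟨M, hM⟩ := hDhT.2.1.exists_bound_of_continuousOn
    (hQ.continuousOn.mono hDhT.2.2)
  have hmeas : ∀ {u : (Fin n → ℂ) → ℝ}, ContDiffOn ℝ ∞ u Ω →
      AEStronglyMeasurable (fun z => Real.exp (u z)) (volume.restrict Ω) := fun hu =>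
    (Real.continuous_exp.comp_continuousOn hu.continuousOn).aestronglyMeasurable hΩ.measurableSet
  have hDhi : Integrable (fun z => ‖Dh z‖ ^ 2) (volume.restrict Ω) :=
    ((hDhT.memLp 2).restrict Ω).integrable_norm_pow two_ne_zero
  have hbd : ∀ z ∈ Ω, -B ≤ φ z ∧ φ z ≤ B := fun z hz => abs_le.1 (hφb z hz)
  have hi1 : Integrable (fun z => Real.exp (φ z) * ‖Dh z‖ ^ 2) (volume.restrict Ω) := by
    refine hDhi.bdd_mul (c := Real.exp B) (hmeas hφ) ?_
    filter_upwards [ae_restrict_mem hΩ.measurableSet] with z hz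
    rw [Real.norm_eq_abs, Real.abs_exp]
    exact Real.exp_le_exp.2 (hbd z hz).2
  have hi2 : ∀ j, Integrable (fun z => Real.exp (-φ z) * ‖wderBar n j v z‖ ^ 2)
      (volume.restrict Ω) := fun j => by
    refine ((hvb j).integrable_norm_pow two_ne_zero).bdd_mul (c := Real.exp B) (hmeas hφ.neg) ?_
    filter_upwards [ae_restrict_mem hΩ.measurableSet] with z hz
    rw [Real.norm_eq_abs, Real.abs_exp]
    exact Real.exp_le_exp.2 (by linarith [(hbd z hz).1])
  refine le_of_forall_exp_mul (M := M) fun τ hτ => ?_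
  have key := hormander_dual_of_weight hΩ hP hcomp hPd (Φ := fun w => φ w + τ * P w ^ 5)
    (l := fun z => 1 + τ * c * P z ^ 5) (κ := τ * c)
    (hφ.add (contDiffOn_const.mul hQ)) (by
      exact continuousOn_const.add (continuousOn_const.mul hQ.continuousOn))
    (fun z hz => by have := hP0 z hz; simp only [le_add_iff_nonneg_right]; positivity)
    (by positivity) (fun z hz => by linarith)
    (fun z hz X => by
      rw [hermForm_cHess_add_const_mul hΩ hφ hQ τ hz X]
      have h1 := hφl z hz X
      have h2 := mul_le_mul_of_nonneg_left (hPl z hz X) hτ.le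
      linarith)
    ⟨Real.exp (B / 2), fun z hz => Real.exp_le_exp.2 (by
      have := hP0 z hz
      have h3 : 0 ≤ τ * P z ^ 5 := by positivity
      linarith [(hbd z hz).1])⟩ hv hvb hh
  have hpt : ∀ z ∈ Ω, Real.exp (φ z + τ * P z ^ 5) * ‖Dh z‖ ^ 2 ≤
      Real.exp (τ * M) * (Real.exp (φ z) * ‖Dh z‖ ^ 2) := by
    intro z hz
    by_cases hzD : z ∈ tsupport Dh
    · rw [← mul_assoc, ← Real.exp_add]
      refine mul_le_mul_of_nonneg_right (Real.exp_le_exp.2 ?_) (by positivity)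
      have h1 : P z ^ 5 ≤ M := (le_abs_self _).trans (hM z hzD)
      have := mul_le_mul_of_nonneg_left h1 hτ.le
      linarith
    · rw [image_eq_zero_of_notMem_tsupport hzD]; simp
  have h4 : ∫ z in Ω, Real.exp (φ z + τ * P z ^ 5) * ‖Dh z‖ ^ 2 ≤
      Real.exp (τ * M) * ∫ z in Ω, Real.exp (φ z) * ‖Dh z‖ ^ 2 := by
    rw [← integral_const_mul]
    refine integral_mono_of_nonneg (ae_of_all _ fun z => by positivity) (hi1.const_mul _) ?_
    filter_upwards [ae_restrict_mem hΩ.measurableSet] with z hz using hpt z hz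
  have h5 : ∑ j, ∫ z in Ω, Real.exp (-(φ z + τ * P z ^ 5)) * ‖wderBar n j v z‖ ^ 2 ≤
      ∑ j, ∫ z in Ω, Real.exp (-φ z) * ‖wderBar n j v z‖ ^ 2 := by
    refine Finset.sum_le_sum fun j _ => integral_mono_of_nonneg
      (ae_of_all _ fun z => by positivity) (hi2 j) ?_
    filter_upwards [ae_restrict_mem hΩ.measurableSet] with z hz
    have := hP0 z hz
    gcongr
    have h3 : 0 ≤ τ * P z ^ 5 := by positivity
    linarith
  have h6 : 0 ≤ ∫ z in Ω, Real.exp (φ z + τ * P z ^ 5) * ‖Dh z‖ ^ 2 :=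
    integral_nonneg fun z => by positivity
  have h7 : 0 ≤ ∑ j, ∫ z in Ω, Real.exp (-φ z) * ‖wderBar n j v z‖ ^ 2 :=
    Finset.sum_nonneg fun j _ => integral_nonneg fun z => by positivity
  calc _ ≤ _ := key
    _ ≤ 8 * (∑ j, ∫ z in Ω, Real.exp (-φ z) * ‖wderBar n j v z‖ ^ 2) *
        (Real.exp (τ * M) * ∫ z in Ω, Real.exp (φ z) * ‖Dh z‖ ^ 2) := by gcongr
    _ = _ := by ring

/-- Hörmander's theorem: a smooth function is close, in a weighted `L²` norm, to a holomorphic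
function, the error being controlled by `∂̄`. -/
theorem hormander_l2 (hΩ : IsOpen Ω) {P : (Fin n → ℂ) → ℝ}
    (hP : ContDiffOn ℝ ∞ P Ω) (hP0 : ∀ z ∈ Ω, 0 ≤ P z)
    (hcomp : ∀ c, IsCompact {z ∈ Ω | P z ≤ c}) {A : ℝ}
    (hPd : ∀ z ∈ Ω, ∀ j, ‖wder n j (fun v => (P v : ℂ)) z‖ ≤ A * P z ^ 2) {c : ℝ} (hc : 0 < c)
    (hPl : ∀ z ∈ Ω, ∀ X, c * P z ^ 5 * ∑ j, ‖X j‖ ^ 2 ≤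
      hermForm n (cHess n (fun w => P w ^ 5) z) X X)
    {φ : (Fin n → ℂ) → ℝ} (hφ : ContDiffOn ℝ ∞ φ Ω)
    (hφl : ∀ z ∈ Ω, ∀ X, ∑ j, ‖X j‖ ^ 2 ≤ hermForm n (cHess n φ z) X X)
    {B : ℝ} (hφb : ∀ z ∈ Ω, |φ z| ≤ B)
    {v : (Fin n → ℂ) → ℂ} (hv : ContDiffOn ℝ ∞ v Ω) (hvL : MemLp v 2 (volume.restrict Ω))
    (hvb : ∀ j, MemLp (wderBar n j v) 2 (volume.restrict Ω)) :
    ∃ G : (Fin n → ℂ) → ℂ, DifferentiableOn ℂ G Ω ∧ MemLp G 2 (volume.restrict Ω) ∧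
      ∫ z in Ω, Real.exp (-φ z) * ‖v z - G z‖ ^ 2 ≤
        8 * ∑ j, ∫ z in Ω, Real.exp (-φ z) * ‖wderBar n j v z‖ ^ 2 := by
  set μ := volume.restrict Ω with hμ
  set E : (Fin n → ℂ) → ℂ := fun z => (Real.exp (φ z / 2) : ℂ) with hE
  set E' : (Fin n → ℂ) → ℂ := fun z => (Real.exp (-φ z / 2) : ℂ) with hE'
  have hEs : ContDiffOn ℝ ∞ E Ω := hφ.exp_half_ofReal
  have hE's : ContDiffOn ℝ ∞ E' Ω := hφ.neg.exp_half_ofReal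
  have hEE : ∀ z, E' z * E z = 1 := fun z => by
    simp only [hE, hE']; rw [← ofReal_mul, ← Real.exp_add]; ring_nf; simp
  have hEc : ∀ z, conj (E z) = E z := fun z => conj_ofReal _
  have hE2 : ∀ z, Real.exp (φ z) = ‖E z‖ ^ 2 := fun z => by
    simp only [hE]; rw [Complex.norm_real, Real.norm_eq_abs, Real.abs_exp, ← Real.exp_nat_mul]
    ring_nf
  have hE'2 : ∀ z, Real.exp (-φ z) = ‖E' z‖ ^ 2 := fun z => by
    simp only [hE']; rw [Complex.norm_real, Real.norm_eq_abs, Real.abs_exp, ← Real.exp_nat_mul]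
    ring_nf
  have hbd : ∀ z ∈ Ω, -B ≤ φ z ∧ φ z ≤ B := fun z hz => abs_le.1 (hφb z hz)
  have hmulL : ∀ {e f : (Fin n → ℂ) → ℂ}, ContDiffOn ℝ ∞ e Ω →
      (∀ z ∈ Ω, ‖e z‖ ≤ Real.exp (B / 2)) → MemLp f 2 μ → MemLp (fun z => e z * f z) 2 μ := by
    intro e f he heb hf
    refine (hf.const_mul (Real.exp (B / 2) : ℂ)).mono
      ((he.continuousOn.aestronglyMeasurable hΩ.measurableSet).mul hf.1) ?_
    filter_upwards [ae_restrict_mem hΩ.measurableSet] with z hz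
    rw [norm_mul, norm_mul, Complex.norm_real, Real.norm_eq_abs, Real.abs_exp]
    gcongr
    exact heb z hz
  have hEb : ∀ z ∈ Ω, ‖E z‖ ≤ Real.exp (B / 2) := fun z hz => by
    simp only [hE, Complex.norm_real, Real.norm_eq_abs, Real.abs_exp]
    exact Real.exp_le_exp.2 (by linarith [(hbd z hz).2])
  have hE'b : ∀ z ∈ Ω, ‖E' z‖ ≤ Real.exp (B / 2) := fun z hz => by
    simp only [hE', Complex.norm_real, Real.norm_eq_abs, Real.abs_exp]
    exact Real.exp_le_exp.2 (by linarith [(hbd z hz).1])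
  set V : (Fin n → ℂ) → ℂ := fun z => E' z * v z with hV
  have hVL : MemLp V 2 μ := hmulL hE's hE'b hvL
  set r : (Fin n → (Fin n → ℂ) → ℂ) → (Fin n → ℂ) → ℂ :=
    fun k z => E z * ∑ j, wder n j (k j) z with hr
  set R : Set ((Fin n → ℂ) → ℂ) := {f | ∃ k, (∀ j, IsTestFun n (k j) Ω) ∧ f = r k} with hR
  have hrT : ∀ k, (∀ j, IsTestFun n (k j) Ω) → IsTestFun n (r k) Ω := fun k hk =>
    (IsTestFun.sum fun j _ => (hk j).wder j).mul_left hΩ hEs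
  have h0T : IsTestFun n (fun _ => (0:ℂ)) Ω :=
    ⟨contDiff_const, HasCompactSupport.zero, by simp [tsupport]⟩
  set D := ∑ j, ∫ z in Ω, Real.exp (-φ z) * ‖wderBar n j v z‖ ^ 2 with hD
  have hD0 : 0 ≤ D := Finset.sum_nonneg fun j _ => integral_nonneg fun z => by positivity
  obtain ⟨U, hUL, hUb, hUR⟩ := exists_small_representative (μ := μ) (R := R) (V := V) (c := 8 * D)
    (by rintro _ ⟨k, hk, rfl⟩; exact ((hrT k hk).memLp 2).restrict _)
    ⟨fun _ _ => 0, fun j => h0T, by ext z; simp [hr, wder]⟩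
    (by
      rintro _ ⟨k, hk, rfl⟩ _ ⟨k', hk', rfl⟩
      refine ⟨fun j z => k j z + k' j z, fun j => (hk j).add (hk' j), ?_⟩
      ext z
      simp only [hr, Pi.add_apply]
      rw [← mul_add, ← Finset.sum_add_distrib]
      congr 1
      exact Finset.sum_congr rfl fun j _ =>
        (wder_add ((hk j).differentiableAt z) ((hk' j).differentiableAt z)).symm)
    (by
      rintro a _ ⟨k, hk, rfl⟩
      refine ⟨fun j z => a * k j z, fun j => (hk j).mul_left hΩ contDiffOn_const, ?_⟩
      ext z
      simp only [hr, Pi.smul_apply, smul_eq_mul, Finset.mul_sum]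
      refine Finset.sum_congr rfl fun j _ => ?_
      rw [wder_mul (differentiableAt_const _) ((hk j).differentiableAt z)]
      simp only [wder, fderiv_fun_const, Pi.zero_apply, zero_apply]
      ring)
    hVL (by positivity)
    (by
      rintro _ ⟨k, hk, rfl⟩
      have h1 := hormander_dual hΩ hP hP0 hcomp hPd hc hPl hφ hφl hφb hv hvb
        (h := fun j z => conj (k j z)) fun j => (hk j).star
      have h2 : ∀ z, ∑ j, wderBar n j (fun z => conj (k j z)) z =
          conj (∑ j, wder n j (k j) z) := fun z => by
        simp only [map_sum, wderBar_conj]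
      simp only [h2] at h1
      have e1 : ∫ z in Ω, conj (r k z) * V z = ∫ z in Ω, v z * conj (∑ j, wder n j (k j) z) := by
        congr 1 with z
        simp only [hr, hV, map_mul, hEc]
        linear_combination (conj (∑ j, wder n j (k j) z) * v z) * hEE z
      have e2 : ∫ z in Ω, ‖r k z‖ ^ 2 =
          ∫ z in Ω, Real.exp (φ z) * ‖conj (∑ j, wder n j (k j) z)‖ ^ 2 := by
        congr 1 with z
        rw [hE2, hr, norm_mul, mul_pow, RCLike.norm_conj]
      rw [e1, e2]
      exact h1)
  set F : (Fin n → ℂ) → ℂ := fun z => v z - E z * U z with hF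
  have hFL : MemLp F 2 μ := hvL.sub (hmulL hEs hEb hUL)
  obtain ⟨G, hGd, hGF⟩ := weyl_lemma hΩ hFL (by
    intro ψ hψ j
    have h1 := hUR (r fun m z => if m = j then conj (ψ z) else 0)
      ⟨_, fun m => by by_cases hm : m = j <;> simp [hm, hψ.star, h0T], rfl⟩
    rw [← h1]
    congr 1 with z
    have h2 : r (fun m z => if m = j then conj (ψ z) else 0) z = E z * conj (wderBar n j ψ z) := by
      simp only [hr]
      rw [Finset.sum_eq_single j]
      · simp [wder_conj]
      · intro b _ hb; simp [hb, wder]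
      · simp
    rw [h2, map_mul, hEc, Complex.conj_conj]
    simp only [hF, hV]
    linear_combination (-wderBar n j ψ z * v z) * hEE z)
  refine ⟨G, hGd, hFL.ae_eq hGF, ?_⟩
  refine le_trans (le_of_eq ?_) hUb
  refine integral_congr_ae ?_
  filter_upwards [hGF] with z hz
  rw [← hz, hE'2, ← mul_pow, ← norm_mul]
  congr 2
  simp only [hF]
  linear_combination U z * hEE z

end Hormander

section LeviCalculus

open scoped ContDiff ComplexConjugate

variable {n : ℕ} {Ω : Set (Fin n → ℂ)}

theorem cHess_comp (hΩ : IsOpen Ω) {u : (Fin n → ℂ) → ℝ} (hu : ContDiffOn ℝ ∞ u Ω) {g : ℝ → ℝ}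
    {S : Set ℝ} (hS : IsOpen S) (hg : ContDiffOn ℝ ∞ g S) (hm : MapsTo u Ω S)
    {z : Fin n → ℂ} (hz : z ∈ Ω) (j k : Fin n) :
    cHess n (fun w => g (u w)) z j k = (deriv g (u z) : ℝ) * cHess n u z j k +
      (deriv (deriv g) (u z) : ℝ) * (wder n j (fun v => (u v : ℂ)) z *
        conj (wder n k (fun v => (u v : ℂ)) z)) := by
  have hg' : ContDiffOn ℝ ∞ (deriv g) S := hg.deriv_of_isOpen hS (by simp)
  have hdu : ∀ w ∈ Ω, DifferentiableAt ℝ u w := fun w hw => hu.differentiableAt_of_isOpen hΩ hw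
  have hdg : ∀ w ∈ Ω, DifferentiableAt ℝ g (u w) := fun w hw =>
    (hg.differentiableOn (by simp)).differentiableAt (hS.mem_nhds (hm hw))
  have hdg' : ∀ w ∈ Ω, DifferentiableAt ℝ (deriv g) (u w) := fun w hw =>
    (hg'.differentiableOn (by simp)).differentiableAt (hS.mem_nhds (hm hw))
  have hc : ContDiffOn ℝ ∞ (fun w => deriv g (u w)) Ω := hg'.comp hu hm
  have h1 : (fun w => wder n j (fun v => ((g (u v) : ℝ) : ℂ)) w) =ᶠ[𝓝 z]
      fun w => ((deriv g (u w) : ℝ) : ℂ) * wder n j (fun v => (u v : ℂ)) w := by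
    filter_upwards [hΩ.mem_nhds hz] with w hw using wder_comp_real (hdg w hw) (hdu w hw)
  rw [cHess, h1.wderBar_eq, wderBar_mul (hc.ofReal_complex.differentiableAt_of_isOpen hΩ hz)
    ((hu.ofReal_complex.wder hΩ j).differentiableAt_of_isOpen hΩ hz),
    ← conj_wder_ofReal (fun w => deriv g (u w)), wder_comp_real (hdg' z hz) (hdu z hz), map_mul,
    conj_ofReal, cHess]
  ring

theorem hermForm_cHess_comp (hΩ : IsOpen Ω) {u : (Fin n → ℂ) → ℝ} (hu : ContDiffOn ℝ ∞ u Ω)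
    {g : ℝ → ℝ} {S : Set ℝ} (hS : IsOpen S) (hg : ContDiffOn ℝ ∞ g S) (hm : MapsTo u Ω S)
    {z : Fin n → ℂ} (hz : z ∈ Ω) (X : Fin n → ℂ) :
    hermForm n (cHess n (fun w => g (u w)) z) X X = deriv g (u z) * hermForm n (cHess n u z) X X +
      deriv (deriv g) (u z) * ‖∑ j, wder n j (fun v => (u v : ℂ)) z * X j‖ ^ 2 := by
  have h : ∑ j, ∑ k, cHess n (fun w => g (u w)) z j k * X j * conj (X k) =
      (deriv g (u z) : ℝ) * (∑ j, ∑ k, cHess n u z j k * X j * conj (X k)) +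
      (deriv (deriv g) (u z) : ℝ) * ((‖∑ j, wder n j (fun v => (u v : ℂ)) z * X j‖ ^ 2 : ℝ) : ℂ) := by
    rw [← Complex.normSq_eq_norm_sq, ← Complex.mul_conj, map_sum, Finset.sum_mul_sum,
      Finset.mul_sum, Finset.mul_sum, ← Finset.sum_add_distrib]
    refine Finset.sum_congr rfl fun j _ => ?_
    rw [Finset.mul_sum, Finset.mul_sum, ← Finset.sum_add_distrib]
    refine Finset.sum_congr rfl fun k _ => ?_
    rw [cHess_comp hΩ hu hS hg hm hz, map_mul]
    ring
  unfold hermForm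
  rw [h, add_re, re_ofReal_mul, re_ofReal_mul, ofReal_re]

theorem hermForm_sub (H H' : Fin n → Fin n → ℂ) (X Y : Fin n → ℂ) :
    hermForm n (H - H') X Y = hermForm n H X Y - hermForm n H' X Y := by
  simp only [hermForm, Pi.sub_apply, sub_mul, Finset.sum_sub_distrib, sub_re]

theorem hermForm_sub_left (H : Fin n → Fin n → ℂ) (X X' Y : Fin n → ℂ) :
    hermForm n H (X - X') Y = hermForm n H X Y - hermForm n H X' Y := by
  simp only [hermForm, Pi.sub_apply, sub_mul, mul_sub, Finset.sum_sub_distrib, sub_re]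

theorem hermForm_sub_right (H : Fin n → Fin n → ℂ) (X Y Y' : Fin n → ℂ) :
    hermForm n H X (Y - Y') = hermForm n H X Y - hermForm n H X Y' := by
  simp only [hermForm, Pi.sub_apply, map_sub, mul_sub, Finset.sum_sub_distrib, sub_re]

theorem abs_hermForm_le (H : Fin n → Fin n → ℂ) (X Y : Fin n → ℂ) :
    |hermForm n H X Y| ≤ n ^ 2 * ‖H‖ * ‖X‖ * ‖Y‖ := by
  refine (Complex.abs_re_le_norm _).trans ((norm_sum_le _ _).trans ?_)
  have h : ∀ j ∈ Finset.univ, ‖∑ k, H j k * X j * conj (Y k)‖ ≤ n * (‖H‖ * ‖X‖ * ‖Y‖) := by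
    intro j _
    refine (norm_sum_le _ _).trans ((Finset.sum_le_card_nsmul _ _ (‖H‖ * ‖X‖ * ‖Y‖)
      fun k _ => ?_).trans (by simp))
    rw [norm_mul, norm_mul, RCLike.norm_conj]
    gcongr
    · exact (norm_le_pi_norm (H j) k).trans (norm_le_pi_norm H j)
    · exact norm_le_pi_norm X j
    · exact norm_le_pi_norm Y k
  refine (Finset.sum_le_card_nsmul _ _ _ h).trans (le_of_eq ?_)
  simp
  ring

theorem norm_sum_mul_le (p X : Fin n → ℂ) : ‖∑ j, p j * X j‖ ≤ n * ‖p‖ * ‖X‖ := by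
  refine (norm_sum_le _ _).trans ((Finset.sum_le_card_nsmul _ _ (‖p‖ * ‖X‖) fun k _ => ?_).trans
    (by simp [mul_assoc]))
  rw [norm_mul]
  gcongr
  · exact norm_le_pi_norm p k
  · exact norm_le_pi_norm X k

/-- A Hermitian form that is close to one which is nonnegative on the kernel of `p₀` is bounded
below up to terms controlled by the distance and by `p`. -/
theorem hermForm_ge_of_near (n : ℕ) (K M : ℝ) (hK : 0 ≤ K) (hM : 0 ≤ M) : ∃ C ≥ 0, ∀ (H H₀ : Fin n → Fin n → ℂ)
    (p p₀ Y : Fin n → ℂ) (δ : ℝ), 0 ≤ δ → ‖H - H₀‖ ≤ K * δ → ‖p - p₀‖ ≤ K * δ → ‖H₀‖ ≤ M →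
    ‖p₀‖ ≤ M → ‖Y‖ ≤ M → 1 / 2 ≤ ‖∑ j, p₀ j * Y j‖ →
    (∀ X, ∑ j, p₀ j * X j = 0 → 0 ≤ hermForm n H₀ X X) →
    ∀ X, -(C * (δ * ‖X‖ ^ 2 + ‖∑ j, p j * X j‖ * ‖X‖)) ≤ hermForm n H X X := by
  have hn : (0:ℝ) ≤ n := Nat.cast_nonneg n
  refine ⟨n ^ 2 * K + n ^ 2 * M * M * (2 + 2 * n * M * M) * (2 + 2 * n * K), by positivity, ?_⟩
  intro H H₀ p p₀ Y δ hδ hH hp hH₀ hp₀ hY hpY hpos X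
  set s := ∑ j, p₀ j * Y j with hs
  set a := (∑ j, p₀ j * X j) / s with ha
  have hs0 : s ≠ 0 := by
    intro h; rw [h] at hpY; norm_num at hpY
  have hspos : 0 < ‖s‖ := norm_pos_iff.2 hs0
  have hx := hpos (X - a • Y) (by
    simp only [Pi.sub_apply, Pi.smul_apply, smul_eq_mul, mul_sub, Finset.sum_sub_distrib]
    have : ∑ j, p₀ j * (a * Y j) = a * s := by
      rw [hs, Finset.mul_sum]; exact Finset.sum_congr rfl fun j _ => by ring
    rw [this, ha, div_mul_cancel₀ _ hs0, sub_self])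
  have hanorm : ‖a‖ ≤ 2 * ‖∑ j, p₀ j * X j‖ := by
    rw [ha, norm_div, div_le_iff₀ hspos]
    nlinarith [norm_nonneg (∑ j, p₀ j * X j)]
  have ha1 : ‖a‖ ≤ 2 * n * M * ‖X‖ := by
    refine hanorm.trans ?_
    have := norm_sum_mul_le p₀ X
    have h2 : (n:ℝ) * ‖p₀‖ * ‖X‖ ≤ n * M * ‖X‖ := by gcongr
    linarith
  have ha2 : ‖a‖ ≤ 2 * (‖∑ j, p j * X j‖ + n * (K * δ) * ‖X‖) := by
    refine hanorm.trans ?_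
    have h1 : ∑ j, p₀ j * X j = ∑ j, p j * X j - ∑ j, (p - p₀) j * X j := by
      rw [← Finset.sum_sub_distrib]
      exact Finset.sum_congr rfl fun j _ => by simp only [Pi.sub_apply]; ring
    have h2 := norm_sum_mul_le (p - p₀) X
    have h3 : (n:ℝ) * ‖p - p₀‖ * ‖X‖ ≤ n * (K * δ) * ‖X‖ := by gcongr
    rw [h1]
    linarith [norm_sub_le (∑ j, p j * X j) (∑ j, (p - p₀) j * X j)]
  have haY : ‖a • Y‖ ≤ ‖a‖ * M := by rw [norm_smul]; gcongr
  have hX' : ‖X - a • Y‖ ≤ (1 + 2 * n * M * M) * ‖X‖ := by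
    have := norm_sub_le X (a • Y)
    have h2 : ‖a‖ * M ≤ 2 * n * M * ‖X‖ * M := by gcongr
    nlinarith
  have hdec : hermForm n H X X = hermForm n (H - H₀) X X + hermForm n H₀ (X - a • Y) (X - a • Y) +
      hermForm n H₀ (X - a • Y) (a • Y) + hermForm n H₀ (a • Y) X := by
    simp only [hermForm_sub, hermForm_sub_left, hermForm_sub_right]; ring
  have e1 : |hermForm n (H - H₀) X X| ≤ n ^ 2 * (K * δ) * ‖X‖ * ‖X‖ :=
    (abs_hermForm_le _ _ _).trans (by gcongr)
  have e2 : |hermForm n H₀ (X - a • Y) (a • Y)| ≤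
      n ^ 2 * M * ((1 + 2 * n * M * M) * ‖X‖) * (‖a‖ * M) :=
    (abs_hermForm_le _ _ _).trans (by gcongr)
  have e3 : |hermForm n H₀ (a • Y) X| ≤ n ^ 2 * M * (‖a‖ * M) * ‖X‖ :=
    (abs_hermForm_le _ _ _).trans (by gcongr)
  have e4 : n ^ 2 * M * M * (2 + 2 * n * M * M) * ‖X‖ * ‖a‖ ≤
      n ^ 2 * M * M * (2 + 2 * n * M * M) * ‖X‖ *
        (2 * (‖∑ j, p j * X j‖ + n * (K * δ) * ‖X‖)) := by gcongr
  have e5 : 0 ≤ n ^ 2 * K * (‖∑ j, p j * X j‖ * ‖X‖) := by positivity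
  have e6 : 0 ≤ n ^ 2 * M * M * (2 + 2 * n * M * M) * (2 * n * K * (‖∑ j, p j * X j‖ * ‖X‖)) := by
    positivity
  have e7 : 0 ≤ n ^ 2 * M * M * (2 + 2 * n * M * M) * (2 * (δ * ‖X‖ ^ 2)) := by positivity
  rw [hdec]
  have f1 := (abs_le.1 e1).1
  have f2 := (abs_le.1 e2).1
  have f3 := (abs_le.1 e3).1
  linarith [hx, f1, f2, f3, e4, e5, e6, e7]

end LeviCalculus

section Exhaustion

open scoped ContDiff ComplexConjugate

variable {n : ℕ} {Ω : Set (Fin n → ℂ)}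

theorem IsDefining.exists_frontier_near {ρ : (Fin n → ℂ) → ℝ} (hΩ : IsOpen Ω)
    (hb : Bornology.IsBounded Ω) (hρ : IsDefining n Ω ρ) {q : Fin n → ℂ} (hq : q ∈ frontier Ω) :
    ∃ c > 0, ∀ᶠ z in 𝓝 q, z ∈ Ω →
      ∃ q' ∈ frontier Ω, c * ‖z - q'‖ ≤ -ρ z ∧ ‖z - q'‖ ≤ ‖z - q‖ := by
  obtain ⟨hs, hneg, -, hd⟩ := hρ
  have hdiff : Differentiable ℝ ρ := hs.differentiable (by simp)
  obtain ⟨v, hv1, hv⟩ : ∃ v : Fin n → ℂ, ‖v‖ ≤ 1 ∧ 0 < fderiv ℝ ρ q v := by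
    obtain ⟨v, hv⟩ : ∃ v, fderiv ℝ ρ q v ≠ 0 := by
      by_contra! h
      exact hd q hq (ContinuousLinearMap.ext h)
    obtain ⟨v, hv⟩ : ∃ v, 0 < fderiv ℝ ρ q v := by
      rcases lt_or_gt_of_ne hv with h | h
      · exact ⟨-v, by rw [map_neg]; linarith⟩
      · exact ⟨v, h⟩
    refine ⟨(‖v‖⁻¹ : ℝ) • v, ?_, ?_⟩
    · rw [norm_smul, norm_inv, norm_norm]
      exact inv_mul_le_one
    · have hv0 : v ≠ 0 := by rintro rfl; simp at hv
      rw [map_smul, smul_eq_mul]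
      have := norm_pos_iff.2 hv0
      positivity
  have hcont : Continuous fun w => fderiv ℝ ρ w v :=
    (hs.continuous_fderiv (by simp)).clm_apply continuous_const
  obtain ⟨ε, hε, hball⟩ := Metric.eventually_nhds_iff_ball.1
    (hcont.continuousAt.eventually (lt_mem_nhds (half_lt_self hv)))
  set c := fderiv ℝ ρ q v / 2 with hc
  have hc0 : 0 < c := by positivity
  refine ⟨c, hc0, ?_⟩
  filter_upwards [Metric.ball_mem_nhds q (half_pos hε)] with z hz hzΩ
  have hcf : IsCompact (frontier Ω) :=
    Metric.isCompact_of_isClosed_isBounded isClosed_frontier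
      (hb.closure.subset frontier_subset_closure)
  obtain ⟨q', hq', hdist⟩ := hcf.exists_infDist_eq_dist ⟨q, hq⟩ z
  have hle : dist z q' ≤ dist z q := hdist ▸ Metric.infDist_le_dist_of_mem hq
  refine ⟨q', hq', ?_, by rwa [← dist_eq_norm, ← dist_eq_norm]⟩
  rw [← dist_eq_norm]
  have hin : Metric.ball z (dist z q') ⊆ Ω := by
    refine fun x hx => ((convex_ball z (dist z q')).isPreconnected.subset_left_of_subset_union hΩ
      (isClosed_closure (s := Ω)).isOpen_compl ?_ ?_ ?_) hx
    · exact Set.disjoint_left.2 fun y hy hy' => hy' (subset_closure hy)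
    · intro y hy
      by_cases hyΩ : y ∈ Ω
      · exact Or.inl hyΩ
      · refine Or.inr fun hyc => ?_
        have hyf : y ∈ frontier Ω := ⟨hyc, by rwa [hΩ.interior_eq]⟩
        have := Metric.infDist_le_dist_of_mem (x := z) hyf
        rw [hdist] at this
        rw [Metric.mem_ball, dist_comm] at hy
        linarith
    · exact ⟨z, Metric.mem_ball_self (dist_nonneg.trans_lt hx), hzΩ⟩
  have hsub : ∀ t ∈ Ico 0 (dist z q'), c * t ≤ -ρ z := by
    intro t ht
    have hmem : ∀ s ∈ Icc (0:ℝ) t, z + s • v ∈ Metric.ball z (dist z q') := by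
      intro s hs
      rw [mem_ball_iff_norm, add_sub_cancel_left, norm_smul, Real.norm_of_nonneg hs.1]
      nlinarith [hs.1, hs.2, ht.2, norm_nonneg v]
    have hder : ∀ s, HasDerivAt (fun s : ℝ => ρ (z + s • v)) (fderiv ℝ ρ (z + s • v) v) s := by
      intro s
      have h1 : HasDerivAt (fun s : ℝ => z + s • v) v s := by
        simpa using ((hasDerivAt_id s).smul_const v).const_add z
      exact (hdiff _).hasFDerivAt.comp_hasDerivAt s h1
    have := (convex_Icc (0:ℝ) t).mul_sub_le_image_sub_of_le_deriv (C := c)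
      (fun s _ => (hder s).continuousAt.continuousWithinAt)
      (fun s _ => (hder s).differentiableAt.differentiableWithinAt)
      (fun s hs => by
        rw [(hder s).deriv]
        refine (hball _ ?_).le
        have h2 := hmem s (interior_subset hs)
        rw [Metric.mem_ball] at h2 hz ⊢
        have := dist_triangle (z + s • v) z q
        linarith) 0 ⟨le_rfl, ht.1⟩ t ⟨ht.1, le_rfl⟩ ht.1
    have h3 := hneg _ (hin (hmem t ⟨ht.1, le_rfl⟩))
    simp only [sub_zero, zero_smul, add_zero] at this
    linarith
  by_contra! hlt
  have hρz := hneg z hzΩ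
  have h0 : 0 ≤ -ρ z / c := by have : 0 < -ρ z := by linarith
                               positivity
  have h1 : -ρ z / c < dist z q' := by rw [div_lt_iff₀ hc0]; linarith
  have h2 := hsub ((-ρ z / c + dist z q') / 2) ⟨by positivity, by linarith⟩
  have h3 : -ρ z < c * ((-ρ z / c + dist z q') / 2) := by
    have : c * (-ρ z / c) = -ρ z := by field_simp
    nlinarith
  linarith

theorem norm_sq_le_sum_norm_sq (X : Fin n → ℂ) : ‖X‖ ^ 2 ≤ ∑ j, ‖X j‖ ^ 2 := by
  have h : ‖X‖ ≤ √(∑ j, ‖X j‖ ^ 2) := by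
    refine (pi_norm_le_iff_of_nonneg (Real.sqrt_nonneg _)).2 fun j => Real.le_sqrt_of_sq_le ?_
    exact Finset.single_le_sum (f := fun j => ‖X j‖ ^ 2) (fun _ _ => by positivity)
      (Finset.mem_univ j)
  calc ‖X‖ ^ 2 ≤ (√(∑ j, ‖X j‖ ^ 2)) ^ 2 := by gcongr
    _ = _ := Real.sq_sqrt (Finset.sum_nonneg fun _ _ => by positivity)

theorem contDiff_cHess {ρ : (Fin n → ℂ) → ℝ} (hρ : ContDiff ℝ ∞ ρ) : ContDiff ℝ ∞ (cHess n ρ) := by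
  have h := (contDiffOn_univ.2 hρ).ofReal_complex
  refine contDiff_pi.2 fun j => contDiff_pi.2 fun k => contDiffOn_univ.1 ?_
  exact (h.wder isOpen_univ j).wderBar isOpen_univ k

theorem contDiff_dzCoef {ρ : (Fin n → ℂ) → ℝ} (hρ : ContDiff ℝ ∞ ρ) : ContDiff ℝ ∞ (dzCoef n ρ) := by
  have h := (contDiffOn_univ.2 hρ).ofReal_complex
  exact contDiff_pi.2 fun j => contDiffOn_univ.1 (h.wder isOpen_univ j)

theorem dzCoef_ne_zero {ρ : (Fin n → ℂ) → ℝ} {q : Fin n → ℂ} (hd : DifferentiableAt ℝ ρ q)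
    (h : fderiv ℝ ρ q ≠ 0) : dzCoef n ρ q ≠ 0 := by
  intro h0
  refine h (ContinuousLinearMap.ext fun v => ?_)
  have h1 : ∀ j, wder n j (fun v => (ρ v : ℂ)) q = 0 := fun j => congrFun h0 j
  have h2 : ∀ j, wderBar n j (fun v => (ρ v : ℂ)) q = 0 := fun j => by
    rw [← conj_wder_ofReal, h1, map_zero]
  have h3 := fderiv_apply_of_wder (u := fun v => (ρ v : ℂ)) (z := q) v
  rw [fderiv_ofReal_apply hd] at h3
  simp only [h1, h2, mul_zero, add_zero, Finset.sum_const_zero] at h3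
  exact_mod_cast h3

end Exhaustion

section EuclideanSquare

open scoped ContDiff ComplexConjugate

variable {n : ℕ}

theorem contDiff_sum_norm_sub_sq (a : Fin n → ℂ) :
    ContDiff ℝ ∞ fun w : Fin n → ℂ => ∑ i, ‖w i - a i‖ ^ 2 :=
  ContDiff.sum fun i _ => ((contDiff_apply ℝ ℂ i).sub contDiff_const).norm_sq ℝ

theorem wder_sum_norm_sub_sq (a : Fin n → ℂ) (j : Fin n) (z : Fin n → ℂ) :
    wder n j (fun w => ((∑ i, ‖w i - a i‖ ^ 2 : ℝ) : ℂ)) z = conj (z j - a j) := by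
  have h : HasFDerivAt (fun w : Fin n → ℂ => ∑ i, ‖w i - a i‖ ^ 2)
      (∑ i, 2 • (innerSL ℝ (z i - a i)).comp
        (ContinuousLinearMap.proj (R := ℝ) (φ := fun _ : Fin n => ℂ) i)) z := by
    refine HasFDerivAt.fun_sum fun i _ => ?_
    have h1 : HasFDerivAt (fun w : Fin n → ℂ => w i - a i)
        (ContinuousLinearMap.proj (R := ℝ) (φ := fun _ : Fin n => ℂ) i) z :=
      (ContinuousLinearMap.proj (R := ℝ) (φ := fun _ : Fin n => ℂ) i).hasFDerivAt.sub_const _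
    exact h1.norm_sq
  have h2 : ∀ c : ℂ, fderiv ℝ (fun w : Fin n → ℂ => ∑ i, ‖w i - a i‖ ^ 2) z (Pi.single j c) =
      2 * (conj (z j - a j) * c).re := by
    intro c
    rw [h.fderiv]
    simp only [sum_apply, smul_apply, ContinuousLinearMap.comp_apply, ContinuousLinearMap.proj_apply]
    rw [Finset.sum_eq_single j]
    · simp [mul_comm]
      ring
    · intro i _ hi
      simp [Pi.single_eq_of_ne hi]
    · simp
  simp only [wder]
  rw [fderiv_ofReal_apply h.differentiableAt, fderiv_ofReal_apply h.differentiableAt, h2, h2]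
  apply Complex.ext <;> simp

theorem wder_apply_sub (a : Fin n → ℂ) (j k : Fin n) (z : Fin n → ℂ) :
    wder n k (fun w => w j - a j) z = if k = j then 1 else 0 := by
  have h1 : HasFDerivAt (fun w : Fin n → ℂ => w j - a j)
      (ContinuousLinearMap.proj (R := ℝ) (φ := fun _ : Fin n => ℂ) j) z :=
    (ContinuousLinearMap.proj (R := ℝ) (φ := fun _ : Fin n => ℂ) j).hasFDerivAt.sub_const _
  simp only [wder, h1.fderiv, ContinuousLinearMap.proj_apply]
  split_ifs with h
  · subst h
    simp
    norm_num
  · simp [Pi.single_eq_of_ne (Ne.symm h)]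

theorem cHess_sum_norm_sub_sq (a : Fin n → ℂ) (z : Fin n → ℂ) (j k : Fin n) :
    cHess n (fun w => ∑ i, ‖w i - a i‖ ^ 2) z j k = if k = j then 1 else 0 := by
  rw [cHess, funext (wder_sum_norm_sub_sq a j), wderBar_conj, wder_apply_sub]
  split_ifs <;> simp

theorem hermForm_cHess_sum_norm_sub_sq (a : Fin n → ℂ) (z X : Fin n → ℂ) :
    hermForm n (cHess n (fun w => ∑ i, ‖w i - a i‖ ^ 2) z) X X = ∑ j, ‖X j‖ ^ 2 := by
  simp only [hermForm, cHess_sum_norm_sub_sq]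
  simp only [ite_mul, one_mul, zero_mul, Finset.sum_ite_eq', Finset.mem_univ, if_true, mul_conj,
    re_sum, ofReal_re, Complex.normSq_eq_norm_sq]

end EuclideanSquare

section Exhaustion

open scoped ContDiff ComplexConjugate

variable {n : ℕ} {Ω : Set (Fin n → ℂ)}

theorem levi_real_aux {C c r x a h δ : ℝ} (hC : 0 ≤ C) (hc : 0 < c) (hr : 0 < r)
    (hδ : c * δ ≤ r) (h1 : -(C * (δ * x ^ 2 + a * x)) ≤ h) :
    -((C / c + C ^ 2) * x ^ 2) ≤ h / r + a ^ 2 / r ^ 2 := by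
  have h2 : δ ≤ r / c := by rwa [le_div_iff₀ hc, mul_comm]
  have h3 : -(C * (r / c * x ^ 2 + a * x)) ≤ h := by
    refine le_trans ?_ h1
    have : C * (δ * x ^ 2) ≤ C * (r / c * x ^ 2) := by gcongr
    linarith
  have h4 : -(C * (r / c * x ^ 2 + a * x)) / r ≤ h / r := by gcongr
  have h5 : -(C * (r / c * x ^ 2 + a * x)) / r = -(C / c * x ^ 2) - C * (a / r) * x := by
    field_simp
    ring
  have h6 : a ^ 2 / r ^ 2 = (a / r) ^ 2 := by rw [div_pow]
  nlinarith [sq_nonneg (a / r - C * x), sq_nonneg (a / r)]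

theorem IsDefining.levi_near {ρ : (Fin n → ℂ) → ℝ} (hΩ : IsOpen Ω)
    (hb : Bornology.IsBounded Ω) (hρ : IsDefining n Ω ρ)
    (hpsc : ∀ q ∈ frontier Ω, LeviPSDAt n ρ q) {q : Fin n → ℂ} (hq : q ∈ frontier Ω) :
    ∃ C : ℝ, ∀ᶠ z in 𝓝 q, z ∈ Ω → ∀ X : Fin n → ℂ,
      -(C * ‖X‖ ^ 2) ≤ hermForm n (cHess n ρ z) X X / (-ρ z) +
        ‖∑ j, dzCoef n ρ z j * X j‖ ^ 2 / (-ρ z) ^ 2 := by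
  obtain ⟨c, hc, hnear⟩ := hρ.exists_frontier_near hΩ hb hq
  have hs := hρ.1
  obtain ⟨K₁, t₁, ht₁, hK₁⟩ := (((contDiff_cHess hs).of_le
    (m := 1) (by exact_mod_cast le_top)).contDiffAt (x := q)).exists_lipschitzOnWith
  obtain ⟨K₂, t₂, ht₂, hK₂⟩ := (((contDiff_dzCoef hs).of_le
    (m := 1) (by exact_mod_cast le_top)).contDiffAt (x := q)).exists_lipschitzOnWith
  obtain ⟨Y, hY⟩ : ∃ Y : Fin n → ℂ, ∑ j, dzCoef n ρ q j * Y j = 1 := by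
    obtain ⟨j, hj⟩ := Function.ne_iff.1
      (dzCoef_ne_zero (hs.differentiable (by simp) q) (hρ.2.2.2 q hq))
    refine ⟨Pi.single j (dzCoef n ρ q j)⁻¹, ?_⟩
    rw [Finset.sum_eq_single j]
    · rw [Pi.single_eq_same]; exact mul_inv_cancel₀ hj
    · intro i _ hi; simp [Pi.single_eq_of_ne hi]
    · simp
  have c1 : Continuous fun w => ‖cHess n ρ w‖ := (contDiff_cHess hs).continuous.norm
  have c2 : Continuous fun w => ‖dzCoef n ρ w‖ := (contDiff_dzCoef hs).continuous.norm
  have c3 : Continuous fun w => ‖∑ j, dzCoef n ρ w j * Y j‖ :=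
    (continuous_finsetSum _ fun j _ =>
      ((continuous_apply j).comp (contDiff_dzCoef hs).continuous).mul continuous_const).norm
  have e1 := c1.continuousAt.eventually (gt_mem_nhds (lt_add_one ‖cHess n ρ q‖))
  have e2 := c2.continuousAt.eventually (gt_mem_nhds (lt_add_one ‖dzCoef n ρ q‖))
  have e3 := c3.continuousAt.eventually (lt_mem_nhds (a := 1 / 2) (b := ‖∑ j, dzCoef n ρ q j * Y j‖)
    (by rw [hY]; norm_num))
  obtain ⟨ε, hε, hball⟩ := Metric.eventually_nhds_iff_ball.1
    ((((e1.and e2).and e3).and ht₁).and ht₂)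
  set M := (‖cHess n ρ q‖ + 1) + (‖dzCoef n ρ q‖ + 1) + ‖Y‖
  obtain ⟨C, hC, hmain⟩ := hermForm_ge_of_near n (K₁ + K₂) M (by positivity) (by positivity)
  refine ⟨C / c + C ^ 2, ?_⟩
  filter_upwards [hnear, Metric.ball_mem_nhds q (half_pos hε)] with z hz hzb hzΩ X
  obtain ⟨q', hq', hd1, hd2⟩ := hz hzΩ
  have hzb' : z ∈ Metric.ball q ε := Metric.ball_subset_ball (by linarith) hzb
  have hqb' : q' ∈ Metric.ball q ε := by
    rw [mem_ball_iff_norm] at hzb ⊢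
    have : q' - q = (z - q) - (z - q') := by abel
    rw [this]
    linarith [norm_sub_le (z - q) (z - q')]
  obtain ⟨⟨⟨⟨a1, a2⟩, a3⟩, a4⟩, a5⟩ := hball q' hqb'
  obtain ⟨⟨-, b4⟩, b5⟩ := hball z hzb'
  have hYn := norm_nonneg Y
  have hp1 := norm_nonneg (cHess n ρ q)
  have hp2 := norm_nonneg (dzCoef n ρ q)
  refine levi_real_aux (δ := ‖z - q'‖) hC hc (by linarith [hρ.2.1 z hzΩ]) hd1
    (hmain _ (cHess n ρ q') _ (dzCoef n ρ q') Y ‖z - q'‖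
    (norm_nonneg _) ?_ ?_ ?_ ?_ ?_ a3.le ?_ X)
  · refine (hK₁.norm_sub_le b4 a4).trans ?_
    gcongr
    exact le_add_of_nonneg_right K₂.2
  · refine (hK₂.norm_sub_le b5 a5).trans ?_
    gcongr
    exact le_add_of_nonneg_left K₁.2
  · simp only [M]; linarith
  · simp only [M]; linarith
  · simp only [M]; linarith
  · intro X hX
    refine hpsc q' hq' X ?_
    rw [cTangent, LinearMap.mem_ker, cTangentMap]
    simpa [LinearMap.sum_apply] using hX

theorem contDiffOn_neg_log_neg : ContDiffOn ℝ ∞ (fun t : ℝ => -Real.log (-t)) (Iio 0) := by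
  intro t ht
  have : -t ≠ 0 := by simpa using (ne_of_lt ht)
  exact ((contDiff_neg.contDiffAt).log this).neg.contDiffWithinAt

theorem hermForm_cHess_neg_log_neg {ρ : (Fin n → ℂ) → ℝ} (hΩ : IsOpen Ω) (hs : ContDiff ℝ ∞ ρ)
    (hneg : ∀ z ∈ Ω, ρ z < 0) {z : Fin n → ℂ} (hz : z ∈ Ω) (X : Fin n → ℂ) :
    hermForm n (cHess n (fun w => -Real.log (-ρ w)) z) X X =
      hermForm n (cHess n ρ z) X X / (-ρ z) +
        ‖∑ j, dzCoef n ρ z j * X j‖ ^ 2 / (-ρ z) ^ 2 := by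
  have hd : ∀ t : ℝ, t < 0 → HasDerivAt (fun t : ℝ => -Real.log (-t)) (-t⁻¹) t := by
    intro t ht
    have := ((hasDerivAt_neg t).log (by simpa using ht.ne)).fun_neg
    rwa [neg_div_neg_eq, one_div] at this
  have hd2 : deriv (deriv fun t : ℝ => -Real.log (-t)) (ρ z) = ((ρ z) ^ 2)⁻¹ := by
    have : deriv (fun t : ℝ => -Real.log (-t)) =ᶠ[𝓝 (ρ z)] fun t => -t⁻¹ := by
      filter_upwards [Iio_mem_nhds (hneg z hz)] with t ht using (hd t ht).deriv
    rw [this.deriv_eq, ((hasDerivAt_inv (hneg z hz).ne).fun_neg).deriv, neg_neg]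
  rw [hermForm_cHess_comp hΩ hs.contDiffOn isOpen_Iio contDiffOn_neg_log_neg hneg hz,
    hd2, (hd _ (hneg z hz)).deriv]
  simp only [dzCoef, div_eq_mul_inv, neg_sq, neg_inv]
  ring

theorem IsDefining.exists_levi_bound {ρ : (Fin n → ℂ) → ℝ} (hΩ : IsOpen Ω)
    (hb : Bornology.IsBounded Ω) (hρ : IsDefining n Ω ρ)
    (hpsc : ∀ q ∈ frontier Ω, LeviPSDAt n ρ q) :
    ∃ C : ℝ, ∀ z ∈ Ω, ∀ X : Fin n → ℂ, -(C * ‖X‖ ^ 2) ≤ hermForm n (cHess n ρ z) X X / (-ρ z) +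
        ‖∑ j, dzCoef n ρ z j * X j‖ ^ 2 / (-ρ z) ^ 2 := by
  have hs := hρ.1
  suffices h : ∃ C : ℝ, ∀ z ∈ closure Ω, z ∈ Ω → ∀ X : Fin n → ℂ,
      -(C * ‖X‖ ^ 2) ≤ hermForm n (cHess n ρ z) X X / (-ρ z) +
        ‖∑ j, dzCoef n ρ z j * X j‖ ^ 2 / (-ρ z) ^ 2 by
    obtain ⟨C, hC⟩ := h
    exact ⟨C, fun z hz => hC z (subset_closure hz) hz⟩
  refine IsCompact.induction_on (p := fun S => ∃ C : ℝ, ∀ z ∈ S, z ∈ Ω → ∀ X : Fin n → ℂ,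
      -(C * ‖X‖ ^ 2) ≤ hermForm n (cHess n ρ z) X X / (-ρ z) +
        ‖∑ j, dzCoef n ρ z j * X j‖ ^ 2 / (-ρ z) ^ 2) hb.isCompact_closure ⟨0, by simp⟩ ?_ ?_ ?_
  · rintro s t hst ⟨C, hC⟩
    exact ⟨C, fun z hz => hC z (hst hz)⟩
  · rintro s t ⟨C, hC⟩ ⟨C', hC'⟩
    refine ⟨max C C', fun z hz hzΩ X => ?_⟩
    rcases hz with hz | hz
    · refine le_trans ?_ (hC z hz hzΩ X)
      have : C * ‖X‖ ^ 2 ≤ max C C' * ‖X‖ ^ 2 := by gcongr; exact le_max_left _ _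
      linarith
    · refine le_trans ?_ (hC' z hz hzΩ X)
      have : C' * ‖X‖ ^ 2 ≤ max C C' * ‖X‖ ^ 2 := by gcongr; exact le_max_right _ _
      linarith
  · intro q hq
    by_cases hqΩ : q ∈ Ω
    · have hρq := hρ.2.1 q hqΩ
      have cont : ContinuousAt (fun w => n ^ 2 * ‖cHess n ρ w‖ / (-ρ w)) q := by
        refine ContinuousAt.div ?_ hs.continuous.neg.continuousAt (by linarith)
        exact (continuous_const.mul (contDiff_cHess hs).continuous.norm).continuousAt
      set C := n ^ 2 * ‖cHess n ρ q‖ / (-ρ q) + 1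
      have hev := cont.eventually (gt_mem_nhds (lt_add_one _))
      refine ⟨_, mem_nhdsWithin_of_mem_nhds hev, C, fun z hz hzΩ X => ?_⟩
      have hz' : n ^ 2 * ‖cHess n ρ z‖ / (-ρ z) < C := hz
      have hr : 0 < -ρ z := by linarith [hρ.2.1 z hzΩ]
      have h1 : -(n ^ 2 * ‖cHess n ρ z‖ * ‖X‖ * ‖X‖) / (-ρ z) ≤
          hermForm n (cHess n ρ z) X X / (-ρ z) := by
        gcongr
        exact (abs_le.1 (abs_hermForm_le _ _ _)).1
      have h2 : -(n ^ 2 * ‖cHess n ρ z‖ * ‖X‖ * ‖X‖) / (-ρ z) =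
          -(n ^ 2 * ‖cHess n ρ z‖ / (-ρ z) * ‖X‖ ^ 2) := by ring
      have h3 : n ^ 2 * ‖cHess n ρ z‖ / (-ρ z) * ‖X‖ ^ 2 ≤ C * ‖X‖ ^ 2 := by gcongr
      have h4 : 0 ≤ ‖∑ j, dzCoef n ρ z j * X j‖ ^ 2 / (-ρ z) ^ 2 := by positivity
      linarith
    · obtain ⟨C, hC⟩ := hρ.levi_near hΩ hb hpsc (q := q) ⟨hq, by rwa [hΩ.interior_eq]⟩
      exact ⟨_, mem_nhdsWithin_of_mem_nhds hC, C, fun z hz => hz⟩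

end Exhaustion

section ExhaustionFunction

open scoped ContDiff ComplexConjugate

variable {n : ℕ} {Ω : Set (Fin n → ℂ)}

theorem sum_norm_sq_le (X : Fin n → ℂ) : ∑ j, ‖X j‖ ^ 2 ≤ n * ‖X‖ ^ 2 := by
  refine (Finset.sum_le_card_nsmul _ _ (‖X‖ ^ 2) fun j _ => ?_).trans (by simp)
  gcongr
  exact norm_le_pi_norm X j

theorem IsDefining.exists_exhaustion {ρ : (Fin n → ℂ) → ℝ} (hΩ : IsOpen Ω)
    (hb : Bornology.IsBounded Ω) (hρ : IsDefining n Ω ρ)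
    (hpsc : ∀ q ∈ frontier Ω, LeviPSDAt n ρ q) :
    ∃ (P : (Fin n → ℂ) → ℝ) (A c : ℝ), ContDiffOn ℝ ∞ P Ω ∧ (∀ z ∈ Ω, 0 ≤ P z) ∧
      (∀ c : ℝ, IsCompact {z | z ∈ Ω ∧ P z ≤ c}) ∧
      (∀ z ∈ Ω, ∀ j, ‖wder n j (fun v => (P v : ℂ)) z‖ ≤ A * P z ^ 2) ∧ 0 < c ∧
      ∀ z ∈ Ω, ∀ X : Fin n → ℂ,
        c * P z ^ 5 * ∑ j, ‖X j‖ ^ 2 ≤ hermForm n (cHess n (fun w => P w ^ 5) z) X X := by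
  obtain ⟨C₀, hC₀⟩ := hρ.exists_levi_bound hΩ hb hpsc
  obtain ⟨hs, hneg, hzero, -⟩ := hρ
  set C := |C₀| + 1 with hC
  have hCpos : 0 < C := by positivity
  set Q : (Fin n → ℂ) → ℝ := fun w => ∑ i, ‖w i - (0 : Fin n → ℂ) i‖ ^ 2 with hQdef
  have hQ : ContDiff ℝ ∞ Q := contDiff_sum_norm_sub_sq 0
  have hQ0 : ∀ w, 0 ≤ Q w := fun w => Finset.sum_nonneg fun _ _ => by positivity
  set ψ₀ : (Fin n → ℂ) → ℝ := fun w => -Real.log (-ρ w) with hψ₀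
  have hψ₀s : ContDiffOn ℝ ∞ ψ₀ Ω := contDiffOn_neg_log_neg.comp hs.contDiffOn hneg
  set ψ : (Fin n → ℂ) → ℝ := fun w => ψ₀ w + C * Q w with hψ
  have hψs : ContDiffOn ℝ ∞ ψ Ω := hψ₀s.add (contDiffOn_const.mul hQ.contDiffOn)
  have hPval : ∀ z ∈ Ω, Real.exp (ψ z) = (-ρ z)⁻¹ * Real.exp (C * Q z) := by
    intro z hz
    rw [hψ, Real.exp_add, hψ₀, Real.exp_neg, Real.exp_log (by linarith [hneg z hz])]
  have hLψ : ∀ z ∈ Ω, ∀ X : Fin n → ℂ, ∑ j, ‖X j‖ ^ 2 ≤ hermForm n (cHess n ψ z) X X := by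
    intro z hz X
    rw [hψ, hermForm_cHess_add_const_mul hΩ hψ₀s hQ.contDiffOn C hz, hQdef,
      hermForm_cHess_sum_norm_sub_sq, hψ₀, hermForm_cHess_neg_log_neg hΩ hs hneg hz]
    have h1 := hC₀ z hz X
    have h2 : C₀ * ‖X‖ ^ 2 ≤ |C₀| * ∑ j, ‖X j‖ ^ 2 :=
      mul_le_mul (le_abs_self _) (norm_sq_le_sum_norm_sq X) (by positivity) (abs_nonneg _)
    rw [hC]
    linarith
  obtain ⟨M, hM⟩ := hb.isCompact_closure.exists_bound_of_continuousOn
    (f := fun z => ‖dzCoef n ρ z‖ + C * ‖z‖ * (-ρ z)) (by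
      have h1 := (contDiff_dzCoef hs).continuous
      have h2 := hs.continuous
      fun_prop)
  refine ⟨fun w => Real.exp (ψ w), M, 5, hψs.exp, fun z _ => (Real.exp_pos _).le, ?_, ?_,
    by norm_num, ?_⟩
  · intro c
    have heq : {z | z ∈ Ω ∧ Real.exp (ψ z) ≤ c} =
        closure Ω ∩ {z | Real.exp (C * Q z) ≤ c * (-ρ z)} := by
      ext z
      constructor
      · rintro ⟨hz, hle⟩
        refine ⟨subset_closure hz, ?_⟩
        have hr : 0 < -ρ z := by linarith [hneg z hz]
        rw [hPval z hz, inv_mul_le_iff₀ hr] at hle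
        rw [mem_ofPred_eq]
        linarith
      · rintro ⟨hz, hle⟩
        rw [mem_ofPred_eq] at hle
        have hzΩ : z ∈ Ω := by
          by_contra hzΩ
          rw [hzero z ⟨hz, by rwa [hΩ.interior_eq]⟩] at hle
          have := Real.exp_pos (C * Q z)
          linarith
        have hr : 0 < -ρ z := by linarith [hneg z hzΩ]
        refine ⟨hzΩ, ?_⟩
        rw [hPval z hzΩ, inv_mul_le_iff₀ hr]
        linarith
    rw [heq]
    refine hb.isCompact_closure.inter_right (isClosed_le ?_ ?_)
    · exact Real.continuous_exp.comp (continuous_const.mul hQ.continuous)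
    · exact continuous_const.mul hs.continuous.neg
  · intro z hz j
    have hr : 0 < -ρ z := by linarith [hneg z hz]
    have hψd := hψs.differentiableAt_of_isOpen hΩ hz
    have h1 : wder n j (fun v => ((ψ v : ℝ) : ℂ)) z =
        ((-ρ z)⁻¹ : ℝ) * dzCoef n ρ z j + C * conj (z j) := by
      have e : (fun v => ((ψ v : ℝ) : ℂ)) =
          fun v => ((ψ₀ v : ℝ) : ℂ) + ((C : ℝ) : ℂ) * ((Q v : ℝ) : ℂ) := by
        funext v; simp [hψ]
      have hd : HasDerivAt (fun t : ℝ => -Real.log (-t)) (-(ρ z)⁻¹) (ρ z) := by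
        have := ((hasDerivAt_neg (ρ z)).log (by simpa using (hneg z hz).ne)).fun_neg
        rwa [neg_div_neg_eq, one_div] at this
      have hQc : DifferentiableAt ℝ (fun v => ((Q v : ℝ) : ℂ)) z :=
        (hQ.contDiffOn (s := Ω)).ofReal_complex.differentiableAt_of_isOpen hΩ hz
      rw [e, wder_add (hψ₀s.ofReal_complex.differentiableAt_of_isOpen hΩ hz)
        ((differentiableAt_const _).fun_mul hQc), wder_mul (differentiableAt_const _) hQc,
        hψ₀, wder_comp_real (g := fun t : ℝ => -Real.log (-t)) hd.differentiableAt
          (hs.differentiable (by simp) z), hd.deriv, hQdef, wder_sum_norm_sub_sq]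
      have : wder n j (fun _ => ((C : ℝ) : ℂ)) z = 0 := by simp [wder]
      rw [this]
      simp [dzCoef, inv_neg]
    rw [wder_comp_real Real.differentiableAt_exp hψd, Real.deriv_exp, h1, norm_mul, norm_real,
      Real.norm_of_nonneg (Real.exp_pos _).le]
    have h2 : ‖(((-ρ z)⁻¹ : ℝ) : ℂ) * dzCoef n ρ z j + C * conj (z j)‖ ≤ (-ρ z)⁻¹ * M := by
      refine (norm_add_le _ _).trans ?_
      rw [norm_mul, norm_mul, norm_real, norm_real, RCLike.norm_conj, Real.norm_of_nonneg
        (inv_nonneg.2 hr.le), Real.norm_of_nonneg hCpos.le]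
      have h3 := (le_abs_self _).trans (hM z (subset_closure hz))
      have h4 : C * ‖z j‖ = (-ρ z)⁻¹ * (C * ‖z j‖ * (-ρ z)) := by
        rw [mul_comm (-ρ z)⁻¹, mul_assoc, mul_inv_cancel₀ hr.ne', mul_one]
      rw [h4, ← mul_add]
      refine mul_le_mul_of_nonneg_left (le_trans ?_ h3) (inv_nonneg.2 hr.le)
      gcongr
      · exact norm_le_pi_norm (dzCoef n ρ z) j
      · exact norm_le_pi_norm z j
    have h5 : (-ρ z)⁻¹ ≤ Real.exp (ψ z) := by
      rw [hPval z hz]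
      refine le_mul_of_one_le_right (inv_nonneg.2 hr.le) (Real.one_le_exp ?_)
      exact mul_nonneg hCpos.le (hQ0 z)
    have hM0 : 0 ≤ M := (norm_nonneg _).trans (hM z (subset_closure hz))
    calc _ ≤ Real.exp (ψ z) * ((-ρ z)⁻¹ * M) := by gcongr
      _ ≤ Real.exp (ψ z) * (Real.exp (ψ z) * M) := by gcongr
      _ = _ := by ring
  · intro z hz X
    have e : (fun w => Real.exp (ψ w) ^ 5) = fun w => (fun t : ℝ => Real.exp (5 * t)) (ψ w) := by
      funext w
      rw [← Real.exp_nat_mul]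
      norm_num
    have hd : ∀ t : ℝ, deriv (fun t : ℝ => Real.exp (5 * t)) t = 5 * Real.exp (5 * t) := by
      intro t
      have h := ((hasDerivAt_id t).const_mul (5:ℝ)).exp
      simp only [mul_one, id] at h
      rw [h.deriv, mul_comm]
    have hd2 : ∀ t : ℝ, deriv (deriv fun t : ℝ => Real.exp (5 * t)) t = 25 * Real.exp (5 * t) := by
      intro t
      have h := (((hasDerivAt_id t).const_mul (5:ℝ)).exp).const_mul (5:ℝ)
      simp only [mul_one, id] at h
      rw [funext hd, h.deriv]
      ring
    rw [e, hermForm_cHess_comp hΩ hψs isOpen_univ (g := fun t : ℝ => Real.exp (5 * t))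
      ((contDiff_const.mul contDiff_id).exp.contDiffOn) (mapsTo_univ _ _) hz, hd, hd2]
    have h1 := hLψ z hz X
    have h2 : Real.exp (ψ z) ^ 5 = Real.exp (5 * ψ z) := by rw [← Real.exp_nat_mul]; norm_num
    have h3 : 0 ≤ 25 * Real.exp (5 * ψ z) * ‖∑ j, wder n j (fun v => (ψ v : ℂ)) z * X j‖ ^ 2 := by
      positivity
    have h4 := mul_le_mul_of_nonneg_left h1 (by positivity : 0 ≤ 5 * Real.exp (5 * ψ z))
    beta_reduce
    rw [h2]
    linarith

end ExhaustionFunction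

section MeanValue

variable {n : ℕ}

/-- The modulus of the real Jacobian determinant of a complex linear automorphism of `ℂⁿ`. -/
noncomputable def realJac (n : ℕ) (T : (Fin n → ℂ) ≃L[ℂ] (Fin n → ℂ)) : ℝ :=
  |((T : (Fin n → ℂ) →L[ℂ] (Fin n → ℂ)).restrictScalars ℝ).det|

theorem realJac_pos (T : (Fin n → ℂ) ≃L[ℂ] (Fin n → ℂ)) : 0 < realJac n T := by
  refine abs_pos.2 ?_
  exact ((T.toLinearEquiv.restrictScalars ℝ).isUnit_det').ne_zero

theorem lintegral_affine_image (T : (Fin n → ℂ) ≃L[ℂ] (Fin n → ℂ)) (z : Fin n → ℂ)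
    {s : Set (Fin n → ℂ)} (hs : MeasurableSet s) (g : (Fin n → ℂ) → ENNReal) :
    ∫⁻ y in (fun x => z + T x) '' s, g y =
      ENNReal.ofReal (realJac n T) * ∫⁻ x in s, g (z + T x) := by
  rw [lintegral_image_eq_lintegral_abs_det_fderiv_mul volume hs
    (f' := fun _ => (T : (Fin n → ℂ) →L[ℂ] (Fin n → ℂ)).restrictScalars ℝ)]
  · rw [← lintegral_const_mul' _ _ ENNReal.ofReal_ne_top]
    rfl
  · intro x _
    have : HasFDerivAt (fun x => z + T x)
        ((T : (Fin n → ℂ) →L[ℂ] (Fin n → ℂ)).restrictScalars ℝ) x :=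
      (((T : (Fin n → ℂ) →L[ℂ] (Fin n → ℂ)).restrictScalars ℝ).hasFDerivAt).const_add z
    exact this.hasFDerivWithinAt
  · intro x _ y _ h
    exact T.injective (add_left_cancel h)

theorem integrableOn_affine_image (T : (Fin n → ℂ) ≃L[ℂ] (Fin n → ℂ)) (z : Fin n → ℂ)
    {s : Set (Fin n → ℂ)} (hs : MeasurableSet s) (g : (Fin n → ℂ) → ℝ) :
    IntegrableOn g ((fun x => z + T x) '' s) ↔ IntegrableOn (fun x => g (z + T x)) s := by
  have h1 : ∀ x ∈ s, HasFDerivWithinAt (fun x => z + T x)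
      ((T : (Fin n → ℂ) →L[ℂ] (Fin n → ℂ)).restrictScalars ℝ) s x := fun x _ =>
    ((((T : (Fin n → ℂ) →L[ℂ] (Fin n → ℂ)).restrictScalars ℝ).hasFDerivAt).const_add
      z).hasFDerivWithinAt
  rw [integrableOn_image_iff_integrableOn_abs_det_fderiv_smul volume hs h1
    (fun x _ y _ h => T.injective (add_left_cancel h))]
  have h0 : |((T : (Fin n → ℂ) →L[ℂ] (Fin n → ℂ)).restrictScalars ℝ).det| ≠ 0 :=
    (realJac_pos T).ne'
  exact integrable_smul_iff h0 _

theorem integral_affine_image (T : (Fin n → ℂ) ≃L[ℂ] (Fin n → ℂ)) (z : Fin n → ℂ)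
    {s : Set (Fin n → ℂ)} (hs : MeasurableSet s) (g : (Fin n → ℂ) → ℝ) :
    ∫ y in (fun x => z + T x) '' s, g y = realJac n T * ∫ x in s, g (z + T x) := by
  have h1 : ∀ x ∈ s, HasFDerivWithinAt (fun x => z + T x)
      ((T : (Fin n → ℂ) →L[ℂ] (Fin n → ℂ)).restrictScalars ℝ) s x := fun x _ =>
    ((((T : (Fin n → ℂ) →L[ℂ] (Fin n → ℂ)).restrictScalars ℝ).hasFDerivAt).const_add
      z).hasFDerivWithinAt
  rw [integral_image_eq_integral_abs_det_fderiv_smul volume hs h1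
    (fun x _ y _ h => T.injective (add_left_cancel h)), ← integral_const_mul]
  rfl

/-- The sub-mean value inequality on affine images of the unit polydisc. -/
theorem exists_sq_mul_jac_le (n : ℕ) :
    ∃ C > (0:ℝ), ∀ (T : (Fin n → ℂ) ≃L[ℂ] (Fin n → ℂ)) (z : Fin n → ℂ) (S : Set (Fin n → ℂ))
      (f : (Fin n → ℂ) → ℂ), (fun x => z + T x) '' Metric.ball 0 1 ⊆ S → MeasurableSet S →
      DifferentiableOn ℂ f S → IntegrableOn (fun y => ‖f y‖ ^ 2) S →
      ‖f z‖ ^ 2 * realJac n T ≤ C * ∫ y in S, ‖f y‖ ^ 2 := by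
  obtain ⟨C, hC, h⟩ := exists_enorm_sq_le_lintegral n one_pos
  refine ⟨C, hC, fun T z S f hS hSm hf hInt => ?_⟩
  have hmaps : MapsTo (fun x => z + T x) (Metric.ball 0 1) S := fun x hx => hS ⟨x, hx, rfl⟩
  have hg := h (fun x => f (z + T x)) 0 (hf.comp
    ((T : (Fin n → ℂ) →L[ℂ] (Fin n → ℂ)).differentiable.const_add z).differentiableOn hmaps)
  have h2 : ∫⁻ x in Metric.ball 0 1, ‖f (z + T x)‖ₑ ^ 2 * ENNReal.ofReal (realJac n T) ≤
      ∫⁻ y in S, ‖f y‖ₑ ^ 2 := by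
    rw [lintegral_mul_const' _ _ ENNReal.ofReal_ne_top, mul_comm,
      ← lintegral_affine_image T z measurableSet_ball (fun y => ‖f y‖ₑ ^ 2)]
    exact lintegral_mono_set hS
  have h3 : ‖f z‖ₑ ^ 2 * ENNReal.ofReal (realJac n T) ≤
      ENNReal.ofReal C * ∫⁻ y in S, ‖f y‖ₑ ^ 2 := by
    have h4 : ‖f z‖ₑ ^ 2 ≤ ENNReal.ofReal C *
        ∫⁻ x in Metric.ball 0 1, ‖f (z + T x)‖ₑ ^ 2 := by simpa using hg
    calc _ ≤ ENNReal.ofReal C * (∫⁻ x in Metric.ball 0 1, ‖f (z + T x)‖ₑ ^ 2) *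
          ENNReal.ofReal (realJac n T) := by gcongr
      _ ≤ _ := by
        rw [mul_assoc, ← lintegral_mul_const' _ _ ENNReal.ofReal_ne_top]
        gcongr
  have h5 : ∀ y, ‖f y‖ₑ ^ 2 = ENNReal.ofReal (‖f y‖ ^ 2) := fun y => by
    rw [ENNReal.ofReal_pow (norm_nonneg _), ofReal_norm]
  simp only [h5] at h3
  rw [← ofReal_integral_eq_lintegral_ofReal hInt (ae_of_all _ fun y => by positivity),
    ← ENNReal.ofReal_mul (by positivity), ← ENNReal.ofReal_mul hC.le] at h3
  refine (ENNReal.ofReal_le_ofReal_iff ?_).1 h3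
  exact mul_nonneg hC.le (integral_nonneg fun y => by positivity)

/-- Multiplication by a nonzero real number as a complex linear automorphism. -/
noncomputable def scaleEquiv (n : ℕ) {δ : ℝ} (hδ : 0 < δ) : (Fin n → ℂ) ≃L[ℂ] (Fin n → ℂ) :=
  ContinuousLinearEquiv.smulLeft (Units.mk0 (δ : ℂ) (by exact_mod_cast hδ.ne'))

theorem scaleEquiv_apply {δ : ℝ} (hδ : 0 < δ) (x : Fin n → ℂ) : scaleEquiv n hδ x = (δ : ℂ) • x :=
  rfl

theorem realJac_scaleEquiv {δ : ℝ} (hδ : 0 < δ) : realJac n (scaleEquiv n hδ) = δ ^ (2 * n) := by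
  have h : (((scaleEquiv n hδ : (Fin n → ℂ) ≃L[ℂ] (Fin n → ℂ)) :
      (Fin n → ℂ) →L[ℂ] (Fin n → ℂ)).restrictScalars ℝ) =
      δ • ContinuousLinearMap.id ℝ (Fin n → ℂ) := by
    ext x j
    simp [scaleEquiv_apply]
  have h2 : (δ • ContinuousLinearMap.id ℝ (Fin n → ℂ)).det = δ ^ (2 * n) := by
    rw [ContinuousLinearMap.det, ContinuousLinearMap.toLinearMap_smul, LinearMap.det_smul]
    simp [Module.finrank_pi_fintype, Complex.finrank_real_complex, mul_comm]
  rw [realJac, h, h2, abs_of_nonneg (by positivity)]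

theorem exists_value_deriv_le (n : ℕ) :
    ∃ C > (0:ℝ), ∀ (f : (Fin n → ℂ) → ℂ) (z : Fin n → ℂ) (δ I : ℝ), 0 < δ →
      DifferentiableOn ℂ f (Metric.ball z δ) →
      IntegrableOn (fun y => ‖f y‖ ^ 2) (Metric.ball z δ) →
      ∫ y in Metric.ball z δ, ‖f y‖ ^ 2 ≤ I * δ ^ (2 * n + 4) →
      ‖f z‖ ^ 2 ≤ C * I * δ ^ 4 ∧ ‖fderiv ℂ f z‖ ^ 2 ≤ C * I * δ ^ 2 := by
  obtain ⟨C, hC, h⟩ := exists_sq_mul_jac_le n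
  refine ⟨C * 2 ^ (2 * n) * 16, by positivity, fun f z δ I hδ hf hInt hI => ?_⟩
  have hδ2 := half_pos hδ
  have hI0 : 0 ≤ I * δ ^ (2 * n + 4) :=
    (integral_nonneg fun y => by positivity).trans hI
  have hI0' : 0 ≤ I := nonneg_of_mul_nonneg_left hI0 (by positivity)
  have hval : ∀ w ∈ Metric.ball z (δ / 2), ‖f w‖ ^ 2 ≤ C * 2 ^ (2 * n) * I * δ ^ 4 := by
    intro w hw
    have h1 := h (scaleEquiv n hδ2) w (Metric.ball z δ) f (by
      rintro _ ⟨x, hx, rfl⟩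
      rw [mem_ball_zero_iff] at hx
      rw [Metric.mem_ball] at hw ⊢
      refine (dist_triangle _ w _).trans_lt ?_
      have : dist (w + scaleEquiv n hδ2 x) w < δ / 2 := by
        rw [dist_self_add_left, scaleEquiv_apply, norm_smul, norm_real,
          Real.norm_of_nonneg hδ2.le]
        exact mul_lt_of_lt_one_right hδ2 hx
      linarith) measurableSet_ball hf hInt
    rw [realJac_scaleEquiv, div_pow] at h1
    have h2 : ‖f w‖ ^ 2 * (δ ^ (2 * n) / 2 ^ (2 * n)) ≤ C * (I * δ ^ (2 * n + 4)) :=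
      h1.trans (by gcongr)
    have h3 : 0 < δ ^ (2 * n) := by positivity
    rw [mul_div_assoc', div_le_iff₀ (by positivity), pow_add] at h2
    refine le_of_mul_le_mul_right (h2.trans (le_of_eq ?_)) h3
    ring
  constructor
  · refine (hval z (Metric.mem_ball_self hδ2)).trans ?_
    have : 0 ≤ C * 2 ^ (2 * n) * I * δ ^ 4 := by positivity
    linarith
  · have h4 : ∀ w ∈ Metric.ball z (δ / 2), ‖f w‖ ≤ √(C * 2 ^ (2 * n) * I * δ ^ 4) := fun w hw =>
      Real.le_sqrt_of_sq_le (hval w hw)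
    have h5 := norm_fderiv_le_of_forall_ball hδ2
      (hf.mono (Metric.ball_subset_ball (by linarith))) h4
    calc ‖fderiv ℂ f z‖ ^ 2 ≤ (2 * √(C * 2 ^ (2 * n) * I * δ ^ 4) / (δ / 2)) ^ 2 := by gcongr
      _ = C * 2 ^ (2 * n) * 16 * I * δ ^ 2 := by
        rw [div_pow, mul_pow, Real.sq_sqrt (by positivity)]
        field_simp
        ring

end MeanValue

/-! ### Localization of the Bergman space -/

section Localization

open scoped ContDiff ENNReal ComplexConjugate

variable {n : ℕ} {Ω : Set (Fin n → ℂ)}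

/-- A strictly plurisubharmonic weight with an approximate logarithmic pole at `z`. -/
noncomputable def logWeight (n : ℕ) (z : Fin n → ℂ) (δ : ℝ) (w : Fin n → ℂ) : ℝ :=
  ∑ i, ‖w i - z i‖ ^ 2 + ((n : ℝ) + 2) * Real.log (∑ i, ‖w i - z i‖ ^ 2 + δ ^ 2)

theorem sum_norm_sub_sq_add_pos (w z : Fin n → ℂ) {δ : ℝ} (hδ : 0 < δ) :
    0 < ∑ i, ‖w i - z i‖ ^ 2 + δ ^ 2 := by positivity

theorem contDiff_logWeight (z : Fin n → ℂ) {δ : ℝ} (hδ : 0 < δ) :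
    ContDiff ℝ ∞ (logWeight n z δ) :=
  (contDiff_sum_norm_sub_sq z).add (contDiff_const.mul
    (((contDiff_sum_norm_sub_sq z).add contDiff_const).log
      fun w => (sum_norm_sub_sq_add_pos w z hδ).ne'))

theorem exp_neg_logWeight (z w : Fin n → ℂ) {δ : ℝ} (hδ : 0 < δ) :
    Real.exp (-logWeight n z δ w) = Real.exp (-∑ i, ‖w i - z i‖ ^ 2) *
      ((∑ i, ‖w i - z i‖ ^ 2 + δ ^ 2) ^ (n + 2))⁻¹ := by
  have h := sum_norm_sub_sq_add_pos w z hδ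
  rw [logWeight, neg_add, Real.exp_add, ← Real.exp_log (pow_pos h (n + 2)), ← Real.exp_neg,
    Real.log_pow]
  push_cast
  rfl

theorem hermForm_logWeight (z : Fin n → ℂ) {δ : ℝ} (hδ : 0 < δ) (w X : Fin n → ℂ) :
    ∑ j, ‖X j‖ ^ 2 ≤ hermForm n (cHess n (logWeight n z δ) w) X X := by
  set Q : (Fin n → ℂ) → ℝ := fun w => ∑ i, ‖w i - z i‖ ^ 2 with hQ
  have hQs : ContDiff ℝ ∞ Q := contDiff_sum_norm_sub_sq z
  have hQ0 : ∀ w, 0 ≤ Q w := fun w => Finset.sum_nonneg fun _ _ => by positivity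
  set S : Set ℝ := Ioi (-δ ^ 2) with hS
  have hpos : ∀ t ∈ S, 0 < t + δ ^ 2 := fun t ht => by
    have : -δ ^ 2 < t := ht
    linarith
  set g : ℝ → ℝ := fun t => Real.log (t + δ ^ 2) with hg
  have hgs : ContDiffOn ℝ ∞ g S :=
    (contDiffOn_id.add contDiffOn_const).log fun t ht => (hpos t ht).ne'
  have hm : MapsTo Q univ S := fun w _ => by
    have := hQ0 w
    have := sq_pos_of_pos hδ
    simp only [hS, mem_Ioi]; linarith
  have hd1 : ∀ t ∈ S, deriv g t = (t + δ ^ 2)⁻¹ := fun t ht => by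
    have := ((hasDerivAt_id t).add_const (δ ^ 2)).log (hpos t ht).ne'
    rw [show g = fun t => Real.log (id t + δ ^ 2) from rfl, this.deriv]; simp
  have hd2 : ∀ t ∈ S, deriv (deriv g) t = -((t + δ ^ 2) ^ 2)⁻¹ := fun t ht => by
    have h1 : deriv g =ᶠ[𝓝 t] fun t => (t + δ ^ 2)⁻¹ := by
      filter_upwards [isOpen_Ioi.mem_nhds ht] with s hs using hd1 s hs
    rw [h1.deriv_eq]
    have := ((hasDerivAt_id t).add_const (δ ^ 2)).fun_inv (hpos t ht).ne'
    rw [show (fun t => (t + δ ^ 2)⁻¹) = fun t => (id t + δ ^ 2)⁻¹ from rfl, this.deriv]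
    simp [neg_div]
  have hlog := hermForm_cHess_comp isOpen_univ hQs.contDiffOn isOpen_Ioi hgs hm (mem_univ w) X
  rw [hd1 _ (hm (mem_univ w)), hd2 _ (hm (mem_univ w)),
    hermForm_cHess_sum_norm_sub_sq z w X] at hlog
  have hCS : ‖∑ j, wder n j (fun v => (Q v : ℂ)) w * X j‖ ^ 2 ≤ Q w * ∑ j, ‖X j‖ ^ 2 := by
    have : ∀ j, wder n j (fun v => (Q v : ℂ)) w = conj (w j - z j) :=
      fun j => wder_sum_norm_sub_sq z j w
    simp only [this]
    calc _ ≤ (∑ j, ‖w j - z j‖ * ‖X j‖) ^ 2 := by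
          gcongr
          refine (norm_sum_le _ _).trans (le_of_eq ?_)
          simp only [norm_mul, RCLike.norm_conj]
      _ ≤ _ := Finset.sum_mul_sq_le_sq_mul_sq _ _ _
  have hsum := hermForm_cHess_add_const_mul isOpen_univ hQs.contDiffOn
    (hgs.comp hQs.contDiffOn hm) ((n : ℝ) + 2) (mem_univ w) X
  rw [hermForm_cHess_sum_norm_sub_sq z w X] at hsum
  have hX : 0 ≤ ∑ j, ‖X j‖ ^ 2 := Finset.sum_nonneg fun _ _ => by positivity
  have hp := hpos _ (hm (mem_univ w))
  have hnn : 0 ≤ hermForm n (cHess n (fun w => g (Q w)) w) X X := by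
    rw [hlog]
    have h2 : ((Q w + δ ^ 2) ^ 2)⁻¹ * ‖∑ j, wder n j (fun v => (Q v : ℂ)) w * X j‖ ^ 2 ≤
        (Q w + δ ^ 2)⁻¹ * ∑ j, ‖X j‖ ^ 2 := by
      calc _ ≤ ((Q w + δ ^ 2) ^ 2)⁻¹ * ((Q w + δ ^ 2) * ∑ j, ‖X j‖ ^ 2) := by
            refine mul_le_mul_of_nonneg_left (hCS.trans ?_) (by positivity)
            exact mul_le_mul_of_nonneg_right (by nlinarith [sq_nonneg δ]) hX
        _ = _ := by field_simp
    linarith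
  change _ ≤ hermForm n (cHess n (fun w => Q w + ((n : ℝ) + 2) * (g ∘ Q) w) w) X X
  rw [hsum]
  have : 0 ≤ ((n : ℝ) + 2) * hermForm n (cHess n (g ∘ Q) w) X X := mul_nonneg (by positivity) hnn
  linarith

theorem memLp_two_of_norm_sq_le (hΩ : IsOpen Ω) {D : Set (Fin n → ℂ)} (hD : MeasurableSet D)
    (hDΩ : D ⊆ Ω) {u : (Fin n → ℂ) → ℂ} {g : (Fin n → ℂ) → ℝ} {M : ℝ} (hu : ContinuousOn u Ω)
    (hg : IntegrableOn g D) (h1 : ∀ w ∈ D, ‖u w‖ ^ 2 ≤ M * g w) (h0 : ∀ w ∈ Ω \ D, u w = 0) :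
    MemLp u 2 (volume.restrict Ω) ∧ ∫ w in Ω, ‖u w‖ ^ 2 ≤ M * ∫ w in D, g w := by
  have hms : AEStronglyMeasurable u (volume.restrict Ω) :=
    hu.aestronglyMeasurable hΩ.measurableSet
  have hmD : AEStronglyMeasurable (fun w => ‖u w‖ ^ 2) (volume.restrict D) :=
    ((hms.mono_measure (Measure.restrict_mono hDΩ le_rfl)).norm.pow 2)
  have hID : IntegrableOn (fun w => ‖u w‖ ^ 2) D := by
    refine Integrable.mono' (hg.const_mul M) hmD ?_
    filter_upwards [ae_restrict_mem hD] with w hw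
    rw [Real.norm_of_nonneg (by positivity)]
    exact h1 w hw
  have hI : IntegrableOn (fun w => ‖u w‖ ^ 2) Ω :=
    hID.of_forall_sdiff_eq_zero hΩ.measurableSet fun w hw => by simp [h0 w hw]
  refine ⟨(memLp_two_iff_integrable_sq_norm hms).2 hI, ?_⟩
  rw [setIntegral_eq_of_subset_of_forall_sdiff_eq_zero hΩ.measurableSet hDΩ
    fun w hw => by simp [h0 w hw], ← integral_const_mul]
  exact setIntegral_mono_on hID (hg.const_mul M) hD h1

end Localization

section Localization

open scoped ContDiff ENNReal ComplexConjugate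

variable {n : ℕ} {Ω : Set (Fin n → ℂ)}

theorem exists_ball_cutoff (z₀ : Fin n → ℂ) {r : ℝ} (hr : 0 < r) :
    ∃ (χ : (Fin n → ℂ) → ℂ) (M : ℝ), 0 < M ∧ ContDiff ℝ ∞ χ ∧ (∀ w, ‖χ w‖ ≤ 1) ∧
      (∀ w ∈ Metric.ball z₀ (r / 2), χ w = 1) ∧ tsupport χ ⊆ Metric.ball z₀ r ∧
      (∀ j w, ‖wderBar n j χ w‖ ≤ M) ∧
      ∀ j w, w ∈ Metric.ball z₀ (r / 2) → wderBar n j χ w = 0 := by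
  let b : ContDiffBump z₀ := ⟨r / 2, 3 * r / 4, by positivity, by linarith⟩
  set χ : (Fin n → ℂ) → ℂ := fun w => (b w : ℂ) with hχ
  have hs : ContDiff ℝ ∞ χ := Complex.ofRealCLM.contDiff.comp b.contDiff
  have hsup : tsupport χ ⊆ Metric.closedBall z₀ (3 * r / 4) := by
    rw [← b.tsupport_eq]
    refine closure_mono fun w hw => ?_
    simpa [hχ] using hw
  have hc : HasCompactSupport χ :=
    (isCompact_closedBall z₀ (3 * r / 4)).of_isClosed_subset (isClosed_tsupport χ) hsup
  have ht : IsTestFun n χ univ := ⟨hs, hc, subset_univ _⟩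
  have h1 : ∀ w ∈ Metric.ball z₀ (r / 2), χ w = 1 := fun w hw => by
    have : b w = 1 := b.one_of_mem_closedBall (Metric.ball_subset_closedBall hw)
    simp [hχ, this]
  choose M hM using fun j => (ht.wderBar j).exists_bound
  refine ⟨χ, 1 + ∑ j, |M j|, by positivity, hs, fun w => ?_, h1,
    hsup.trans (Metric.closedBall_subset_ball (by linarith)), fun j w => ?_, fun j w hw => ?_⟩
  · simp only [hχ, Complex.norm_real, Real.norm_eq_abs, abs_of_nonneg b.nonneg]
    exact b.le_one
  · have : |M j| ≤ ∑ i, |M i| :=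
      Finset.single_le_sum (f := fun i => |M i|) (fun i _ => abs_nonneg _) (Finset.mem_univ j)
    have h2 := hM j
    have := (hM j w).trans (le_abs_self _)
    linarith
  · have : χ =ᶠ[𝓝 w] fun _ => 1 := by
      filter_upwards [Metric.isOpen_ball.mem_nhds hw] with v hv using h1 v hv
    rw [this.wderBar_eq]
    exact wderBar_eq_zero_of_differentiableAt (differentiableAt_const _) j

theorem IsDefining.exists_localization {ρ : (Fin n → ℂ) → ℝ} (hΩ : IsOpen Ω)
    (hb : Bornology.IsBounded Ω) (hρ : IsDefining n Ω ρ)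
    (hpsc : ∀ q ∈ frontier Ω, LeviPSDAt n ρ q) (z₀ : Fin n → ℂ) {r : ℝ} (hr : 0 < r) :
    ∃ C > (0:ℝ), ∀ z ∈ Ω ∩ Metric.ball z₀ (r / 4), ∀ f : (Fin n → ℂ) → ℂ,
      InBergman n (Ω ∩ Metric.ball z₀ r) f → ∀ ε > 0, ∃ F, InBergman n Ω F ∧
        l2sq n Ω F ≤ C * l2sq n (Ω ∩ Metric.ball z₀ r) f ∧ ‖F z - f z‖ ≤ ε ∧
        ‖fderiv ℂ F z - fderiv ℂ f z‖ ≤ ε := by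
  obtain ⟨P, A, c, hP, hP0, hcomp, hPd, hc, hPl⟩ := hρ.exists_exhaustion hΩ hb hpsc
  obtain ⟨χ, M, hM, hχs, hχ1, hχeq, hχsup, hχM, hχ0⟩ := exists_ball_cutoff z₀ hr
  obtain ⟨d, hd⟩ := hb.exists_norm_le
  obtain ⟨C₂, hC₂, hvd⟩ := exists_value_deriv_le n
  set D := Ω ∩ Metric.ball z₀ r with hD
  have hDo : IsOpen D := hΩ.inter Metric.isOpen_ball
  have hDΩ : D ⊆ Ω := inter_subset_left
  set R : ℝ := n * (2 * |d|) ^ 2 with hR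
  have hR0 : 0 ≤ R := by positivity
  have hQR : ∀ z ∈ Ω, ∀ w ∈ Ω, ∑ i, ‖w i - z i‖ ^ 2 ≤ R := fun z hz w hw => by
    refine (sum_norm_sq_le (w - z)).trans (mul_le_mul_of_nonneg_left ?_ n.cast_nonneg)
    refine pow_le_pow_left₀ (norm_nonneg _) ?_ 2
    have h1 := (hd w hw).trans (le_abs_self d)
    have h2 := (hd z hz).trans (le_abs_self d)
    linarith [norm_sub_le w z]
  set m : ℝ := Real.exp (-R) * ((R + 1) ^ (n + 2))⁻¹ with hm
  have hm0 : 0 < m := by positivity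
  set W : ℝ := (((r / 4) ^ 2) ^ (n + 2))⁻¹ with hW
  have hW0 : 0 < W := by positivity
  refine ⟨2 + 2 * (m⁻¹ * (8 * (n * (W * M ^ 2)))), by positivity, fun z hz f hf ε hε => ?_⟩
  set I := l2sq n D f with hI
  have hI0 : 0 ≤ I := integral_nonneg fun _ => by positivity
  set S : ℝ := 8 * (n * (W * M ^ 2)) * I with hS
  have hS0 : 0 ≤ S := by positivity
  set L : ℝ := Real.exp n * ((n + 1) ^ (n + 2)) * S with hL
  have hL0 : 0 ≤ L := by positivity
  have hnz : Ω ∩ Metric.ball z₀ (r / 4) ∈ 𝓝 z := (hΩ.inter Metric.isOpen_ball).mem_nhds hz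
  obtain ⟨δ₀, hδ₀, hball⟩ := Metric.mem_nhds_iff.1 hnz
  obtain ⟨δ, hδ, hδ1, hδδ₀, hδε⟩ : ∃ δ > 0, δ ≤ 1 ∧ δ ≤ δ₀ ∧ C₂ * L * δ ^ 2 ≤ ε ^ 2 := by
    have ht : Tendsto (fun δ : ℝ => C₂ * L * δ ^ 2) (𝓝[>] 0) (𝓝 (C₂ * L * 0 ^ 2)) :=
      ((by fun_prop : Continuous fun δ : ℝ => C₂ * L * δ ^ 2).tendsto 0).mono_left
        nhdsWithin_le_nhds
    have hlt : C₂ * L * 0 ^ 2 < ε ^ 2 := by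
      have := pow_pos hε 2
      simpa using this
    have h := (ht.eventually (gt_mem_nhds hlt)).and
      ((Ioo_mem_nhdsGT (lt_min one_pos hδ₀)))
    obtain ⟨δ, h1, h2⟩ := h.exists
    exact ⟨δ, h2.1, (h2.2.trans_le (min_le_left _ _)).le, (h2.2.trans_le (min_le_right _ _)).le,
      h1.le⟩
  have hδball : Metric.ball z δ ⊆ Ω ∩ Metric.ball z₀ (r / 4) :=
    (Metric.ball_subset_ball hδδ₀).trans hball
  set φ := logWeight n z δ with hφ
  have hφs : ContDiff ℝ ∞ φ := contDiff_logWeight z hδ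
  obtain ⟨B, hB⟩ := (hb.isCompact_closure).exists_bound_of_continuousOn
    hφs.continuous.continuousOn
  have hφb : ∀ w ∈ Ω, |φ w| ≤ B := fun w hw => hB w (subset_closure hw)
  set v : (Fin n → ℂ) → ℂ := fun w => χ w * f w with hv
  have hfs : ContDiffOn ℝ ∞ f D := hf.1.contDiffOn_real_pi hDo
  have hv0 : ∀ w, w ∉ Metric.ball z₀ r → v =ᶠ[𝓝 w] fun _ => 0 := fun w hw => by
    have : χ =ᶠ[𝓝 w] 0 := notMem_tsupport_iff_eventuallyEq.1 fun h => hw (hχsup h)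
    filter_upwards [this] with y hy
    simp [hv, hy]
  have hvs : ContDiffOn ℝ ∞ v Ω := fun w hw => by
    by_cases hwr : w ∈ Metric.ball z₀ r
    · exact (hχs.contDiffAt.mul
        (hfs.contDiffAt (hDo.mem_nhds ⟨hw, hwr⟩))).contDiffWithinAt
    · exact (contDiffAt_const.congr_of_eventuallyEq (hv0 w hwr)).contDiffWithinAt
  have hvb : ∀ j, ∀ w ∈ D, wderBar n j v w = wderBar n j χ w * f w := fun j w hw => by
    have hfd : DifferentiableAt ℂ f w := hf.1.differentiableAt (hDo.mem_nhds hw)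
    rw [hv, wderBar_mul (hχs.differentiable (by simp) w) (hfd.restrictScalars ℝ),
      wderBar_eq_zero_of_differentiableAt hfd]
    simp
  have hvb0 : ∀ j, ∀ w ∈ Ω \ D, wderBar n j v w = 0 := fun j w hw => by
    have : w ∉ Metric.ball z₀ r := fun h => hw.2 ⟨hw.1, h⟩
    rw [(hv0 w this).wderBar_eq]
    exact wderBar_eq_zero_of_differentiableAt (differentiableAt_const _) j
  obtain ⟨hvL, hvI⟩ := memLp_two_of_norm_sq_le (u := v) (M := 1) hΩ hDo.measurableSet hDΩ
    hvs.continuousOn hf.2 (fun w _ => by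
      rw [hv, norm_mul, mul_pow]
      exact mul_le_mul_of_nonneg_right (pow_le_one₀ (norm_nonneg _) (hχ1 w)) (by positivity))
    (fun w hw => (hv0 w fun h => hw.2 ⟨hw.1, h⟩).eq_of_nhds)
  have hvbL := fun j => memLp_two_of_norm_sq_le (u := wderBar n j v) (M := M ^ 2) hΩ
    hDo.measurableSet hDΩ (ContDiffOn.wderBar hvs hΩ j).continuousOn hf.2 (fun w hw => by
      rw [hvb j w hw, norm_mul, mul_pow]
      gcongr
      exact hχM j w) (hvb0 j)
  obtain ⟨G, hGd, hGL, hGI⟩ := hormander_l2 hΩ hP hP0 hcomp hPd hc hPl hφs.contDiffOn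
    (fun w _ X => hermForm_logWeight z hδ w X) hφb hvs hvL fun j => (hvbL j).1
  have hexpb : ∀ w ∈ Ω, Real.exp (-φ w) ≤ Real.exp B := fun w hw =>
    Real.exp_le_exp.2 ((neg_le_abs _).trans (hφb w hw))
  have hexpI : ∀ u : (Fin n → ℂ) → ℂ, MemLp u 2 (volume.restrict Ω) →
      IntegrableOn (fun w => Real.exp (-φ w) * ‖u w‖ ^ 2) Ω := fun u hu => by
    have h2 := (memLp_two_iff_integrable_sq_norm hu.1).1 hu
    refine Integrable.mono' (h2.const_mul (Real.exp B))
      ((Real.continuous_exp.comp hφs.continuous.neg).aestronglyMeasurable.mul h2.1) ?_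
    filter_upwards [ae_restrict_mem hΩ.measurableSet] with w hw
    rw [Real.norm_of_nonneg (by positivity)]
    exact mul_le_mul_of_nonneg_right (hexpb w hw) (by positivity)
  have hGS : ∫ w in Ω, Real.exp (-φ w) * ‖v w - G w‖ ^ 2 ≤ S := by
    refine hGI.trans ?_
    have : ∀ j, ∫ w in Ω, Real.exp (-φ w) * ‖wderBar n j v w‖ ^ 2 ≤ W * M ^ 2 * I := fun j => by
      have h2 := (memLp_two_iff_integrable_sq_norm (hvbL j).1.1).1 (hvbL j).1
      calc _ ≤ ∫ w in Ω, W * ‖wderBar n j v w‖ ^ 2 := by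
            refine setIntegral_mono_on (hexpI _ (hvbL j).1) (h2.const_mul W) hΩ.measurableSet
              fun w hw => ?_
            by_cases hw2 : w ∈ Metric.ball z₀ (r / 2)
            · have hwD : w ∈ D := ⟨hw, Metric.ball_subset_ball (by linarith) hw2⟩
              rw [hvb j w hwD, hχ0 j w hw2]
              simp
            · refine mul_le_mul_of_nonneg_right ?_ (by positivity)
              have h4 : r / 4 ≤ ‖w - z‖ := by
                have h5 : r / 2 ≤ dist w z₀ := not_lt.1 hw2
                have h6 : dist z z₀ < r / 4 := hz.2
                have := dist_triangle w z z₀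
                rw [← dist_eq_norm]; linarith
              have h7 : (r / 4) ^ 2 ≤ ∑ i, ‖w i - z i‖ ^ 2 :=
                (pow_le_pow_left₀ (by positivity) h4 2).trans (norm_sq_le_sum_norm_sq (w - z))
              rw [hφ, exp_neg_logWeight z w hδ]
              refine (mul_le_of_le_one_left (by positivity)
                (Real.exp_le_one_iff.2 (neg_nonpos.2 (by positivity)))).trans ?_
              refine inv_anti₀ (by positivity) (pow_le_pow_left₀ (by positivity) ?_ _)
              nlinarith [sq_nonneg δ]
        _ ≤ _ := by
            rw [integral_const_mul, mul_assoc]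
            exact mul_le_mul_of_nonneg_left (hvbL j).2 hW0.le
    calc _ ≤ 8 * ∑ _j : Fin n, W * M ^ 2 * I := by
          gcongr with j
          exact this j
      _ = S := by simp [hS]; ring
  have hvG : MemLp (fun w => v w - G w) 2 (volume.restrict Ω) := hvL.sub hGL
  have hvGi := (memLp_two_iff_integrable_sq_norm hvG.1).1 hvG
  have hvi := (memLp_two_iff_integrable_sq_norm hvL.1).1 hvL
  have hGi := (memLp_two_iff_integrable_sq_norm hGL.1).1 hGL
  have hvG2 : ∫ w in Ω, ‖v w - G w‖ ^ 2 ≤ m⁻¹ * S := by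
    rw [← div_eq_inv_mul, le_div_iff₀ hm0, mul_comm, ← integral_const_mul]
    refine le_trans (setIntegral_mono_on (hvGi.const_mul m) (hexpI _ hvG) hΩ.measurableSet
      fun w hw => mul_le_mul_of_nonneg_right ?_ (by positivity)) hGS
    rw [hφ, exp_neg_logWeight z w hδ, hm]
    have h1 := hQR z hz.1 w hw
    have h2 := sum_norm_sub_sq_add_pos w z hδ
    refine mul_le_mul (Real.exp_le_exp.2 (neg_le_neg h1)) ?_ (by positivity) (by positivity)
    refine inv_anti₀ (by positivity) (pow_le_pow_left₀ h2.le ?_ _)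
    have : δ ^ 2 ≤ 1 := pow_le_one₀ hδ.le hδ1
    linarith
  have hloc : ∫ w in Metric.ball z δ, ‖(fun w => f w - G w) w‖ ^ 2 ≤ L * δ ^ (2 * n + 4) := by
    have hsub : Metric.ball z δ ⊆ Ω := hδball.trans inter_subset_left
    set q : ℝ := Real.exp (-n) * (((n + 1) * δ ^ 2) ^ (n + 2))⁻¹ with hq
    have hq0 : 0 < q := by positivity
    have hqL : L * δ ^ (2 * n + 4) = q⁻¹ * S := by
      rw [hL, hq, mul_inv, inv_inv, ← Real.exp_neg, neg_neg, mul_pow, ← pow_mul]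
      ring_nf
    rw [hqL, ← div_eq_inv_mul, le_div_iff₀ hq0, mul_comm, ← integral_const_mul]
    have hmono : ∫ w in Metric.ball z δ, Real.exp (-φ w) * ‖v w - G w‖ ^ 2 ≤ S := by
      refine le_trans (setIntegral_mono_set (hexpI _ hvG) ?_ hsub.eventuallyLE) hGS
      filter_upwards with w using by positivity
    refine le_trans (setIntegral_mono_on ?_ ((hexpI _ hvG).mono_set hsub)
      Metric.isOpen_ball.measurableSet fun w hw => ?_) hmono
    · refine (((hvGi.mono_measure (Measure.restrict_mono hsub le_rfl))).const_mul q).congr ?_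
      filter_upwards [ae_restrict_mem Metric.isOpen_ball.measurableSet] with w hw
      have : w ∈ Metric.ball z₀ (r / 2) :=
        Metric.ball_subset_ball (by linarith) (hδball hw).2
      simp [hv, hχeq w this]
    · have hw2 : w ∈ Metric.ball z₀ (r / 2) :=
        Metric.ball_subset_ball (by linarith) (hδball hw).2
      simp only [hv, hχeq w hw2, one_mul]
      refine mul_le_mul_of_nonneg_right ?_ (by positivity)
      rw [hφ, exp_neg_logWeight z w hδ, hq]
      have h2 := sum_norm_sub_sq_add_pos w z hδ
      have h3 : ∑ i, ‖w i - z i‖ ^ 2 ≤ n * δ ^ 2 := by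
        refine (sum_norm_sq_le (w - z)).trans (mul_le_mul_of_nonneg_left ?_ n.cast_nonneg)
        refine pow_le_pow_left₀ (norm_nonneg _) ?_ 2
        rw [← dist_eq_norm]
        exact (Metric.mem_ball.1 hw).le
      have h4 : δ ^ 2 ≤ 1 := pow_le_one₀ hδ.le hδ1
      refine mul_le_mul (Real.exp_le_exp.2 (neg_le_neg (h3.trans ?_))) ?_ (by positivity)
        (by positivity)
      · exact mul_le_of_le_one_right n.cast_nonneg h4
      · refine inv_anti₀ (by positivity) (pow_le_pow_left₀ h2.le ?_ _)
        linarith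
  have hsubΩ : Metric.ball z δ ⊆ Ω := hδball.trans inter_subset_left
  have hsubD : Metric.ball z δ ⊆ D := fun w hw =>
    ⟨(hδball hw).1, Metric.ball_subset_ball (by linarith) (hδball hw).2⟩
  have hzδ : z ∈ Metric.ball z δ := Metric.mem_ball_self hδ
  have hval := hvd (fun w => f w - G w) z δ L hδ ((hf.1.mono hsubD).fun_sub (hGd.mono hsubΩ)) (by
    refine ((hvGi.mono_measure (Measure.restrict_mono hsubΩ le_rfl))).congr ?_
    filter_upwards [ae_restrict_mem Metric.isOpen_ball.measurableSet] with w hw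
    have : w ∈ Metric.ball z₀ (r / 2) :=
      Metric.ball_subset_ball (by linarith) (hδball hw).2
    simp [hv, hχeq w this]) hloc
  refine ⟨G, ⟨hGd, hGi⟩, ?_, ?_, ?_⟩
  · have h1 : l2sq n Ω G ≤ ∫ w in Ω, (2 * ‖v w‖ ^ 2 + 2 * ‖v w - G w‖ ^ 2) := by
      refine integral_mono hGi ((hvi.const_mul 2).add (hvGi.const_mul 2)) fun w => ?_
      have h : ‖G w‖ ≤ ‖v w‖ + ‖v w - G w‖ := by
        have := norm_sub_le (v w) (v w - G w)
        simpa using this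
      have h0 := norm_nonneg (G w)
      change ‖G w‖ ^ 2 ≤ 2 * ‖v w‖ ^ 2 + 2 * ‖v w - G w‖ ^ 2
      nlinarith [sq_nonneg (‖v w‖ - ‖v w - G w‖)]
    rw [integral_add (hvi.const_mul 2) (hvGi.const_mul 2), integral_const_mul,
      integral_const_mul] at h1
    have h2 : ∫ w in Ω, ‖v w‖ ^ 2 ≤ I := by simpa [hI, l2sq] using hvI
    calc _ ≤ 2 * I + 2 * (m⁻¹ * S) := by linarith
      _ = _ := by rw [hS]; ring
  · rw [norm_sub_rev]
    refine abs_le_of_sq_le_sq' ?_ hε.le |>.2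
    refine hval.1.trans (le_trans ?_ hδε)
    refine mul_le_mul_of_nonneg_left ?_ (by positivity)
    exact pow_le_pow_of_le_one hδ.le hδ1 (by norm_num)
  · rw [norm_sub_rev, ← fderiv_sub (hf.1.differentiableAt (hDo.mem_nhds (hsubD hzδ)))
      (hGd.differentiableAt (hΩ.mem_nhds hz.1))]
    exact (abs_le_of_sq_le_sq' (hval.2.trans hδε) hε.le).2

end Localization

/-! ### Adapted linear coordinates at a point of a convex domain -/

section ConvexCoordinates

open scoped ContDiff ENNReal ComplexConjugate

variable {n : ℕ}

theorem norm_le_of_forall_re_mul_le {a : ℂ} {c : ℝ} (h : ∀ u : ℂ, ‖u‖ ≤ 1 → (u * a).re ≤ c) :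
    ‖a‖ ≤ c := by
  by_cases ha : a = 0
  · simpa [ha] using h 0 (by simp)
  have hn : (‖a‖ : ℂ) ≠ 0 := by simpa using ha
  have := h (conj a / ‖a‖) (by
    rw [norm_div, RCLike.norm_conj, Complex.norm_real, norm_norm, div_self (norm_ne_zero_iff.2 ha)])
  rwa [div_mul_eq_mul_div, mul_comm, Complex.mul_conj, Complex.normSq_eq_norm_sq, pow_two,
    ofReal_mul, mul_div_assoc, div_self hn, mul_one, ofReal_re] at this

theorem exists_auerbach {D : Set (Fin n → ℂ)} (hD : IsOpen D) (hb : Bornology.IsBounded D)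
    {z : Fin n → ℂ} (hz : z ∈ D) :
    ∃ A : Matrix (Fin n) (Fin n) ℂ, A.det ≠ 0 ∧
      (∀ i, ∀ w ∈ D, (A.mulVec (w - z) i).re ≤ 1) ∧
      ∀ b : Fin n → ℂ, (∀ w ∈ D, (∑ j, b j * (w - z) j).re ≤ 1) →
        ∃ c : Fin n → ℂ, (∀ i, ‖c i‖ ≤ 1) ∧ ∀ x, ∑ j, b j * x j = ∑ i, c i * A.mulVec x i := by
  set C : Set (Fin n → ℂ) := {b | ∀ w ∈ D, (∑ j, b j * (w - z) j).re ≤ 1} with hC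
  obtain ⟨s, hs, hsD⟩ := Metric.isOpen_iff.1 hD z hz
  have hCc : IsCompact C := by
    refine Metric.isCompact_of_isClosed_isBounded ?_ ?_
    · have : C = ⋂ w ∈ D, {b : Fin n → ℂ | (∑ j, b j * (w - z) j).re ≤ 1} := by
        ext b; simp [hC]
      rw [this]
      exact isClosed_biInter fun w _ => isClosed_le (by fun_prop) continuous_const
    · refine (Metric.isBounded_iff_subset_closedBall 0).2 ⟨2 / s, fun b hbC => ?_⟩
      rw [mem_closedBall_zero_iff]
      refine (pi_norm_le_iff_of_nonneg (by positivity)).2 fun i => ?_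
      refine norm_le_of_forall_re_mul_le fun u hu => ?_
      have hmem : z + Pi.single i (((s / 2 : ℝ) : ℂ) * u) ∈ D := hsD (by
        rw [Metric.mem_ball, dist_eq_norm, add_sub_cancel_left, Pi.norm_single, norm_mul,
          Complex.norm_real, Real.norm_of_nonneg (by positivity)]
        nlinarith [norm_nonneg u])
      have := hbC _ hmem
      have h2 : (∑ j, b j * (z + (Pi.single i (((s / 2 : ℝ) : ℂ) * u) : Fin n → ℂ) - z) j).re =
          s / 2 * (u * b i).re := by
        rw [add_sub_cancel_left, Finset.sum_eq_single i]
        · rw [Pi.single_eq_same, ← re_ofReal_mul]; ring_nf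
        · intro j _ hj; simp [Pi.single_eq_of_ne hj]
        · simp
      rw [h2] at this
      rw [le_div_iff₀ hs]
      linarith
  have h0 : (0 : Fin n → ℂ) ∈ C := fun w _ => by simp
  obtain ⟨A, hA, hmax⟩ := (isCompact_univ_pi fun _ : Fin n => hCc).exists_isMaxOn
    ⟨fun _ => 0, fun _ _ => h0⟩
    (f := fun A : Fin n → Fin n → ℂ => ‖(Matrix.of A).det‖)
    (by
      refine Continuous.continuousOn (continuous_norm.comp ?_)
      exact Continuous.matrix_det continuous_id)
  obtain ⟨d, hd⟩ := hb.exists_norm_le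
  have hdet : (Matrix.of A).det ≠ 0 := by
    set e : ℝ := (2 * |d| + 1)⁻¹ with he
    have he0 : 0 < e := by positivity
    set E : Fin n → Fin n → ℂ := fun i => Pi.single i (e : ℂ) with hE
    have hmem : E ∈ univ.pi fun _ : Fin n => C := by
      intro i _ w hw
      simp only [hE]
      rw [Finset.sum_eq_single i]
      · rw [Pi.single_eq_same, re_ofReal_mul]
        have h1 : ((w - z) i).re ≤ 2 * |d| := by
          refine (Complex.re_le_norm _).trans ((norm_le_pi_norm _ i).trans ((norm_sub_le _ _).trans ?_))
          have h1 := (hd w hw).trans (le_abs_self d)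
          have h2 := (hd z hz).trans (le_abs_self d)
          linarith
        rw [he, inv_mul_le_iff₀ (by positivity)]
        linarith
      · intro j _ hj; simp [Pi.single_eq_of_ne hj]
      · simp
    have h1 : ‖(Matrix.of E).det‖ ≤ ‖(Matrix.of A).det‖ := hmax hmem
    have h2 : Matrix.of E =
        Matrix.diagonal fun _ => (e : ℂ) := by
      ext i j
      by_cases hij : i = j
      · subst hij; simp [hE]
      · simp [hE, Matrix.diagonal_apply_ne _ hij, Pi.single_eq_of_ne (Ne.symm hij)]
    rw [h2, Matrix.det_diagonal] at h1
    intro h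
    simp only [h, norm_zero, Finset.prod_const, norm_pow, Complex.norm_real] at h1
    have : 0 < ‖e‖ ^ (Finset.univ : Finset (Fin n)).card := by
      have := norm_pos_iff.2 he0.ne'
      positivity
    linarith
  refine ⟨Matrix.of A, hdet, fun i w hw => ?_, fun b hbC => ?_⟩
  · have := hA i (mem_univ i) w hw
    simpa [Matrix.mulVec, dotProduct] using this
  · refine ⟨((Matrix.of A).det)⁻¹ • (Matrix.of A).transpose.cramer b, fun i => ?_, fun x => ?_⟩
    · rw [Pi.smul_apply, Matrix.cramer_transpose_apply, norm_smul, norm_inv,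
        inv_mul_le_iff₀ (norm_pos_iff.2 hdet), mul_one]
      refine hmax (a := Function.update A i b) fun j _ => ?_
      by_cases hj : j = i
      · subst hj; rwa [Function.update_self]
      · simpa [Function.update_of_ne hj] using hA j (mem_univ j)
    · have h1 := Matrix.mulVec_cramer (Matrix.of A).transpose b
      rw [Matrix.det_transpose] at h1
      have h2 : (Matrix.of A).transpose.mulVec
          (((Matrix.of A).det)⁻¹ • (Matrix.of A).transpose.cramer b) = b := by
        rw [Matrix.mulVec_smul, h1, smul_smul, inv_mul_cancel₀ hdet, one_smul]
      have h3 : b ⬝ᵥ x = (((Matrix.of A).det)⁻¹ • (Matrix.of A).transpose.cramer b) ⬝ᵥ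
          (Matrix.of A).mulVec x := by
        conv_lhs => rw [← h2]
        rw [Matrix.dotProduct_mulVec, Matrix.mulVec_transpose]
      exact h3

theorem exists_adapted_coordinates {D : Set (Fin n → ℂ)} (hD : IsOpen D)
    (hb : Bornology.IsBounded D) (hc : Convex ℝ D) {z : Fin n → ℂ} (hz : z ∈ D) :
    ∃ T : (Fin n → ℂ) ≃L[ℂ] (Fin n → ℂ),
      (∀ x, ‖x‖ < ((n : ℝ) + 1)⁻¹ → z + T x ∈ D) ∧
      ∀ w ∈ D, ∀ i, (T.symm (w - z) i).re ≤ 1 := by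
  obtain ⟨A, hdet, hA, hAu⟩ := exists_auerbach hD hb hz
  let e := (Matrix.toLinearEquiv' A (Matrix.invertibleOfIsUnitDet A
    (isUnit_iff_ne_zero.2 hdet))).toContinuousLinearEquiv
  have he : ∀ x, e x = A.mulVec x := fun x => rfl
  refine ⟨e.symm, fun x hx => ?_, fun w hw i => ?_⟩
  · by_contra hmem
    obtain ⟨f, hf⟩ := RCLike.geometric_hahn_banach_open_point (𝕜 := ℂ) hc hD hmem
    set y := e.symm x with hy
    have ht : 0 < (f y).re := by
      have := hf z hz
      rw [map_add] at this
      simpa using this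
    have hfs : ∀ v : Fin n → ℂ, f v = ∑ j, v j * f (Pi.single j 1) := fun v => by
      conv_lhs => rw [pi_eq_sum_univ' v]
      rw [map_sum]
      refine Finset.sum_congr rfl fun j _ => ?_
      rw [map_smul, smul_eq_mul]
    obtain ⟨c, hc1, hc2⟩ := hAu (fun j => (((f y).re)⁻¹ : ℝ) * f (Pi.single j 1)) fun w hw => by
      have h1 : ∑ j, (((f y).re)⁻¹ : ℝ) * f (Pi.single j 1) * (w - z) j =
          (((f y).re)⁻¹ : ℝ) * f (w - z) := by
        rw [hfs (w - z), Finset.mul_sum]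
        exact Finset.sum_congr rfl fun j _ => by ring
      rw [h1, re_ofReal_mul, inv_mul_le_iff₀ ht, mul_one, map_sub, sub_re]
      have := hf w hw
      rw [map_add] at this
      simp only [RCLike.re_eq_complex_re, add_re] at this
      linarith
    have h1 : (∑ i, c i * A.mulVec y i).re = 1 := by
      rw [← hc2 y]
      have h1 : ∑ j, (((f y).re)⁻¹ : ℝ) * f (Pi.single j 1) * y j =
          (((f y).re)⁻¹ : ℝ) * f y := by
        have := hfs y
        conv_rhs => rw [show (((f y).re)⁻¹ : ℝ) * f y =
          (((f y).re)⁻¹ : ℝ) * ∑ j, y j * f (Pi.single j 1) from congrArg _ this, Finset.mul_sum]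
        exact Finset.sum_congr rfl fun j _ => by ring
      rw [h1, re_ofReal_mul, inv_mul_cancel₀ ht.ne']
    have h2 : A.mulVec y = x := by rw [← he, hy, e.apply_symm_apply]
    rw [h2] at h1
    have h3 : (1:ℝ) ≤ ∑ _i : Fin n, ‖x‖ := by
      rw [← h1]
      refine (Complex.re_le_norm _).trans ((norm_sum_le _ _).trans ?_)
      refine Finset.sum_le_sum fun i _ => ?_
      rw [norm_mul]
      exact (mul_le_of_le_one_left (norm_nonneg _) (hc1 i)).trans (norm_le_pi_norm x i)
    rw [Finset.sum_const, Finset.card_univ, Fintype.card_fin, nsmul_eq_mul] at h3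
    have h4 : ‖x‖ * (n + 1) < 1 := (lt_inv_mul_iff₀' (by positivity)).1 (by simpa using hx)
    nlinarith [norm_nonneg x]
  · exact hA i w hw

end ConvexCoordinates

section PeakFunctions

open scoped ContDiff ENNReal ComplexConjugate

variable {n : ℕ}

theorem one_le_norm_two_sub {ζ : ℂ} (h : ζ.re ≤ 1) : 1 ≤ ‖2 - ζ‖ := by
  have := Complex.re_le_norm (2 - ζ)
  simp only [sub_re, re_ofNat] at this
  linarith

theorem one_add_norm_le_norm_two_sub {ζ : ℂ} (h : ζ.re ≤ 1) : 1 + ‖ζ‖ ≤ 4 * ‖2 - ζ‖ := by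
  have h1 := one_le_norm_two_sub h
  have h2 : ‖ζ‖ ≤ ‖(2:ℂ)‖ + ‖2 - ζ‖ := by
    have := norm_sub_le (2:ℂ) (2 - ζ)
    simpa using this
  rw [show ‖(2:ℂ)‖ = 2 by simp] at h2
  linarith

theorem norm_div_two_sub_le {ζ : ℂ} (h : ζ.re ≤ 1) : ‖ζ / (2 - ζ)‖ ≤ 1 := by
  have h1 := one_le_norm_two_sub h
  rw [norm_div, div_le_one (by linarith), ← sq_le_sq₀ (norm_nonneg _) (norm_nonneg _),
    ← Complex.normSq_eq_norm_sq, ← Complex.normSq_eq_norm_sq, normSq_apply, normSq_apply]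
  simp only [sub_re, sub_im, re_ofNat, im_ofNat]
  nlinarith

theorem norm_inv_two_sub_sq_le {ζ : ℂ} (h : ζ.re ≤ 1) :
    ‖((2 - ζ) ^ 2)⁻¹‖ ^ 2 ≤ 256 * (1 + ‖ζ‖) ^ (-4 : ℝ) := by
  have h1 := one_le_norm_two_sub h
  have h2 := one_add_norm_le_norm_two_sub h
  have h3 : 0 < 1 + ‖ζ‖ := by positivity
  rw [norm_inv, norm_pow, inv_pow, ← pow_mul, Real.rpow_neg h3.le]
  norm_num
  rw [← div_eq_mul_inv, ← one_div, div_le_div_iff₀ (by positivity) (by positivity)]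
  have := pow_le_pow_left₀ h3.le h2 4
  calc _ ≤ (4 * ‖2 - ζ‖) ^ 4 := by linarith
    _ = _ := by ring

theorem integrable_prod_one_add_norm (n : ℕ) :
    Integrable (fun x : Fin n → ℂ => ∏ i, (256 * (1 + ‖x i‖) ^ (-4 : ℝ))) := by
  refine Integrable.fintype_prod fun _ => Integrable.const_mul (integrable_one_add_norm ?_) _
  rw [Complex.finrank_real_complex]
  norm_num

theorem l2sq_le_of_affine_bound {D : Set (Fin n → ℂ)} (hD : IsOpen D) {z : Fin n → ℂ}
    (T : (Fin n → ℂ) ≃L[ℂ] (Fin n → ℂ)) {f : (Fin n → ℂ) → ℂ} (hf : DifferentiableOn ℂ f D)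
    (hb : ∀ w ∈ D, ‖f w‖ ^ 2 ≤ ∏ i, (256 * (1 + ‖T.symm (w - z) i‖) ^ (-4 : ℝ))) :
    InBergman n D f ∧ l2sq n D f ≤
      (1 + ∫ x : Fin n → ℂ, ∏ i, (256 * (1 + ‖x i‖) ^ (-4 : ℝ))) * realJac n T := by
  set g : (Fin n → ℂ) → ℝ := fun x => ∏ i, (256 * (1 + ‖x i‖) ^ (-4 : ℝ)) with hg
  have hg0 : ∀ x, 0 ≤ g x := fun x => Finset.prod_nonneg fun i _ => by positivity
  have hgi : Integrable g := integrable_prod_one_add_norm n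
  set S : Set (Fin n → ℂ) := (fun x => z + T x) ⁻¹' D with hS
  have hSo : IsOpen S := hD.preimage (by fun_prop)
  have hSD : (fun x => z + T x) '' S = D := by
    refine image_preimage_eq_of_subset fun w _ => ⟨T.symm (w - z), ?_⟩
    simp
  have hInt : IntegrableOn (fun x => ‖f (z + T x)‖ ^ 2) S := by
    refine Integrable.mono' hgi.integrableOn ?_ ?_
    · refine ContinuousOn.aestronglyMeasurable ?_ hSo.measurableSet
      exact (((hf.continuousOn.comp (by fun_prop : Continuous fun x => z + T x).continuousOn
        fun x hx => hx)).norm).pow 2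
    · filter_upwards [ae_restrict_mem hSo.measurableSet] with x hx
      rw [Real.norm_of_nonneg (by positivity)]
      simpa [hg] using hb _ hx
  refine ⟨⟨hf, ?_⟩, ?_⟩
  · rw [← hSD, integrableOn_affine_image T z hSo.measurableSet]
    exact hInt
  · rw [l2sq]
    conv_lhs => rw [← hSD]
    rw [integral_affine_image T z hSo.measurableSet, mul_comm]
    refine mul_le_mul_of_nonneg_right ?_ (realJac_pos T).le
    calc _ ≤ ∫ x in S, g x :=
          setIntegral_mono_on hInt hgi.integrableOn hSo.measurableSet fun x hx => by
            simpa [hg] using hb _ hx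
      _ ≤ ∫ x, g x := setIntegral_le_integral hgi (ae_of_all _ hg0)
      _ ≤ _ := by linarith

/-- Square-integrable holomorphic functions with controlled norm and prescribed first-order
behaviour at a point of a convex domain, in terms of adapted linear coordinates. -/
theorem exists_peak_functions (n : ℕ) :
    ∃ C > (0:ℝ), ∃ c > (0:ℝ), ∀ (D : Set (Fin n → ℂ)) (z : Fin n → ℂ)
      (T : (Fin n → ℂ) ≃L[ℂ] (Fin n → ℂ)), IsOpen D → z ∈ D →
      (∀ w ∈ D, ∀ i, (T.symm (w - z) i).re ≤ 1) →
      (∃ f, InBergman n D f ∧ l2sq n D f ≤ C * realJac n T ∧ ‖f z‖ = c) ∧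
      ∀ X, ∃ f, InBergman n D f ∧ l2sq n D f ≤ C * realJac n T ∧ f z = 0 ∧
        ‖fderiv ℂ f z X‖ = c * ‖T.symm X‖ := by
  have hC : 0 < 1 + ∫ x : Fin n → ℂ, ∏ i, (256 * (1 + ‖x i‖) ^ (-4 : ℝ)) := by
    have : 0 ≤ ∫ x : Fin n → ℂ, ∏ i, (256 * (1 + ‖x i‖) ^ (-4 : ℝ)) :=
      integral_nonneg fun x => Finset.prod_nonneg fun i _ => by positivity
    linarith
  set a : ℂ := ∏ _i : Fin n, ((2:ℂ) ^ 2)⁻¹ with ha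
  have ha0 : a ≠ 0 := Finset.prod_ne_zero_iff.2 fun _ _ => by norm_num
  refine ⟨_, hC, ‖a‖ / 2, by have := norm_pos_iff.2 ha0; positivity, fun D z T hD hz hT => ?_⟩
  set ζ : (Fin n → ℂ) → Fin n → ℂ := fun w => T.symm (w - z) with hζ
  have hζd : ∀ i, Differentiable ℂ fun w => ζ w i := fun i =>
    differentiable_pi.1 (T.symm.differentiable.comp (differentiable_id.sub_const z)) i
  have hne : ∀ w ∈ D, ∀ i, 2 - ζ w i ≠ 0 := fun w hw i h => by
    have := one_le_norm_two_sub (hT w hw i)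
    change 1 ≤ ‖2 - ζ w i‖ at this
    rw [h, norm_zero] at this; linarith
  have hζz : ζ z = 0 := by simp [hζ]
  set f₀ : (Fin n → ℂ) → ℂ := fun w => ∏ i, ((2 - ζ w i) ^ 2)⁻¹ with hf₀
  have hf₀d : DifferentiableOn ℂ f₀ D := by
    intro w hw
    have h : ∀ i ∈ (Finset.univ : Finset (Fin n)),
        DifferentiableAt ℂ (fun w => ((2 - ζ w i) ^ 2)⁻¹) w := fun i _ =>
      DifferentiableAt.fun_inv (((differentiable_const _).fun_sub (hζd i)).fun_pow 2 w)
        (pow_ne_zero 2 (hne w hw i))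
    have h2 := HasFDerivAt.finsetProd fun i hi => (h i hi).hasFDerivAt
    refine DifferentiableAt.differentiableWithinAt ?_
    convert h2.differentiableAt using 1
  have hf₀b : ∀ w ∈ D, ‖f₀ w‖ ^ 2 ≤ ∏ i, (256 * (1 + ‖T.symm (w - z) i‖) ^ (-4 : ℝ)) := by
    intro w hw
    rw [hf₀, norm_prod, ← Finset.prod_pow]
    exact Finset.prod_le_prod (fun i _ => by positivity)
      fun i _ => norm_inv_two_sub_sq_le (hT w hw i)
  have hf₀z : f₀ z = a := by simp [hf₀, hζz, ha]
  refine ⟨?_, fun X => ?_⟩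
  · obtain ⟨h1, h2⟩ := l2sq_le_of_affine_bound hD T (f := fun w => f₀ w * (1 / 2))
      (hf₀d.mul_const _) fun w hw => by
        rw [norm_mul, mul_pow]
        refine (mul_le_of_le_one_right (by positivity) ?_).trans (hf₀b w hw)
        norm_num
    refine ⟨_, h1, h2, ?_⟩
    rw [hf₀z, norm_mul]
    norm_num [div_eq_mul_inv]
  rcases isEmpty_or_nonempty (Fin n) with hn | hn
  · have h0 : T.symm X = 0 := Subsingleton.elim _ _
    refine ⟨fun _ => 0, ⟨differentiableOn_const _, by simp⟩, ?_, rfl, ?_⟩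
    · have := realJac_pos T
      simp only [l2sq, norm_zero]
      simp only [ne_eq, OfNat.ofNat_ne_zero, not_false_eq_true, zero_pow, integral_zero]
      positivity
    · simp [h0]
  obtain ⟨j, hj⟩ := Finite.exists_max fun j => ‖T.symm X j‖
  have hj' : ‖T.symm X‖ = ‖T.symm X j‖ :=
    le_antisymm ((pi_norm_le_iff_of_nonneg (norm_nonneg _)).2 hj) (norm_le_pi_norm _ j)
  have hqd : DifferentiableOn ℂ (fun w => ζ w j / (2 - ζ w j)) D :=
    by
      simp only [div_eq_mul_inv]
      exact (hζd j).differentiableOn.fun_mul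
        (((differentiable_const _).fun_sub (hζd j)).differentiableOn.fun_inv
          fun w hw => hne w hw j)
  obtain ⟨h1, h2⟩ := l2sq_le_of_affine_bound hD T
    (f := fun w => f₀ w * (ζ w j / (2 - ζ w j))) (hf₀d.fun_mul hqd) fun w hw => by
      rw [norm_mul, mul_pow]
      refine (mul_le_of_le_one_right (by positivity) ?_).trans (hf₀b w hw)
      exact pow_le_one₀ (norm_nonneg _) (norm_div_two_sub_le (hT w hw j))
  refine ⟨_, h1, h2, by simp [hζz], ?_⟩
  have hζj : HasFDerivAt (fun w => ζ w j)
      ((ContinuousLinearMap.proj (R := ℂ) (φ := fun _ : Fin n => ℂ) j).comp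
        (T.symm : (Fin n → ℂ) →L[ℂ] (Fin n → ℂ))) z := by
    have := ((ContinuousLinearMap.proj (R := ℂ) (φ := fun _ : Fin n => ℂ) j).comp
        (T.symm : (Fin n → ℂ) →L[ℂ] (Fin n → ℂ))).hasFDerivAt.comp z
        ((hasFDerivAt_id (𝕜 := ℂ) z).sub_const z)
    exact this
  have hf₀z' := (hf₀d.differentiableAt (hD.mem_nhds hz)).hasFDerivAt
  have hu : DifferentiableAt ℂ (fun w => f₀ w * (2 - ζ w j)⁻¹) z :=
    ((hf₀d.differentiableAt (hD.mem_nhds hz))).fun_mul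
      ((((differentiable_const _).fun_sub (hζd j)) z).fun_inv (hne z hz j))
  have hfin := hu.hasFDerivAt.mul hζj
  have heq : (fun w => f₀ w * (ζ w j / (2 - ζ w j))) =
      (fun w => f₀ w * (2 - ζ w j)⁻¹) * fun w => ζ w j := by
    ext w
    simp only [Pi.mul_apply, div_eq_mul_inv]; ring
  rw [heq, hfin.fderiv, hj']
  simp [hζz, hf₀z, div_eq_mul_inv]

end PeakFunctions

open scoped ComplexConjugate

/-- A locally bounded weak-* holomorphic map into a dual space is holomorphic. -/
theorem differentiableOn_dual_of_apply {n : ℕ} {A : Type*} [NormedAddCommGroup A]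
    [NormedSpace ℂ A] {Ω : Set (Fin n → ℂ)} {e : (Fin n → ℂ) → StrongDual ℂ A}
    (he : ∀ f, DifferentiableOn ℂ (fun z => e z f) Ω)
    (hbd : ∀ p ∈ Ω, ∃ r > 0, ∃ M, Metric.ball p r ⊆ Ω ∧ ∀ z ∈ Metric.ball p r, ‖e z‖ ≤ M) :
    DifferentiableOn ℂ e Ω := by
  intro p hp
  obtain ⟨r, hr, M, hsub, hM⟩ := hbd p hp
  have hM0 : 0 ≤ M := (norm_nonneg _).trans (hM p (Metric.mem_ball_self hr))
  obtain ⟨C, hC, hT⟩ := exists_taylor_bound hr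
  have hd : ∀ f, DifferentiableAt ℂ (fun z => e z f) p := fun f =>
    ((he f).mono hsub).differentiableAt (Metric.isOpen_ball.mem_nhds (Metric.mem_ball_self hr))
  have hle : ∀ f, ∀ w ∈ Metric.ball p r, ‖e w f‖ ≤ M * ‖f‖ := fun f w hw =>
    ((e w).le_opNorm f).trans (mul_le_mul_of_nonneg_right (hM w hw) (norm_nonneg _))
  let B : (Fin n → ℂ) →ₗ[ℂ] A →ₗ[ℂ] ℂ := LinearMap.mk₂ ℂ
    (fun h f => fderiv ℂ (fun z => e z f) p h)
    (fun h h' f => by simp) (fun c h f => by simp)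
    (fun h f g => by
      have : (fun z => e z (f + g)) = fun z => e z f + e z g := by ext; simp
      rw [this, fderiv_fun_add (hd f) (hd g)]; rfl)
    (fun c h f => by
      have : (fun z => e z (c • f)) = fun z => c • e z f := by ext; simp
      rw [this, fderiv_fun_const_smul (hd f)]; rfl)
  let L : (Fin n → ℂ) →L[ℂ] StrongDual ℂ A := LinearMap.mkContinuous₂ B (2 * M / r) (by
    intro h f
    change ‖fderiv ℂ (fun z => e z f) p h‖ ≤ _
    have h1 := norm_fderiv_le_of_forall_ball hr ((he f).mono hsub) (hle f)
    calc _ ≤ ‖fderiv ℂ (fun z => e z f) p‖ * ‖h‖ := ContinuousLinearMap.le_opNorm _ _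
      _ ≤ (2 * (M * ‖f‖) / r) * ‖h‖ := mul_le_mul_of_nonneg_right h1 (norm_nonneg _)
      _ = _ := by ring)
  have hL : HasFDerivAt e L p := by
    rw [hasFDerivAt_iff_isLittleO_nhds_zero]
    have h1 : (fun h : Fin n → ℂ => e (p + h) - e p - L h) =O[𝓝 0] fun h => ‖h‖ ^ 2 := by
      refine Asymptotics.IsBigO.of_bound (C * M) ?_
      filter_upwards [Metric.ball_mem_nhds (0 : Fin n → ℂ) (half_pos hr)] with h hh
      rw [mem_ball_zero_iff] at hh
      refine ContinuousLinearMap.opNorm_le_bound _ (by positivity) fun f => ?_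
      have h2 := hT n (fun z => e z f) p (M * ‖f‖) ((he f).mono hsub) (hle f) h hh
      calc _ = ‖e (p + h) f - e p f - fderiv ℂ (fun z => e z f) p h‖ := rfl
        _ ≤ _ := h2
        _ = _ := by rw [Real.norm_of_nonneg (by positivity)]; ring
    refine h1.trans_isLittleO ?_
    simpa using (Asymptotics.isLittleO_norm_pow_id (E' := Fin n → ℂ) one_lt_two)
  exact hL.differentiableAt.differentiableWithinAt

/-- The dual of a Hilbert space carries a Hilbert space structure inducing the dual norm. -/
noncomputable abbrev dualInnerProductSpace (A : Type*) [NormedAddCommGroup A] [InnerProductSpace ℂ A]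
    [CompleteSpace A] : InnerProductSpace ℂ (StrongDual ℂ A) :=
  InnerProductSpace.ofNorm ℂ fun x y => by
    have h := parallelogram_law_with_norm ℂ ((InnerProductSpace.toDual ℂ A).symm x)
      ((InnerProductSpace.toDual ℂ A).symm y)
    rw [← map_add, ← map_sub] at h
    simp only [LinearIsometryEquiv.norm_map] at h
    simpa [pow_two] using h

/-- The classes in `L²(Ω)` with a holomorphic representative. -/
def bergmanSpace (n : ℕ) (Ω : Set (Fin n → ℂ)) : Submodule ℂ (Lp ℂ 2 (volume.restrict Ω)) where
  carrier := {f | ∃ G, DifferentiableOn ℂ G Ω ∧ f =ᵐ[volume.restrict Ω] G}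
  add_mem' := by
    rintro f g ⟨F, hF, hf⟩ ⟨G, hG, hg⟩
    exact ⟨F + G, hF.add hG, (Lp.coeFn_add f g).trans (hf.add hg)⟩
  zero_mem' := ⟨0, differentiableOn_const 0, Lp.coeFn_zero _ _ _⟩
  smul_mem' := by
    rintro c f ⟨F, hF, hf⟩
    exact ⟨c • F, hF.const_smul c, (Lp.coeFn_smul c f).trans (hf.const_smul c)⟩

theorem DifferentiableOn.integral_mul_wderBar_eq_zero {n : ℕ} {Ω : Set (Fin n → ℂ)}
    (hΩ : IsOpen Ω) {G ψ : (Fin n → ℂ) → ℂ} (hG : DifferentiableOn ℂ G Ω) (hψ : IsTestFun n ψ Ω)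
    (j : Fin n) : ∫ z in Ω, G z * wderBar n j ψ z = 0 := by
  rw [← (hψ.mul_left hΩ (hG.contDiffOn_real_pi hΩ)).integral_wderBar j]
  refine setIntegral_congr_fun hΩ.measurableSet fun z hz => ?_
  have hd := hG.differentiableAt (hΩ.mem_nhds hz)
  change _ = wderBar n j (fun z => G z * ψ z) z
  rw [wderBar_mul (hd.restrictScalars ℝ) (hψ.1.differentiable (by simp) z),
    wderBar_eq_zero_of_differentiableAt hd]
  ring

theorem isClosed_bergmanSpace {n : ℕ} {Ω : Set (Fin n → ℂ)} (hΩ : IsOpen Ω) :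
    IsClosed (bergmanSpace n Ω : Set (Lp ℂ 2 (volume.restrict Ω))) := by
  refine isClosed_of_closure_subset fun f hf => ?_
  obtain ⟨G, hG, hfG⟩ := weyl_lemma hΩ (Lp.memLp f) (fun ψ hψ j => by
    have hm : MemLp (fun z => conj (wderBar n j ψ z)) 2 (volume.restrict Ω) :=
      ((hψ.wderBar j).star.1.continuous.memLp_of_hasCompactSupport
        (hψ.wderBar j).star.2.1).restrict Ω
    have key : ∀ f : Lp ℂ 2 (volume.restrict Ω),
        inner ℂ (hm.toLp _) f = ∫ z in Ω, f z * wderBar n j ψ z := by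
      intro f
      rw [L2.inner_def]
      refine integral_congr_ae ?_
      filter_upwards [hm.coeFn_toLp] with z hz
      rw [hz, RCLike.inner_apply, starRingEnd_self_apply]
    rw [← key]
    have hcl : IsClosed {f : Lp ℂ 2 (volume.restrict Ω) | inner ℂ (hm.toLp _) f = 0} :=
      isClosed_eq (by fun_prop) continuous_const
    refine closure_minimal ?_ hcl hf
    rintro f ⟨G, hG, hfG⟩
    rw [mem_ofPred_eq, key, ← hG.integral_mul_wderBar_eq_zero hΩ hψ j]
    exact integral_congr_ae (hfG.mul (ae_eq_refl _)))
  exact ⟨G, hG, hfG⟩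

section BergmanEvaluation

variable {n : ℕ} {Ω : Set (Fin n → ℂ)}

theorem norm_sq_eq_l2sq {f : Lp ℂ 2 (volume.restrict Ω)} {G : (Fin n → ℂ) → ℂ}
    (h : f =ᵐ[volume.restrict Ω] G) : ‖f‖ ^ 2 = l2sq n Ω G := by
  have h1 : ((‖f‖ ^ 2 : ℝ) : ℂ) = ∫ z in Ω, ((‖G z‖ ^ 2 : ℝ) : ℂ) := by
    have h2 := inner_self_eq_norm_sq_to_K (𝕜 := ℂ) f
    rw [L2.inner_def] at h2
    push_cast
    rw [← RCLike.ofReal_eq_complex_ofReal, ← h2]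
    refine integral_congr_ae ?_
    filter_upwards [h] with z hz
    rw [hz, inner_self_eq_norm_sq_to_K]
  rw [integral_complex_ofReal] at h1
  exact_mod_cast h1

theorem exists_mem_bergmanSpace (hΩ : IsOpen Ω) {g : (Fin n → ℂ) → ℂ} (hg : InBergman n Ω g) :
    ∃ a : bergmanSpace n Ω, (a : Lp ℂ 2 (volume.restrict Ω)) =ᵐ[volume.restrict Ω] g := by
  have hm : MemLp g 2 (volume.restrict Ω) := (memLp_two_iff_integrable_sq_norm
    (hg.1.continuousOn.aestronglyMeasurable hΩ.measurableSet)).2 hg.2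
  exact ⟨⟨hm.toLp g, g, hg.1, hm.coeFn_toLp⟩, hm.coeFn_toLp⟩

/-- The holomorphic representative of an element of the Bergman space. -/
noncomputable def bergmanRep (n : ℕ) (Ω : Set (Fin n → ℂ)) (a : bergmanSpace n Ω) :
    (Fin n → ℂ) → ℂ := a.2.choose

theorem differentiableOn_bergmanRep (a : bergmanSpace n Ω) :
    DifferentiableOn ℂ (bergmanRep n Ω a) Ω := a.2.choose_spec.1

theorem coeFn_ae_eq_bergmanRep (a : bergmanSpace n Ω) :
    (a : Lp ℂ 2 (volume.restrict Ω)) =ᵐ[volume.restrict Ω] bergmanRep n Ω a := a.2.choose_spec.2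

theorem eqOn_bergmanRep (hΩ : IsOpen Ω) {a : bergmanSpace n Ω} {g : (Fin n → ℂ) → ℂ}
    (hg : DifferentiableOn ℂ g Ω)
    (h : (a : Lp ℂ 2 (volume.restrict Ω)) =ᵐ[volume.restrict Ω] g) :
    EqOn (bergmanRep n Ω a) g Ω :=
  Measure.eqOn_open_of_ae_eq ((coeFn_ae_eq_bergmanRep a).symm.trans h) hΩ
    (differentiableOn_bergmanRep a).continuousOn hg.continuousOn

theorem inBergman_bergmanRep (hΩ : IsOpen Ω) (a : bergmanSpace n Ω) :
    InBergman n Ω (bergmanRep n Ω a) := by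
  refine ⟨differentiableOn_bergmanRep a, ?_⟩
  refine (memLp_two_iff_integrable_sq_norm
    ((differentiableOn_bergmanRep a).continuousOn.aestronglyMeasurable hΩ.measurableSet)).1 ?_
  exact (memLp_congr_ae (coeFn_ae_eq_bergmanRep a)).1 (Lp.memLp _)

theorem exists_bergmanRep_bound (hΩ : IsOpen Ω) {p : Fin n → ℂ} (hp : p ∈ Ω) :
    ∃ r > 0, ∃ M ≥ 0, Metric.ball p r ⊆ Ω ∧ ∀ z ∈ Metric.ball p r, ∀ a,
      ‖bergmanRep n Ω a z‖ ≤ M * ‖a‖ := by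
  obtain ⟨s, hs, hsub⟩ := Metric.isOpen_iff.1 hΩ p hp
  obtain ⟨C, hC, h⟩ := exists_sq_mul_jac_le n
  have h2 : 0 < s / 2 := half_pos hs
  have hJ := realJac_pos (scaleEquiv n h2)
  refine ⟨s / 2, h2, Real.sqrt (C / realJac n (scaleEquiv n h2)), Real.sqrt_nonneg _,
    (Metric.ball_subset_ball (by linarith)).trans hsub, fun z hz a => ?_⟩
  have h3 := h (scaleEquiv n h2) z Ω (bergmanRep n Ω a) (by
    rintro _ ⟨x, hx, rfl⟩
    apply hsub
    rw [Metric.mem_ball, dist_eq_norm] at hz ⊢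
    rw [mem_ball_zero_iff] at hx
    have : z + scaleEquiv n h2 x - p = (z - p) + scaleEquiv n h2 x := by abel
    rw [this]
    refine (norm_add_le _ _).trans_lt ?_
    rw [scaleEquiv_apply, norm_smul, Complex.norm_real, Real.norm_of_nonneg h2.le]
    nlinarith) hΩ.measurableSet
    (differentiableOn_bergmanRep a) (inBergman_bergmanRep hΩ a).2
  have h4 : ‖a‖ ^ 2 = ∫ y in Ω, ‖bergmanRep n Ω a y‖ ^ 2 :=
    norm_sq_eq_l2sq (coeFn_ae_eq_bergmanRep a)
  rw [← h4] at h3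
  rw [← Real.sqrt_sq (norm_nonneg a), ← Real.sqrt_mul (by positivity)]
  refine Real.le_sqrt_of_sq_le ?_
  rw [div_mul_eq_mul_div, le_div_iff₀ hJ]
  exact h3

theorem exists_evaluation (hΩ : IsOpen Ω) {p : Fin n → ℂ} (hp : p ∈ Ω) :
    ∃ e : StrongDual ℂ (bergmanSpace n Ω), ∀ a, e a = bergmanRep n Ω a p := by
  obtain ⟨r, hr, M, hM, -, h⟩ := exists_bergmanRep_bound hΩ hp
  let L : bergmanSpace n Ω →ₗ[ℂ] ℂ :=
    { toFun := fun a => bergmanRep n Ω a p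
      map_add' := fun a b => eqOn_bergmanRep hΩ
        ((differentiableOn_bergmanRep a).add (differentiableOn_bergmanRep b))
        ((Lp.coeFn_add _ _).trans
          ((coeFn_ae_eq_bergmanRep a).add (coeFn_ae_eq_bergmanRep b))) hp
      map_smul' := fun c a => eqOn_bergmanRep hΩ
        ((differentiableOn_bergmanRep a).const_smul c)
        ((Lp.coeFn_smul _ _).trans ((coeFn_ae_eq_bergmanRep a).const_smul c)) hp }
  exact ⟨L.mkContinuous M (h p (Metric.mem_ball_self hr)), fun a => rfl⟩

theorem exists_hilbert_of_dual {A : Type} [NormedAddCommGroup A] [InnerProductSpace ℂ A]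
    [CompleteSpace A] {E : (Fin n → ℂ) → StrongDual ℂ A} (hE : DifferentiableOn ℂ E Ω)
    (hK : ∀ p ∈ Ω, ‖E p‖ ^ 2 = bergmanKernel n Ω p)
    (hf : ∀ f, InBergman n Ω f → ∃ a : A, ‖a‖ ^ 2 = l2sq n Ω f ∧ ∀ p ∈ Ω, E p a = f p) :
    ∃ (F : Type) (_ : NormedAddCommGroup F) (_ : InnerProductSpace ℂ F) (_ : CompleteSpace F)
      (E : (Fin n → ℂ) → F), DifferentiableOn ℂ E Ω ∧
      (∀ p ∈ Ω, ‖E p‖ ^ 2 = bergmanKernel n Ω p) ∧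
      ∀ f, InBergman n Ω f → ∃ Λ : StrongDual ℂ F,
        ‖Λ‖ ^ 2 ≤ l2sq n Ω f ∧ ∀ p ∈ Ω, Λ (E p) = f p := by
  refine ⟨StrongDual ℂ A, inferInstance, dualInnerProductSpace A, inferInstance, E, hE, hK, ?_⟩
  intro f hfB
  obtain ⟨a, ha, hap⟩ := hf f hfB
  refine ⟨ContinuousLinearMap.apply ℂ ℂ a, ?_, hap⟩
  rw [← ha]
  gcongr
  refine ContinuousLinearMap.opNorm_le_bound _ (norm_nonneg _) fun e => ?_
  rw [mul_comm]
  exact e.le_opNorm a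

/-- The Bergman kernel on the diagonal is the squared norm of a holomorphic map into a Hilbert
space on which the elements of the Bergman space act as functionals. -/
theorem exists_bergman_hilbert (hΩ : IsOpen Ω) :
    ∃ (F : Type) (_ : NormedAddCommGroup F) (_ : InnerProductSpace ℂ F) (_ : CompleteSpace F)
      (E : (Fin n → ℂ) → F), DifferentiableOn ℂ E Ω ∧
      (∀ p ∈ Ω, ‖E p‖ ^ 2 = bergmanKernel n Ω p) ∧
      ∀ f, InBergman n Ω f → ∃ Λ : StrongDual ℂ F,
        ‖Λ‖ ^ 2 ≤ l2sq n Ω f ∧ ∀ p ∈ Ω, Λ (E p) = f p := by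
  have : CompleteSpace (bergmanSpace n Ω) := (isClosed_bergmanSpace hΩ).completeSpace_coe
  have hex : ∀ p, ∃ e : StrongDual ℂ (bergmanSpace n Ω), p ∈ Ω → ∀ a, e a = bergmanRep n Ω a p := by
    intro p
    by_cases hp : p ∈ Ω
    · obtain ⟨e, he⟩ := exists_evaluation hΩ hp
      exact ⟨e, fun _ => he⟩
    · exact ⟨0, fun h => absurd h hp⟩
  choose E hE using hex
  have hfun : ∀ f, InBergman n Ω f → ∃ a : bergmanSpace n Ω, ‖a‖ ^ 2 = l2sq n Ω f ∧
      ∀ p ∈ Ω, E p a = f p := by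
    intro f hf
    obtain ⟨a, ha⟩ := exists_mem_bergmanSpace hΩ hf
    exact ⟨a, norm_sq_eq_l2sq ha, fun p hp => by rw [hE p hp, eqOn_bergmanRep hΩ hf.1 ha hp]⟩
  refine exists_hilbert_of_dual (A := bergmanSpace n Ω) (E := E) ?_ ?_ hfun
  · refine differentiableOn_dual_of_apply (fun a => ?_) fun p hp => ?_
    · exact (differentiableOn_bergmanRep a).congr fun p hp => hE p hp a
    · obtain ⟨r, hr, M, hM, hsub, h⟩ := exists_bergmanRep_bound hΩ hp
      refine ⟨r, hr, M, hsub, fun z hz => ContinuousLinearMap.opNorm_le_bound _ hM fun a => ?_⟩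
      rw [hE z (hsub hz)]
      exact h z hz a
  · intro p hp
    have hub : ∀ x ∈ {r | ∃ f, InBergman n Ω f ∧ l2sq n Ω f ≤ 1 ∧ r = ‖f p‖ ^ 2},
        x ≤ ‖E p‖ ^ 2 := by
      rintro x ⟨f, hf, hf1, rfl⟩
      obtain ⟨a, ha, hap⟩ := hfun f hf
      have ha1 : ‖a‖ ≤ 1 := by
        rw [← ha] at hf1
        nlinarith [norm_nonneg a]
      rw [← hap p hp]
      gcongr
      calc ‖E p a‖ ≤ ‖E p‖ * ‖a‖ := (E p).le_opNorm a
        _ ≤ ‖E p‖ * 1 := by gcongr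
        _ = _ := mul_one _
    refine le_antisymm ?_ (csSup_le ⟨0, 0, ⟨differentiableOn_const 0, by simp⟩, by
      simp [l2sq], by simp⟩ hub)
    have hbdd : BddAbove {r | ∃ f, InBergman n Ω f ∧ l2sq n Ω f ≤ 1 ∧ r = ‖f p‖ ^ 2} :=
      ⟨_, hub⟩
    have hK0 : 0 ≤ bergmanKernel n Ω p :=
      Real.sSup_nonneg (by rintro x ⟨f, -, -, rfl⟩; positivity)
    have hle : ‖E p‖ ≤ Real.sqrt (bergmanKernel n Ω p) := by
      refine ContinuousLinearMap.opNorm_le_of_unit_norm (Real.sqrt_nonneg _) fun a ha => ?_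
      refine Real.le_sqrt_of_sq_le (le_csSup hbdd ⟨bergmanRep n Ω a, inBergman_bergmanRep hΩ a,
        ?_, by rw [hE p hp]⟩)
      rw [← norm_sq_eq_l2sq (coeFn_ae_eq_bergmanRep a)]
      change ‖a‖ ^ 2 ≤ 1
      rw [ha]
      norm_num
    exact (Real.le_sqrt (norm_nonneg (E p)) hK0).1 hle

end BergmanEvaluation

open scoped ContDiff

/-- Uniform bounds for the derivatives of `‖f‖²` up to order `N`, for bounded holomorphic `f`. -/
theorem exists_norm_iteratedFDeriv_norm_sq_le (N : ℕ) {s : ℝ} (hs : 0 < s) (m : ℝ) :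
    ∃ C, 0 ≤ C ∧ ∀ (n : ℕ) (F : Type) [NormedAddCommGroup F] [InnerProductSpace ℂ F]
      [CompleteSpace F] (f : (Fin n → ℂ) → F), DifferentiableOn ℂ f (Metric.ball 0 s) →
      (∀ w ∈ Metric.ball (0 : Fin n → ℂ) s, ‖f w‖ ≤ m) →
      ∀ i ≤ N, ‖iteratedFDeriv ℝ i (fun z => ‖f z‖ ^ 2) 0‖ ≤ C := by
  choose B hB0 hB using fun i => exists_norm_iteratedFDeriv_le i hs
  set S : ℝ := ∑ i ∈ Finset.range (N + 1), B i * |m| with hS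
  have hS0 : 0 ≤ S := Finset.sum_nonneg fun i _ => mul_nonneg (hB0 i) (abs_nonneg m)
  have hSi : ∀ i ≤ N, B i * |m| ≤ S := fun i hi =>
    Finset.single_le_sum (f := fun i => B i * |m|)
      (fun i _ => mul_nonneg (hB0 i) (abs_nonneg m)) (Finset.mem_range.2 (by omega))
  refine ⟨2 ^ N * S ^ 2, by positivity, ?_⟩
  intro n F _ _ _ f hf hfm i hi
  let _ : InnerProductSpace ℝ F := InnerProductSpace.complexToReal
  have hfi : ∀ k ≤ N, ‖iteratedFDerivWithin ℝ k f (Metric.ball 0 s) 0‖ ≤ S := by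
    intro k hk
    rw [iteratedFDerivWithin_of_isOpen k Metric.isOpen_ball (Metric.mem_ball_self hs)]
    exact (hB k n F f 0 |m| hf fun w hw => (hfm w hw).trans (le_abs_self m)).trans (hSi k hk)
  have hcd : ContDiffOn ℝ ∞ f (Metric.ball 0 s) := hf.contDiffOn_real_pi Metric.isOpen_ball
  have h := (innerSL ℝ (E := F)).norm_iteratedFDerivWithin_le_of_bilinear hcd hcd
    Metric.isOpen_ball.uniqueDiffOn (Metric.mem_ball_self hs) (n := i) (by exact_mod_cast le_top)
  have hfun : (fun y => (innerSL ℝ (E := F)) (f y) (f y)) = fun z => ‖f z‖ ^ 2 := by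
    ext y
    exact real_inner_self_eq_norm_sq (f y)
  rw [iteratedFDerivWithin_of_isOpen i Metric.isOpen_ball (Metric.mem_ball_self hs), hfun] at h
  have hsum : ∑ k ∈ Finset.range (i + 1), (i.choose k : ℝ) *
      ‖iteratedFDerivWithin ℝ k f (Metric.ball 0 s) 0‖ *
      ‖iteratedFDerivWithin ℝ (i - k) f (Metric.ball 0 s) 0‖ ≤ 2 ^ N * S ^ 2 := by
    calc _ ≤ ∑ k ∈ Finset.range (i + 1), (i.choose k : ℝ) * S ^ 2 := by
          refine Finset.sum_le_sum fun k hk => ?_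
          rw [Finset.mem_range] at hk
          rw [mul_assoc, pow_two]
          gcongr
          · exact hfi k (by omega)
          · exact hfi _ (by omega)
      _ = 2 ^ i * S ^ 2 := by
          rw [← Finset.sum_mul]
          congr 1
          exact_mod_cast Nat.sum_range_choose i
      _ ≤ _ := by gcongr; norm_num
  refine h.trans ((mul_le_mul_of_nonneg_right (norm_innerSL_le ℝ) ?_).trans ?_)
  · exact Finset.sum_nonneg fun k _ => by positivity
  · rw [one_mul]; exact hsum

/-- A uniform bound for the derivatives of `log ‖e‖²` at a point near which the holomorphic map
`e` is controlled by its value at the point. -/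
theorem exists_norm_iteratedFDeriv_log_le {N : ℕ} (hN : N ≠ 0) {s : ℝ} (hs : 0 < s) (m : ℝ) :
    ∃ C, 0 ≤ C ∧ ∀ (n : ℕ) (F : Type) [NormedAddCommGroup F] [InnerProductSpace ℂ F]
      [CompleteSpace F] (e : (Fin n → ℂ) → F), DifferentiableOn ℂ e (Metric.ball 0 s) → e 0 ≠ 0 →
      (∀ w ∈ Metric.ball (0 : Fin n → ℂ) s, ‖e w‖ ≤ m * ‖e 0‖) →
      ‖iteratedFDeriv ℝ N (fun z => Real.log (‖e z‖ ^ 2)) 0‖ ≤ C := by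
  obtain ⟨A, hA, hbd⟩ := exists_norm_iteratedFDeriv_norm_sq_le N hs m
  set L : ℝ := ∑ i ∈ Finset.range (N + 1), ‖iteratedFDerivWithin ℝ i Real.log (Ioi 0) 1‖ with hL
  have hL0 : 0 ≤ L := Finset.sum_nonneg fun i _ => norm_nonneg _
  refine ⟨N.factorial * L * (1 + A) ^ N, by positivity, ?_⟩
  intro n F _ _ _ e he h0 hem
  set c : ℝ := ‖e 0‖ with hc
  have hc0 : 0 < c := norm_pos_iff.2 h0
  set f : (Fin n → ℂ) → F := fun z => ((c⁻¹ : ℝ) : ℂ) • e z with hf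
  have hfn : ∀ z, ‖f z‖ = c⁻¹ * ‖e z‖ := fun z => by
    rw [hf, norm_smul, Complex.norm_real, Real.norm_of_nonneg (by positivity)]
  have hfd : DifferentiableOn ℂ f (Metric.ball 0 s) := he.const_smul _
  have hf0 : ‖f 0‖ = 1 := by rw [hfn, ← hc, inv_mul_cancel₀ hc0.ne']
  have hb := hbd n F f hfd (fun w hw => by
    rw [hfn, inv_mul_le_iff₀ hc0, mul_comm]
    exact hem w hw)
  set U : Set (Fin n → ℂ) := Metric.ball 0 s ∩ f ⁻¹' {0}ᶜ with hU
  have hUo : IsOpen U := hfd.continuousOn.isOpen_inter_preimage Metric.isOpen_ball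
    isOpen_compl_singleton
  have h0U : (0 : Fin n → ℂ) ∈ U := ⟨Metric.mem_ball_self hs, by
    intro h
    rw [mem_singleton_iff] at h
    rw [h, norm_zero] at hf0
    exact zero_ne_one hf0⟩
  have hcd : ContDiffOn ℝ ∞ (fun z => ‖f z‖ ^ 2) U := by
    let _ : InnerProductSpace ℝ F := InnerProductSpace.complexToReal
    have := (hfd.contDiffOn_real_pi Metric.isOpen_ball).mono (inter_subset_left : U ⊆ _)
    exact this.norm_sq ℝ
  have hlog : ContDiffOn ℝ ∞ Real.log (Ioi 0) := fun x hx =>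
    (Real.contDiffAt_log.2 (ne_of_gt hx)).contDiffWithinAt
  have hmaps : MapsTo (fun z => ‖f z‖ ^ 2) U (Ioi 0) := fun z hz => by
    have : f z ≠ 0 := hz.2
    exact pow_pos (norm_pos_iff.2 this) 2
  have key := norm_iteratedFDerivWithin_comp_le hlog hcd (n := N) (by exact_mod_cast le_top)
    isOpen_Ioi.uniqueDiffOn hUo.uniqueDiffOn hmaps h0U (C := L) (D := 1 + A) (fun i hi => by
      change ‖iteratedFDerivWithin ℝ i Real.log (Ioi 0) (‖f 0‖ ^ 2)‖ ≤ L
      rw [hf0, one_pow]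
      exact Finset.single_le_sum (f := fun i => ‖iteratedFDerivWithin ℝ i Real.log (Ioi 0) 1‖)
        (fun i _ => norm_nonneg _) (Finset.mem_range.2 (by omega))) (fun i hi1 hi => by
      rw [iteratedFDerivWithin_of_isOpen i hUo h0U]
      calc _ ≤ A := hb i hi
        _ ≤ 1 + A := by linarith
        _ = (1 + A) ^ 1 := (pow_one _).symm
        _ ≤ _ := pow_le_pow_right₀ (by linarith) hi1)
  rw [iteratedFDerivWithin_of_isOpen N hUo h0U] at key
  have heq : (fun z => Real.log (‖e z‖ ^ 2)) =ᶠ[𝓝 0]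
      (fun _ => Real.log (c ^ 2)) + Real.log ∘ fun z => ‖f z‖ ^ 2 := by
    filter_upwards [hUo.mem_nhds h0U] with z hz
    have hz0 : f z ≠ 0 := hz.2
    change _ = Real.log (c ^ 2) + Real.log (‖f z‖ ^ 2)
    rw [← Real.log_mul (by positivity) (pow_pos (norm_pos_iff.2 hz0) 2).ne', hfn]
    congr 1
    field_simp
  rw [(heq.iteratedFDeriv ℝ N).eq_of_nhds, iteratedFDeriv_add_apply contDiffAt_const,
    iteratedFDeriv_const_of_ne hN]
  · simpa using key
  · exact ((hlog.comp hcd hmaps).contDiffAt (hUo.mem_nhds h0U)).of_le (by exact_mod_cast le_top)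

open scoped ComplexConjugate ContDiff
section DirectionalWirtinger

variable {n : ℕ} {u : (Fin n → ℂ) → ℂ} {z : Fin n → ℂ} {U : Set (Fin n → ℂ)}

/-- The functional `g ↦ (g X + c g(iX)) / 2`. -/
noncomputable def wirtingerCLM (n : ℕ) (c : ℂ) (X : Fin n → ℂ) :
    ((Fin n → ℂ) →L[ℝ] ℂ) →L[ℝ] ℂ :=
  (1 / 2 : ℝ) • (ContinuousLinearMap.apply ℝ ℂ X +
    c • ContinuousLinearMap.apply ℝ ℂ (Complex.I • X))

theorem wirtingerCLM_apply (c : ℂ) (X : Fin n → ℂ) (g : (Fin n → ℂ) →L[ℝ] ℂ) :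
    wirtingerCLM n c X g = (1 / 2) * (g X + c * g (Complex.I • X)) := by
  simp [wirtingerCLM, Complex.real_smul, mul_add]

theorem norm_wirtingerCLM_le {c : ℂ} (hc : ‖c‖ = 1) (X : Fin n → ℂ) :
    ‖wirtingerCLM n c X‖ ≤ ‖X‖ := by
  refine ContinuousLinearMap.opNorm_le_bound _ (norm_nonneg _) fun g => ?_
  rw [wirtingerCLM_apply, norm_mul]
  have h1 := g.le_opNorm X
  have h2 := g.le_opNorm (Complex.I • X)
  have h3 := norm_add_le (g X) (c * g (Complex.I • X))
  rw [norm_mul, hc, one_mul] at h3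
  rw [norm_smul, Complex.norm_I, one_mul] at h2
  have h4 : ‖(1 / 2 : ℂ)‖ = 1 / 2 := by norm_num
  rw [h4]
  linarith

theorem wirtingerCLM_neg_I_fderiv (X : Fin n → ℂ) :
    wirtingerCLM n (-Complex.I) X (fderiv ℝ u z) = ∑ j, X j * wder n j u z := by
  rw [wirtingerCLM_apply, fderiv_apply_of_wder, fderiv_apply_of_wder, Finset.mul_sum,
    ← Finset.sum_add_distrib, Finset.mul_sum]
  refine Finset.sum_congr rfl fun j _ => ?_
  simp only [Pi.smul_apply, smul_eq_mul, map_mul, Complex.conj_I]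
  linear_combination (-1 / 2 * X j * wder n j u z
    + 1 / 2 * conj (X j) * wderBar n j u z) * Complex.I_mul_I

theorem wirtingerCLM_I_fderiv (X : Fin n → ℂ) :
    wirtingerCLM n Complex.I X (fderiv ℝ u z) = ∑ j, conj (X j) * wderBar n j u z := by
  rw [wirtingerCLM_apply, fderiv_apply_of_wder, fderiv_apply_of_wder, Finset.mul_sum,
    ← Finset.sum_add_distrib, Finset.mul_sum]
  refine Finset.sum_congr rfl fun j _ => ?_
  simp only [Pi.smul_apply, smul_eq_mul, map_mul, Complex.conj_I]
  linear_combination (1 / 2 * X j * wder n j u z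
    - 1 / 2 * conj (X j) * wderBar n j u z) * Complex.I_mul_I

theorem ContDiffOn.wirtingerCLM_fderiv (hu : ContDiffOn ℝ ∞ u U) (hU : IsOpen U) (c : ℂ)
    (X : Fin n → ℂ) : ContDiffOn ℝ ∞ (fun w => wirtingerCLM n c X (fderiv ℝ u w)) U :=
  (wirtingerCLM n c X).contDiff.comp_contDiffOn (hu.fderiv_of_isOpen hU (by simp))

theorem norm_iteratedFDeriv_wirtingerCLM_le (hu : ContDiffOn ℝ ∞ u U) (hU : IsOpen U) (hz : z ∈ U)
    {c : ℂ} (hc : ‖c‖ = 1) (X : Fin n → ℂ) (i : ℕ) :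
    ‖iteratedFDeriv ℝ i (fun w => wirtingerCLM n c X (fderiv ℝ u w)) z‖ ≤
      ‖X‖ * ‖iteratedFDeriv ℝ (i + 1) u z‖ := by
  have h1 : ContDiffAt ℝ ∞ (fderiv ℝ u) z :=
    (hu.fderiv_of_isOpen hU (m := ∞) (by simp)).contDiffAt (hU.mem_nhds hz)
  have h2 := (wirtingerCLM n c X).norm_iteratedFDeriv_comp_left h1 (n := i)
    (by exact_mod_cast le_top)
  rw [norm_iteratedFDeriv_fderiv] at h2
  exact h2.trans (mul_le_mul_of_nonneg_right (norm_wirtingerCLM_le hc X) (norm_nonneg _))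

theorem wirtingerCLM_comp_affine (T : (Fin n → ℂ) ≃L[ℂ] (Fin n → ℂ)) (c : ℂ) (X ζ : Fin n → ℂ) :
    wirtingerCLM n c X (fderiv ℝ u (z + T ζ)) =
      wirtingerCLM n c (T.symm X) (fderiv ℝ (fun ζ => u (z + T ζ)) ζ) := by
  have h : fderiv ℝ (fun ζ => u (z + T ζ)) ζ =
      (fderiv ℝ u (z + T ζ)).comp
        ((T : (Fin n → ℂ) →L[ℂ] (Fin n → ℂ)).restrictScalars ℝ) := by
    have h1 := (T.restrictScalars ℝ).comp_right_fderiv (f := fun y => u (z + y)) (x := ζ)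
    rw [fderiv_comp_add_left] at h1
    exact h1
  rw [h, wirtingerCLM_apply, wirtingerCLM_apply]
  simp

/-- The bound for the fourth order contraction `∂_Y ∂̄_Y ∂_X ∂̄_X` in affine coordinates. -/
theorem norm_wirtinger_four_le (hu : ContDiffOn ℝ ∞ u U) (hU : IsOpen U) (hz : z ∈ U)
    (T : (Fin n → ℂ) ≃L[ℂ] (Fin n → ℂ)) {c₁ c₂ c₃ c₄ : ℂ} (h₁ : ‖c₁‖ = 1) (h₂ : ‖c₂‖ = 1)
    (h₃ : ‖c₃‖ = 1) (h₄ : ‖c₄‖ = 1) (X Y : Fin n → ℂ) :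
    ‖wirtingerCLM n c₄ Y (fderiv ℝ (fun w => wirtingerCLM n c₃ Y (fderiv ℝ (fun w =>
      wirtingerCLM n c₂ X (fderiv ℝ (fun w => wirtingerCLM n c₁ X (fderiv ℝ u w)) w)) w)) z)‖ ≤
      ‖T.symm X‖ ^ 2 * ‖T.symm Y‖ ^ 2 * ‖iteratedFDeriv ℝ 4 (fun ζ => u (z + T ζ)) 0‖ := by
  set W : Set (Fin n → ℂ) := (fun ζ => z + T ζ) ⁻¹' U with hW
  have hWo : IsOpen W := hU.preimage (by fun_prop)
  have h0 : (0 : Fin n → ℂ) ∈ W := by simpa [hW] using hz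
  have hv : ContDiffOn ℝ ∞ (fun ζ => u (z + T ζ)) W := by
    refine hu.comp (t := U) ?_ fun ζ hζ => hζ
    exact (contDiff_const.add (T.restrictScalars ℝ).contDiff).contDiffOn
  have hz' : z = z + T 0 := by simp
  conv_lhs => rw [hz']
  simp only [wirtingerCLM_comp_affine T]
  have a1 := hv.wirtingerCLM_fderiv hWo c₁ (T.symm X)
  have a2 := a1.wirtingerCLM_fderiv hWo c₂ (T.symm X)
  have a3 := a2.wirtingerCLM_fderiv hWo c₃ (T.symm Y)
  rw [← norm_iteratedFDeriv_zero (𝕜 := ℝ) (f := fun w => wirtingerCLM n c₄ (T.symm Y)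
    (fderiv ℝ (fun w => wirtingerCLM n c₃ (T.symm Y) (fderiv ℝ (fun w =>
      wirtingerCLM n c₂ (T.symm X) (fderiv ℝ (fun w => wirtingerCLM n c₁ (T.symm X)
        (fderiv ℝ (fun ζ => u (z + T ζ)) w)) w)) w)) w))]
  have b4 := norm_iteratedFDeriv_wirtingerCLM_le a3 hWo h0 h₄ (T.symm Y) 0
  have b3 := norm_iteratedFDeriv_wirtingerCLM_le a2 hWo h0 h₃ (T.symm Y) 1
  have b2 := norm_iteratedFDeriv_wirtingerCLM_le a1 hWo h0 h₂ (T.symm X) 2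
  have b1 := norm_iteratedFDeriv_wirtingerCLM_le hv hWo h0 h₁ (T.symm X) 3
  calc _ ≤ ‖T.symm Y‖ * (‖T.symm Y‖ * (‖T.symm X‖ * (‖T.symm X‖ *
        ‖iteratedFDeriv ℝ 4 (fun ζ => u (z + T ζ)) 0‖))) := by
        refine b4.trans ?_
        gcongr
        refine b3.trans ?_
        gcongr
        refine b2.trans ?_
        gcongr
    _ = _ := by ring

end DirectionalWirtinger

section CurvatureForm

open scoped ComplexConjugate ContDiff ComplexOrder

variable {n : ℕ} {z : Fin n → ℂ} {U : Set (Fin n → ℂ)} {φ : (Fin n → ℂ) → ℝ}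

theorem wder_sum_const_mul {ι : Type*} [Fintype ι] {c : ι → ℂ} {f : ι → (Fin n → ℂ) → ℂ}
    (hf : ∀ i, DifferentiableAt ℝ (f i) z) (k : Fin n) :
    wder n k (fun w => ∑ i, c i * f i w) z = ∑ i, c i * wder n k (f i) z := by
  have h : ∀ a, fderiv ℝ (fun w => ∑ i, c i * f i w) z a = ∑ i, c i * fderiv ℝ (f i) z a := by
    intro a
    rw [fderiv_fun_sum fun i _ => (hf i).const_mul (c i), sum_apply]
    exact Finset.sum_congr rfl fun i _ => by rw [fderiv_const_mul (hf i)]; rfl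
  simp only [wder, h, Finset.mul_sum, ← Finset.sum_sub_distrib]
  exact Finset.sum_congr rfl fun i _ => by ring

theorem wderBar_sum_const_mul {ι : Type*} [Fintype ι] {c : ι → ℂ} {f : ι → (Fin n → ℂ) → ℂ}
    (hf : ∀ i, DifferentiableAt ℝ (f i) z) (k : Fin n) :
    wderBar n k (fun w => ∑ i, c i * f i w) z = ∑ i, c i * wderBar n k (f i) z := by
  have h : ∀ a, fderiv ℝ (fun w => ∑ i, c i * f i w) z a = ∑ i, c i * fderiv ℝ (f i) z a := by
    intro a
    rw [fderiv_fun_sum fun i _ => (hf i).const_mul (c i), sum_apply]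
    exact Finset.sum_congr rfl fun i _ => by rw [fderiv_const_mul (hf i)]; rfl
  simp only [wderBar, h, Finset.mul_sum, ← Finset.sum_add_distrib]
  exact Finset.sum_congr rfl fun i _ => by ring

theorem ContDiffOn.cHess_apply (hφ : ContDiffOn ℝ ∞ φ U) (hU : IsOpen U) (j k : Fin n) :
    ContDiffOn ℝ ∞ (fun v => cHess n φ v j k) U :=
  (hφ.ofReal_complex.wder hU j).wderBar hU k

theorem wirtinger_four_eq_sum (hφ : ContDiffOn ℝ ∞ φ U) (hU : IsOpen U) (hz : z ∈ U)
    (X Y : Fin n → ℂ) :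
    wirtingerCLM n Complex.I Y (fderiv ℝ (fun w => wirtingerCLM n (-Complex.I) Y (fderiv ℝ
      (fun w => wirtingerCLM n Complex.I X (fderiv ℝ (fun w => wirtingerCLM n (-Complex.I) X
        (fderiv ℝ (fun v => (φ v : ℂ)) w)) w)) w)) z) =
    ∑ h, ∑ j, ∑ k, ∑ l, wderBar n l (fun w => wder n k (fun v => cHess n φ v j h) w) z *
      conj (X h) * X j * Y k * conj (Y l) := by
  have hd1 : ∀ w ∈ U, ∀ j, DifferentiableAt ℝ (wder n j (fun v => (φ v : ℂ))) w := fun w hw j =>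
    (hφ.ofReal_complex.wder hU j).differentiableAt_of_isOpen hU hw
  have hd2 : ∀ w ∈ U, ∀ p : Fin n × Fin n, DifferentiableAt ℝ (fun v => cHess n φ v p.2 p.1) w :=
    fun w hw p => (hφ.cHess_apply hU p.2 p.1).differentiableAt_of_isOpen hU hw
  have hd3 : ∀ w ∈ U, ∀ p : Fin n × Fin n × Fin n,
      DifferentiableAt ℝ (wder n p.1 (fun v => cHess n φ v p.2.2 p.2.1)) w :=
    fun w hw p => ((hφ.cHess_apply hU p.2.2 p.2.1).wder hU p.1).differentiableAt_of_isOpen hU hw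
  simp only [wirtingerCLM_neg_I_fderiv, wirtingerCLM_I_fderiv]
  have e2 : ∀ w ∈ U, ∑ h, conj (X h) * wderBar n h (fun w => ∑ j, X j *
      wder n j (fun v => (φ v : ℂ)) w) w =
      ∑ p : Fin n × Fin n, (conj (X p.1) * X p.2) * cHess n φ w p.2 p.1 := by
    intro w hw
    rw [Fintype.sum_prod_type]
    refine Finset.sum_congr rfl fun h _ => ?_
    rw [wderBar_sum_const_mul (hd1 w hw), Finset.mul_sum]
    exact Finset.sum_congr rfl fun j _ => by rw [cHess]; ring
  have e3 : ∀ w ∈ U, ∑ k, Y k * wder n k (fun w => ∑ h, conj (X h) * wderBar n h (fun w =>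
      ∑ j, X j * wder n j (fun v => (φ v : ℂ)) w) w) w =
      ∑ p : Fin n × Fin n × Fin n, (Y p.1 * (conj (X p.2.1) * X p.2.2)) *
        wder n p.1 (fun v => cHess n φ v p.2.2 p.2.1) w := by
    intro w hw
    rw [Fintype.sum_prod_type]
    refine Finset.sum_congr rfl fun k _ => ?_
    have : (fun w => ∑ h, conj (X h) * wderBar n h (fun w => ∑ j, X j *
        wder n j (fun v => (φ v : ℂ)) w) w) =ᶠ[𝓝 w]
        fun w => ∑ p : Fin n × Fin n, (conj (X p.1) * X p.2) * cHess n φ w p.2 p.1 := by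
      filter_upwards [hU.mem_nhds hw] with w hw using e2 w hw
    rw [this.wder_eq, wder_sum_const_mul (hd2 w hw), Finset.mul_sum]
    exact Finset.sum_congr rfl fun p _ => by ring
  have e4 : (fun w => ∑ k, Y k * wder n k (fun w => ∑ h, conj (X h) * wderBar n h (fun w =>
      ∑ j, X j * wder n j (fun v => (φ v : ℂ)) w) w) w) =ᶠ[𝓝 z]
      fun w => ∑ p : Fin n × Fin n × Fin n, (Y p.1 * (conj (X p.2.1) * X p.2.2)) *
        wder n p.1 (fun v => cHess n φ v p.2.2 p.2.1) w := by
    filter_upwards [hU.mem_nhds hz] with w hw using e3 w hw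
  simp only [e4.wderBar_eq, wderBar_sum_const_mul (hd3 z hz)]
  simp only [Finset.mul_sum, Fintype.sum_prod_type]
  calc _ = ∑ k, ∑ l, ∑ h, ∑ j, conj (Y l) * ((Y k * (conj (X h) * X j)) *
        wderBar n l (wder n k (fun v => cHess n φ v j h)) z) := Finset.sum_comm
    _ = ∑ k, ∑ h, ∑ l, ∑ j, conj (Y l) * ((Y k * (conj (X h) * X j)) *
        wderBar n l (wder n k (fun v => cHess n φ v j h)) z) :=
      Finset.sum_congr rfl fun k _ => Finset.sum_comm
    _ = ∑ h, ∑ k, ∑ l, ∑ j, conj (Y l) * ((Y k * (conj (X h) * X j)) *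
        wderBar n l (wder n k (fun v => cHess n φ v j h)) z) := Finset.sum_comm
    _ = ∑ h, ∑ k, ∑ j, ∑ l, conj (Y l) * ((Y k * (conj (X h) * X j)) *
        wderBar n l (wder n k (fun v => cHess n φ v j h)) z) :=
      Finset.sum_congr rfl fun h _ => Finset.sum_congr rfl fun k _ => Finset.sum_comm
    _ = ∑ h, ∑ j, ∑ k, ∑ l, conj (Y l) * ((Y k * (conj (X h) * X j)) *
        wderBar n l (wder n k (fun v => cHess n φ v j h)) z) :=
      Finset.sum_congr rfl fun h _ => Finset.sum_comm
    _ = _ := by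
      refine Finset.sum_congr rfl fun h _ => Finset.sum_congr rfl fun j _ =>
        Finset.sum_congr rfl fun k _ => Finset.sum_congr rfl fun l _ => ?_
      ring

theorem norm_fourth_order_sum_le (hφ : ContDiffOn ℝ ∞ φ U) (hU : IsOpen U) (hz : z ∈ U)
    (T : (Fin n → ℂ) ≃L[ℂ] (Fin n → ℂ)) (X Y : Fin n → ℂ) :
    ‖∑ h, ∑ j, ∑ k, ∑ l, wderBar n l (fun w => wder n k (fun v => cHess n φ v j h) w) z *
      conj (X h) * X j * Y k * conj (Y l)‖ ≤
      ‖T.symm X‖ ^ 2 * ‖T.symm Y‖ ^ 2 * ‖iteratedFDeriv ℝ 4 (fun ζ => φ (z + T ζ)) 0‖ := by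
  rw [← wirtinger_four_eq_sum hφ hU hz]
  refine (norm_wirtinger_four_le hφ.ofReal_complex hU hz T (by simp) (by simp) (by simp)
    (by simp) X Y).trans ?_
  gcongr
  have hv : ContDiffAt ℝ ∞ (fun ζ => φ (z + T ζ)) 0 := by
    have h1 : ContDiffAt ℝ ∞ φ (z + T 0) := by
      simpa using hφ.contDiffAt (hU.mem_nhds hz)
    exact h1.comp (0 : Fin n → ℂ)
      (contDiff_const.add (T.restrictScalars ℝ).contDiff).contDiffAt
  have h := Complex.ofRealCLM.norm_iteratedFDeriv_comp_left hv (n := 4)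
    (by simpa using WithTop.coe_le_coe.2 (le_top : (4 : ℕ∞) ≤ ⊤))
  rw [Complex.ofRealCLM_norm, one_mul] at h
  exact h

theorem conj_cHess (hφ : ContDiffOn ℝ ∞ φ U) (hU : IsOpen U) (hz : z ∈ U) (j k : Fin n) :
    conj (cHess n φ z j k) = cHess n φ z k j := by
  have h : (fun w => conj (wder n j (fun v => (φ v : ℂ)) w)) =
      fun w => wderBar n j (fun v => (φ v : ℂ)) w := funext fun w => conj_wder_ofReal φ
  rw [cHess, ← wder_conj, h, cHess]
  exact (wderBar_wder_comm hU hφ.ofReal_complex hz).symm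

theorem posSemidef_cHess (hφ : ContDiffOn ℝ ∞ φ U) (hU : IsOpen U) (hz : z ∈ U)
    (hpos : ∀ X, 0 ≤ hermForm n (cHess n φ z) X X) :
    (Matrix.of (cHess n φ z)).PosSemidef := by
  have hH : (Matrix.of (cHess n φ z)).IsHermitian := by
    ext j k
    exact conj_cHess hφ hU hz k j
  refine Matrix.PosSemidef.of_dotProduct_mulVec_nonneg hH fun x => ?_
  have him := hH.im_star_dotProduct_mulVec_self x
  rw [RCLike.nonneg_iff]
  refine ⟨?_, him⟩
  have h := hpos fun j => conj (x j)
  rw [hermForm] at h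
  convert h using 1
  simp only [dotProduct, Matrix.mulVec, Finset.mul_sum, Pi.star_apply, Matrix.of_apply,
    RCLike.star_def, Complex.conj_conj, RCLike.re_to_complex]
  congr 1
  exact Finset.sum_congr rfl fun j _ => Finset.sum_congr rfl fun k _ => by ring

theorem wderBar_cHess (hφ : ContDiffOn ℝ ∞ φ U) (hU : IsOpen U) (hz : z ∈ U) (l j k : Fin n) :
    wderBar n l (fun v => cHess n φ v j k) z =
      conj (wder n l (fun v => cHess n φ v k j) z) := by
  have h : (fun v => cHess n φ v j k) =ᶠ[𝓝 z] fun v => conj (cHess n φ v k j) := by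
    filter_upwards [hU.mem_nhds hz] with w hw using (conj_cHess hφ hU hw k j).symm
  rw [h.wderBar_eq, wderBar_conj]

theorem re_second_order_sum_nonneg (hφ : ContDiffOn ℝ ∞ φ U) (hU : IsOpen U) (hz : z ∈ U)
    (hpos : ∀ X, 0 ≤ hermForm n (cHess n φ z) X X) (X Y : Fin n → ℂ) :
    0 ≤ (∑ h, ∑ j, ∑ k, ∑ l, (∑ ν, ∑ μ, (Matrix.of (cHess n φ z))⁻¹ ν μ *
      wder n k (fun v => cHess n φ v j μ) z * wderBar n l (fun v => cHess n φ v ν h) z) *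
      conj (X h) * X j * Y k * conj (Y l)).re := by
  set A : Fin n → ℂ := fun μ => ∑ j, ∑ k, X j * Y k * wder n k (fun v => cHess n φ v j μ) z
    with hA
  have h := ((posSemidef_cHess hφ hU hz hpos).inv).re_dotProduct_nonneg A
  convert h using 1
  simp only [RCLike.re_to_complex]
  congr 1
  have hconj : ∀ ν, star (A ν) = ∑ h, ∑ l, conj (X h) * conj (Y l) *
      wderBar n l (fun v => cHess n φ v ν h) z := by
    intro ν
    simp only [hA, RCLike.star_def, map_sum, map_mul, wderBar_cHess hφ hU hz]
  simp only [dotProduct, Matrix.mulVec, Pi.star_apply, hconj]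
  simp only [hA, Finset.mul_sum, Finset.sum_mul]
  calc _ = ∑ p : Fin n × Fin n × Fin n × Fin n × Fin n × Fin n,
        (Matrix.of (cHess n φ z))⁻¹ p.2.2.2.2.1 p.2.2.2.2.2 *
        wder n p.2.2.1 (fun v => cHess n φ v p.2.1 p.2.2.2.2.2) z *
        wderBar n p.2.2.2.1 (fun v => cHess n φ v p.2.2.2.2.1 p.1) z *
        conj (X p.1) * X p.2.1 * Y p.2.2.1 * conj (Y p.2.2.2.1) := by
        simp only [Fintype.sum_prod_type]
    _ = _ := by
        symm
        refine Eq.trans (b := ∑ p : Fin n × Fin n × Fin n × Fin n × Fin n × Fin n,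
          conj (X p.2.2.2.2.1) * conj (Y p.2.2.2.2.2) *
          wderBar n p.2.2.2.2.2 (fun v => cHess n φ v p.1 p.2.2.2.2.1) z *
          ((Matrix.of (cHess n φ z))⁻¹ p.1 p.2.1 * (X p.2.2.1 * Y p.2.2.2.1 *
          wder n p.2.2.2.1 (fun v => cHess n φ v p.2.2.1 p.2.1) z))) ?_ ?_
        · simp only [Fintype.sum_prod_type]
        refine Fintype.sum_equiv ⟨fun p => (p.2.2.2.2.1, p.2.2.1, p.2.2.2.1, p.2.2.2.2.2, p.1, p.2.1),
          fun p => (p.2.2.2.2.1, p.2.2.2.2.2, p.2.1, p.2.2.1, p.1, p.2.2.2.1),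
          fun _ => rfl, fun _ => rfl⟩ _ _ fun p => ?_
        simp only [Equiv.coe_fn_mk]
        ring

theorem neg_le_re_bergCurvTensor_sum {Ω : Set (Fin n → ℂ)}
    (hφ : ContDiffOn ℝ ∞ (fun w => Real.log (bergmanKernel n Ω w)) U) (hU : IsOpen U) (hz : z ∈ U)
    (hpos : ∀ X, 0 ≤ bergMetric n Ω z X) (T : (Fin n → ℂ) ≃L[ℂ] (Fin n → ℂ)) (X Y : Fin n → ℂ) :
    -(‖T.symm X‖ ^ 2 * ‖T.symm Y‖ ^ 2 * ‖iteratedFDeriv ℝ 4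
      (fun ζ => Real.log (bergmanKernel n Ω (z + T ζ))) 0‖) ≤
    (∑ h, ∑ j, ∑ k, ∑ l,
      bergCurvTensor n Ω z h j k l * conj (X h) * X j * Y k * conj (Y l)).re := by
  have h1 := norm_fourth_order_sum_le hφ hU hz T X Y
  have h2 := re_second_order_sum_nonneg hφ hU hz hpos X Y
  have h3 := (Complex.re_le_norm _).trans h1
  have h4 : (∑ h, ∑ j, ∑ k, ∑ l,
      bergCurvTensor n Ω z h j k l * conj (X h) * X j * Y k * conj (Y l)) =
      -(∑ h, ∑ j, ∑ k, ∑ l, wderBar n l (fun w => wder n k (fun v =>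
        cHess n (fun w => Real.log (bergmanKernel n Ω w)) v j h) w) z *
        conj (X h) * X j * Y k * conj (Y l)) +
      ∑ h, ∑ j, ∑ k, ∑ l, (∑ ν, ∑ μ,
        (Matrix.of (cHess n (fun w => Real.log (bergmanKernel n Ω w)) z))⁻¹ ν μ *
        wder n k (fun v => cHess n (fun w => Real.log (bergmanKernel n Ω w)) v j μ) z *
        wderBar n l (fun v => cHess n (fun w => Real.log (bergmanKernel n Ω w)) v ν h) z) *
        conj (X h) * X j * Y k * conj (Y l) := by
    simp only [← Finset.sum_neg_distrib]
    rw [← Finset.sum_add_distrib]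
    refine Finset.sum_congr rfl fun h _ => ?_
    rw [← Finset.sum_add_distrib]
    refine Finset.sum_congr rfl fun j _ => ?_
    rw [← Finset.sum_add_distrib]
    refine Finset.sum_congr rfl fun k _ => ?_
    rw [← Finset.sum_add_distrib]
    refine Finset.sum_congr rfl fun l _ => ?_
    rw [← neg_mul, ← neg_mul, ← neg_mul, ← neg_mul, ← add_mul, ← add_mul, ← add_mul, ← add_mul]
    rfl
  rw [h4, Complex.add_re, Complex.neg_re]
  linarith

end CurvatureForm

section HilbertMetric

open scoped ComplexConjugate ContDiff

variable {n : ℕ} {z : Fin n → ℂ} {U Ω : Set (Fin n → ℂ)} {F : Type}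
  [NormedAddCommGroup F] [InnerProductSpace ℂ F] {E G H : (Fin n → ℂ) → F}

theorem fderiv_real_inner_apply (hG : DifferentiableAt ℂ G z) (hH : DifferentiableAt ℂ H z)
    (a : Fin n → ℂ) : fderiv ℝ (fun w => inner ℂ (G w) (H w)) z a =
      inner ℂ (G z) (fderiv ℂ H z a) + inner ℂ (fderiv ℂ G z a) (H z) := by
  let _ : NormedSpace ℝ F := NormedSpace.restrictScalars ℝ ℂ F
  have h := (hG.hasFDerivAt.restrictScalars ℝ).inner ℂ (hH.hasFDerivAt.restrictScalars ℝ)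
  rw [h.fderiv]
  simp [fderivInnerCLM_apply]

theorem wirtingerCLM_neg_I_inner (hG : DifferentiableAt ℂ G z) (hH : DifferentiableAt ℂ H z)
    (X : Fin n → ℂ) :
    wirtingerCLM n (-Complex.I) X (fderiv ℝ (fun w => inner ℂ (G w) (H w)) z) =
      inner ℂ (G z) (fderiv ℂ H z X) := by
  rw [wirtingerCLM_apply, fderiv_real_inner_apply hG hH, fderiv_real_inner_apply hG hH,
    map_smul, map_smul, inner_smul_left, inner_smul_right, Complex.conj_I]
  linear_combination (1 / 2 * inner ℂ (fderiv ℂ G z X) (H z)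
    - 1 / 2 * inner ℂ (G z) (fderiv ℂ H z X)) * Complex.I_mul_I

theorem wirtingerCLM_I_inner (hG : DifferentiableAt ℂ G z) (hH : DifferentiableAt ℂ H z)
    (X : Fin n → ℂ) :
    wirtingerCLM n Complex.I X (fderiv ℝ (fun w => inner ℂ (G w) (H w)) z) =
      inner ℂ (fderiv ℂ G z X) (H z) := by
  rw [wirtingerCLM_apply, fderiv_real_inner_apply hG hH, fderiv_real_inner_apply hG hH,
    map_smul, map_smul, inner_smul_left, inner_smul_right, Complex.conj_I]
  linear_combination (1 / 2 * inner ℂ (G z) (fderiv ℂ H z X)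
    - 1 / 2 * inner ℂ (fderiv ℂ G z X) (H z)) * Complex.I_mul_I

theorem ofReal_norm_sq_eq_inner (E : (Fin n → ℂ) → F) :
    (fun v => ((‖E v‖ ^ 2 : ℝ) : ℂ)) = fun v => inner ℂ (E v) (E v) := by
  funext v
  rw [inner_self_eq_norm_sq_to_K]
  norm_cast

theorem sum_wder_norm_sq (hE : DifferentiableAt ℂ E z) (X : Fin n → ℂ) :
    ∑ j, wder n j (fun v => ((‖E v‖ ^ 2 : ℝ) : ℂ)) z * X j =
      inner ℂ (E z) (fderiv ℂ E z X) := by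
  rw [← wirtingerCLM_neg_I_inner hE hE, ← ofReal_norm_sq_eq_inner, wirtingerCLM_neg_I_fderiv]
  exact Finset.sum_congr rfl fun j _ => mul_comm _ _

variable [CompleteSpace F]

theorem DifferentiableOn.contDiffOn_norm_sq (hE : DifferentiableOn ℂ E U) (hU : IsOpen U) :
    ContDiffOn ℝ ∞ (fun v => ‖E v‖ ^ 2) U := by
  let _ : NormedSpace ℝ F := NormedSpace.restrictScalars ℝ ℂ F
  exact (hE.contDiffOn_real_pi hU).norm_sq ℂ

theorem hermForm_cHess_norm_sq (hE : DifferentiableOn ℂ E U) (hU : IsOpen U) (hz : z ∈ U)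
    (X : Fin n → ℂ) :
    hermForm n (cHess n (fun v => ‖E v‖ ^ 2) z) X X = ‖fderiv ℂ E z X‖ ^ 2 := by
  have hEz : ∀ w ∈ U, DifferentiableAt ℂ E w := fun w hw => (hE w hw).differentiableAt
    (hU.mem_nhds hw)
  have hE' : DifferentiableAt ℂ (fun w => fderiv ℂ E w X) z :=
    ((hE.fderiv_pi hU z hz).differentiableAt (hU.mem_nhds hz)).clm_apply
      (differentiableAt_const X)
  have h1 : (fun w => ∑ j, X j * wder n j (fun v => ((‖E v‖ ^ 2 : ℝ) : ℂ)) w) =ᶠ[𝓝 z]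
      fun w => inner ℂ (E w) (fderiv ℂ E w X) := by
    filter_upwards [hU.mem_nhds hz] with w hw
    rw [← sum_wder_norm_sq (hEz w hw)]
    exact Finset.sum_congr rfl fun j _ => mul_comm _ _
  have h2 := wirtingerCLM_I_inner (hEz z hz) hE' X
  rw [← h1.fderiv_eq, wirtingerCLM_I_fderiv, inner_self_eq_norm_sq_to_K] at h2
  have hd : ∀ j, DifferentiableAt ℝ (wder n j (fun v => ((‖E v‖ ^ 2 : ℝ) : ℂ))) z := fun j =>
    ((hE.contDiffOn_norm_sq hU).ofReal_complex.wder hU j).differentiableAt_of_isOpen hU hz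
  rw [hermForm]
  have h3 : (∑ j, ∑ k, cHess n (fun v => ‖E v‖ ^ 2) z j k * X j * conj (X k)) =
      ((‖fderiv ℂ E z X‖ ^ 2 : ℝ) : ℂ) := by
    push_cast
    refine Eq.trans ?_ h2
    rw [Finset.sum_comm]
    refine Finset.sum_congr rfl fun k _ => ?_
    rw [wderBar_sum_const_mul hd, Finset.mul_sum]
    refine Finset.sum_congr rfl fun j _ => ?_
    rw [cHess]
    ring
  rw [h3, Complex.ofReal_re]

theorem bergMetric_eq (hE : DifferentiableOn ℂ E U) (hU : IsOpen U) (hz : z ∈ U)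
    (hK : ∀ p ∈ U, ‖E p‖ ^ 2 = bergmanKernel n Ω p) (h0 : ∀ p ∈ U, E p ≠ 0) (X : Fin n → ℂ) :
    bergMetric n Ω z X = ‖fderiv ℂ E z X‖ ^ 2 / ‖E z‖ ^ 2 -
      ‖inner ℂ (E z) (fderiv ℂ E z X)‖ ^ 2 / (‖E z‖ ^ 2) ^ 2 := by
  have hpos : ∀ p ∈ U, 0 < ‖E p‖ ^ 2 := fun p hp => by
    have := norm_pos_iff.2 (h0 p hp)
    positivity
  have hev : ∀ w ∈ U, (fun w => ((Real.log (bergmanKernel n Ω w) : ℝ) : ℂ)) =ᶠ[𝓝 w]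
      fun w => ((Real.log (‖E w‖ ^ 2) : ℝ) : ℂ) := by
    intro w hw
    filter_upwards [hU.mem_nhds hw] with v hv using by rw [hK v hv]
  have h1 : bergMetricMat n Ω z = cHess n (fun w => Real.log (‖E w‖ ^ 2)) z := by
    funext j k
    rw [bergMetricMat, cHess, cHess]
    refine Filter.EventuallyEq.wderBar_eq ?_
    filter_upwards [hU.mem_nhds hz] with w hw using (hev w hw).wder_eq
  have hlog : ContDiffOn ℝ ∞ Real.log (Ioi 0) := fun x hx =>
    (Real.contDiffAt_log.2 (ne_of_gt hx)).contDiffWithinAt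
  rw [bergMetric, h1, hermForm_cHess_comp hU (hE.contDiffOn_norm_sq hU) isOpen_Ioi hlog hpos hz,
    hermForm_cHess_norm_sq hE hU hz, sum_wder_norm_sq ((hE z hz).differentiableAt
    (hU.mem_nhds hz)), Real.deriv_log', deriv_inv]
  ring

theorem norm_sub_projection_sq (hE : DifferentiableOn ℂ E U) (hU : IsOpen U) (hz : z ∈ U)
    (hK : ∀ p ∈ U, ‖E p‖ ^ 2 = bergmanKernel n Ω p) (h0 : ∀ p ∈ U, E p ≠ 0) (X : Fin n → ℂ) :
    ‖fderiv ℂ E z X - (inner ℂ (E z) (fderiv ℂ E z X) / (‖E z‖ : ℂ) ^ 2) • E z‖ ^ 2 =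
      ‖E z‖ ^ 2 * bergMetric n Ω z X := by
  have hne : ‖E z‖ ≠ 0 := norm_ne_zero_iff.2 (h0 z hz)
  rw [bergMetric_eq hE hU hz hK h0, @norm_sub_sq ℂ, inner_smul_right, norm_smul, norm_div,
    norm_pow, Complex.norm_real, norm_norm, ← inner_conj_symm (fderiv ℂ E z X) (E z)]
  have h : inner ℂ (E z) (fderiv ℂ E z X) / (‖E z‖ : ℂ) ^ 2 *
      (starRingEnd ℂ) (inner ℂ (E z) (fderiv ℂ E z X)) =
      ((‖inner ℂ (E z) (fderiv ℂ E z X)‖ ^ 2 / ‖E z‖ ^ 2 : ℝ) : ℂ) := by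
    rw [div_mul_eq_mul_div, Complex.mul_conj']
    push_cast
    rfl
  rw [h, RCLike.re_to_complex, Complex.ofReal_re]
  field_simp
  ring

theorem bergMetric_nonneg (hE : DifferentiableOn ℂ E U) (hU : IsOpen U) (hz : z ∈ U)
    (hK : ∀ p ∈ U, ‖E p‖ ^ 2 = bergmanKernel n Ω p) (h0 : ∀ p ∈ U, E p ≠ 0) (X : Fin n → ℂ) :
    0 ≤ bergMetric n Ω z X := by
  have h := norm_sub_projection_sq hE hU hz hK h0 X
  have hne := norm_pos_iff.2 (h0 z hz)
  exact nonneg_of_mul_nonneg_right (h ▸ sq_nonneg _) (by positivity)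

theorem sq_le_mul_bergMetric (hE : DifferentiableOn ℂ E U) (hU : IsOpen U) (hz : z ∈ U)
    (hK : ∀ p ∈ U, ‖E p‖ ^ 2 = bergmanKernel n Ω p) (h0 : ∀ p ∈ U, E p ≠ 0)
    (hΛ : ∀ f, InBergman n Ω f → ∃ Λ : StrongDual ℂ F, ‖Λ‖ ^ 2 ≤ l2sq n Ω f ∧
      ∀ p ∈ U, Λ (E p) = f p)
    {X : Fin n → ℂ} {M s : ℝ} (hs : 0 ≤ s)
    (h : ∀ ε > 0, ∃ f, InBergman n Ω f ∧ l2sq n Ω f ≤ M ∧ ‖f z‖ ≤ ε ∧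
      s ≤ ‖fderiv ℂ f z X‖ + ε * ‖X‖) :
    s ^ 2 ≤ M * (‖E z‖ ^ 2 * bergMetric n Ω z X) := by
  set a : ℂ := inner ℂ (E z) (fderiv ℂ E z X) / (‖E z‖ : ℂ) ^ 2
  set v : F := fderiv ℂ E z X - a • E z with hv
  have hEz : DifferentiableAt ℂ E z := (hE z hz).differentiableAt (hU.mem_nhds hz)
  have key : ∀ ε > 0, s ≤ √M * ‖v‖ + ε * (‖X‖ + ‖a‖) := by
    intro ε hε
    obtain ⟨f, hf, hfM, hfz, hfX⟩ := h ε hε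
    obtain ⟨Λ, hΛ1, hΛ2⟩ := hΛ f hf
    have h1 : fderiv ℂ f z X = Λ (fderiv ℂ E z X) := by
      have h2 : f =ᶠ[𝓝 z] fun w => Λ (E w) := by
        filter_upwards [hU.mem_nhds hz] with w hw using (hΛ2 w hw).symm
      have h3 : HasFDerivAt (fun w => Λ (E w)) (Λ.comp (fderiv ℂ E z)) z :=
        Λ.hasFDerivAt.comp z hEz.hasFDerivAt
      rw [h2.fderiv_eq, h3.fderiv]
      rfl
    have h2 : fderiv ℂ f z X = Λ v + a * f z := by
      rw [h1, hv, map_sub, map_smul, hΛ2 z hz, smul_eq_mul]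
      ring
    have h3 : ‖Λ‖ ≤ √M := Real.le_sqrt_of_sq_le (hΛ1.trans hfM)
    have h4 : ‖Λ v‖ ≤ √M * ‖v‖ := (Λ.le_opNorm v).trans (by gcongr)
    have h5 : ‖fderiv ℂ f z X‖ ≤ √M * ‖v‖ + ‖a‖ * ε := by
      rw [h2]
      refine (norm_add_le _ _).trans ?_
      rw [norm_mul]
      gcongr
    linarith
  have h1 : s ≤ √M * ‖v‖ := by
    refine le_of_forall_pos_le_add fun δ hδ => ?_
    refine (key (δ / (‖X‖ + ‖a‖ + 1)) (by positivity)).trans ?_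
    gcongr
    rw [div_mul_eq_mul_div, div_le_iff₀ (by positivity)]
    nlinarith
  have hM : 0 ≤ M := by
    obtain ⟨f, hf, hfM, -⟩ := h 1 one_pos
    obtain ⟨Λ, hΛ1, -⟩ := hΛ f hf
    exact (sq_nonneg _).trans (hΛ1.trans hfM)
  rw [← norm_sub_projection_sq hE hU hz hK h0]
  calc s ^ 2 ≤ (√M * ‖v‖) ^ 2 := by gcongr
    _ = M * ‖v‖ ^ 2 := by rw [mul_pow, Real.sq_sqrt hM]

end HilbertMetric

section KernelEstimates

open scoped ComplexConjugate ContDiff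

variable {n : ℕ}

theorem realJac_trans (S T : (Fin n → ℂ) ≃L[ℂ] (Fin n → ℂ)) :
    realJac n (S.trans T) = realJac n T * realJac n S := by
  rw [realJac, realJac, realJac, ← abs_mul]
  congr 1
  exact LinearMap.det_comp
    (((T : (Fin n → ℂ) →L[ℂ] (Fin n → ℂ)).restrictScalars ℝ).toLinearMap)
    (((S : (Fin n → ℂ) →L[ℂ] (Fin n → ℂ)).restrictScalars ℝ).toLinearMap)

/-- Upper bound for the Bergman kernel at points well inside an affine polydisc. -/
theorem exists_bergmanKernel_le (n : ℕ) {δ : ℝ} (hδ : 0 < δ) :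
    ∃ A > (0:ℝ), ∀ (Ω : Set (Fin n → ℂ)) (z : Fin n → ℂ) (T : (Fin n → ℂ) ≃L[ℂ] (Fin n → ℂ)),
      IsOpen Ω → (∀ x, ‖x‖ < 2 * δ → z + T x ∈ Ω) →
      ∀ ζ, ‖ζ‖ < δ → bergmanKernel n Ω (z + T ζ) ≤ A / realJac n T := by
  obtain ⟨C, hC, h⟩ := exists_sq_mul_jac_le n
  refine ⟨C / δ ^ (2 * n), by positivity, fun Ω z T hΩ hT ζ hζ => ?_⟩
  have hJ := realJac_pos T
  refine Real.sSup_le ?_ (by positivity)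
  rintro x ⟨f, hf, hf1, rfl⟩
  have hsub : (fun x => z + T ζ + ((scaleEquiv n hδ).trans T) x) '' Metric.ball 0 1 ⊆ Ω := by
    rintro _ ⟨x, hx, rfl⟩
    have h1 : z + T ζ + ((scaleEquiv n hδ).trans T) x = z + T (ζ + (δ : ℂ) • x) := by
      rw [map_add, ContinuousLinearEquiv.trans_apply, scaleEquiv_apply, add_assoc]
    simp only [h1]
    refine hT _ ((norm_add_le _ _).trans_lt ?_)
    rw [norm_smul, Complex.norm_real, Real.norm_of_nonneg hδ.le]
    rw [mem_ball_zero_iff] at hx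
    nlinarith
  have h2 := h ((scaleEquiv n hδ).trans T) (z + T ζ) Ω f hsub hΩ.measurableSet hf.1 hf.2
  rw [realJac_trans, realJac_scaleEquiv] at h2
  have h3 : C * ∫ y in Ω, ‖f y‖ ^ 2 ≤ C * 1 := by
    gcongr
    exact hf1
  rw [div_div, le_div_iff₀ (by positivity)]
  linarith

end KernelEstimates

section Main

open scoped ContDiff

theorem bisecCurv_ge_of_localization {n : ℕ} {Ω D U : Set (Fin n → ℂ)} (hΩ : IsOpen Ω)
    (hDo : IsOpen D) (hDb : Bornology.IsBounded D) (hDc : Convex ℝ D) (hDΩ : D ⊆ Ω)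
    (hU : IsOpen U) (hUD : U ⊆ D) {C : ℝ} (hC : 0 < C)
    (hloc : ∀ z ∈ U, ∀ f : (Fin n → ℂ) → ℂ, InBergman n D f → ∀ ε > 0, ∃ F, InBergman n Ω F ∧
      l2sq n Ω F ≤ C * l2sq n D f ∧ ‖F z - f z‖ ≤ ε ∧ ‖fderiv ℂ F z - fderiv ℂ f z‖ ≤ ε) :
    ∃ B > (0:ℝ), ∀ z ∈ U, ∀ X Y : Fin n → ℂ, X ≠ 0 → Y ≠ 0 → -B ≤ bisecCurv n Ω z X Y := by
  obtain ⟨F, _, _, _, E, hE, hK, hΛ⟩ := exists_bergman_hilbert hΩ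
  obtain ⟨P, hP, c, hc, hpeak⟩ := exists_peak_functions n
  set δ : ℝ := ((n : ℝ) + 1)⁻¹ / 2 with hδd
  have hδ : 0 < δ := by positivity
  obtain ⟨A, hA, hupper⟩ := exists_bergmanKernel_le n hδ
  obtain ⟨Q, hQ, hlog⟩ := exists_norm_iteratedFDeriv_log_le (N := 4) (by norm_num) hδ
    (√(A * (4 * (C * P) / c ^ 2)))
  set κ : ℝ := c ^ 2 / (C * P * A) with hκ
  have hκ0 : 0 < κ := by positivity
  have hUΩ : U ⊆ Ω := hUD.trans hDΩ
  have hlower : ∀ z ∈ U, ∀ T : (Fin n → ℂ) ≃L[ℂ] (Fin n → ℂ),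
      (∀ w ∈ D, ∀ i, (T.symm (w - z) i).re ≤ 1) →
      c ^ 2 / 4 ≤ C * (P * realJac n T) * ‖E z‖ ^ 2 := by
    intro z hz T hT
    obtain ⟨f, hf, hfl, hfz⟩ := (hpeak D z T hDo (hUD hz) hT).1
    obtain ⟨g, hg, hgl, hgz, -⟩ := hloc z hz f hf (c / 2) (by positivity)
    obtain ⟨Λ, hΛ1, hΛ2⟩ := hΛ g hg
    have h1 : c / 2 ≤ ‖g z‖ := by
      have := norm_sub_norm_le (f z) (g z)
      rw [norm_sub_rev] at this
      linarith
    have h2 : ‖g z‖ ≤ ‖Λ‖ * ‖E z‖ := by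
      rw [← hΛ2 z (hUΩ hz)]
      exact Λ.le_opNorm _
    calc c ^ 2 / 4 = (c / 2) ^ 2 := by ring
      _ ≤ (‖Λ‖ * ‖E z‖) ^ 2 := by gcongr; exact h1.trans h2
      _ = ‖Λ‖ ^ 2 * ‖E z‖ ^ 2 := mul_pow _ _ _
      _ ≤ _ := by
        gcongr
        exact hΛ1.trans (hgl.trans (by gcongr))
  have hEU : DifferentiableOn ℂ E U := hE.mono hUΩ
  have hKU : ∀ p ∈ U, ‖E p‖ ^ 2 = bergmanKernel n Ω p := fun p hp => hK p (hUΩ hp)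
  have h0 : ∀ p ∈ U, E p ≠ 0 := by
    intro p hp h
    obtain ⟨T, -, hT⟩ := exists_adapted_coordinates hDo hDb hDc (hUD hp)
    have h1 := hlower p hp T hT
    rw [h, norm_zero] at h1
    have : 0 < c ^ 2 := by positivity
    linarith
  have hφ : ContDiffOn ℝ ∞ (fun w => Real.log (bergmanKernel n Ω w)) U :=
    ((hEU.contDiffOn_norm_sq hU).log fun p hp =>
      pow_ne_zero 2 (norm_ne_zero_iff.2 (h0 p hp))).congr fun p hp => by rw [hKU p hp]
  refine ⟨Q / κ ^ 2 + 1, by positivity, fun z hz X Y hX hY => ?_⟩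
  obtain ⟨T, hTin, hT⟩ := exists_adapted_coordinates hDo hDb hDc (hUD hz)
  have hJ := realJac_pos T
  have hup : ∀ ζ, ‖ζ‖ < δ → z + T ζ ∈ Ω ∧ ‖E (z + T ζ)‖ ^ 2 ≤ A / realJac n T := by
    intro ζ hζ
    have h2δ : 2 * δ = ((n : ℝ) + 1)⁻¹ := by rw [hδd]; ring
    have hin : z + T ζ ∈ Ω := hDΩ (hTin ζ (by linarith))
    rw [hK _ hin]
    exact ⟨hin, hupper Ω z T hΩ (fun x hx => hDΩ (hTin x (h2δ ▸ hx))) ζ hζ⟩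
  have hz2 : ‖E z‖ ^ 2 ≤ A / realJac n T := by
    have := (hup 0 (by simpa using hδ)).2
    simpa using this
  have hmetric : ∀ X, κ * ‖T.symm X‖ ^ 2 ≤ bergMetric n Ω z X := by
    intro X
    have hg0 := bergMetric_nonneg hEU hU hz hKU h0 X
    have h1 : (c * ‖T.symm X‖) ^ 2 ≤
        C * (P * realJac n T) * (‖E z‖ ^ 2 * bergMetric n Ω z X) := by
      refine sq_le_mul_bergMetric hEU hU hz hKU h0 (fun f hf => ?_) (by positivity) fun ε hε => ?_
      · obtain ⟨Λ, hΛ1, hΛ2⟩ := hΛ f hf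
        exact ⟨Λ, hΛ1, fun p hp => hΛ2 p (hUΩ hp)⟩
      obtain ⟨f, hf, hfl, hfz, hfX⟩ := (hpeak D z T hDo (hUD hz) hT).2 X
      obtain ⟨g, hg, hgl, hgz, hgX⟩ := hloc z hz f hf ε hε
      refine ⟨g, hg, hgl.trans (by gcongr), by simpa [hfz] using hgz, ?_⟩
      have h2 := ((fderiv ℂ g z - fderiv ℂ f z).le_opNorm X).trans
        (mul_le_mul_of_nonneg_right hgX (norm_nonneg X))
      have h3 := norm_sub_norm_le (fderiv ℂ f z X) (fderiv ℂ g z X)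
      rw [norm_sub_rev] at h3
      rw [sub_apply] at h2
      linarith
    have h2 : (c * ‖T.symm X‖) ^ 2 ≤ C * P * A * bergMetric n Ω z X := by
      refine h1.trans ?_
      calc _ ≤ C * (P * realJac n T) * (A / realJac n T * bergMetric n Ω z X) := by gcongr
        _ = _ := by field_simp
    rw [hκ, div_mul_eq_mul_div, div_le_iff₀ (by positivity)]
    rw [mul_pow] at h2
    linarith
  have hfour : ‖iteratedFDeriv ℝ 4 (fun ζ => Real.log (bergmanKernel n Ω (z + T ζ))) 0‖ ≤ Q := by
    have hev : (fun ζ => Real.log (bergmanKernel n Ω (z + T ζ))) =ᶠ[𝓝 0]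
        fun ζ => Real.log (‖E (z + T ζ)‖ ^ 2) := by
      filter_upwards [Metric.ball_mem_nhds (0 : Fin n → ℂ) hδ] with ζ hζ
      rw [hK _ (hup ζ (by simpa using hζ)).1]
    rw [(hev.iteratedFDeriv ℝ 4).eq_of_nhds]
    refine hlog n F (fun ζ => E (z + T ζ)) ?_ (by simpa using h0 z hz) fun ζ hζ => ?_
    · exact hE.comp ((T : (Fin n → ℂ) →L[ℂ] (Fin n → ℂ)).differentiable.const_add
        z).differentiableOn fun ζ hζ => (hup ζ (by simpa using hζ)).1
    · have h1 := (hup ζ (by simpa using hζ)).2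
      have h2 := hlower z hz T hT
      simp only [map_zero, add_zero]
      refine abs_le_of_sq_le_sq' ?_ (by positivity) |>.2
      rw [mul_pow, Real.sq_sqrt (by positivity)]
      refine h1.trans ?_
      rw [div_le_iff₀ hJ]
      have h3 : 1 ≤ 4 / c ^ 2 * (C * (P * realJac n T) * ‖E z‖ ^ 2) := by
        rw [div_mul_eq_mul_div, le_div_iff₀ (by positivity)]
        linarith
      calc A = A * 1 := (mul_one A).symm
        _ ≤ A * (4 / c ^ 2 * (C * (P * realJac n T) * ‖E z‖ ^ 2)) := by gcongr
        _ = _ := by ring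
  have hXpos : 0 < ‖T.symm X‖ := norm_pos_iff.2 (by simpa using hX)
  have hYpos : 0 < ‖T.symm Y‖ := norm_pos_iff.2 (by simpa using hY)
  have hgX : 0 < bergMetric n Ω z X := lt_of_lt_of_le (by positivity) (hmetric X)
  have hgY : 0 < bergMetric n Ω z Y := lt_of_lt_of_le (by positivity) (hmetric Y)
  have hR := neg_le_re_bergCurvTensor_sum hφ hU hz
    (bergMetric_nonneg hEU hU hz hKU h0) T X Y
  rw [bisecCurv, le_div_iff₀ (by positivity)]
  refine le_trans ?_ hR
  have h1 : κ ^ 2 * (‖T.symm X‖ ^ 2 * ‖T.symm Y‖ ^ 2) ≤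
      bergMetric n Ω z X * bergMetric n Ω z Y :=
    calc _ = (κ * ‖T.symm X‖ ^ 2) * (κ * ‖T.symm Y‖ ^ 2) := by ring
      _ ≤ _ := mul_le_mul (hmetric X) (hmetric Y) (by positivity) hgX.le
  have h2 : ‖T.symm X‖ ^ 2 * ‖T.symm Y‖ ^ 2 *
      ‖iteratedFDeriv ℝ 4 (fun ζ => Real.log (bergmanKernel n Ω (z + T ζ))) 0‖ ≤
      Q / κ ^ 2 * (bergMetric n Ω z X * bergMetric n Ω z Y) := by
    calc _ ≤ ‖T.symm X‖ ^ 2 * ‖T.symm Y‖ ^ 2 * Q := by gcongr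
      _ = Q / κ ^ 2 * (κ ^ 2 * (‖T.symm X‖ ^ 2 * ‖T.symm Y‖ ^ 2)) := by field_simp
      _ ≤ _ := by gcongr
  have h3 : 0 < bergMetric n Ω z X * bergMetric n Ω z Y := by positivity
  linarith

end Main

/-- Let `Ω ⊂ ℂⁿ` be a smooth bounded pseudoconvex domain and `z₀ ∈ ∂Ω` a point of finite
type in the sense of D'Angelo, and suppose `Ω` is convex near `z₀` (on a neighborhood `V`
of `z₀`). Then there are a neighborhood `U` of `z₀` and `C > 0` such that all bisectional
curvatures of the Bergman metric of `Ω` satisfy `B_Ω(z;X,Y) ≥ −C` on `U ∩ Ω`. -/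
theorem bisectional_curvature_bounded_below_convex_finite_type
    {n : ℕ} (Ω : Set (Fin n → ℂ)) (hΩ : IsOpen Ω) (hb : Bornology.IsBounded Ω)
    (hconn : IsPreconnected Ω) (ρ : (Fin n → ℂ) → ℝ) (hρ : IsDefining n Ω ρ)
    (hpsc : ∀ q ∈ frontier Ω, LeviPSDAt n ρ q)
    (z₀ : Fin n → ℂ) (hz₀ : z₀ ∈ frontier Ω)
    (hft : FiniteTypeAt n ρ z₀)
    (V : Set (Fin n → ℂ)) (hV : V ∈ 𝓝 z₀)
    (hconv : ∃ K : Set (Fin n → ℂ), Convex ℝ K ∧ V ∩ Ω = V ∩ K) :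
    ∃ U ∈ 𝓝 z₀, ∃ C > (0:ℝ), ∀ z ∈ U ∩ Ω, ∀ X Y : Fin n → ℂ, X ≠ 0 → Y ≠ 0 →
      -C ≤ bisecCurv n Ω z X Y := by
  obtain ⟨K, hK, hVK⟩ := hconv
  obtain ⟨r, hr, hrV⟩ := Metric.mem_nhds_iff.1 hV
  have hD : Ω ∩ Metric.ball z₀ r = K ∩ Metric.ball z₀ r := by
    ext w
    refine and_congr_left fun hw => ?_
    have h := Set.ext_iff.1 hVK w
    simpa [hrV hw] using h
  obtain ⟨C, hC, hloc⟩ := hρ.exists_localization hΩ hb hpsc z₀ hr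
  obtain ⟨B, hB, h⟩ := bisecCurv_ge_of_localization hΩ (hΩ.inter Metric.isOpen_ball)
    (hb.subset inter_subset_left) (hD ▸ hK.inter (convex_ball z₀ r)) inter_subset_left
    (hΩ.inter (Metric.isOpen_ball (x := z₀) (ε := r / 4)))
    (inter_subset_inter_right Ω (Metric.ball_subset_ball (by linarith))) hC hloc
  exact ⟨Metric.ball z₀ (r / 4), Metric.ball_mem_nhds z₀ (by positivity), B, hB,
    fun z hz => h z ⟨hz.2, hz.1⟩⟩
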